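/- Suppose the elementary abelian 2-group (ℤ/2)^r acts freely and continuously on a finite CW complex X homotopy equivalent to a product (ℝP^n)^m of m copies of real projective n-space. Then: if n ≡ 0 or 2 (mod 4) no such free action exists (r ≤ 0, i.e., r = 0); if n ≡ 1 (mod 4) then r ≤ m; and if n ≡ 3 (mod 4) then r ≤ 2m. -/

import Mathlib

open Metric

/-- `Sph n` is the unit sphere `S^n`, i.e. the set of unit vectors in `ℝ^{n+1}`. -/
abbrev Sph (n : ℕ) : Type := Metric.sphere (0 : EuclideanSpace ℝ (Fin (n + 1))) 1

/-- The self-homeomorphisms of a topological space form a group under composition.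
A continuous action of a group `G` on `X` (every element acting by a homeomorphism)
is then precisely a group homomorphism `G →* (X ≃ₜ X)`. -/
instance homeoGroup (X : Type*) [TopologicalSpace X] : Group (X ≃ₜ X) where
  mul e f := f.trans e
  one := Homeomorph.refl X
  inv := Homeomorph.symm
  mul_assoc _ _ _ := Homeomorph.ext fun _ => rfl
  one_mul _ := Homeomorph.ext fun _ => rfl
  mul_one _ := Homeomorph.ext fun _ => rfl
  inv_mul_cancel e := Homeomorph.ext fun x => e.symm_apply_apply x

/-- The boundary sphere `S^{n-1}` of an `n`-cell: the unit sphere in `ℝ^n`. -/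
abbrev CellBoundary (n : ℕ) : Type := Metric.sphere (0 : EuclideanSpace ℝ (Fin n)) 1

/-- A closed `n`-cell: the closed unit ball `D^n` in `ℝ^n`. -/
abbrev Cell (n : ℕ) : Type := Metric.closedBall (0 : EuclideanSpace ℝ (Fin n)) 1

/-- The space obtained from `X` by attaching `k` cells of dimension `n` along the attaching
maps `f i : S^{n-1} → X`: the quotient of the disjoint union `X ⊔ (Fin k × D^n)` obtained by
identifying each boundary point of each disk with its image under the corresponding
attaching map, endowed with the quotient topology. -/
abbrev AttachCells (n k : ℕ) (X : Type) [TopologicalSpace X]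
    (f : Fin k → C(CellBoundary n, X)) : Type :=
  Quot (fun a b : X ⊕ (Σ _ : Fin k, Cell n) =>
    ∃ (i : Fin k) (s : CellBoundary n),
      a = Sum.inl (f i s) ∧ b = Sum.inr ⟨i, ⟨s.1, Metric.sphere_subset_closedBall s.2⟩⟩)

/-- `IsFiniteCWAtMost n X` : the space `X` is a finite CW complex of dimension at most `n`,
i.e. it is built from the empty space by attaching, for each dimension `0, 1, …, n` in
increasing order, finitely many cells of that dimension (and it is allowed to skip
dimensions, and to replace the space by a homeomorphic copy). -/
inductive IsFiniteCWAtMost : (n : ℕ) → (X : Type) → [TopologicalSpace X] → Prop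
  | base (k : ℕ) (f : Fin k → C(CellBoundary 0, Empty)) :
      IsFiniteCWAtMost 0 (AttachCells 0 k Empty f)
  | up {n : ℕ} {X : Type} [TopologicalSpace X] :
      IsFiniteCWAtMost n X → IsFiniteCWAtMost (n + 1) X
  | attach {n : ℕ} {X : Type} [TopologicalSpace X] (hX : IsFiniteCWAtMost n X)
      (k : ℕ) (f : Fin k → C(CellBoundary (n + 1), X)) :
      IsFiniteCWAtMost (n + 1) (AttachCells (n + 1) k X f)
  | homeo {n : ℕ} {X Y : Type} [TopologicalSpace X] [TopologicalSpace Y]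
      (hX : IsFiniteCWAtMost n X) (e : X ≃ₜ Y) : IsFiniteCWAtMost n Y

/-- `X` is a finite CW complex: it can be built from finitely many cells, attached in
order of increasing dimension. -/
def IsFiniteCW (X : Type) [TopologicalSpace X] : Prop :=
  ∃ n, IsFiniteCWAtMost n X

open scoped LinearAlgebra.Projectivization

/-- Real projective `n`-space `ℝP^n`, the projectivization of `ℝ^{n+1}`. -/
abbrev RP (n : ℕ) : Type := ℙ ℝ (EuclideanSpace ℝ (Fin (n + 1)))

/-- `ℝP^n` carries the quotient topology coming from `ℝ^{n+1} \ {0}`. -/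
noncomputable instance (n : ℕ) : TopologicalSpace (RP n) :=
  (inferInstance :
    TopologicalSpace (Quotient (projectivizationSetoid ℝ (EuclideanSpace ℝ (Fin (n + 1))))))

section

open Topology

namespace AlexSpan

variable {X Y Z : Type}

/-- The Alexander-Spanier coboundary. -/
def cd : (List X → ZMod 2) → List X → ZMod 2
  | _, [] => 0
  | z, x :: l => z l + cd (fun l' => z (x :: l')) l

/-- The cup product on functions of finite sequences. -/
def cup : (List X → ZMod 2) → (List X → ZMod 2) → List X → ZMod 2
  | _, _, [] => 0
  | z, w, x :: l => z [x] * w (x :: l) + cup (fun l' => z (x :: l')) w l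

/-- Pull-back of a function of finite sequences. -/
def pull (f : X → Y) (z : List Y → ZMod 2) : List X → ZMod 2 := fun l => z (l.map f)

/-- The function supported on sequences of length one given by a function of points. -/
def pt (u : X → ZMod 2) : List X → ZMod 2
  | [x] => u x
  | _ => 0

/-- The part of a function supported on sequences of length `k + 1`. -/
def degPart (k : ℕ) (z : List X → ZMod 2) : List X → ZMod 2 :=
  fun l => if l.length = k + 1 then z l else 0

@[simp] lemma cd_nil (z : List X → ZMod 2) : cd z [] = 0 := by simp [cd]
lemma cd_cons (z : List X → ZMod 2) (x l) : cd z (x :: l) = z l + cd (fun l' => z (x :: l')) l := by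
  rw [cd]
@[simp] lemma cup_nil (z w : List X → ZMod 2) : cup z w [] = 0 := by simp [cup]
lemma cup_cons (z w : List X → ZMod 2) (x l) :
    cup z w (x :: l) = z [x] * w (x :: l) + cup (fun l' => z (x :: l')) w l := by rw [cup]

lemma cd_add (z w : List X → ZMod 2) : cd (z + w) = cd z + cd w := by
  funext l
  induction l generalizing z w with
  | nil => simp
  | cons x l ih =>
    have := ih (fun l' => z (x :: l')) (fun l' => w (x :: l'))
    simp only [cd_cons, Pi.add_apply] at this ⊢
    rw [show (fun l' => z (x :: l') + w (x :: l')) = (fun l' => z (x :: l')) + fun l' => w (x :: l')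
      from rfl, this]
    ring

lemma cd_zero : cd (0 : List X → ZMod 2) = 0 := by
  have := cd_add (0 : List X → ZMod 2) 0
  simpa using this

lemma cup_add (z w w' : List X → ZMod 2) : cup z (w + w') = cup z w + cup z w' := by
  funext l
  induction l generalizing z with
  | nil => simp
  | cons x l ih =>
    have := ih (fun l' => z (x :: l'))
    simp only [cup_cons, Pi.add_apply] at this ⊢
    rw [this]
    ring

lemma add_cup (z z' w : List X → ZMod 2) : cup (z + z') w = cup z w + cup z' w := by
  funext l
  induction l generalizing z z' with
  | nil => simp
  | cons x l ih =>
    have := ih (fun l' => z (x :: l')) (fun l' => z' (x :: l'))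
    simp only [cup_cons, Pi.add_apply] at this ⊢
    rw [show (fun l' => z (x :: l') + z' (x :: l')) = (fun l' => z (x :: l')) + fun l' => z' (x :: l')
      from rfl, this]
    ring

lemma smul_cup (c : ZMod 2) (z w : List X → ZMod 2) : cup (fun l => c * z l) w = fun l => c * cup z w l := by
  funext l
  induction l generalizing z with
  | nil => simp
  | cons x l ih =>
    have := ih (fun l' => z (x :: l'))
    simp only [cup_cons] at this ⊢
    rw [this]
    ring

lemma cup_assoc (z w v : List X → ZMod 2) : cup (cup z w) v = cup z (cup w v) := by
  funext l
  induction l generalizing z with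
  | nil => simp
  | cons x l ih =>
    have h : (fun l' => cup z w (x :: l')) = (fun l' => z [x] * w (x :: l')) +
        cup (fun l' => z (x :: l')) w := by
      funext l'; simp [cup_cons]
    rw [cup_cons, h, add_cup, Pi.add_apply, ih, cup_cons z w, cup_cons z (cup w v), cup_cons w v,
      smul_cup (z [x]) (fun l' => w (x :: l'))]
    simp only [cup_nil]
    ring

lemma cd_cd (z : List X → ZMod 2) : cd (cd z) = 0 := by
  funext l
  induction l generalizing z with
  | nil => simp
  | cons x l ih =>
    have h : (fun l' => cd z (x :: l')) = z + cd (fun l' => z (x :: l')) := by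
      funext l'; simp [cd_cons]
    rw [cd_cons, h, cd_add, Pi.add_apply, ih]
    simp only [Pi.zero_apply]
    grind

lemma cd_smul (c : ZMod 2) (z : List X → ZMod 2) : cd (fun l => c * z l) = fun l => c * cd z l := by
  funext l
  induction l generalizing z with
  | nil => simp
  | cons x l ih =>
    have := ih (fun l' => z (x :: l'))
    simp only [cd_cons] at this ⊢
    rw [this]
    ring

lemma cd_cup' (z w : List X → ZMod 2) (hw : w [] = 0) :
    cd (cup z w) = cup (cd z) w + cup z (cd w) + fun l => z [] * w l := by
  funext l
  induction l generalizing z with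
  | nil => simp [hw]
  | cons x l ih =>
    have h : (fun l' => cup z w (x :: l')) = (fun l' => z [x] * w (x :: l')) +
        cup (fun l' => z (x :: l')) w := by
      funext l'; simp [cup_cons]
    have h2 : (fun l' => cd z (x :: l')) = z + cd (fun l' => z (x :: l')) := by
      funext l'; simp [cd_cons]
    simp only [Pi.add_apply]
    rw [cd_cons, h, cd_add, Pi.add_apply, ih, cup_cons (cd z), h2, add_cup, cup_cons z, cd_cons w,
      cd_smul]
    simp only [Pi.add_apply, cd_cons, cd_nil]
    grind

lemma cd_cup (z w : List X → ZMod 2) (hz : z [] = 0) (hw : w [] = 0) :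
    cd (cup z w) = cup (cd z) w + cup z (cd w) := by
  rw [cd_cup' z w hw]
  funext l
  simp [hz]

lemma pt_one_cup (w : List X → ZMod 2) (hw : w [] = 0) : cup (pt fun _ => 1) w = w := by
  funext l
  cases l with
  | nil => simp [hw]
  | cons x l =>
    have : ∀ z : List X → ZMod 2, (∀ l ≠ [], z l = 0) → cup z w l = 0 := by
      induction l with
      | nil => simp
      | cons y l ih => intro z hz; rw [cup_cons, hz _ (by simp), ih _ (fun l _ => hz _ (by simp))]; simp
    rw [cup_cons, this]
    · simp [pt]
    · intro l hl
      cases l <;> simp_all [pt]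

lemma cup_pt_one (w : List X → ZMod 2) (hw : w [] = 0) : cup w (pt fun _ => 1) = w := by
  funext l
  induction l generalizing w with
  | nil => simp [hw]
  | cons x l ih =>
    rw [cup_cons]
    cases l with
    | nil => simp [pt]
    | cons y l =>
      have := ih (fun l' => if l' = [] then 0 else w (x :: l')) (by simp)
      have h2 : cup (fun l' => w (x :: l')) (pt fun _ => 1) (y :: l) =
        cup (fun l' => if l' = [] then 0 else w (x :: l')) (pt fun _ => 1) (y :: l) := by
        simp [cup_cons]
      rw [h2, this]
      simp [pt]

/-- Pointwise vanishing on sequences in `U`. -/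
def VanOn (U : Set X) (z : List X → ZMod 2) : Prop := ∀ l : List X, (∀ y ∈ l, y ∈ U) → z l = 0

lemma VanOn.mono {U V : Set X} {z : List X → ZMod 2} (h : VanOn V z) (hU : U ⊆ V) : VanOn U z :=
  fun l hl => h l fun y hy => hU (hl y hy)

lemma VanOn.add {U : Set X} {z w : List X → ZMod 2} (hz : VanOn U z) (hw : VanOn U w) :
    VanOn U (z + w) := fun l hl => by simp [hz l hl, hw l hl]

lemma VanOn.cd {U : Set X} {z : List X → ZMod 2} (hz : VanOn U z) : VanOn U (cd z) := by
  intro l hl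
  induction l generalizing z with
  | nil => simp
  | cons x l ih =>
    rw [cd_cons, hz l (by simp_all), ih (z := fun l' => z (x :: l'))] <;> simp_all [VanOn]

lemma VanOn.cup_left {U : Set X} {z : List X → ZMod 2} (hz : VanOn U z) (w : List X → ZMod 2) :
    VanOn U (cup z w) := by
  intro l hl
  induction l generalizing z with
  | nil => simp
  | cons x l ih =>
    rw [cup_cons, hz [x] (by simp_all), ih (z := fun l' => z (x :: l'))] <;> simp_all [VanOn]

lemma VanOn.cup_right {U : Set X} {w : List X → ZMod 2} (z : List X → ZMod 2) (hw : VanOn U w) :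
    VanOn U (cup z w) := by
  intro l hl
  induction l generalizing z with
  | nil => simp
  | cons x l ih =>
    rw [cup_cons, hw (x :: l) (by simp_all), ih (z := fun l' => z (x :: l'))] <;> simp_all [VanOn]

lemma VanOn.degPart {U : Set X} {z : List X → ZMod 2} (hz : VanOn U z) (k : ℕ) :
    VanOn U (degPart k z) := fun l hl => by simp [AlexSpan.degPart, hz l hl]

lemma pull_cd (f : X → Y) (z : List Y → ZMod 2) : pull f (cd z) = cd (pull f z) := by
  funext l
  induction l generalizing z with
  | nil => simp [pull]
  | cons x l ih =>
    have := ih (fun l' => z (f x :: l'))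
    simp only [pull, List.map_cons, cd_cons] at this ⊢
    rw [this]
    rfl

lemma pull_cup (f : X → Y) (z w : List Y → ZMod 2) :
    pull f (cup z w) = cup (pull f z) (pull f w) := by
  funext l
  induction l generalizing z with
  | nil => simp [pull]
  | cons x l ih =>
    have := ih (fun l' => z (f x :: l'))
    simp only [pull, List.map_cons, cup_cons, List.map_nil] at this ⊢
    rw [this]
    rfl

lemma pull_pt (f : X → Y) (u : Y → ZMod 2) : pull f (pt u) = pt (u ∘ f) := by
  funext l
  match l with
  | [] => rfl
  | [x] => rfl
  | x :: y :: l => rfl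

lemma pull_degPart (f : X → Y) (k) (z : List Y → ZMod 2) :
    pull f (degPart k z) = degPart k (pull f z) := by
  funext l
  simp [pull, degPart]

lemma degPart_cd (k : ℕ) (z : List X → ZMod 2) :
    degPart (k + 1) (cd z) = cd (degPart k z) := by
  have key : ∀ (l : List X) (k : ℕ) (z : List X → ZMod 2),
      cd (fun l => if l.length = k then z l else 0) l = if l.length = k + 1 then cd z l else 0 := by
    intro l
    induction l with
    | nil => simp
    | cons x l ih =>
      intro k z
      rw [cd_cons]
      cases k with
      | zero =>
        cases l with
        | nil => simp [cd_cons]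
        | cons y l =>
          simp only [List.length_cons, Nat.add_eq_zero_iff, one_ne_zero, and_false, if_false,
            zero_add, Nat.reduceEqDiff]
          exact congrFun cd_zero (y :: l)
      | succ k =>
        simp only [List.length_cons, Nat.add_right_cancel_iff]
        rw [ih k, cd_cons]
        split_ifs <;> simp
  funext l
  exact (key l (k + 1) z).symm

lemma degPart_zero_cd (z : List X → ZMod 2) (hz : z [] = 0) : degPart 0 (cd z) = 0 := by
  funext l
  match l with
  | [] => simp [degPart]
  | [x] => simp [degPart, cd_cons, hz]
  | x :: y :: l => simp [degPart]

/-- The prism operator of two maps. -/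
def prism (f g : X → Y) : (List Y → ZMod 2) → List X → ZMod 2
  | _, [] => 0
  | z, x :: l => z (f x :: g x :: l.map g) + prism f g (fun l' => z (f x :: l')) l

lemma prism_add (f g : X → Y) (z w : List Y → ZMod 2) :
    prism f g (z + w) = prism f g z + prism f g w := by
  funext l
  induction l generalizing z w with
  | nil => simp [prism]
  | cons x l ih =>
    have := ih (fun l' => z (f x :: l')) (fun l' => w (f x :: l'))
    simp only [prism, Pi.add_apply] at this ⊢
    rw [show (fun l' => z (f x :: l') + w (f x :: l')) =
      (fun l' => z (f x :: l')) + fun l' => w (f x :: l') from rfl, this]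
    ring

lemma prism_cd (f g : X → Y) (z : List Y → ZMod 2) :
    cd (prism f g z) + prism f g (cd z) = pull f z + pull g z := by
  funext l
  induction l generalizing z with
  | nil => simp [prism, pull]; grind
  | cons x l ih =>
    have h : (fun l' => cd z (f x :: l')) = z + cd (fun l' => z (f x :: l')) := by
      funext l'; simp [cd_cons]
    have h2 : (fun l' => prism f g z (x :: l')) = pull g (fun l' => z (f x :: g x :: l')) +
        prism f g (fun l' => z (f x :: l')) := by
      funext l'; simp [prism, pull]
    have := ih (fun l' => z (f x :: l'))
    simp only [Pi.add_apply, cd_cons, pull, List.map_cons] at this ⊢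
    rw [prism, h, h2, prism_add, cd_add, ← pull_cd]
    simp only [Pi.add_apply, cd_cons, pull]
    grind

lemma prism_van {f g : X → Y} {U : Set X} {V : Set Y} {z : List Y → ZMod 2} (hz : VanOn V z)
    (hf : Set.MapsTo f U V) (hg : Set.MapsTo g U V) : VanOn U (prism f g z) := by
  intro l hl
  induction l generalizing z with
  | nil => simp [prism]
  | cons x l ih =>
    rw [prism, hz, ih (z := fun l' => z (f x :: l'))]
    · simp
    · intro l' hl'
      apply hz
      simp only [List.mem_cons, forall_eq_or_imp]
      exact ⟨hf (hl x (by simp)), hl'⟩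
    · exact fun y hy => hl y (by simp [hy])
    · intro y hy
      simp only [List.mem_cons, List.mem_map] at hy
      rcases hy with rfl | rfl | ⟨a, ha, rfl⟩
      · exact hf (hl x (by simp))
      · exact hg (hl x (by simp))
      · exact hg (hl a (by simp [ha]))

lemma VanOn.pull {f : X → Y} {U : Set X} {V : Set Y} {z : List Y → ZMod 2} (hz : VanOn V z)
    (hf : Set.MapsTo f U V) : VanOn U (pull f z) := by
  intro l hl
  apply hz
  intro y hy
  obtain ⟨a, ha, rfl⟩ := List.mem_map.1 hy
  exact hf (hl a ha)

end AlexSpan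

end

section

open Topology

/-- A ring with a square-zero derivation. -/
class Dga (C : Type) extends Ring C where
  /-- The differential. -/
  d : C →+ C
  d_mul : ∀ a b, d (a * b) = d a * b + a * d b
  d_d : ∀ a, d (d a) = 0

/-- A differential ring with degree projections and a commutative product `star` on each degree
which bounds the commutator of two cocycles of degree one. -/
class GDga (C : Type) extends Dga C where
  /-- The projection to degree `k`. -/
  pr : ℕ → C →+ C
  pr_pr : ∀ j k a, pr j (pr k a) = if j = k then pr k a else 0
  pr_d : ∀ k a, pr (k + 1) (d a) = d (pr k a)
  pr_zero_d : ∀ a, pr 0 (d a) = 0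
  pr_one : pr 0 1 = 1
  pr_mul : ∀ j k a b, pr j a = a → pr k b = b → pr (j + k) (a * b) = a * b
  /-- The degreewise commutative product. -/
  star : C → C → C
  star_comm : ∀ a b, star a b = star b a
  d_star : ∀ a b, pr 1 a = a → pr 1 b = b → d a = 0 → d b = 0 → d (star a b) = a * b + b * a

namespace AlexSpan
variable {X Y Z : Type}

/-- `z` vanishes on all sequences in `S` with sufficiently close entries. -/
def LZOn [TopologicalSpace X] (S : Set X) (z : List X → ZMod 2) : Prop :=
  ∀ x ∈ S, ∃ U ∈ 𝓝 x, VanOn (U ∩ S) z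

section
variable [TopologicalSpace X] [TopologicalSpace Y] {S T : Set X} {z w : List X → ZMod 2}

lemma LZOn.mono (h : LZOn T z) (hS : S ⊆ T) : LZOn S z := fun x hx => by
  obtain ⟨U, hU, h⟩ := h x (hS hx)
  exact ⟨U, hU, h.mono (Set.inter_subset_inter_right _ hS)⟩

lemma LZOn.add (hz : LZOn S z) (hw : LZOn S w) : LZOn S (z + w) := fun x hx => by
  obtain ⟨U, hU, h⟩ := hz x hx
  obtain ⟨V, hV, h'⟩ := hw x hx
  exact ⟨U ∩ V, Filter.inter_mem hU hV, (h.mono (by grind)).add (h'.mono (by grind))⟩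

lemma LZOn.zero : LZOn S (0 : List X → ZMod 2) := fun _ _ => ⟨Set.univ, Filter.univ_mem, fun _ _ => rfl⟩

lemma LZOn.cd (hz : LZOn S z) : LZOn S (cd z) := fun x hx => by
  obtain ⟨U, hU, h⟩ := hz x hx
  exact ⟨U, hU, h.cd⟩

lemma LZOn.cup_left (hz : LZOn S z) (w : List X → ZMod 2) : LZOn S (cup z w) := fun x hx => by
  obtain ⟨U, hU, h⟩ := hz x hx
  exact ⟨U, hU, h.cup_left w⟩

lemma LZOn.cup_right (z : List X → ZMod 2) (hw : LZOn S w) : LZOn S (cup z w) := fun x hx => by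
  obtain ⟨U, hU, h⟩ := hw x hx
  exact ⟨U, hU, h.cup_right z⟩

lemma LZOn.degPart (hz : LZOn S z) (k : ℕ) : LZOn S (degPart k z) := fun x hx => by
  obtain ⟨U, hU, h⟩ := hz x hx
  exact ⟨U, hU, h.degPart k⟩

lemma LZOn.pull {f : X → Y} {T : Set Y} {z : List Y → ZMod 2} (hz : LZOn T z)
    (hf : ContinuousOn f S) (h : Set.MapsTo f S T) : LZOn S (pull f z) := fun x hx => by
  obtain ⟨U, hU, h'⟩ := hz (f x) (h hx)
  obtain ⟨V, hV, hVU⟩ := mem_nhdsWithin_iff_exists_mem_nhds_inter.1 (hf x hx hU)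
  exact ⟨V, hV, h'.pull fun y hy => ⟨hVU hy, h hy.2⟩⟩
end

/-- Cochains: functions of finite sequences vanishing at the empty one. -/
def cochains (X : Type) : AddSubgroup (List X → ZMod 2) where
  carrier := {z | z [] = 0}
  zero_mem' := rfl
  add_mem' := by intro a b ha hb; simp_all
  neg_mem' := by intro a ha; simp_all

instance : Mul (cochains X) := ⟨fun z w => ⟨cup z w, cup_nil _ _⟩⟩
instance : One (cochains X) := ⟨⟨pt fun _ => 1, rfl⟩⟩
lemma coe_mul (z w : cochains X) : ((z * w : cochains X) : List X → ZMod 2) = cup z w := rfl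
lemma coe_one : ((1 : cochains X) : List X → ZMod 2) = pt fun _ => 1 := rfl

instance : Ring (cochains X) :=
  { (inferInstance : AddCommGroup (cochains X)) with
    mul := (· * ·)
    one := 1
    mul_assoc := fun a b c => Subtype.ext (cup_assoc _ _ _)
    one_mul := fun a => Subtype.ext (pt_one_cup _ a.2)
    mul_one := fun a => Subtype.ext (cup_pt_one _ a.2)
    left_distrib := fun a b c => Subtype.ext (cup_add _ _ _)
    right_distrib := fun a b c => Subtype.ext (add_cup _ _ _)
    zero_mul := fun a => Subtype.ext (by
      have := add_cup (0 : List X → ZMod 2) 0 a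
      rw [add_zero, left_eq_add] at this
      exact this)
    mul_zero := fun a => Subtype.ext (by
      have := cup_add (a : List X → ZMod 2) 0 0
      rw [add_zero, left_eq_add] at this
      exact this) }

/-- The ideal of locally zero cochains. -/
def lz (X : Type) [TopologicalSpace X] : Ideal (cochains X) where
  carrier := {z | LZOn Set.univ (z : List X → ZMod 2)}
  zero_mem' := LZOn.zero
  add_mem' := fun ha hb => ha.add hb
  smul_mem' := fun _ _ hx => LZOn.cup_right _ hx

instance [TopologicalSpace X] : (lz X).IsTwoSided := ⟨fun _ ha => LZOn.cup_left ha _⟩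

lemma mem_lz [TopologicalSpace X] {z : cochains X} : z ∈ lz X ↔ LZOn Set.univ z.1 := Iff.rfl

/-- The Alexander-Spanier cochain ring with coefficients modulo two. -/
def AS (X : Type) [TopologicalSpace X] : Type := cochains X ⧸ lz X

instance [TopologicalSpace X] : Ring (AS X) := inferInstanceAs (Ring (cochains X ⧸ lz X))

/-- The class of a cochain. -/
def AS.mk [TopologicalSpace X] : cochains X →+* AS X := Ideal.Quotient.mk (lz X)

lemma AS.mk_surj [TopologicalSpace X] (a : AS X) : ∃ z, AS.mk z = a :=
  Ideal.Quotient.mk_surjective a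

/-- The coboundary on cochains. -/
def cdHom (X : Type) : cochains X →+ cochains X :=
  AddMonoidHom.mk' (fun z => ⟨cd z, cd_nil _⟩) fun _ _ => Subtype.ext (cd_add _ _)

/-- The degree projection on cochains. -/
def degHom (X : Type) (k : ℕ) : cochains X →+ cochains X :=
  AddMonoidHom.mk' (fun z => ⟨degPart k z, by
    have : z.1 [] = 0 := z.2
    change degPart k z.1 [] = 0
    rw [degPart, this, ite_self]⟩) fun a b => Subtype.ext (by
    funext l
    change (if _ then a.1 l + b.1 l else 0) = (if _ then a.1 l else 0) + if _ then b.1 l else 0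
    split_ifs <;> simp)

lemma coe_cdHom (z : cochains X) : (cdHom X z).1 = cd z.1 := rfl
lemma coe_degHom (k : ℕ) (z : cochains X) : (degHom X k z).1 = degPart k z.1 := rfl
lemma coe_addc (z w : cochains X) : (z + w).1 = z.1 + w.1 := rfl

/-- The pointwise product on cochains. -/
def ptMul (z w : cochains X) : cochains X := ⟨fun l => z.1 l * w.1 l, by
  have : z.1 [] = 0 := z.2
  change z.1 [] * w.1 [] = 0
  rw [this, zero_mul]⟩

lemma coe_ptMul (z w : cochains X) : (ptMul z w).1 = fun l => z.1 l * w.1 l := rfl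

lemma AS.mk_eq [TopologicalSpace X] {z w : cochains X} :
    AS.mk z = AS.mk w ↔ LZOn Set.univ (z.1 + w.1) := by
  refine Ideal.Quotient.eq.trans ?_
  rw [mem_lz, show (z - w).1 = z.1 + w.1 by
    funext l; change z.1 l - w.1 l = z.1 l + w.1 l; grind]

lemma AS.mk_eq_zero [TopologicalSpace X] {z : cochains X} :
    AS.mk z = 0 ↔ LZOn Set.univ z.1 := by
  rw [← map_zero AS.mk, AS.mk_eq]
  exact Iff.of_eq (congrArg _ (add_zero _))

/-- The additive map induced on classes by an additive map preserving local vanishing. -/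
def AS.lift [TopologicalSpace X] (f : cochains X →+ cochains X)
    (h : ∀ a ∈ lz X, f a ∈ lz X) : AS X →+ AS X :=
  QuotientAddGroup.map (lz X).toAddSubgroup (lz X).toAddSubgroup f h

/-- The differential. -/
def AS.dif [TopologicalSpace X] : AS X →+ AS X :=
  AS.lift (cdHom X) fun _ ha => mem_lz.2 (mem_lz.1 ha).cd

/-- The degree projection. -/
def AS.proj [TopologicalSpace X] (k : ℕ) : AS X →+ AS X :=
  AS.lift (degHom X k) fun _ ha => mem_lz.2 ((mem_lz.1 ha).degPart k)

lemma AS.dif_mk [TopologicalSpace X] (z : cochains X) : AS.dif (AS.mk z) = AS.mk (cdHom X z) := rfl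
lemma AS.proj_mk [TopologicalSpace X] (k : ℕ) (z : cochains X) :
    AS.proj k (AS.mk z) = AS.mk (degHom X k z) := rfl

lemma cup_degPart (j k : ℕ) (z w : List X → ZMod 2) :
    degPart (j + k) (cup (degPart j z) (degPart k w)) = cup (degPart j z) (degPart k w) := by
  have key : ∀ (l : List X) (j : ℕ) (z : List X → ZMod 2), l.length ≠ j + k →
      cup (fun l => if l.length = j then z l else 0) (degPart k w) l = 0 := by
    intro l
    induction l with
    | nil => simp
    | cons x l ih =>
      intro j z hl
      rw [cup_cons]
      have h1 : (if [x].length = j then z [x] else 0) * degPart k w (x :: l) = 0 := by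
        simp only [degPart, List.length_cons, List.length_nil] at hl ⊢
        split_ifs <;> simp <;> omega
      rw [h1, zero_add]
      cases j with
      | zero => 
        simp only [List.length_cons, Nat.add_eq_zero_iff, one_ne_zero, and_false, if_false]
        exact VanOn.cup_left (U := Set.univ) (fun _ _ => rfl) _ l (by simp)
      | succ j =>
        simp only [List.length_cons, Nat.add_right_cancel_iff]
        exact ih j (fun l' => z (x :: l')) (by simp at hl; omega)
  funext l
  rw [degPart]
  split_ifs with h
  · rfl
  · rw [eq_comm]
    exact key l (j + 1) z (by omega)

lemma cup_one (z w : List X → ZMod 2) (x y t : X) :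
    cup (degPart 1 z) (degPart 1 w) [x, y, t] = z [x, y] * w [y, t] := by
  simp [cup_cons, degPart]

noncomputable instance [TopologicalSpace X] : GDga (AS X) where
  d := AS.dif
  d_mul a b := by
    obtain ⟨z, rfl⟩ := AS.mk_surj a
    obtain ⟨w, rfl⟩ := AS.mk_surj b
    rw [← map_mul]
    simp only [AS.dif_mk]
    rw [← map_mul, ← map_mul, ← map_add]
    congr 1
    exact Subtype.ext (cd_cup _ _ z.2 w.2)
  d_d a := by
    obtain ⟨z, rfl⟩ := AS.mk_surj a
    simp only [AS.dif_mk]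
    rw [show cdHom X (cdHom X z) = 0 from Subtype.ext (cd_cd _), map_zero]
  pr k := AS.proj k
  pr_pr j k a := by
    obtain ⟨z, rfl⟩ := AS.mk_surj a
    simp only [AS.proj_mk]
    split_ifs with h
    · subst h
      congr 1
      exact Subtype.ext (by funext l; simp only [coe_degHom, degPart]; split_ifs <;> rfl)
    · rw [← map_zero (AS.mk)]
      congr 1
      exact Subtype.ext (by
        funext l
        simp only [coe_degHom, degPart]
        split_ifs <;> first | rfl | omega)
  pr_d k a := by
    obtain ⟨z, rfl⟩ := AS.mk_surj a
    simp only [AS.dif_mk, AS.proj_mk]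
    congr 1
    exact Subtype.ext (degPart_cd k z.1)
  pr_zero_d a := by
    obtain ⟨z, rfl⟩ := AS.mk_surj a
    simp only [AS.dif_mk, AS.proj_mk]
    rw [show degHom X 0 (cdHom X z) = 0 from Subtype.ext (degPart_zero_cd _ z.2), map_zero]
  pr_one := by
    rw [← map_one AS.mk, AS.proj_mk]
    congr 1
    refine Subtype.ext ?_
    funext l
    match l with
    | [] => simp [coe_degHom, degPart, coe_one, pt]
    | [x] => simp [coe_degHom, degPart, coe_one, pt]
    | x :: y :: l => simp [coe_degHom, degPart, coe_one, pt]
  pr_mul j k a b ha hb := by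
    obtain ⟨z, rfl⟩ := AS.mk_surj a
    obtain ⟨w, rfl⟩ := AS.mk_surj b
    rw [← ha, ← hb]
    simp only [AS.proj_mk]
    rw [← map_mul, AS.proj_mk]
    congr 1
    exact Subtype.ext (cup_degPart j k z.1 w.1)
  star := Quotient.map₂ ptMul (by
    intro a b h a' b' h'
    have h1 := AS.mk_eq.1 (Quotient.sound h)
    have h2 := AS.mk_eq.1 (Quotient.sound h')
    refine Quotient.exact (AS.mk_eq.2 ?_)
    intro x hx
    obtain ⟨U, hU, h⟩ := h1 x hx
    obtain ⟨V, hV, h'⟩ := h2 x hx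
    refine ⟨U ∩ V, Filter.inter_mem hU hV, fun l hl => ?_⟩
    have e1 := h l fun y hy => by grind
    have e2 := h' l fun y hy => by grind
    simp only [coe_ptMul, Pi.add_apply] at e1 e2 ⊢
    have e3 : a.1 l = b.1 l := by grind
    have e4 : a'.1 l = b'.1 l := by grind
    rw [e3, e4]
    grind)
  star_comm a b := by
    obtain ⟨z, rfl⟩ := AS.mk_surj a
    obtain ⟨w, rfl⟩ := AS.mk_surj b
    change AS.mk (ptMul z w) = AS.mk (ptMul w z)
    congr 1
    exact Subtype.ext (by funext l; simp [coe_ptMul, mul_comm])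
  d_star a b ha hb ha' hb' := by
    obtain ⟨z, rfl⟩ := AS.mk_surj a
    obtain ⟨w, rfl⟩ := AS.mk_surj b
    rw [AS.proj_mk] at ha hb
    rw [← ha] at ha'
    rw [← hb] at hb'
    rw [← ha, ← hb]
    change AS.mk (cdHom X (ptMul _ _)) = AS.mk (_ * _ + _ * _)
    rw [AS.mk_eq]
    rw [AS.dif_mk, AS.mk_eq_zero] at ha' hb'
    intro x hx
    obtain ⟨U, hU, h⟩ := ha' x hx
    obtain ⟨V, hV, h'⟩ := hb' x hx
    refine ⟨U ∩ V, Filter.inter_mem hU hV, fun l hl => ?_⟩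
    by_cases hlen : l.length = 2 + 1
    · obtain ⟨a, b, c, rfl⟩ := List.length_eq_three.1 hlen
      have e1 := h [a, b, c] fun y hy => by grind
      have e2 := h' [a, b, c] fun y hy => by grind
      have p1 := cup_one z.1 w.1 a b c
      have p2 := cup_one w.1 z.1 a b c
      simp only [coe_cdHom, coe_degHom, Pi.add_apply, cd_cons, coe_ptMul, coe_mul,
        coe_addc, p1, p2] at e1 e2 ⊢
      simp [degPart] at e1 e2 ⊢
      grind
    · have hc := cup_degPart 1 1 z.1 w.1
      have hc' := cup_degPart 1 1 w.1 z.1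
      have hp : degPart 1 (ptMul (degHom X 1 z) (degHom X 1 w)).1 =
          (ptMul (degHom X 1 z) (degHom X 1 w)).1 := by
        funext l
        simp only [degPart, coe_ptMul, coe_degHom]
        split_ifs <;> simp
      have hp' := degPart_cd 1 (ptMul (degHom X 1 z) (degHom X 1 w)).1
      rw [hp] at hp'
      simp only [Pi.add_apply, coe_addc, coe_mul]
      have e1 := congrFun hc l
      have e2 := congrFun hc' l
      have e3 := congrFun hp' l
      rw [degPart, if_neg hlen] at e1 e2 e3
      simp only [coe_degHom, coe_cdHom] at e3 ⊢
      rw [← e1, ← e2, ← e3]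
      simp

section
variable [TopologicalSpace X] [TopologicalSpace Y] [TopologicalSpace Z]

lemma AS.d_mk (z : cochains X) : Dga.d (AS.mk z) = AS.mk (cdHom X z) := rfl
lemma AS.pr_mk (k : ℕ) (z : cochains X) : GDga.pr k (AS.mk z) = AS.mk (degHom X k z) := rfl

instance [Nonempty X] : CharP (AS X) 2 := by
  refine CharTwo.of_one_ne_zero_of_two_eq_zero (fun h => ?_) ?_
  · rw [← map_one AS.mk, AS.mk_eq_zero] at h
    obtain ⟨x⟩ := ‹Nonempty X›
    obtain ⟨U, hU, h⟩ := h x trivial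
    have := h [x] (by simpa using mem_of_mem_nhds hU)
    simp [coe_one, pt] at this
  · rw [← one_add_one_eq_two, ← map_one AS.mk, ← map_add, AS.mk_eq_zero]
    convert LZOn.zero
    funext l
    simp only [coe_addc, Pi.add_apply, Pi.zero_apply]
    grind

/-- Pull-back of cochains. -/
def pullHom (f : X → Y) : cochains Y →+* cochains X where
  toFun z := ⟨pull f z, z.2⟩
  map_one' := Subtype.ext (pull_pt f _)
  map_zero' := rfl
  map_add' _ _ := rfl
  map_mul' _ _ := Subtype.ext (pull_cup f _ _)

omit [TopologicalSpace X] [TopologicalSpace Y] in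
lemma coe_pullHom (f : X → Y) (z : cochains Y) : (pullHom f z).1 = pull f z.1 := rfl

/-- The ring homomorphism induced by a continuous map. -/
noncomputable def AS.map (f : C(X, Y)) : AS Y →+* AS X :=
  Ideal.quotientMap (lz X) (pullHom f) fun _ hz =>
    mem_lz.2 <| LZOn.pull (mem_lz.1 hz) f.continuous.continuousOn (Set.mapsTo_univ _ _)

lemma AS.map_mk (f : C(X, Y)) (z : cochains Y) : AS.map f (AS.mk z) = AS.mk (pullHom f z) := rfl

lemma AS.map_d (f : C(X, Y)) (a : AS Y) : AS.map f (Dga.d a) = Dga.d (AS.map f a) := by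
  obtain ⟨z, rfl⟩ := AS.mk_surj a
  simp only [AS.map_mk, AS.d_mk]
  congr 1
  exact Subtype.ext (pull_cd _ _)

lemma AS.map_pr (f : C(X, Y)) (k : ℕ) (a : AS Y) :
    AS.map f (GDga.pr k a) = GDga.pr k (AS.map f a) := by
  obtain ⟨z, rfl⟩ := AS.mk_surj a
  simp only [AS.map_mk, AS.pr_mk]
  congr 1
  exact Subtype.ext (pull_degPart _ _ _)

lemma AS.map_star (f : C(X, Y)) (a b : AS Y) :
    AS.map f (GDga.star a b) = GDga.star (AS.map f a) (AS.map f b) := by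
  obtain ⟨z, rfl⟩ := AS.mk_surj a
  obtain ⟨w, rfl⟩ := AS.mk_surj b
  rfl

lemma AS.map_comp (f : C(X, Y)) (g : C(Y, Z)) (a : AS Z) :
    AS.map (g.comp f) a = AS.map f (AS.map g a) := by
  obtain ⟨z, rfl⟩ := AS.mk_surj a
  simp only [AS.map_mk]
  congr 1
  exact Subtype.ext (by funext l; simp [coe_pullHom, pull])

lemma AS.map_id (a : AS X) : AS.map (ContinuousMap.id X) a = a := by
  obtain ⟨z, rfl⟩ := AS.mk_surj a
  simp only [AS.map_mk]
  congr 1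
  exact Subtype.ext (by funext l; simp [coe_pullHom, pull])
end

end AlexSpan

end

section

open Topology

namespace AlexSpan
variable {X Y Z : Type} [TopologicalSpace X] [TopologicalSpace Y]

lemma exists_uniform_subdivision {S : Set X} (hS : IsCompact S) {T : Set Y} {H : ℝ × X → Y}
    (hH : ContinuousOn H (Set.Icc 0 1 ×ˢ S)) (hT : Set.MapsTo H (Set.Icc 0 1 ×ˢ S) T)
    {z : List Y → ZMod 2} (hz : LZOn T z) :
    ∃ δ > 0, ∀ x ∈ S, ∃ U ∈ 𝓝 x, ∀ s ∈ Set.Icc (0 : ℝ) 1, ∃ V : Set Y, VanOn V z ∧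
      ∀ t ∈ Set.Icc (0 : ℝ) 1, |t - s| ≤ δ → ∀ y ∈ U ∩ S, H (t, y) ∈ V := by
  refine hS.induction_on (p := fun K => ∃ δ > 0, ∀ x ∈ K, ∃ U ∈ 𝓝 x, ∀ s ∈ Set.Icc (0 : ℝ) 1,
    ∃ V : Set Y, VanOn V z ∧ ∀ t ∈ Set.Icc (0 : ℝ) 1, |t - s| ≤ δ → ∀ y ∈ U ∩ S, H (t, y) ∈ V)
    ⟨1, one_pos, by simp⟩ ?_ ?_ ?_
  · rintro s t hst ⟨δ, hδ, h⟩
    exact ⟨δ, hδ, fun x hx => h x (hst hx)⟩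
  · rintro s t ⟨δ, hδ, h⟩ ⟨δ', hδ', h'⟩
    refine ⟨min δ δ', lt_min hδ hδ', fun x hx => ?_⟩
    rcases hx with hx | hx
    · obtain ⟨U, hU, hU'⟩ := h x hx
      refine ⟨U, hU, fun s hs => ?_⟩
      obtain ⟨V, hV, h⟩ := hU' s hs
      exact ⟨V, hV, fun t ht hts => h t ht (hts.trans (min_le_left _ _))⟩
    · obtain ⟨U, hU, hU'⟩ := h' x hx
      refine ⟨U, hU, fun s hs => ?_⟩
      obtain ⟨V, hV, h⟩ := hU' s hs
      exact ⟨V, hV, fun t ht hts => h t ht (hts.trans (min_le_right _ _))⟩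
  · intro x hx
    obtain ⟨δ, hδ, U, hU, h⟩ : ∃ δ > 0, ∃ U ∈ 𝓝 x, ∀ s ∈ Set.Icc (0 : ℝ) 1,
        ∃ V : Set Y, VanOn V z ∧
          ∀ t ∈ Set.Icc (0 : ℝ) 1, |t - s| ≤ δ → ∀ y ∈ U ∩ S, H (t, y) ∈ V := by
      refine isCompact_Icc.induction_on (p := fun K => ∃ δ > 0, ∃ U ∈ 𝓝 x, ∀ s ∈ K,
        ∃ V : Set Y, VanOn V z ∧
          ∀ t ∈ Set.Icc (0 : ℝ) 1, |t - s| ≤ δ → ∀ y ∈ U ∩ S, H (t, y) ∈ V)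
        ⟨1, one_pos, Set.univ, Filter.univ_mem, by simp⟩ ?_ ?_ ?_
      · rintro s t hst ⟨δ, hδ, U, hU, h⟩
        exact ⟨δ, hδ, U, hU, fun x hx => h x (hst hx)⟩
      · rintro s t ⟨δ, hδ, U, hU, h⟩ ⟨δ', hδ', U', hU', h'⟩
        refine ⟨min δ δ', lt_min hδ hδ', U ∩ U', Filter.inter_mem hU hU', fun s hs => ?_⟩
        rcases hs with hs | hs
        · obtain ⟨V, hV, h⟩ := h s hs
          exact ⟨V, hV, fun t ht hts y hy =>
            h t ht (hts.trans (min_le_left _ _)) y ⟨hy.1.1, hy.2⟩⟩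
        · obtain ⟨V, hV, h⟩ := h' s hs
          exact ⟨V, hV, fun t ht hts y hy =>
            h t ht (hts.trans (min_le_right _ _)) y ⟨hy.1.2, hy.2⟩⟩
      · intro s hs
        obtain ⟨V, hV, hVz⟩ := hz (H (s, x)) (hT ⟨hs, hx⟩)
        have := hH (s, x) ⟨hs, hx⟩ hV
        rw [Filter.mem_map, mem_nhdsWithin_iff_exists_mem_nhds_inter] at this
        obtain ⟨W, hW, hW'⟩ := this
        rw [nhds_prod_eq, Filter.mem_prod_iff] at hW
        obtain ⟨A, hA, U, hU, hAU⟩ := hW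
        obtain ⟨ε, hε, hA⟩ := Metric.mem_nhds_iff.1 hA
        refine ⟨Metric.ball s (ε / 2), mem_nhdsWithin_of_mem_nhds (Metric.ball_mem_nhds _ (half_pos hε)),
          ε / 4, by positivity, U, hU, fun s' hs' => ⟨V ∩ T, hVz, fun t ht hts y hy => ?_⟩⟩
        refine ⟨hW' ⟨hAU ⟨hA ?_, hy.1⟩, ht, hy.2⟩, hT ⟨ht, hy.2⟩⟩
        rw [Metric.mem_ball, Real.dist_eq] at hs' ⊢
        calc |t - s| = |(t - s') + (s' - s)| := by ring_nf
          _ ≤ |t - s'| + |s' - s| := abs_add_le _ _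
          _ < ε := by linarith
    refine ⟨interior U, mem_nhdsWithin_of_mem_nhds (interior_mem_nhds.2 hU), δ, hδ,
      fun x' hx' => ⟨U, mem_interior_iff_mem_nhds.1 hx', h⟩⟩

theorem homotopy_invariance {S : Set X} (hS : IsCompact S) {T : Set Y} {H : ℝ × X → Y}
    (hH : ContinuousOn H (Set.Icc 0 1 ×ˢ S)) (hT : Set.MapsTo H (Set.Icc 0 1 ×ˢ S) T)
    {z : List Y → ZMod 2} (hz : LZOn T (cd z)) :
    ∃ y : List X → ZMod 2, y [] = 0 ∧
      LZOn S (pull (fun x => H (0, x)) z + pull (fun x => H (1, x)) z + cd y) := by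
  obtain ⟨δ, hδ, h⟩ := exists_uniform_subdivision hS hH hT hz
  obtain ⟨N, hN⟩ := exists_nat_one_div_lt hδ
  have hN0 : (0 : ℝ) < N + 1 := by positivity
  have key : ∀ k : ℕ, k ≤ N + 1 → ∃ y : List X → ZMod 2, y [] = 0 ∧
      LZOn S (pull (fun x => H (0, x)) z + pull (fun x => H (k / (N + 1), x)) z + cd y) := by
    intro k
    induction k with
    | zero =>
      refine fun _ => ⟨0, rfl, ?_⟩
      convert LZOn.zero
      rw [cd_zero]
      funext l
      simp only [CharP.cast_eq_zero, zero_div, add_zero, Pi.add_apply, Pi.zero_apply]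
      grind
    | succ k ih =>
      intro hk
      obtain ⟨y, hy, hy'⟩ := ih (by omega)
      refine ⟨y + prism (fun x => H (k / (N + 1), x)) (fun x => H ((k + 1 : ℕ) / (N + 1), x)) z,
        by simp [hy, prism], ?_⟩
      have e := prism_cd (fun x => H (k / (N + 1), x)) (fun x => H ((k + 1 : ℕ) / (N + 1), x)) z
      have h2 : LZOn S (prism (fun x => H (k / (N + 1), x))
          (fun x => H ((k + 1 : ℕ) / (N + 1), x)) (cd z)) := by
        intro x hx
        obtain ⟨U, hU, h⟩ := h x hx
        have hk1 : ((k : ℝ) + 1) ≤ N + 1 := by exact_mod_cast hk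
        have hm : (k / (N + 1) : ℝ) ∈ Set.Icc (0 : ℝ) 1 :=
          ⟨by positivity, by rw [div_le_one hN0]; linarith⟩
        have hm' : ((k + 1 : ℕ) / (N + 1) : ℝ) ∈ Set.Icc (0 : ℝ) 1 :=
          ⟨by positivity, by rw [div_le_one hN0]; push_cast; linarith⟩
        obtain ⟨V, hV, h⟩ := h _ hm
        refine ⟨U, hU, prism_van hV (fun y hy => h _ hm (by simp [hδ.le]) y hy)
          (fun y hy => h _ hm' ?_ y hy)⟩
        rw [← sub_div]
        push_cast
        rw [add_sub_cancel_left, abs_of_pos (by positivity)]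
        exact hN.le
      convert hy'.add h2 using 1
      rw [cd_add]
      funext l
      have := congrFun e l
      simp only [Pi.add_apply] at this ⊢
      grind
  obtain ⟨y, hy, h⟩ := key (N + 1) le_rfl
  refine ⟨y, hy, ?_⟩
  convert h using 6
  push_cast
  rw [div_self hN0.ne']

theorem AS.map_homotopic [CompactSpace X] {f g : C(X, Y)} (h : f.Homotopic g) {a : AS Y}
    (ha : Dga.d a = 0) : ∃ y, AS.map f a + AS.map g a = Dga.d y := by
  obtain ⟨z, rfl⟩ := AS.mk_surj a
  obtain ⟨F⟩ := h
  have hz : LZOn Set.univ (cd z.1) := by rwa [AS.d_mk, AS.mk_eq_zero] at ha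
  obtain ⟨y, hy, h⟩ := homotopy_invariance (H := fun p : ℝ × X => F (Set.projIcc 0 1 zero_le_one p.1, p.2))
    isCompact_univ (by fun_prop) (Set.mapsTo_univ _ _) hz
  refine ⟨AS.mk ⟨y, hy⟩, ?_⟩
  rw [AS.d_mk, AS.map_mk, AS.map_mk, ← map_add, AS.mk_eq]
  have e0 : pull (fun x => F (Set.projIcc 0 1 zero_le_one ((0 : ℝ), x).1, ((0 : ℝ), x).2)) z.1 =
      pull f z.1 := by congr 1; funext x; simp
  have e1 : pull (fun x => F (Set.projIcc 0 1 zero_le_one ((1 : ℝ), x).1, ((1 : ℝ), x).2)) z.1 =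
      pull g z.1 := by congr 1; funext x; simp
  rw [e0, e1] at h
  exact h

end AlexSpan

end

section

open Topology

namespace AlexSpan
variable {X Y Z : Type}

lemma VanOn.pt_const {U : Set X} {u : X → ZMod 2} {c : ZMod 2} (h : ∀ x ∈ U, u x = c) :
    VanOn U (pt u + fun l => c * pt (fun _ => 1) l) := by
  intro l hl
  match l with
  | [] => simp [pt]
  | [x] => simp [pt, h x (hl x (by simp))]; grind
  | x :: y :: l => simp [pt]

lemma cd_pt_one : cd (pt fun _ : X => 1) = 0 := by
  funext l
  match l with
  | [] => simp
  | [x] => simp [cd_cons, pt]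
  | [x, y] => simp [cd_cons, pt]; grind
  | x :: y :: t :: l =>
    have : ∀ (z : List X → ZMod 2) l, (∀ l' ≠ [], z l' = 0) → 2 ≤ l.length → cd z l = 0 := by
      intro z l hz hl
      induction l generalizing z with
      | nil => simp
      | cons x l ih =>
        rw [cd_cons, hz l (by rintro rfl; simp at hl)]
        match l with
        | [] => simp
        | y :: [] => simp [cd_cons, hz]
        | y :: y' :: l => rw [ih _ (fun l' _ => hz _ (by simp)) (by simp)]; simp
    rw [cd_cons, this _ _ ?_ (by simp)]
    · simp [pt]
    · intro l hl
      cases l <;> simp_all [pt]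

lemma VanOn.cd_pt_const {U : Set X} {u : X → ZMod 2} {c : ZMod 2} (h : ∀ x ∈ U, u x = c) :
    VanOn U (AlexSpan.cd (pt u)) := by
  have := (VanOn.pt_const h).cd
  rw [cd_add, cd_smul, cd_pt_one] at this
  intro l hl
  simpa using this l hl

lemma VanOn.cup_pt_const {U : Set X} {u : X → ZMod 2} {c : ZMod 2} (h : ∀ x ∈ U, u x = c)
    (w : List X → ZMod 2) (hw : w [] = 0) : VanOn U (cup w (pt u) + fun l => c * w l) := by
  have h1 := VanOn.cup_right w (VanOn.pt_const h)
  rw [cup_add] at h1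
  have h2 : cup w (fun l => c * pt (fun _ => 1) l) = fun l => c * w l := by
    have : ∀ c : ZMod 2, c = 0 ∨ c = 1 := by decide
    rcases this c with rfl | rfl
    · funext l
      simp only [zero_mul]
      have := cup_add w 0 0
      rw [add_zero, left_eq_add] at this
      exact congrFun this l
    · simp only [one_mul]
      exact cup_pt_one w hw
  rwa [h2] at h1

lemma VanOn.congr {U : Set X} {z w : List X → ZMod 2} (h : VanOn U z) (h' : VanOn U (z + w)) :
    VanOn U w := fun l hl => by
  have := h l hl; have := h' l hl; simp only [Pi.add_apply] at *; grind

lemma glue [TopologicalSpace X] {S D D' : Set X} {ζ ψ ψ' : List X → ZMod 2}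
    (hD : IsClosed D)
    (hcov : ∀ x ∈ S, D ∈ 𝓝[S] x ∨ D' ∈ 𝓝[S] x) (hψ : ψ [] = 0) (hψ' : ψ' [] = 0)
    (h : LZOn D (ζ + cd ψ)) (h' : LZOn D' (ζ + cd ψ')) (hL : LZOn (D ∩ D') (ψ + ψ')) :
    ∃ χ : List X → ZMod 2, χ [] = 0 ∧ LZOn S (ζ + cd χ) := by
  classical
  refine ⟨fun l => if ∀ y ∈ l, y ∈ D then ψ l else ψ' l, by simp [hψ], fun x hx => ?_⟩
  rcases hcov x hx with hx' | hx'
  · obtain ⟨V, hV, hVD⟩ := mem_nhdsWithin_iff_exists_mem_nhds_inter.1 hx'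
    obtain ⟨U, hU, h⟩ := h x (hVD ⟨mem_of_mem_nhds hV, hx⟩)
    refine ⟨U ∩ V, Filter.inter_mem hU hV, ?_⟩
    have h1 : VanOn (U ∩ V ∩ S) (ζ + cd ψ) := h.mono (by
      rintro y ⟨⟨hy, hy'⟩, hy''⟩; exact ⟨hy, hVD ⟨hy', hy''⟩⟩)
    have h2 : VanOn (U ∩ V ∩ S) (ψ + fun l => if ∀ y ∈ l, y ∈ D then ψ l else ψ' l) := by
      intro l hl
      have : ∀ y ∈ l, y ∈ D := fun y hy => hVD ⟨(hl y hy).1.2, (hl y hy).2⟩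
      simp only [Pi.add_apply, if_pos this]
      grind
    have h3 := h2.cd
    rw [cd_add] at h3
    refine h1.congr ?_
    convert h3 using 1
    funext l; simp only [Pi.add_apply]; grind
  · obtain ⟨V, hV, hVD⟩ := mem_nhdsWithin_iff_exists_mem_nhds_inter.1 hx'
    obtain ⟨U, hU, h⟩ := h' x (hVD ⟨mem_of_mem_nhds hV, hx⟩)
    obtain ⟨W, hW, hW'⟩ : ∃ W ∈ 𝓝 x, VanOn (W ∩ (V ∩ S))
        (ψ' + fun l => if ∀ y ∈ l, y ∈ D then ψ l else ψ' l) := by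
      by_cases hxD : x ∈ D
      · obtain ⟨W, hW, hL⟩ := hL x ⟨hxD, hVD ⟨mem_of_mem_nhds hV, hx⟩⟩
        refine ⟨W, hW, fun l hl => ?_⟩
        by_cases hlD : ∀ y ∈ l, y ∈ D
        · simp only [Pi.add_apply, if_pos hlD]
          have := hL l fun y hy => ⟨(hl y hy).1, hlD y hy, hVD (hl y hy).2⟩
          simp only [Pi.add_apply] at this
          grind
        · simp only [Pi.add_apply, if_neg hlD]
          grind
      · refine ⟨Dᶜ, hD.isOpen_compl.mem_nhds hxD, fun l hl => ?_⟩
        cases l with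
        | nil => simp [hψ, hψ']
        | cons y l =>
          have : ¬ ∀ y' ∈ y :: l, y' ∈ D := fun hc => (hl y (by simp)).1 (hc y (by simp))
          simp only [Pi.add_apply, if_neg this]
          grind
    refine ⟨U ∩ V ∩ W, Filter.inter_mem (Filter.inter_mem hU hV) hW, ?_⟩
    have h1 : VanOn (U ∩ V ∩ W ∩ S) (ζ + cd ψ') := h.mono (by
      rintro y ⟨⟨⟨hy, hy'⟩, hy3⟩, hy''⟩; exact ⟨hy, hVD ⟨hy', hy''⟩⟩)
    have h3 := (hW'.mono (U := U ∩ V ∩ W ∩ S) (by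
      rintro y ⟨⟨⟨hy, hy'⟩, hy3⟩, hy''⟩; exact ⟨hy3, hy', hy''⟩)).cd
    rw [cd_add] at h3
    refine h1.congr ?_
    convert h3 using 1
    funext l; simp only [Pi.add_apply]; grind

/-- Every cocycle on the product of the unit sphere of `E` with `B` is cohomologous to a
combination of `1` and `s` with coefficients coming from `B`. -/
def SphereClaim (E B : Type) [NormedAddCommGroup E] [TopologicalSpace B]
    (s : List (E × B) → ZMod 2) : Prop :=
  ∀ z : List (E × B) → ZMod 2, z [] = 0 → LZOn (Metric.sphere 0 1 ×ˢ Set.univ) (cd z) →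
    ∃ (b b' : List B → ZMod 2) (y : List (E × B) → ZMod 2), b [] = 0 ∧ b' [] = 0 ∧ y [] = 0 ∧
      LZOn Set.univ (cd b) ∧ LZOn Set.univ (cd b') ∧
      LZOn (Metric.sphere 0 1 ×ˢ Set.univ)
        (z + pull Prod.snd b + cup (pull Prod.snd b') s + cd y)

variable {E B : Type} [NormedAddCommGroup E] [NormedSpace ℝ E] [TopologicalSpace B]

lemma norm_pair (t : ℝ) (v : E) : ‖(t, v)‖ = max |t| ‖v‖ := by
  rw [Prod.norm_def, Real.norm_eq_abs]

/-- The part of the sphere of `ℝ × E` away from one pole. -/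
def Dpole (E B : Type) [NormedAddCommGroup E] (ε : ℝ) : Set ((ℝ × E) × B) :=
  {p | ‖p.1‖ = 1 ∧ -‖p.1.2‖ ≤ ε * p.1.1}

lemma isCompact_Dpole [FiniteDimensional ℝ E] [CompactSpace B] (ε : ℝ) :
    IsCompact (Dpole E B ε) := by
  have : IsCompact (Metric.sphere (0 : ℝ × E) 1 ×ˢ (Set.univ : Set B)) :=
    (isCompact_sphere _ _).prod isCompact_univ
  have h2 : IsCompact ((Metric.sphere (0 : ℝ × E) 1 ∩ {p : ℝ × E | -‖p.2‖ ≤ ε * p.1}) ×ˢ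
      (Set.univ : Set B)) :=
    ((isCompact_sphere _ _).inter_right 
      (isClosed_le (f := fun p : ℝ × E => -‖p.2‖) (g := fun p : ℝ × E => ε * p.1)
        continuous_snd.norm.neg (continuous_const.mul continuous_fst))).prod
      isCompact_univ
  convert h2 using 1
  ext p
  simp [Dpole]

lemma isClosed_Dpole (ε : ℝ) : IsClosed (Dpole E B ε) :=
  (isClosed_eq (f := fun p : (ℝ × E) × B => ‖p.1‖) (by fun_prop) continuous_const).inter
    (isClosed_le (f := fun p : (ℝ × E) × B => -‖p.1.2‖) (g := fun p : (ℝ × E) × B => ε * p.1.1)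
      (by fun_prop) (by fun_prop))

lemma cocycle_on_Dpole [FiniteDimensional ℝ E] [CompactSpace B] {ε : ℝ} (hε : ε = 1 ∨ ε = -1)
    {z : List ((ℝ × E) × B) → ZMod 2} (hz : LZOn (Dpole E B ε) (cd z)) :
    ∃ y : List ((ℝ × E) × B) → ZMod 2, y [] = 0 ∧ LZOn (Dpole E B ε)
      (z + pull Prod.snd (pull (fun b => ((ε, (0 : E)), b)) z) + cd y) := by
  have hε2 : ε * ε = 1 := by rcases hε with rfl | rfl <;> norm_num
  have hεa : |ε| = 1 := by rcases hε with rfl | rfl <;> norm_num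
  let K : ℝ × ((ℝ × E) × B) → ℝ × E := fun q => (1 - q.1) • q.2.1 + q.1 • (ε, (0 : E))
  have hK : Continuous K := by fun_prop
  have hcone : ∀ q ∈ Set.Icc (0 : ℝ) 1 ×ˢ Dpole E B ε, -‖(K q).2‖ ≤ ε * (K q).1 := by
    rintro ⟨τ, ⟨⟨t, v⟩, b⟩⟩ ⟨⟨h0, h1⟩, hn, hq⟩
    simp only [K, Prod.smul_mk, Prod.mk_add_mk, smul_zero, add_zero, smul_eq_mul] at *
    rw [norm_smul, Real.norm_of_nonneg (by linarith)]
    have := mul_le_mul_of_nonneg_left hq (sub_nonneg.2 h1)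
    nlinarith
  have hK0 : ∀ q ∈ Set.Icc (0 : ℝ) 1 ×ˢ Dpole E B ε, ‖K q‖ ≠ 0 := by
    rintro ⟨τ, ⟨⟨t, v⟩, b⟩⟩ ⟨⟨h0, h1⟩, hn, hq⟩ hc
    simp only [K, Prod.smul_mk, Prod.mk_add_mk, smul_zero, add_zero, smul_eq_mul, norm_eq_zero,
      Prod.mk_eq_zero, smul_eq_zero] at *
    obtain ⟨hc1, hc2 | rfl⟩ := hc
    · have : τ = 1 := by linarith
      subst this
      simp at hc1
      simp [hc1] at hεa
    · rw [norm_pair, norm_zero] at hn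
      rw [norm_zero, neg_zero] at hq
      rw [max_eq_left (abs_nonneg t)] at hn
      have : ε * t = 1 := by
        rw [← abs_of_nonneg hq, abs_mul, hεa, hn, one_mul]
      have h2 : ε * ((1 - τ) * t + τ * ε) = 0 := by rw [hc1, mul_zero]
      have h3 : ε * ((1 - τ) * t + τ * ε) = (1 - τ) * (ε * t) + τ * (ε * ε) := by ring
      rw [h3, this, hε2] at h2
      linarith
  refine Exists.elim (homotopy_invariance (X := (ℝ × E) × B) (S := Dpole E B ε)
    (H := fun q => (‖K q‖⁻¹ • K q, q.2.2)) (isCompact_Dpole ε)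
    (T := Dpole E B ε) (z := z) ?_ ?_ hz) ?_
  rotate_left 2
  · rintro y ⟨hy, h⟩
    refine ⟨y, hy, ?_⟩
    intro x hx
    obtain ⟨U, hU, h⟩ := h x hx
    refine ⟨U, hU, fun l hl => ?_⟩
    rw [← h l hl]
    have e0 : l.map (fun p => (‖K (0, p)‖⁻¹ • K (0, p), p.2)) = l := by
      refine (List.map_congr_left fun p hp => ?_).trans (List.map_id l)
      have : ‖p.1‖ = 1 := (hl p hp).2.1
      simp only [K, sub_zero, one_smul, zero_smul, add_zero, this, inv_one]
      rfl
    have e1 : l.map (fun p => (‖K (1, p)‖⁻¹ • K (1, p), p.2)) =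
        (l.map Prod.snd).map (fun b => ((ε, (0 : E)), b)) := by
      rw [List.map_map]
      refine List.map_congr_left fun p hp => ?_
      simp only [K, Function.comp]
      have : ‖((ε, 0) : ℝ × E)‖ = 1 := by rw [norm_pair, norm_zero, hεa]; simp
      simp only [sub_self, zero_smul, one_smul, zero_add, this, inv_one]
    simp only [Pi.add_apply, pull, e0, e1]
  · refine ContinuousOn.prodMk (ContinuousOn.smul (ContinuousOn.inv₀ hK.norm.continuousOn hK0)
      hK.continuousOn) (by fun_prop)
  · intro q hq
    refine ⟨?_, ?_⟩
    · simp only [norm_smul, norm_inv, norm_norm]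
      exact inv_mul_cancel₀ (hK0 q hq)
    · simp only [Prod.smul_fst, Prod.smul_snd, norm_smul, norm_inv, norm_norm, smul_eq_mul]
      have := mul_le_mul_of_nonneg_left (hcone q hq) (inv_nonneg.2 (norm_nonneg (K q)))
      linarith

lemma exact_on_band [FiniteDimensional ℝ E] [CompactSpace B]
    {z : List ((ℝ × E) × B) → ZMod 2} (hz : LZOn (Dpole E B 1 ∩ Dpole E B (-1)) (cd z))
    {y : List (E × B) → ZMod 2} (hy0 : y [] = 0) (hy : LZOn (Metric.sphere 0 1 ×ˢ Set.univ)
      (pull (fun q : E × B => (((0 : ℝ), q.1), q.2)) z + cd y)) :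
    ∃ y : List ((ℝ × E) × B) → ZMod 2, y [] = 0 ∧
      LZOn (Dpole E B 1 ∩ Dpole E B (-1)) (z + cd y) := by
  have hL : ∀ p : (ℝ × E) × B, p ∈ Dpole E B 1 ∩ Dpole E B (-1) ↔ |p.1.1| ≤ 1 ∧ ‖p.1.2‖ = 1 := by
    rintro ⟨⟨t, v⟩, b⟩
    simp only [Dpole, Set.mem_inter_iff, Set.mem_ofPred_eq, norm_pair]
    constructor
    · rintro ⟨⟨h, h1⟩, _, h2⟩
      have : |t| ≤ ‖v‖ := abs_le.2 ⟨by linarith, by linarith⟩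
      rw [max_eq_right this] at h
      exact ⟨this.trans h.le, h⟩
    · rintro ⟨h, h'⟩
      rw [h', max_eq_right h]
      have := abs_le.1 h
      exact ⟨⟨rfl, by linarith⟩, rfl, by linarith⟩
  refine Exists.elim (homotopy_invariance (X := (ℝ × E) × B)
    (S := Dpole E B 1 ∩ Dpole E B (-1)) (T := Dpole E B 1 ∩ Dpole E B (-1))
    (H := fun q => (((1 - q.1) * q.2.1.1, q.2.1.2), q.2.2))
    ((isCompact_Dpole 1).inter_right (isClosed_Dpole _)) (z := z) (by fun_prop) ?_ hz) ?_
  rotate_left 1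
  · rintro y' ⟨hy', h⟩
    have hρ := LZOn.pull (S := Dpole E B 1 ∩ Dpole E B (-1))
      (f := fun p : (ℝ × E) × B => (p.1.2, p.2)) hy (by fun_prop)
      (fun p hp => by simpa using ((hL p).1 hp).2)
    refine ⟨y' + pull (fun p : (ℝ × E) × B => (p.1.2, p.2)) y, ?_, ?_⟩
    · simp [hy', pull, hy0]
    · convert h.add hρ using 1
      rw [cd_add, ← pull_cd]
      funext l
      simp only [Pi.add_apply, pull, List.map_map, Function.comp_def, sub_zero, one_mul, sub_self,
        zero_mul, Prod.mk.eta, List.map_id']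
      grind
  · rintro ⟨τ, p⟩ ⟨⟨h0, h1⟩, hp⟩
    rw [hL] at hp ⊢
    refine ⟨?_, hp.2⟩
    simp only [abs_mul]
    rw [abs_of_nonneg (by linarith)]
    have := abs_nonneg p.1.1
    nlinarith [hp.1]

theorem sphereClaim_succ [FiniteDimensional ℝ E] [Nontrivial E] [CompactSpace B]
    {w s : List ((ℝ × E) × B) → ZMod 2} (hw0 : w [] = 0)
    (hE : SphereClaim E B (pull (fun q : E × B => (((0 : ℝ), q.1), q.2)) w))
    (hw : LZOn (Dpole E B 1 ∩ Dpole E B (-1)) (cd w))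
    (hs : LZOn (Dpole E B 1) (s + cd w)) (hs' : LZOn (Dpole E B (-1)) s) :
    SphereClaim (ℝ × E) B s := by
  intro z hz0 hz
  have hD : ∀ ε, Dpole E B ε ⊆ Metric.sphere 0 1 ×ˢ Set.univ := fun ε p hp => by
    simpa using hp.1
  obtain ⟨ψ, hψ0, hψ⟩ := cocycle_on_Dpole (.inl rfl) (hz.mono (hD 1))
  obtain ⟨ψ', hψ0', hψ'⟩ := cocycle_on_Dpole (.inr rfl) (hz.mono (hD (-1)))
  set b := pull (fun b : B => (((1 : ℝ), (0 : E)), b)) z with hb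
  set b₁ := pull (fun b : B => (((-1 : ℝ), (0 : E)), b)) z with hb₁
  obtain ⟨v, hv⟩ : ∃ v : E, ‖v‖ = 1 := exists_norm_eq E zero_le_one
  have hj : ∀ ε x, (((0 : ℝ), v), x) ∈ Dpole E B ε := fun ε x => by
    simp [Dpole, hv]
  have h1 := hψ.pull (S := Set.univ) (f := fun x : B => (((0 : ℝ), v), x)) (by fun_prop)
    fun x _ => hj _ x
  have h2 := hψ'.pull (S := Set.univ) (f := fun x : B => (((0 : ℝ), v), x)) (by fun_prop)
    fun x _ => hj _ x
  set κ := pull (fun x : B => (((0 : ℝ), v), x)) (ψ + ψ') with hκ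
  have hκ' : LZOn Set.univ (b + b₁ + cd κ) := by
    convert h1.add h2 using 1
    rw [hκ, ← pull_cd, cd_add]
    funext l
    simp only [Pi.add_apply, pull, List.map_map, Function.comp_def, List.map_id']
    grind
  have h3 := (hκ'.pull (S := Dpole E B (-1)) (f := Prod.snd) continuous_snd.continuousOn
    (Set.mapsTo_univ _ _))
  have hψ2 : LZOn (Dpole E B (-1)) (z + pull Prod.snd b + cd (ψ' + pull Prod.snd κ)) := by
    convert hψ'.add h3 using 1
    rw [cd_add, ← pull_cd]
    funext l
    simp only [Pi.add_apply, pull]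
    grind
  set ψ₂ := ψ' + pull Prod.snd κ with hψ₂
  have hψ₂0 : ψ₂ [] = 0 := by simp [hψ₂, hψ0', hκ, pull, hψ0]
  have hχ : LZOn (Dpole E B 1 ∩ Dpole E B (-1)) (cd (ψ + ψ₂)) := by
    convert (hψ.mono Set.inter_subset_left).add (hψ2.mono Set.inter_subset_right) using 1
    rw [cd_add]
    funext l
    simp only [Pi.add_apply]
    grind
  have hi : Set.MapsTo (fun q : E × B => (((0 : ℝ), q.1), q.2)) (Metric.sphere 0 1 ×ˢ Set.univ)
      (Dpole E B 1 ∩ Dpole E B (-1)) := by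
    rintro ⟨v, x⟩ ⟨hv, -⟩
    simp only [mem_sphere_iff_norm, sub_zero] at hv
    simp [Dpole, hv]
  obtain ⟨c, c', y, hc0, hc0', hy0, hc, hc', h⟩ := hE
    (pull (fun q : E × B => (((0 : ℝ), q.1), q.2)) (ψ + ψ₂)) (by simp [pull, hψ0, hψ₂0]) (by
      rw [← pull_cd]
      exact hχ.pull (by fun_prop) hi)
  have hpc := hc.pull (S := Set.univ) (f := (Prod.snd : (ℝ × E) × B → B))
    continuous_snd.continuousOn (Set.mapsTo_univ _ _)
  have hpc' := hc'.pull (S := Set.univ) (f := (Prod.snd : (ℝ × E) × B → B))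
    continuous_snd.continuousOn (Set.mapsTo_univ _ _)
  rw [pull_cd] at hpc hpc'
  have hcw : cd (cup (pull Prod.snd c') w) =
      cup (cd (pull Prod.snd c')) w + cup (pull Prod.snd c') (cd w) := cd_cup _ _ (by
        simp [pull, hc0']) hw0
  obtain ⟨χ, hχ0, hχ'⟩ := exact_on_band (E := E) (B := B)
    (z := ψ + ψ₂ + pull Prod.snd c + cup (pull Prod.snd c') w) (by
      rw [cd_add, cd_add, hcw]
      exact ((hχ.add (hpc.mono (Set.subset_univ _))).add
        (((hpc'.cup_left w).mono (Set.subset_univ _)).add (hw.cup_right _)))) hy0 (by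
      convert h using 1
      have := pull_cup (fun q : E × B => (((0 : ℝ), q.1), q.2)) (pull Prod.snd c') w
      have e2 : pull (fun q : E × B => (((0 : ℝ), q.1), q.2)) (pull Prod.snd c') =
          pull Prod.snd c' := by
        funext l
        simp only [pull, List.map_map, Function.comp_def]
      rw [e2] at this
      rw [← this]
      funext l
      simp only [Pi.add_apply, pull, List.map_map, Function.comp_def])
  refine Exists.elim (glue (S := Metric.sphere 0 1 ×ˢ Set.univ) (D' := Dpole E B (-1)) (ζ := z + pull Prod.snd b + cup (pull Prod.snd c') s)
    (ψ := ψ + pull Prod.snd c + cup (pull Prod.snd c') w + cd χ) (ψ' := ψ₂)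
    (isClosed_Dpole 1) ?_ ?_ hψ₂0 ?_ ?_ ?_) ?_
  rotate_left 5
  · rintro η ⟨hη0, hη⟩
    refine ⟨b, c', η, ?_, hc0', hη0, ?_, hc', hη⟩
    · simp [hb, pull, hz0]
    · rw [hb, ← pull_cd]
      exact hz.pull (by fun_prop) fun x _ => by simp
  · rintro ⟨⟨t, v⟩, x⟩ ⟨hn, -⟩
    simp only [mem_sphere_iff_norm, sub_zero] at hn
    by_cases ht : -‖v‖ < t
    · left
      have : {p : (ℝ × E) × B | -‖p.1.2‖ < p.1.1} ∈ 𝓝 ((t, v), x) :=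
        (isOpen_lt (by fun_prop) (by fun_prop)).mem_nhds ht
      filter_upwards [mem_nhdsWithin_of_mem_nhds this, self_mem_nhdsWithin] with p hp hp'
      exact ⟨by simpa using hp'.1, by rw [one_mul]; exact hp.le⟩
    · right
      have ht' : t < ‖v‖ := by
        by_contra hc
        have h1 := norm_nonneg v
        have h2 : t = 0 := by linarith
        have h3 : ‖v‖ = 0 := by linarith
        rw [norm_pair, h2, h3] at hn
        simp at hn
      have : {p : (ℝ × E) × B | p.1.1 < ‖p.1.2‖} ∈ 𝓝 ((t, v), x) :=
        (isOpen_lt (by fun_prop) (by fun_prop)).mem_nhds ht'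
      filter_upwards [mem_nhdsWithin_of_mem_nhds this, self_mem_nhdsWithin] with p hp hp'
      exact ⟨by simpa using hp'.1, by rw [neg_one_mul]; exact neg_le_neg hp.le⟩
  · simp [hψ0, pull, hc0]
  · have e1 := hs.cup_right (pull Prod.snd c')
    have e2 := (hpc'.cup_left w).mono (Set.subset_univ (Dpole E B 1))
    convert ((hψ.add e1).add e2).add (hpc.mono (Set.subset_univ (Dpole E B 1))) using 1
    rw [cd_add, cd_add, cd_add, cd_cd, hcw, cup_add]
    funext l
    simp only [Pi.add_apply, Pi.zero_apply]
    grind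
  · convert hψ2.add (hs'.cup_right (pull Prod.snd c')) using 1
    funext l
    simp only [Pi.add_apply]
    grind
  · convert hχ' using 1
    funext l
    simp only [Pi.add_apply]
    grind

omit [NormedSpace ℝ E] in
lemma SphereClaim.transfer {E' : Type} [NormedAddCommGroup E'] {L : E → E'} {L' : E' → E}
    (hL : Continuous L) (hL' : Continuous L') (hn : ∀ x, ‖L x‖ = ‖x‖) (h1 : ∀ x, L (L' x) = x)
    {s : List (E' × B) → ZMod 2}
    (h : SphereClaim E B (pull (fun q : E × B => (L q.1, q.2)) s)) : SphereClaim E' B s := by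
  intro z hz0 hz
  obtain ⟨b, b', y, hb, hb', hy, hcb, hcb', hc⟩ := h (pull (fun q : E × B => (L q.1, q.2)) z) hz0
    (by
      rw [← pull_cd]
      exact hz.pull (by fun_prop) fun p hp => by simpa [hn] using hp)
  refine ⟨b, b', pull (fun q : E' × B => (L' q.1, q.2)) y, hb, hb', hy, hcb, hcb', ?_⟩
  have := hc.pull (S := Metric.sphere 0 1 ×ˢ Set.univ) (f := fun q : E' × B => (L' q.1, q.2))
    (by fun_prop) fun p hp => by simpa [← hn, h1] using hp
  have e1 := pull_cup (fun q : E × B => (L q.1, q.2)) (pull Prod.snd b') s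
  have e2 : pull (fun q : E × B => (L q.1, q.2)) (pull Prod.snd b') = pull Prod.snd b' := by
    funext l
    simp only [pull, List.map_map, Function.comp_def]
  rw [e2] at e1
  rw [← e1] at this
  convert this using 1
  rw [← pull_cd]
  funext l
  simp only [Pi.add_apply, pull, List.map_map, Function.comp_def, h1, List.map_id']

/-- The fundamental cochain of a sphere in terms of the signs of the coordinates. -/
def sph : ∀ n : ℕ, (Fin (n + 1) → X → ZMod 2) → List X → ZMod 2
  | 0, θ => pt (θ 0)
  | n + 1, θ => cup (cd (sph n fun i => θ i.succ)) (pt (θ 0))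

lemma sph_nil (n : ℕ) (θ : Fin (n + 1) → X → ZMod 2) : sph n θ [] = 0 := by
  cases n <;> simp [sph, pt]

lemma pull_sph (f : X → Y) (n : ℕ) (θ : Fin (n + 1) → Y → ZMod 2) :
    pull f (sph n θ) = sph n fun i x => θ i (f x) := by
  induction n with
  | zero => simp only [sph, pull_pt]; rfl
  | succ n ih => simp only [sph, pull_cup, pull_pt, pull_cd, ih]; rfl

lemma cd_sph_succ (n : ℕ) (θ : Fin (n + 2) → X → ZMod 2) :
    cd (sph (n + 1) θ) = cup (cd (sph n fun i => θ i.succ)) (cd (pt (θ 0))) := by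
  have h0 : cup (0 : List X → ZMod 2) (pt (θ 0)) = 0 := by
    have := add_cup 0 0 (pt (θ 0))
    rwa [add_zero, left_eq_add] at this
  simp only [sph]
  rw [cd_cup _ _ (cd_nil _) rfl, cd_cd, h0, zero_add]

lemma vanOn_cd_sph {U : Set X} (n : ℕ) (θ : Fin (n + 1) → X → ZMod 2) (i : Fin (n + 1))
    {c : ZMod 2} (h : ∀ x ∈ U, θ i x = c) : VanOn U (cd (sph n θ)) := by
  induction n with
  | zero =>
    simp only [sph]
    rw [Fin.fin_one_eq_zero i] at h
    exact VanOn.cd_pt_const h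
  | succ n ih =>
    rw [cd_sph_succ]
    cases i using Fin.cases with
    | zero => exact (VanOn.cd_pt_const h).cup_right _
    | succ i => exact (ih (fun i => θ i.succ) i h).cup_left _

theorem sphereClaim_fin [CompactSpace B] (n : ℕ)
    (θ : Fin (n + 1) → (Fin (n + 1) → ℝ) × B → ZMod 2)
    (hpos : ∀ i p, 0 < p.1 i → θ i p = 1) (hneg : ∀ i p, p.1 i < 0 → θ i p = 0) :
    SphereClaim (Fin (n + 1) → ℝ) B (sph n θ) := by
  induction n with
  | zero =>
    intro z hz0 hz
    have hS : ∀ p ∈ (Metric.sphere 0 1 ×ˢ Set.univ : Set ((Fin 1 → ℝ) × B)),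
        p.1 = (fun _ => 1) ∨ p.1 = (fun _ => -1) := by
      rintro ⟨v, x⟩ ⟨hv, -⟩
      have hv' : ‖v‖ = 1 := by simpa using hv
      have : |v 0| = 1 := by
        rw [Pi.norm_def] at hv'
        simpa using hv'
      rcases (abs_eq zero_le_one).1 this with h | h
      · left; funext i; rw [Fin.fin_one_eq_zero i]; exact h
      · right; funext i; rw [Fin.fin_one_eq_zero i]; exact h
    have hm : ∀ c : ℝ, |c| = 1 → ∀ x : B, (((fun _ => c : Fin 1 → ℝ)), x) ∈
        (Metric.sphere 0 1 ×ˢ Set.univ : Set ((Fin 1 → ℝ) × B)) := fun c hc x => by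
      simp [Pi.norm_def, hc]
    set a := pull (fun x : B => (((fun _ => -1 : Fin 1 → ℝ)), x)) z with ha
    set a' := pull (fun x : B => (((fun _ => 1 : Fin 1 → ℝ)), x)) z with ha'
    have hca : LZOn Set.univ (cd a) := by
      rw [ha, ← pull_cd]
      exact hz.pull (by fun_prop) fun x _ => hm _ (by simp) x
    have hca' : LZOn Set.univ (cd a') := by
      rw [ha', ← pull_cd]
      exact hz.pull (by fun_prop) fun x _ => hm _ (by simp) x
    refine ⟨a, a + a', 0, hz0, by simp [ha, ha', pull, hz0], rfl, hca, by
      rw [cd_add]; exact hca.add hca', ?_⟩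
    rw [cd_zero, add_zero]
    simp only [sph]
    have h00 : (a + a') [] = 0 := by simp [ha, ha', pull, hz0]
    intro p hp
    rcases hS p hp with h | h
    · refine ⟨{q | 0 < q.1 0}, (isOpen_lt continuous_const (by fun_prop)).mem_nhds
        (by simp [h]), ?_⟩
      have h2 := VanOn.cup_pt_const (U := {q : (Fin 1 → ℝ) × B | 0 < q.1 0} ∩
        Metric.sphere 0 1 ×ˢ Set.univ) (u := θ 0) (c := 1) (fun q hq => hpos 0 q hq.1)
        (pull Prod.snd (a + a')) h00
      intro l hl
      have h3 := h2 l hl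
      have e : pull Prod.snd a' l = z l := by
        simp only [ha', pull, List.map_map]
        congr 1
        refine (List.map_congr_left fun q hq => ?_).trans (List.map_id l)
        rcases hS q (hl q hq).2 with h | h
        · simp only [Function.comp, ← h]; rfl
        · have := (hl q hq).1
          simp only [Set.mem_ofPred_eq, h] at this
          norm_num at this
      simp only [Pi.add_apply, pull, one_mul] at h3 e ⊢
      grind
    · refine ⟨{q | q.1 0 < 0}, (isOpen_lt (by fun_prop) continuous_const).mem_nhds
        (by simp [h]), ?_⟩
      have h2 := VanOn.cup_pt_const (U := {q : (Fin 1 → ℝ) × B | q.1 0 < 0} ∩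
        Metric.sphere 0 1 ×ˢ Set.univ) (u := θ 0) (c := 0) (fun q hq => hneg 0 q hq.1)
        (pull Prod.snd (a + a')) h00
      intro l hl
      have h3 := h2 l hl
      have e : pull Prod.snd a l = z l := by
        simp only [ha, pull, List.map_map]
        congr 1
        refine (List.map_congr_left fun q hq => ?_).trans (List.map_id l)
        rcases hS q (hl q hq).2 with h | h
        · have := (hl q hq).1
          simp only [Set.mem_ofPred_eq, h] at this
          norm_num at this
        · simp only [Function.comp, ← h]; rfl
      simp only [Pi.add_apply, pull, zero_mul] at h3 e ⊢
      grind
  | succ n ih =>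
    refine SphereClaim.transfer (E := ℝ × (Fin (n + 1) → ℝ))
      (L := fun q => Fin.cons q.1 q.2) (L' := fun x => (x 0, fun i => x i.succ)) ?_ (by fun_prop)
      ?_ ?_ ?_
    · refine continuous_pi fun i => ?_
      cases i using Fin.cases with
      | zero => simpa using continuous_fst
      | succ i => simp only [Fin.cons_succ]; fun_prop
    · intro x
      rw [Prod.norm_def]
      refine le_antisymm ((pi_norm_le_iff_of_nonneg (by positivity)).2 fun i => ?_)
        (max_le (by simpa using norm_le_pi_norm (Fin.cons x.1 x.2 : Fin (n + 2) → ℝ) 0)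
          ((pi_norm_le_iff_of_nonneg (norm_nonneg _)).2 fun i => by
            simpa using norm_le_pi_norm (Fin.cons x.1 x.2 : Fin (n + 2) → ℝ) i.succ))
      cases i using Fin.cases with
      | zero => simp
      | succ i => simpa using Or.inr (norm_le_pi_norm x.2 i)
    · intro x
      exact Fin.cons_self_tail x
    · rw [pull_sph]
      have key : ∀ x : (ℝ × (Fin (n + 1) → ℝ)) × B, x.1.2 ≠ 0 → ∃ U ∈ 𝓝 x, VanOn U
          (cd (sph n fun i (p : (ℝ × (Fin (n + 1) → ℝ)) × B) =>
            θ i.succ (Fin.cons p.1.1 p.1.2, p.2))) := by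
        intro x hx
        obtain ⟨i, hi⟩ := Function.ne_iff.1 hx
        rcases lt_or_gt_of_ne hi with h | h
        · refine ⟨{p | p.1.2 i < 0}, (isOpen_lt (by fun_prop) continuous_const).mem_nhds h,
            vanOn_cd_sph n _ i (c := 0) fun p hp => hneg _ _ (by simpa using hp)⟩
        · refine ⟨{p | 0 < p.1.2 i}, (isOpen_lt continuous_const (by fun_prop)).mem_nhds h,
            vanOn_cd_sph n _ i (c := 1) fun p hp => hpos _ _ (by simpa using hp)⟩
      refine sphereClaim_succ (w := sph n fun i (p : (ℝ × (Fin (n + 1) → ℝ)) × B) =>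
            θ i.succ (Fin.cons p.1.1 p.1.2, p.2)) (sph_nil _ _) ?_ ?_ ?_ ?_
      · rw [pull_sph]
        exact ih _ (fun i p hp => hpos _ _ (by simpa using hp))
          (fun i p hp => hneg _ _ (by simpa using hp))
      · rintro ⟨⟨t, v⟩, x⟩ ⟨⟨hn, h1⟩, -, h2⟩
        obtain ⟨U, hU, h⟩ := key ((t, v), x) (by
          rintro rfl
          simp only [norm_zero] at h1 h2
          have : t = 0 := by linarith
          rw [norm_pair, this] at hn
          simp at hn)
        exact ⟨U, hU, h.mono Set.inter_subset_left⟩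
      · rintro ⟨⟨t, v⟩, x⟩ ⟨hn, h1⟩
        simp only [sph]
        by_cases hv : v = 0
        · subst hv
          simp only [norm_zero] at h1
          have ht : 0 < t := by
            rcases eq_or_ne t 0 with rfl | ht
            · simp at hn
            · exact lt_of_le_of_ne (by linarith) ht.symm
          refine ⟨{p | 0 < p.1.1}, (isOpen_lt continuous_const (by fun_prop)).mem_nhds ht, ?_⟩
          have := VanOn.cup_pt_const (U := {p : (ℝ × (Fin (n + 1) → ℝ)) × B | 0 < p.1.1})
            (u := fun p => θ 0 (Fin.cons p.1.1 p.1.2, p.2)) (c := 1)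
            (fun p hp => hpos _ _ (by simpa using hp)) (cd (sph n fun i p =>
              θ i.succ (Fin.cons p.1.1 p.1.2, p.2))) (cd_nil _)
          simp only [one_mul] at this
          exact this.mono Set.inter_subset_left
        · obtain ⟨U, hU, h⟩ := key ((t, v), x) hv
          exact ⟨U, hU, ((h.cup_left _).add h).mono Set.inter_subset_left⟩
      · rintro ⟨⟨t, v⟩, x⟩ ⟨hn, h1⟩
        simp only [sph]
        by_cases hv : v = 0
        · subst hv
          simp only [norm_zero] at h1
          have ht : t < 0 := by
            rcases eq_or_ne t 0 with rfl | ht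
            · simp at hn
            · exact lt_of_le_of_ne (by linarith) ht
          refine ⟨{p | p.1.1 < 0}, (isOpen_lt (by fun_prop) continuous_const).mem_nhds ht, ?_⟩
          have := VanOn.cup_pt_const (U := {p : (ℝ × (Fin (n + 1) → ℝ)) × B | p.1.1 < 0})
            (u := fun p => θ 0 (Fin.cons p.1.1 p.1.2, p.2)) (c := 0)
            (fun p hp => hneg _ _ (by simpa using hp)) (cd (sph n fun i p =>
              θ i.succ (Fin.cons p.1.1 p.1.2, p.2))) (cd_nil _)
          simp only [zero_mul] at this
          exact VanOn.mono (fun l hl => by simpa using this l hl) Set.inter_subset_left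
        · obtain ⟨U, hU, h⟩ := key ((t, v), x) hv
          exact ⟨U, hU, (h.cup_left _).mono Set.inter_subset_left⟩

end AlexSpan

end

section

open Topology

namespace AlexSpan

lemma eq_of_add_eq_zero_two {A : Type} [Ring A] [CharP A 2] {a b : A} (h : a + b = 0) : a = b := by
  have : a = (a + b) + b := by grind
  rw [this, h, zero_add]

lemma add_self_two {A : Type} [Ring A] [CharP A 2] (a : A) : a + a = 0 := by grind

lemma d_one {A : Type} [Dga A] [CharP A 2] : Dga.d (1 : A) = 0 := by
  have := Dga.d_mul (1 : A) 1
  rw [mul_one, mul_one, one_mul] at this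
  grind

lemma d_cocycle_pow {A : Type} [Dga A] [CharP A 2] {w : A} (hw : Dga.d w = 0) (k : ℕ) :
    Dga.d (w ^ k) = 0 := by
  induction k with
  | zero => rw [pow_zero, d_one]
  | succ k ih => rw [pow_succ, Dga.d_mul, ih, hw]; simp

section Cover

variable {A B : Type} [Dga A] [CharP A 2] [Dga B] {τ : A →+* A} {β : B →+* A} {ρ : A →+* B}
  {θ : A} {n : ℕ}

lemma split_odd (h : ∀ a, τ (τ a) = a) (hθ : τ θ = θ + 1) (a : A) :
    ∃ a₀ a₁, τ a₀ = a₀ ∧ τ a₁ = a₁ ∧ a = a₀ + a₁ * θ := by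
  refine ⟨a + (a + τ a) * θ, a + τ a, ?_, ?_, ?_⟩
  · simp only [map_add, map_mul, h, hθ]; grind
  · simp only [map_add, h]; grind
  · grind

lemma split_odd_unique (hθ : τ θ = θ + 1) {a₀ a₁ b₀ b₁ : A} (ha : τ a₀ = a₀)
    (ha' : τ a₁ = a₁) (hb : τ b₀ = b₀) (hb' : τ b₁ = b₁) (e : a₀ + a₁ * θ = b₀ + b₁ * θ) :
    a₀ = b₀ ∧ a₁ = b₁ := by
  have := congrArg τ e
  simp only [map_add, map_mul, ha, ha', hb, hb', hθ] at this
  have h1 : a₁ = b₁ := by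
    apply eq_of_add_eq_zero_two
    have h2 : a₁ + b₁ = (a₀ + a₁ * (θ + 1) + (b₀ + b₁ * (θ + 1))) +
      (a₀ + a₁ * θ + (b₀ + b₁ * θ)) := by grind
    rw [h2, this, e, add_self_two, add_self_two, add_zero]
  exact ⟨by rw [h1] at e; exact add_right_cancel e, h1⟩

/-- The formal properties of the double cover `S^n × B → ℝP^n × B` used in the Leray–Hirsch
argument. -/
structure CoverData (τ : A →+* A) (β : B →+* A) (ρ : A →+* B) (θ : A) (n : ℕ) : Prop where
  inv : ∀ a, τ (τ a) = a
  d_τ : ∀ a, Dga.d (τ a) = τ (Dga.d a)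
  d_β : ∀ b, Dga.d (β b) = β (Dga.d b)
  d_ρ : ∀ a, Dga.d (ρ a) = ρ (Dga.d a)
  τ_β : ∀ b, τ (β b) = β b
  ρ_β : ∀ b, ρ (β b) = b
  τ_θ : τ θ = θ + 1
  ρ_θ : Dga.d (ρ θ) = 0
  sphere : ∃ y₀, τ y₀ = y₀ ∧ ((Dga.d θ) ^ n + Dga.d y₀) * Dga.d θ = 0 ∧
    ∀ a, Dga.d a = 0 → ∃ b b' y, Dga.d b = 0 ∧ Dga.d b' = 0 ∧
      a = β b + β b' * (((Dga.d θ) ^ n + Dga.d y₀) * θ) + Dga.d y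

namespace CoverData
variable (h : CoverData τ β ρ θ n)
include h

lemma τ_dθ : τ (Dga.d θ) = Dga.d θ := by
  rw [← h.d_τ, h.τ_θ, map_add, d_one, add_zero]

lemma pow_exact : ∃ y, τ y = y ∧ (Dga.d θ) ^ (n + 1) = Dga.d y := by
  obtain ⟨y₀, hy, h1, -⟩ := h.sphere
  refine ⟨y₀ * Dga.d θ, by rw [map_mul, hy, h.τ_dθ], ?_⟩
  rw [Dga.d_mul, Dga.d_d, pow_succ, mul_zero, add_zero]
  exact eq_of_add_eq_zero_two (by rw [← add_mul, h1])

lemma descend {P q : A} {b : B} (k : ℕ) (hk : k ≤ n) (hq : τ q = q)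
    (hP : P = β b + q * Dga.d θ) (hdP : Dga.d P = 0)
    (hy : ∃ y, τ y = y ∧ P * (Dga.d θ) ^ k = Dga.d y) :
    ∃ e, b = Dga.d e := by
  obtain ⟨y₀, hy₀, hs, hsph⟩ := h.sphere
  induction k generalizing P q with
  | zero =>
    obtain ⟨y, -, hy⟩ := hy
    refine ⟨ρ y, ?_⟩
    have := congrArg ρ hy
    rw [hP, pow_zero, mul_one, map_add, h.ρ_β, map_mul, ← h.d_ρ, h.ρ_θ, mul_zero, add_zero,
      ← h.d_ρ] at this
    exact this
  | succ k ih =>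
    obtain ⟨y, hyτ, hy⟩ := hy
    have hw := h.τ_dθ
    set w := Dga.d θ with hwd
    have hdw : Dga.d w = 0 := Dga.d_d _
    have hτk : τ (w ^ k) = w ^ k := by rw [map_pow, hw]
    have hτP : τ P = P := by rw [hP, map_add, h.τ_β, map_mul, hq, hw]
    obtain ⟨c, c', a, hc, hc', e⟩ := hsph (y + P * w ^ k * θ) (by
      rw [map_add, ← hy, Dga.d_mul, Dga.d_mul, hdP, d_cocycle_pow hdw, ← hwd, pow_succ]
      grind)
    obtain ⟨a₀, a₁, h0, h1, rfl⟩ := split_odd h.inv h.τ_θ a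
    have e2 : y + (P * w ^ k) * θ = (β c + Dga.d a₀ + a₁ * w) +
        (β c' * (w ^ n + Dga.d y₀) + Dga.d a₁) * θ := by
      rw [e, map_add, Dga.d_mul]
      grind
    have hinv : τ (Dga.d y₀) = Dga.d y₀ := by rw [← h.d_τ, hy₀]
    have hinv0 : τ (Dga.d a₀) = Dga.d a₀ := by rw [← h.d_τ, h0]
    have hinv1 : τ (Dga.d a₁) = Dga.d a₁ := by rw [← h.d_τ, h1]
    have e3 := (split_odd_unique h.τ_θ hyτ (by rw [map_mul, hτk, hτP])
      (by simp only [map_add, map_mul, h.τ_β, hinv0, h1, hw])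
      (by simp only [map_add, map_mul, map_pow, h.τ_β, hinv, hinv1, hw]) e2).2
    have hdc : Dga.d (β c') = 0 := by rw [h.d_β, hc', map_zero]
    obtain ⟨j, rfl⟩ : ∃ j, n = j + 1 + k := ⟨n - k - 1, by omega⟩
    refine ih (P := P + β c' * w ^ (j + 1)) (q := q + β c' * w ^ j) (by omega) ?_ ?_ ?_ ?_
    · simp only [map_add, map_mul, map_pow, h.τ_β, hq, hw]
    · rw [hP, pow_succ]; grind
    · rw [map_add, hdP, Dga.d_mul, hdc, d_cocycle_pow hdw]; simp
    · refine ⟨β c' * y₀ + a₁, by simp only [map_add, map_mul, h.τ_β, hy₀, h1], ?_⟩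
      rw [add_mul, e3, map_add, Dga.d_mul, hdc, zero_mul, zero_add, mul_assoc, ← pow_add]
      grind

lemma independent (b : ℕ → B) (hb : ∀ i, Dga.d (b i) = 0)
    (he : ∃ y, τ y = y ∧ ∑ i ∈ Finset.range (n + 1), β (b i) * (Dga.d θ) ^ i = Dga.d y) :
    ∀ i < n + 1, ∃ e, b i = Dga.d e := by
  have hw := h.τ_dθ
  have hdw : Dga.d (Dga.d θ) = 0 := Dga.d_d _
  intro j
  induction j using Nat.strong_induction_on with
  | _ j ih =>
    intro hj
    have h1 : ∀ k ≤ j, ∃ y, τ y = y ∧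
        (∑ i ∈ Finset.range (n + 1 - k), β (b (k + i)) * (Dga.d θ) ^ (k + i)) = Dga.d y := by
      intro k
      induction k with
      | zero => simpa using he
      | succ k ihk =>
        intro hk
        obtain ⟨y, hyτ, hy⟩ := ihk (by omega)
        obtain ⟨e, he⟩ := ih k (by omega) (by omega)
        obtain ⟨m, hm⟩ : ∃ m, n + 1 - k = m + 1 := ⟨n - k, by omega⟩
        have hm' : n + 1 - (k + 1) = m := by omega
        rw [hm, Finset.sum_range_succ'] at hy
        refine ⟨y + β e * (Dga.d θ) ^ k, by
          simp only [map_add, map_mul, map_pow, h.τ_β, hyτ, hw], ?_⟩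
        rw [map_add, ← hy, Dga.d_mul, d_cocycle_pow hdw, h.d_β, ← he, hm']
        simp only [mul_zero, add_zero]
        rw [add_assoc]
        simp only [Nat.add_assoc, Nat.add_comm 1]
        grind
    obtain ⟨y, hyτ, hy⟩ := h1 j le_rfl
    obtain ⟨m, hm⟩ : ∃ m, n + 1 - j = m + 1 := ⟨n - j, by omega⟩
    rw [hm] at hy
    have hdP : Dga.d (∑ i ∈ Finset.range (m + 1), β (b (j + i)) * (Dga.d θ) ^ i) = 0 := by
      rw [map_sum]
      refine Finset.sum_eq_zero fun i _ => ?_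
      rw [Dga.d_mul, d_cocycle_pow hdw, h.d_β, hb]; simp
    refine h.descend j (by omega)
      (P := ∑ i ∈ Finset.range (m + 1), β (b (j + i)) * (Dga.d θ) ^ i)
      (q := ∑ i ∈ Finset.range m, β (b (j + (i + 1))) * (Dga.d θ) ^ i) ?_ ?_ hdP ⟨y, hyτ, ?_⟩
    · simp only [map_sum, map_mul, map_pow, h.τ_β, hw]
    · rw [Finset.sum_range_succ', Finset.sum_mul, add_comm]
      simp only [Nat.add_zero, pow_zero, mul_one, pow_succ, mul_assoc]
    · rw [← hy, Finset.sum_mul]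
      refine Finset.sum_congr rfl fun i _ => ?_
      rw [mul_assoc, ← pow_add, Nat.add_comm i j]

lemma span_aux (z : A) (hz : Dga.d z = 0) (hτ : τ z = z) : ∃ b q a, Dga.d b = 0 ∧
    τ q = q ∧ Dga.d q = 0 ∧ τ a = a ∧ z = β b + q * Dga.d θ + Dga.d a := by
  obtain ⟨y₀, hy₀, hs, hsph⟩ := h.sphere
  obtain ⟨b, c, y, hb, hc, e⟩ := hsph z hz
  have hw := h.τ_dθ
  have hdw : Dga.d (Dga.d θ) = 0 := Dga.d_d _
  have hinv : τ (Dga.d y₀) = Dga.d y₀ := by rw [← h.d_τ, hy₀]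
  have hdc : Dga.d (β c) = 0 := by rw [h.d_β, hc, map_zero]
  have hce : ∃ e, c = Dga.d e := by
    obtain ⟨a₀, a₁, h0, h1, rfl⟩ := split_odd h.inv h.τ_θ y
    have hinv0 : τ (Dga.d a₀) = Dga.d a₀ := by rw [← h.d_τ, h0]
    have hinv1 : τ (Dga.d a₁) = Dga.d a₁ := by rw [← h.d_τ, h1]
    have e2 : z + 0 * θ = (β b + Dga.d a₀ + a₁ * Dga.d θ) +
        (β c * ((Dga.d θ) ^ n + Dga.d y₀) + Dga.d a₁) * θ := by
      rw [e, map_add, Dga.d_mul]; grind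
    have e3 := (split_odd_unique h.τ_θ hτ (map_zero _)
      (by simp only [map_add, map_mul, h.τ_β, hinv0, h1, hw])
      (by simp only [map_add, map_mul, map_pow, h.τ_β, hinv, hinv1, hw]) e2).2
    refine h.descend (P := β c) (q := 0) n le_rfl (map_zero _) (by simp) hdc
      ⟨β c * y₀ + a₁, by simp only [map_add, map_mul, h.τ_β, hy₀, h1], ?_⟩
    rw [map_add, Dga.d_mul, hdc, zero_mul, zero_add]
    refine eq_of_add_eq_zero_two ?_
    rw [mul_add] at e3
    have e6 : β c * Dga.d θ ^ n + (β c * Dga.d y₀ + Dga.d a₁) =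
      β c * Dga.d θ ^ n + β c * Dga.d y₀ + Dga.d a₁ := by rw [add_assoc]
    rw [e6, ← e3]
  obtain ⟨c, rfl⟩ := hce
  have hds : Dga.d (((Dga.d θ) ^ n + Dga.d y₀) * θ) = 0 := by
    rw [Dga.d_mul, map_add, d_cocycle_pow hdw, Dga.d_d, hs]; simp
  have e4 : z = β b + Dga.d (y + β c * (((Dga.d θ) ^ n + Dga.d y₀) * θ)) := by
    rw [e, map_add, Dga.d_mul (β c), hds, h.d_β]; grind
  obtain ⟨a₀, a₁, h0, h1, e5⟩ := split_odd h.inv h.τ_θ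
    (y + β c * (((Dga.d θ) ^ n + Dga.d y₀) * θ))
  rw [e5, map_add, Dga.d_mul] at e4
  have hinv0 : τ (Dga.d a₀) = Dga.d a₀ := by rw [← h.d_τ, h0]
  have hinv1 : τ (Dga.d a₁) = Dga.d a₁ := by rw [← h.d_τ, h1]
  have e2 : z + 0 * θ = (β b + Dga.d a₀ + a₁ * Dga.d θ) + (Dga.d a₁) * θ := by
    rw [e4]; grind
  have e3 := split_odd_unique h.τ_θ hτ (map_zero _)
      (by simp only [map_add, map_mul, h.τ_β, hinv0, h1, hw]) hinv1 e2
  exact ⟨b, a₁, a₀, hb, h1, e3.2.symm, h0, by rw [e3.1]; grind⟩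

lemma spanning (z : A) (hz : Dga.d z = 0) (hτ : τ z = z) : ∃ b : ℕ → B, (∀ i, Dga.d (b i) = 0) ∧
    ∃ y, τ y = y ∧ z = ∑ i ∈ Finset.range (n + 1), β (b i) * (Dga.d θ) ^ i + Dga.d y := by
  have hw := h.τ_dθ
  have hdw : Dga.d (Dga.d θ) = 0 := Dga.d_d _
  have key : ∀ k z, Dga.d z = 0 → τ z = z → ∃ b : ℕ → B, (∀ i, Dga.d (b i) = 0) ∧
    ∃ q y, τ q = q ∧ Dga.d q = 0 ∧ τ y = y ∧
      z = ∑ i ∈ Finset.range k, β (b i) * (Dga.d θ) ^ i + q * (Dga.d θ) ^ k + Dga.d y := by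
    intro k
    induction k with
    | zero => exact fun z hz hτ => ⟨0, by simp, z, 0, hτ, hz, map_zero _, by simp⟩
    | succ k ih =>
      intro z hz hτ
      obtain ⟨c, q, y, hc, hq, hdq, hy, e⟩ := h.span_aux z hz hτ
      obtain ⟨b, hb, q', y', hq', hdq', hy', e'⟩ := ih q hdq hq
      obtain ⟨f, f0, fs⟩ : ∃ f : ℕ → B, f 0 = c ∧ ∀ i, f (i + 1) = b i :=
        ⟨fun i => Nat.casesOn i c b, rfl, fun _ => rfl⟩
      refine ⟨f, by rintro (_ | i) <;> simp [hc, hb, f0, fs], q',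
        y + y' * Dga.d θ, hq', hdq', by rw [map_add, map_mul, hy, hy', hw], ?_⟩
      have e6 : q * Dga.d θ = ∑ i ∈ Finset.range k, β (b i) * (Dga.d θ) ^ (i + 1) +
          q' * (Dga.d θ) ^ (k + 1) + Dga.d y' * Dga.d θ := by
        conv_lhs => rw [e']
        simp only [pow_succ, mul_assoc, add_mul, Finset.sum_mul]
      rw [Finset.sum_range_succ', map_add, Dga.d_mul, hdw, e, e6]
      simp only [pow_zero, mul_one, mul_zero, add_zero, f0, fs]
      abel
  obtain ⟨b, hb, q, y, hq, hdq, hy, e⟩ := key (n + 1) z hz hτ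
  obtain ⟨v, hv, e'⟩ := h.pow_exact
  refine ⟨b, hb, q * v + y, by rw [map_add, map_mul, hq, hv, hy], ?_⟩
  rw [e, e', map_add, Dga.d_mul, hdq]
  grind

end CoverData
end Cover
end AlexSpan

end

section

open Topology

namespace AlexSpan

variable {X Y B : Type} [TopologicalSpace X] [TopologicalSpace Y] [TopologicalSpace B]

/-- The degree zero class of a function. -/
def AS.pt (u : X → ZMod 2) : AS X := AS.mk ⟨AlexSpan.pt u, rfl⟩

lemma AS.map_pt (f : C(X, Y)) (u : Y → ZMod 2) : AS.map f (AS.pt u) = AS.pt (u ∘ f) := by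
  rw [AS.pt, AS.map_mk, AS.pt]
  congr 1
  exact Subtype.ext (pull_pt f u)

lemma AS.pt_add (u v : X → ZMod 2) : AS.pt (u + v) = AS.pt u + AS.pt v := by
  rw [AS.pt, AS.pt, AS.pt, ← map_add]
  congr 1
  refine Subtype.ext (funext fun l => ?_)
  rw [coe_addc]
  match l with
  | [] => simp [AlexSpan.pt]
  | [x] => simp [AlexSpan.pt]
  | x :: y :: l => simp [AlexSpan.pt]

lemma AS.pt_one : AS.pt (fun _ : X => 1) = 1 := by
  rw [← map_one (AS.mk (X := X)), AS.pt]
  congr 1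

lemma AS.pr_pt (u : X → ZMod 2) : GDga.pr 0 (AS.pt u) = AS.pt u := by
  rw [AS.pt, AS.pr_mk]
  congr 1
  refine Subtype.ext (funext fun l => ?_)
  rw [coe_degHom, degPart]
  match l with
  | [] => simp [AlexSpan.pt]
  | [x] => simp
  | x :: y :: l => simp [AlexSpan.pt]

/-- The class of the fundamental cochain attached to a family of functions. -/
def AS.sph (n : ℕ) (θ : Fin (n + 1) → X → ZMod 2) : AS X := AS.mk ⟨AlexSpan.sph n θ, sph_nil n θ⟩

lemma AS.sph_zero (θ : Fin 1 → X → ZMod 2) : AS.sph 0 θ = AS.pt (θ 0) := rfl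

lemma AS.sph_succ (n : ℕ) (θ : Fin (n + 2) → X → ZMod 2) :
    AS.sph (n + 1) θ = Dga.d (AS.sph n fun i => θ i.succ) * AS.pt (θ 0) := by
  rw [AS.sph, AS.sph, AS.d_mk, AS.pt, ← map_mul]
  rfl

lemma AS.d_sph_succ (n : ℕ) (θ : Fin (n + 2) → X → ZMod 2) :
    Dga.d (AS.sph (n + 1) θ) = Dga.d (AS.sph n fun i => θ i.succ) * Dga.d (AS.pt (θ 0)) := by
  rw [AS.sph_succ, Dga.d_mul, Dga.d_d, zero_mul, zero_add]

lemma AS.d_sph_eq_zero (n : ℕ) (θ : Fin (n + 1) → X → ZMod 2)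
    (h : ∀ x, ∃ i, ∃ c, ∀ᶠ y in 𝓝 x, θ i y = c) : Dga.d (AS.sph n θ) = 0 := by
  rw [AS.sph, AS.d_mk, AS.mk_eq_zero]
  intro x _
  obtain ⟨i, c, hc⟩ := h x
  exact ⟨_, hc, (vanOn_cd_sph n θ i fun y hy => hy).mono Set.inter_subset_left⟩

lemma AS.d_sph_odd [Nonempty X] (τ : C(X, X)) {u : X → ZMod 2}
    (hu : ∀ x, u (τ x) = u x + 1) (n : ℕ) (θ : Fin (n + 1) → X → ZMod 2)
    (h : ∀ i x, θ i (τ x) = θ i x + 1) :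
    ∃ y, AS.map τ y = y ∧ Dga.d (AS.sph n θ) = Dga.d (AS.pt u) ^ (n + 1) + Dga.d y := by
  have hinv : ∀ v : X → ZMod 2, (∀ x, v (τ x) = v x + 1) →
      AS.map τ (AS.pt (v + u)) = AS.pt (v + u) := fun v hv => by
    rw [AS.map_pt]
    congr 1
    funext x
    simp only [Function.comp, Pi.add_apply, hv, hu]
    grind
  have hd : ∀ v : X → ZMod 2, Dga.d (AS.pt v) = Dga.d (AS.pt u) + Dga.d (AS.pt (v + u)) :=
    fun v => by rw [AS.pt_add, map_add]; grind
  induction n with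
  | zero =>
    refine ⟨AS.pt (θ 0 + u), hinv _ (h 0), ?_⟩
    rw [AS.sph_zero, hd (θ 0)]
    simp
  | succ n ih =>
    obtain ⟨y, hy, e⟩ := ih (fun i => θ i.succ) fun i x => h _ x
    have hw : AS.map τ (Dga.d (AS.pt u)) = Dga.d (AS.pt u) := by
      rw [AS.map_d, AS.map_pt]
      have : u ∘ τ = u + fun _ => 1 := funext hu
      rw [this, AS.pt_add, map_add, AS.pt_one, d_one, add_zero]
    set w := Dga.d (AS.pt u) with hwd
    have hdw : Dga.d w = 0 := Dga.d_d _
    refine ⟨w ^ (n + 1) * AS.pt (θ 0 + u) + y * Dga.d (AS.pt (θ 0)), ?_, ?_⟩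
    · rw [map_add, map_mul, map_mul, map_pow, hw, hy, hinv _ (h 0), hd (θ 0), map_add, hw,
        AS.map_d, hinv _ (h 0)]
    · rw [AS.d_sph_succ, e, map_add, Dga.d_mul, Dga.d_mul, d_cocycle_pow hdw, Dga.d_d, hd (θ 0),
        pow_succ _ (n + 1)]
      grind

/-- The unit sphere of `ℝ^{n+1}` for the supremum norm. -/
abbrev SS (n : ℕ) : Type := Metric.sphere (0 : Fin (n + 1) → ℝ) 1

lemma SS.toLp_ne {n : ℕ} (x : SS n) : (WithLp.toLp 2 x.1 : EuclideanSpace ℝ (Fin (n + 1))) ≠ 0 := by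
  intro h
  have h1 : x.1 = 0 := by simpa using h
  have := x.2
  rw [h1] at this
  simp at this

/-- The double cover of projective space. -/
noncomputable def SS.π {n : ℕ} (x : SS n) : RP n := Projectivization.mk ℝ _ x.toLp_ne

lemma SS.continuous_π {n : ℕ} : Continuous (SS.π (n := n)) := by
  have : Continuous fun x : SS n =>
      (⟨WithLp.toLp 2 x.1, x.toLp_ne⟩ : {v : EuclideanSpace ℝ (Fin (n + 1)) // v ≠ 0}) := by
    fun_prop
  exact continuous_quotient_mk'.comp this

lemma SS.π_eq_iff {n : ℕ} (x y : SS n) : x.π = y.π ↔ y = x ∨ y = -x := by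
  rw [SS.π, SS.π, Projectivization.mk_eq_mk_iff']
  have hx : ‖x.1‖ = 1 := by simp
  have hy : ‖y.1‖ = 1 := by simp
  constructor
  · rintro ⟨a, ha⟩
    have h1 : a • y.1 = x.1 := by
      have := congrArg WithLp.ofLp ha
      simpa using this
    have h2 : |a| = 1 := by
      have := congrArg norm h1
      rwa [norm_smul, hx, hy, mul_one, Real.norm_eq_abs] at this
    rcases (abs_eq zero_le_one).1 h2 with rfl | rfl
    · left; exact Subtype.ext (by simpa using h1)
    · right; exact Subtype.ext (by rw [coe_neg_sphere, ← h1]; simp)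
  · rintro (rfl | rfl)
    · exact ⟨1, by simp⟩
    · exact ⟨-1, by ext i; simp⟩

end AlexSpan

end

section

open Topology

namespace AlexSpan

section Descent
variable {E R : Type} [TopologicalSpace E] [TopologicalSpace R]

lemma AS.map_injective_of_isOpenMap (q : C(E, R)) (hq : Function.Surjective q) (ho : IsOpenMap q) :
    Function.Injective (AS.map q) := by
  rw [injective_iff_map_eq_zero]
  intro a ha
  obtain ⟨z, rfl⟩ := AS.mk_surj a
  rw [AS.map_mk, AS.mk_eq_zero] at ha
  rw [AS.mk_eq_zero]
  intro r _
  obtain ⟨e, rfl⟩ := hq r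
  obtain ⟨U, hU, h⟩ := ha e trivial
  refine ⟨q '' U, ho.image_mem_nhds hU, fun l hl => ?_⟩
  have hl' : ∃ l' : List E, (∀ x ∈ l', x ∈ U ∩ Set.univ) ∧ l'.map q = l := by
    induction l with
    | nil => exact ⟨[], by simp, rfl⟩
    | cons x l ih =>
      obtain ⟨l', h1, h2⟩ := ih fun y hy => hl y (by simp [hy])
      obtain ⟨u, hu, hx⟩ := (hl x (by simp)).1
      refine ⟨u :: l', ?_, by simp [h2, hx]⟩
      intro y hy
      rcases List.mem_cons.1 hy with rfl | hy
      · exact ⟨hu, trivial⟩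
      · exact h1 y hy
  obtain ⟨l', h1, rfl⟩ := hl'
  exact h l' h1

lemma AS.exists_map_eq_of_isOpenMap (q : C(E, R)) (hq : Function.Surjective q)
    (T : C(E, E)) (hT : ∀ e, T (T e) = e) (hqT : ∀ e e', q e = q e' ↔ e' = e ∨ e' = T e)
    (D : E → E → ℝ) (hD : Continuous (Function.uncurry D)) (hpos : ∀ e, 0 < D e e)
    (hneg : ∀ e e', D e (T e') = - D e e') (hneg' : ∀ e e', D (T e) e' = - D e e')
    (a : AS E) (ha : AS.map T a = a) : ∃ b, AS.map q b = a := by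
  classical
  obtain ⟨z, rfl⟩ := AS.mk_surj a
  rw [AS.map_mk, AS.mk_eq] at ha
  choose σ hσ using hq
  let L : E → R → E := fun e r => if 0 ≤ D e (σ r) then σ r else T (σ r)
  let lift : List R → List E := fun l => match l with
    | [] => []
    | r :: t => σ r :: t.map (L (σ r))
  refine ⟨AS.mk ⟨fun l => z.1 (lift l), z.2⟩, ?_⟩
  rw [AS.map_mk, AS.mk_eq]
  intro e₀ _
  obtain ⟨U, hU, h⟩ := ha e₀ trivial
  have hW : {p : E × E | 0 < Function.uncurry D p} ∈ 𝓝 (e₀, e₀) :=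
    (isOpen_lt continuous_const hD).mem_nhds (hpos e₀)
  rw [nhds_prod_eq, Filter.mem_prod_same_iff] at hW
  obtain ⟨W, hW, hWs⟩ := hW
  have hWs : ∀ e ∈ W, ∀ e' ∈ W, 0 < D e e' := fun e he e' he' => hWs (Set.mk_mem_prod he he')
  have hσq : ∀ e, σ (q e) = e ∨ σ (q e) = T e := fun e => (hqT e _).1 (hσ _).symm
  have hL : ∀ e ∈ W, ∀ e' ∈ W, L e (q e') = e' ∧ L (T e) (q e') = T e' := by
    intro e he e' he'
    have := hWs e he e' he'
    rcases hσq e' with h1 | h1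
    · simp only [L, h1, hneg', this.le, if_true, true_and]
      rw [if_neg (by linarith)]
    · simp only [L, h1, hneg, hneg', hT, neg_neg, this.le, if_true, and_true]
      rw [if_neg (by linarith)]
  refine ⟨U ∩ W, Filter.inter_mem hU hW, fun l hl => ?_⟩
  have hz := h l fun y hy => ⟨(hl y hy).1.1, trivial⟩
  change z.1 (l.map T) + z.1 l = 0 at hz
  change z.1 (lift (l.map q)) + z.1 l = 0
  cases l with
  | nil => simp [lift]; grind
  | cons e t =>
    have he := (hl e (by simp)).1.2
    have ht : ∀ y ∈ t, y ∈ W := fun y hy => (hl y (by simp [hy])).1.2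
    rcases hσq e with h1 | h1
    · have : lift ((e :: t).map q) = e :: t := by
        simp only [List.map_cons, lift, h1, List.map_map]
        congr 1
        conv_rhs => rw [← List.map_id t]
        exact List.map_congr_left fun y hy => (hL e he y (ht y hy)).1
      rw [this]
      grind
    · have : lift ((e :: t).map q) = (e :: t).map T := by
        simp only [List.map_cons, lift, h1, List.map_map]
        congr 1
        exact List.map_congr_left fun y hy => (hL e he y (ht y hy)).2
      rw [this]
      exact hz

end Descent

section Proj
variable {n : ℕ}

/-- The radial projection to the sphere. -/
noncomputable def SS.normalize (v : {v : EuclideanSpace ℝ (Fin (n + 1)) // v ≠ 0}) : SS n :=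
  ⟨‖v.1.ofLp‖⁻¹ • v.1.ofLp, by
    have h : v.1.ofLp ≠ 0 := by simpa using v.2
    simp [norm_smul, h]⟩

lemma SS.continuous_normalize : Continuous (SS.normalize (n := n)) := by
  refine Continuous.subtype_mk ?_ _
  have h1 : Continuous fun v : {v : EuclideanSpace ℝ (Fin (n + 1)) // v ≠ 0} => v.1.ofLp := by
    fun_prop
  refine (h1.norm.inv₀ fun v => ?_).smul h1
  simpa using v.2

lemma SS.π_normalize (v : {v : EuclideanSpace ℝ (Fin (n + 1)) // v ≠ 0}) :
    (SS.normalize v).π = Projectivization.mk ℝ v.1 v.2 := by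
  rw [SS.π, Projectivization.mk_eq_mk_iff']
  exact ⟨‖v.1.ofLp‖⁻¹, by ext i; simp [SS.normalize]⟩

lemma SS.π_surjective : Function.Surjective (SS.π (n := n)) := fun p => by
  induction p using Projectivization.ind with
  | h v hv => exact ⟨SS.normalize ⟨v, hv⟩, SS.π_normalize ⟨v, hv⟩⟩

lemma SS.isOpenMap_π : IsOpenMap (SS.π (n := n)) := by
  intro U hU
  have h : IsOpen ((Quotient.mk (projectivizationSetoid ℝ (EuclideanSpace ℝ (Fin (n + 1))))) ⁻¹'
      (SS.π '' U)) := by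
    have : (Quotient.mk (projectivizationSetoid ℝ (EuclideanSpace ℝ (Fin (n + 1))))) ⁻¹'
        (SS.π '' U) = SS.normalize ⁻¹' (U ∪ -U) := by
      ext v
      have e : (∃ x ∈ U, SS.π x = Projectivization.mk ℝ v.1 v.2) ↔
          ∃ x ∈ U, (SS.normalize v = x ∨ SS.normalize v = -x) := by
        simp only [← SS.π_normalize v, SS.π_eq_iff]
      refine Iff.trans e ?_
      simp only [Set.mem_preimage, Set.mem_union, Set.mem_neg]
      constructor
      · rintro ⟨x, hx, h | h⟩
        · left; rwa [h]
        · right; rwa [h, neg_neg]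
      · rintro (h | h)
        · exact ⟨_, h, Or.inl rfl⟩
        · exact ⟨_, h, Or.inr (by simp)⟩
    rw [this]
    exact (hU.union hU.neg).preimage SS.continuous_normalize
  exact h

instance : CompactSpace (RP n) := by
  rw [← isCompact_univ_iff, ← Set.range_eq_univ.2 (SS.π_surjective (n := n))]
  exact isCompact_range SS.continuous_π

instance : Nonempty (SS n) := ⟨SS.normalize ⟨WithLp.toLp 2 (fun _ => 1), fun h => by
  have := congrFun (congrArg WithLp.ofLp h) 0
  simp at this⟩⟩

instance : Nonempty (RP n) := ⟨SS.π (Classical.arbitrary (SS n))⟩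

lemma SS.neg_ne (x : SS n) : -x ≠ x := by
  intro h
  have h1 : (-x).1 = x.1 := by rw [h]
  rw [coe_neg_sphere, neg_eq_self] at h1
  have := x.2
  rw [h1] at this
  simp at this

/-- An odd function on the sphere. -/
lemma SS.exists_odd : ∃ ϑ : SS n → ZMod 2, ∀ x, ϑ (-x) = ϑ x + 1 := by
  classical
  choose σ hσ using SS.π_surjective (n := n)
  refine ⟨fun x => if x = σ x.π then 1 else 0, fun x => ?_⟩
  have h1 : (-x).π = x.π := (SS.π_eq_iff _ _).2 (Or.inr (by simp))
  have h2 := (SS.π_eq_iff x _).1 (hσ x.π).symm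
  have := x.neg_ne
  simp only [h1]
  rcases h2 with h2 | h2 <;> rw [h2]
  · simp only [this, if_true, if_false]; grind
  · simp [this.symm]

end Proj

end AlexSpan

end

section

open Topology

namespace AlexSpan

section LH
variable (n : ℕ) (B : Type) [TopologicalSpace B]

/-- The antipodal map. -/
def SS.T : C(SS n × B, SS n × B) := ⟨fun p => (-p.1, p.2), by fun_prop⟩

/-- The double cover. -/
noncomputable def SS.q : C(SS n × B, RP n × B) :=
  ⟨fun p => (p.1.π, p.2), (SS.continuous_π.comp continuous_fst).prodMk continuous_snd⟩

lemma SS.q_surjective : Function.Surjective (SS.q n B) := fun ⟨r, b⟩ => by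
  obtain ⟨x, rfl⟩ := SS.π_surjective r
  exact ⟨(x, b), rfl⟩

lemma SS.isOpenMap_q : IsOpenMap (SS.q n B) := SS.isOpenMap_π.prodMap IsOpenMap.id

lemma SS.map_q_injective : Function.Injective (AS.map (SS.q n B)) :=
  AS.map_injective_of_isOpenMap _ (SS.q_surjective n B) (SS.isOpenMap_q n B)

lemma SS.T_T (e : SS n × B) : SS.T n B (SS.T n B e) = e := by simp [SS.T]

lemma SS.q_T (e : SS n × B) : SS.q n B (SS.T n B e) = SS.q n B e := by
  refine Prod.ext ?_ rfl
  exact (SS.π_eq_iff _ _).2 (Or.inr (by simp [SS.T]))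

lemma SS.exists_map_q (a : AS (SS n × B)) (ha : AS.map (SS.T n B) a = a) :
    ∃ b, AS.map (SS.q n B) b = a := by
  refine AS.exists_map_eq_of_isOpenMap (SS.q n B) (SS.q_surjective n B) (SS.T n B) (SS.T_T n B) ?_
    (fun e e' => ∑ i, e.1.1 i * e'.1.1 i) ?_ ?_ ?_ ?_ a ha
  · intro e e'
    rw [Prod.ext_iff, Prod.ext_iff, Prod.ext_iff]
    simp only [SS.q, ContinuousMap.coe_mk, SS.T, SS.π_eq_iff, ← or_and_right]
    tauto
  · refine continuous_finsetSum _ fun i _ => ?_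
    exact ((continuous_apply i).comp (continuous_subtype_val.comp
      (continuous_fst.comp continuous_fst))).mul ((continuous_apply i).comp
      (continuous_subtype_val.comp (continuous_fst.comp continuous_snd)))
  · intro e
    have h : e.1.1 ≠ 0 := fun h => by
      have := e.1.2
      rw [h] at this
      simp at this
    obtain ⟨i, hi⟩ := Function.ne_iff.1 h
    exact Finset.sum_pos' (fun i _ => mul_self_nonneg _) ⟨i, Finset.mem_univ _, by
      simpa using hi⟩
  · intro e e'
    simp [SS.T, Finset.sum_neg_distrib]
  · intro e e'
    simp [SS.T, Finset.sum_neg_distrib]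

/-- Sign functions of the coordinates, with ties broken by an odd function. -/
noncomputable def SS.sgn {n : ℕ} (ϑ : SS n → ZMod 2) (i : Fin (n + 1)) (x : SS n) : ZMod 2 :=
  if 0 < x.1 i then 1 else if x.1 i < 0 then 0 else ϑ x

lemma SS.sgn_neg {n : ℕ} {ϑ : SS n → ZMod 2} (h : ∀ x, ϑ (-x) = ϑ x + 1) (i : Fin (n + 1))
    (x : SS n) : SS.sgn ϑ i (-x) = SS.sgn ϑ i x + 1 := by
  have e : (-x).1 i = - x.1 i := by simp
  rw [SS.sgn, SS.sgn, e, h]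
  rcases lt_trichotomy (x.1 i) 0 with h1 | h1 | h1
  · simp [h1, h1.le]
  · simp [h1]
  · simp [h1]; grind

lemma SS.sgn_locally {n : ℕ} (ϑ : SS n → ZMod 2) (p : SS n × B) :
    ∃ i c, ∀ᶠ y : SS n × B in 𝓝 p, SS.sgn ϑ i y.1 = c := by
  have h : p.1.1 ≠ 0 := fun h => by
    have := p.1.2
    rw [h] at this
    simp at this
  obtain ⟨i, hi⟩ := Function.ne_iff.1 h
  have hc : Continuous fun y : SS n × B => y.1.1 i :=
    (continuous_apply i).comp (continuous_subtype_val.comp continuous_fst)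
  rcases lt_or_gt_of_ne hi with h1 | h1
  · refine ⟨i, 0, ?_⟩
    filter_upwards [(isOpen_lt hc continuous_const).mem_nhds h1] with y hy
    have hy : y.1.1 i < 0 := hy
    rw [SS.sgn, if_neg hy.not_gt, if_pos hy]
  · refine ⟨i, 1, ?_⟩
    filter_upwards [(isOpen_lt continuous_const hc).mem_nhds h1] with y hy
    exact if_pos hy

lemma SS.sphere_cocycle [CompactSpace B] {n : ℕ} (ϑ : SS n → ZMod 2) (a : AS (SS n × B))
    (ha : Dga.d a = 0) : ∃ (b b' : AS B) (y : AS (SS n × B)), Dga.d b = 0 ∧ Dga.d b' = 0 ∧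
      a = AS.map ContinuousMap.snd b + AS.map ContinuousMap.snd b' *
        AS.sph n (fun i p => SS.sgn ϑ i p.1) + Dga.d y := by
  classical
  obtain ⟨z, rfl⟩ := AS.mk_surj a
  rw [AS.d_mk, AS.mk_eq_zero] at ha
  let E := Fin (n + 1) → ℝ
  let ret : E × B → SS n × B := fun p =>
    if h : p.1 ∈ Metric.sphere (0 : E) 1 then (⟨p.1, h⟩, p.2) else (Classical.arbitrary _, p.2)
  let inc : C(SS n × B, E × B) := ⟨fun p => (p.1.1, p.2), by fun_prop⟩
  have hri : ∀ p, ret (inc p) = p := fun p => dif_pos p.1.2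
  have hret : ContinuousOn ret (Metric.sphere (0 : E) 1 ×ˢ Set.univ) := by
    rw [continuousOn_iff_continuous_domRestrict]
    have : Set.domRestrict (Metric.sphere (0 : E) 1 ×ˢ (Set.univ : Set B)) ret =
        fun p => (⟨p.1.1, p.2.1⟩, p.1.2) := funext fun p => dif_pos p.2.1
    rw [this]
    fun_prop
  have hinc : Set.MapsTo inc Set.univ (Metric.sphere (0 : E) 1 ×ˢ Set.univ) :=
    fun p _ => ⟨p.1.2, trivial⟩
  let θ : Fin (n + 1) → E × B → ZMod 2 := fun i p =>
    if 0 < p.1 i then 1 else if p.1 i < 0 then 0 else ϑ (ret p).1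
  have hS : SphereClaim E B (sph n θ) := by
    refine sphereClaim_fin n θ (fun i p h => if_pos h) fun i p h => ?_
    simp only [θ, if_neg h.not_gt, if_pos h]
  obtain ⟨b, b', y, hb, hb', hy, h1, h2, h3⟩ := hS (pull ret z.1) z.2 (by
    rw [← pull_cd]
    exact LZOn.pull ha hret (Set.mapsTo_univ _ _))
  refine ⟨AS.mk ⟨b, hb⟩, AS.mk ⟨b', hb'⟩, AS.mk ⟨pull inc y, hy⟩, ?_, ?_, ?_⟩
  · rw [AS.d_mk, AS.mk_eq_zero]; exact h1
  · rw [AS.d_mk, AS.mk_eq_zero]; exact h2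
  · rw [AS.map_mk, AS.map_mk, AS.sph, AS.d_mk, ← map_mul, ← map_add, ← map_add, AS.mk_eq]
    have := h3.pull inc.continuous.continuousOn hinc
    have e : sph n (fun i (p : SS n × B) => SS.sgn ϑ i p.1) = pull inc (sph n θ) := by
      rw [pull_sph]
      congr 1
      funext i p
      simp only [θ, hri]
      rfl
    simp only [coe_addc, coe_mul, coe_pullHom, coe_cdHom]
    rw [e]
    have e1 : z.1 = pull inc (pull ret z.1) := by
      funext l
      simp only [pull, List.map_map]
      have : (ret ∘ inc) = id := funext hri
      rw [this, List.map_id]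
    rw [e1, ← pull_cd]
    rw [show pull (⇑(ContinuousMap.snd : C(SS n × B, B))) b = pull inc (pull Prod.snd b) by
      funext l; simp [pull, inc, Function.comp_def],
      show pull (⇑(ContinuousMap.snd : C(SS n × B, B))) b' = pull inc (pull Prod.snd b') by
      funext l; simp [pull, inc, Function.comp_def], ← pull_cup]
    convert this using 1
    funext l
    simp only [Pi.add_apply, pull]
    ring

theorem SS.coverData [CompactSpace B] [Nonempty B] : ∃ θ : AS (SS n × B), ∃ ρ : AS (SS n × B) →+* AS B,
    GDga.pr 0 θ = θ ∧
    CoverData (AS.map (SS.T n B)) (AS.map ContinuousMap.snd) ρ θ n := by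
  obtain ⟨ϑ, hϑ⟩ := SS.exists_odd (n := n)
  let sg : Fin (n + 1) → SS n × B → ZMod 2 := fun i p => SS.sgn ϑ i p.1
  have hsg : ∀ i e, sg i (SS.T n B e) = sg i e + 1 := fun i e => SS.sgn_neg hϑ i e.1
  let x₀ : SS n := Classical.arbitrary _
  let j : C(B, SS n × B) := ⟨fun b => (x₀, b), by fun_prop⟩
  have hsph : ∃ y₀, AS.map (SS.T n B) y₀ = y₀ ∧
      AS.sph n sg = ((Dga.d (AS.pt (sg 0))) ^ n + Dga.d y₀) * AS.pt (sg 0) := by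
    cases n with
    | zero =>
      refine ⟨0, map_zero _, ?_⟩
      rw [AS.sph_zero]; simp
    | succ n =>
      obtain ⟨y, hy, e⟩ := AS.d_sph_odd (SS.T _ B) (hsg 0) n (fun i => sg i.succ)
        fun i => hsg _
      exact ⟨y, hy, by rw [AS.sph_succ, e]⟩
  obtain ⟨y₀, hy₀, e₀⟩ := hsph
  refine ⟨AS.pt (sg 0), AS.map j, AS.pr_pt _, ?_, ?_, ?_, ?_, ?_, ?_, ?_, ?_, y₀, hy₀, ?_, ?_⟩
  · intro a
    rw [← AS.map_comp]
    convert AS.map_id a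
    ext1 e
    exact SS.T_T n B e
  · exact fun a => (AS.map_d _ _).symm
  · exact fun a => (AS.map_d _ _).symm
  · exact fun a => (AS.map_d _ _).symm
  · intro b
    rw [← AS.map_comp]
    rfl
  · intro b
    rw [← AS.map_comp]
    exact AS.map_id b
  · rw [AS.map_pt, show sg 0 ∘ SS.T n B = sg 0 + fun _ => 1 from funext (hsg 0), AS.pt_add,
      AS.pt_one]
  · rw [AS.map_pt]
    have : sg 0 ∘ j = fun _ => sg 0 (x₀, Classical.arbitrary B) := rfl
    rw [this]
    rcases (show ∀ c : ZMod 2, c = 0 ∨ c = 1 by decide) (sg 0 (x₀, Classical.arbitrary B))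
      with h | h
    · rw [h]
      have e : AS.pt (fun _ : B => (0 : ZMod 2)) = AS.pt (fun _ => 1) + AS.pt (fun _ => 1) := by
        rw [← AS.pt_add]; congr 1
      rw [e, AS.pt_one, map_add, d_one, add_zero]
    · rw [h, AS.pt_one, d_one]
  · have := AS.d_sph_eq_zero n sg (SS.sgn_locally B ϑ)
    rw [e₀, Dga.d_mul, map_add, Dga.d_d, d_cocycle_pow (Dga.d_d _)] at this
    simpa using this
  · intro a ha
    obtain ⟨b, b', y, h1, h2, h3⟩ := SS.sphere_cocycle B ϑ a ha
    exact ⟨b, b', y, h1, h2, by rw [h3, ← e₀]⟩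

/-- The cohomology of `ℝP^n × B` is free over the cohomology of `B` on the powers of a class of
degree one. -/
theorem lerayHirsch [CompactSpace B] [Nonempty B] : ∃ w : AS (RP n × B),
    Dga.d w = 0 ∧ GDga.pr 1 w = w ∧ (∃ y, w ^ (n + 1) = Dga.d y) ∧
    (∀ z : AS (RP n × B), Dga.d z = 0 → ∃ b : ℕ → AS B, (∀ i, Dga.d (b i) = 0) ∧
      ∃ y, z = ∑ i ∈ Finset.range (n + 1), AS.map ContinuousMap.snd (b i) * w ^ i + Dga.d y) ∧
    ∀ b : ℕ → AS B, (∀ i, Dga.d (b i) = 0) →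
      (∃ y, ∑ i ∈ Finset.range (n + 1), AS.map ContinuousMap.snd (b i) * w ^ i = Dga.d y) →
      ∀ i < n + 1, ∃ e, b i = Dga.d e := by
  obtain ⟨θ, ρ, hθ, h⟩ := SS.coverData n B
  have hqi := SS.map_q_injective n B
  have hTq : ∀ a, AS.map (SS.T n B) (AS.map (SS.q n B) a) = AS.map (SS.q n B) a := fun a => by
    rw [← AS.map_comp]
    congr 2
    ext1 e
    exact SS.q_T n B e
  have hβ : ∀ b : AS B, AS.map (ContinuousMap.snd : C(SS n × B, B)) b =
      AS.map (SS.q n B) (AS.map ContinuousMap.snd b) := fun b => by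
    rw [← AS.map_comp]; rfl
  obtain ⟨w, hw⟩ := SS.exists_map_q n B (Dga.d θ) h.τ_dθ
  have hsum : ∀ b : ℕ → AS B, AS.map (SS.q n B)
      (∑ i ∈ Finset.range (n + 1), AS.map ContinuousMap.snd (b i) * w ^ i) =
      ∑ i ∈ Finset.range (n + 1), AS.map ContinuousMap.snd (b i) * (Dga.d θ) ^ i := fun b => by
    simp only [map_sum, map_mul, map_pow, hβ, hw]
  refine ⟨w, hqi ?_, hqi ?_, ?_, fun z hz => ?_, fun b hb ⟨y, hy⟩ => ?_⟩
  · rw [AS.map_d, hw, Dga.d_d, map_zero]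
  · rw [AS.map_pr, hw, GDga.pr_d, hθ]
  · obtain ⟨y, hy, e⟩ := h.pow_exact
    obtain ⟨y, rfl⟩ := SS.exists_map_q n B y hy
    refine ⟨y, hqi ?_⟩
    rw [map_pow, hw, e, AS.map_d]
  · obtain ⟨b, hb, y, hy, e⟩ := h.spanning (AS.map (SS.q n B) z)
      (by rw [← AS.map_d, hz, map_zero]) (hTq z)
    obtain ⟨y, rfl⟩ := SS.exists_map_q n B y hy
    refine ⟨b, hb, y, hqi ?_⟩
    rw [e, map_add, hsum, AS.map_d]
  · refine h.independent b hb ⟨AS.map (SS.q n B) y, hTq y, ?_⟩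
    rw [← hsum, hy, AS.map_d]
end LH

end AlexSpan

end

section

open Topology

namespace AlexSpan

section Cohomology
variable (C : Type) [Dga C]

/-- The ring of cocycles. -/
def Cocycles : Subring C where
  carrier := {a | Dga.d a = 0}
  zero_mem' := map_zero _
  one_mem' := by
    have := Dga.d_mul (1 : C) 1
    rw [mul_one, mul_one, one_mul, left_eq_add] at this
    exact this
  add_mem' := fun {a b} ha hb => by
    change Dga.d (a + b) = 0
    rw [map_add, show Dga.d a = 0 from ha, show Dga.d b = 0 from hb, add_zero]
  neg_mem' := fun {a} ha => by
    change Dga.d (-a) = 0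
    rw [map_neg, show Dga.d a = 0 from ha, neg_zero]
  mul_mem' := fun {a b} ha hb => by
    change Dga.d (a * b) = 0
    rw [Dga.d_mul, show Dga.d a = 0 from ha, show Dga.d b = 0 from hb, zero_mul, mul_zero, add_zero]

/-- The ideal of exact elements. -/
def Exacts : Ideal (Cocycles C) where
  carrier := {a | ∃ y, a.1 = Dga.d y}
  zero_mem' := ⟨0, (map_zero _).symm⟩
  add_mem' := fun {a b} ⟨x, hx⟩ ⟨y, hy⟩ => ⟨x + y, by rw [map_add, ← hx, ← hy]; rfl⟩
  smul_mem' := fun c {a} ⟨x, hx⟩ => ⟨c.1 * x, by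
    rw [Dga.d_mul, show Dga.d c.1 = 0 from c.2, zero_mul, zero_add, ← hx]; rfl⟩

instance : (Exacts C).IsTwoSided := ⟨fun {a} b ⟨x, hx⟩ => ⟨x * b.1, by
    rw [Dga.d_mul, show Dga.d b.1 = 0 from b.2, mul_zero, add_zero, ← hx]; rfl⟩⟩

/-- The cohomology ring. -/
def H : Type := Cocycles C ⧸ Exacts C

instance : Ring (H C) := inferInstanceAs (Ring (Cocycles C ⧸ Exacts C))

variable {C}

/-- The cohomology class of a cocycle. -/
def cl : Cocycles C →+* H C := Ideal.Quotient.mk (Exacts C)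

lemma cl_surj (x : H C) : ∃ a, cl a = x := Ideal.Quotient.mk_surjective x

lemma cl_eq_zero {a : Cocycles C} : cl a = 0 ↔ ∃ y, a.1 = Dga.d y :=
  Ideal.Quotient.eq_zero_iff_mem

lemma cl_eq {a b : Cocycles C} [CharP C 2] : cl a = cl b ↔ ∃ y, a.1 + b.1 = Dga.d y := by
  refine Ideal.Quotient.eq.trans ?_
  change (∃ y, a.1 - b.1 = Dga.d y) ↔ _
  rw [CharTwo.sub_eq_add]

variable {D : Type} [Dga D]

/-- The map on cocycles. -/
def cocyclesMap (f : C →+* D) (hf : ∀ a, f (Dga.d a) = Dga.d (f a)) : Cocycles C →+* Cocycles D :=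
  f.restrict (Cocycles C) (Cocycles D) fun a ha => by
    change Dga.d (f a) = 0
    rw [← hf, show Dga.d a = 0 from ha, map_zero]

/-- The map on cohomology. -/
def H.map (f : C →+* D) (hf : ∀ a, f (Dga.d a) = Dga.d (f a)) : H C →+* H D :=
  Ideal.quotientMap (Exacts D) (cocyclesMap f hf) fun _ ⟨y, hy⟩ =>
    ⟨f y, by rw [← hf, ← hy]; rfl⟩

lemma H.map_cl (f : C →+* D) (hf : ∀ a, f (Dga.d a) = Dga.d (f a)) (a : Cocycles C) :
    H.map f hf (cl a) = cl ⟨f a.1, (cocyclesMap f hf a).2⟩ := rfl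
end Cohomology

section Graded
variable {C D : Type} [GDga C] [GDga D]

instance [CharP C 2] : CharP (H C) 2 := by
  refine CharTwo.of_one_ne_zero_of_two_eq_zero (fun h => ?_) ?_
  · rw [← map_one cl, cl_eq_zero] at h
    obtain ⟨y, hy⟩ := h
    have h1 := congrArg (GDga.pr 0) hy
    have : (1 : C) = 0 := by
      rw [GDga.pr_zero_d] at h1
      rw [← h1]
      exact GDga.pr_one.symm
    have h2 : ((1 : ℕ) : C) = 0 := by simpa using this
    have := (CharP.cast_eq_zero_iff C 2 1).1 h2
    omega
  · rw [← one_add_one_eq_two, ← map_one cl, ← map_add,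
      show (1 : Cocycles C) + 1 = 0 from Subtype.ext (add_self_two (1 : C)), map_zero]

noncomputable instance [CharP C 2] : Algebra (ZMod 2) (H C) := ZMod.algebra _ 2

lemma d_pr (k : ℕ) {a : C} (ha : Dga.d a = 0) : Dga.d (GDga.pr k a) = 0 := by
  rw [← GDga.pr_d, ha, map_zero]

/-- The projection to degree `k` on cocycles. -/
def prC (k : ℕ) : Cocycles C →+ Cocycles C :=
  AddMonoidHom.mk' (fun a => ⟨GDga.pr k a.1, d_pr k a.2⟩) fun a b => Subtype.ext (map_add _ a.1 b.1)

/-- The projection to degree `k` on cohomology. -/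
def prH (k : ℕ) : H C →+ H C :=
  QuotientAddGroup.map (Exacts C).toAddSubgroup (Exacts C).toAddSubgroup (prC k) fun a ⟨y, hy⟩ => by
    cases k with
    | zero =>
      refine ⟨0, ?_⟩
      change GDga.pr 0 a.1 = Dga.d 0
      rw [hy, GDga.pr_zero_d, map_zero]
    | succ k =>
      refine ⟨GDga.pr k y, ?_⟩
      change GDga.pr (k + 1) a.1 = _
      rw [hy, GDga.pr_d]

lemma prH_cl (k : ℕ) (a : Cocycles C) : prH k (cl a) = cl ⟨GDga.pr k a.1, d_pr k a.2⟩ := rfl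

/-- Homogeneous classes. -/
def IsDeg (k : ℕ) (x : H C) : Prop := prH k x = x

lemma isDeg_iff {k : ℕ} {x : H C} : IsDeg k x ↔ ∃ a : Cocycles C, GDga.pr k a.1 = a.1 ∧ x = cl a := by
  constructor
  · intro h
    obtain ⟨a, rfl⟩ := cl_surj x
    rw [IsDeg, prH_cl] at h
    refine ⟨_, ?_, h.symm⟩
    simp [GDga.pr_pr]
  · rintro ⟨a, ha, rfl⟩
    rw [IsDeg, prH_cl]
    congr 1
    exact Subtype.ext ha

lemma IsDeg.mul {j k : ℕ} {x y : H C} (hx : IsDeg j x) (hy : IsDeg k y) : IsDeg (j + k) (x * y) := by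
  rw [isDeg_iff] at *
  obtain ⟨a, ha, rfl⟩ := hx
  obtain ⟨b, hb, rfl⟩ := hy
  exact ⟨a * b, GDga.pr_mul _ _ _ _ ha hb, (map_mul _ _ _).symm⟩

lemma isDeg_one : IsDeg 0 (1 : H C) := isDeg_iff.2 ⟨1, GDga.pr_one, (map_one _).symm⟩

lemma IsDeg.pow {j : ℕ} {x : H C} (hx : IsDeg j x) (k : ℕ) : IsDeg (k * j) (x ^ k) := by
  induction k with
  | zero => rw [pow_zero, zero_mul]; exact isDeg_one
  | succ k ih => rw [pow_succ, add_mul, one_mul]; exact ih.mul hx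

lemma IsDeg.prH_ne {j k : ℕ} {x : H C} (hx : IsDeg j x) (h : k ≠ j) : prH k x = 0 := by
  obtain ⟨a, ha, rfl⟩ := isDeg_iff.1 hx
  rw [prH_cl, ← map_zero cl]
  congr 1
  refine Subtype.ext ?_
  change GDga.pr k a.1 = 0
  rw [← ha, GDga.pr_pr, if_neg h]

lemma IsDeg.add {j : ℕ} {x y : H C} (hx : IsDeg j x) (hy : IsDeg j y) : IsDeg j (x + y) := by
  rw [IsDeg, map_add, hx, hy]

lemma isDeg_zero (j : ℕ) : IsDeg j (0 : H C) := map_zero _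

lemma IsDeg.commute [CharP C 2] {x y : H C} (hx : IsDeg 1 x) (hy : IsDeg 1 y) : x * y = y * x := by
  obtain ⟨a, ha, rfl⟩ := isDeg_iff.1 hx
  obtain ⟨b, hb, rfl⟩ := isDeg_iff.1 hy
  rw [← map_mul, ← map_mul, cl_eq]
  exact ⟨GDga.star a.1 b.1, (GDga.d_star _ _ ha hb a.2 b.2).symm⟩

lemma IsDeg.map (f : C →+* D) (hf : ∀ a, f (Dga.d a) = Dga.d (f a))
    (hf' : ∀ k a, f (GDga.pr k a) = GDga.pr k (f a)) {k : ℕ} {x : H C} (hx : IsDeg k x) :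
    IsDeg k (H.map f hf x) := by
  obtain ⟨a, ha, rfl⟩ := isDeg_iff.1 hx
  rw [H.map_cl]
  exact isDeg_iff.2 ⟨_, by rw [← hf', ha], rfl⟩
end Graded

section Trunc

/-- The monomial with exponents `M`. -/
def mon {A : Type} [Ring A] {m : ℕ} (n : ℕ) (v : Fin m → A) (M : Fin m → Fin (n + 1)) : A :=
  (List.ofFn fun j => v j ^ (M j : ℕ)).prod

/-- `A` is commutative and is the quotient of a polynomial ring by the powers of the variables. -/
structure IsTrunc {A : Type} [Ring A] [Algebra (ZMod 2) A] {m : ℕ} (n : ℕ) (v : Fin m → A) :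
    Prop where
  comm : ∀ a b : A, a * b = b * a
  pow : ∀ j, v j ^ (n + 1) = 0
  indep : LinearIndependent (ZMod 2) (mon n v)
  span : ⊤ ≤ Submodule.span (ZMod 2) (Set.range (mon n v))

lemma mon_succ {A : Type} [Ring A] {m : ℕ} (n : ℕ) (v : Fin (m + 1) → A)
    (M : Fin (m + 1) → Fin (n + 1)) :
    mon n v M = v 0 ^ (M 0 : ℕ) * mon n (fun j => v j.succ) (fun j => M j.succ) := by
  rw [mon, mon, List.ofFn_succ, List.prod_cons]

lemma map_mon {A A' : Type} [Ring A] [Ring A'] (f : A →+* A') {m : ℕ} (n : ℕ) (v : Fin m → A)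
    (M : Fin m → Fin (n + 1)) : f (mon n v M) = mon n (f ∘ v) M := by
  rw [mon, mon, map_list_prod, List.map_ofFn]
  congr 2
  funext j
  simp

lemma IsTrunc.of_ringEquiv {A A' : Type} [Ring A] [Ring A'] [Algebra (ZMod 2) A]
    [Algebra (ZMod 2) A'] (f : A →+* A') (hf : Function.Bijective f) {m n : ℕ} {v : Fin m → A}
    (h : IsTrunc n v) : IsTrunc n (f ∘ v) := by
  have e : mon n (f ∘ v) = f.toAddMonoidHom.toZModLinearMap 2 ∘ mon n v :=
    funext fun M => (map_mon f n v M).symm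
  refine ⟨fun a b => ?_, fun j => ?_, ?_, ?_⟩
  · obtain ⟨a, rfl⟩ := hf.2 a
    obtain ⟨b, rfl⟩ := hf.2 b
    rw [← map_mul, h.comm, map_mul]
  · rw [Function.comp, ← map_pow, h.pow, map_zero]
  · rw [e]
    exact h.indep.map' _ (LinearMap.ker_eq_bot.2 hf.1)
  · rw [e, Set.range_comp, Submodule.span_image, top_le_iff.1 h.span, Submodule.map_top]
    exact (LinearMap.range_eq_top.2 hf.2).ge

lemma mon_mem {A : Type} [Ring A] {m : ℕ} (n : ℕ) (v : Fin m → A) (S : Subring A)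
    (h : ∀ j, v j ∈ S) (M : Fin m → Fin (n + 1)) : mon n v M ∈ S := by
  refine S.list_prod_mem fun x hx => ?_
  obtain ⟨j, rfl⟩ := List.mem_ofFn.1 hx
  exact S.pow_mem (h j) _

lemma IsTrunc.mem_subring {A : Type} [Ring A] [Algebra (ZMod 2) A] {m n : ℕ} {v : Fin m → A}
    (hv : IsTrunc n v) (S : Subring A) (h : ∀ j, v j ∈ S) (a : A) : a ∈ S := by
  have ha := hv.span (Submodule.mem_top (x := a))
  induction ha using Submodule.span_induction with
  | mem x hx => obtain ⟨M, rfl⟩ := hx; exact mon_mem n v S h M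
  | zero => exact S.zero_mem
  | add x y _ _ hx hy => exact S.add_mem hx hy
  | smul c x _ hx =>
    rcases (show ∀ c : ZMod 2, c = 0 ∨ c = 1 by decide) c with rfl | rfl
    · rw [zero_smul]; exact S.zero_mem
    · rwa [one_smul]

lemma IsTrunc.cons {A A' : Type} [Ring A] [Ring A'] [Algebra (ZMod 2) A]
    [Algebra (ZMod 2) A'] (f : A →+* A') {m n : ℕ} {v : Fin m → A} (h : IsTrunc n v) (w : A')
    (hw : w ^ (n + 1) = 0) (hc : ∀ j, f (v j) * w = w * f (v j))
    (hspan : ∀ z, ∃ b : ℕ → A, z = ∑ i ∈ Finset.range (n + 1), f (b i) * w ^ i)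
    (hind : ∀ b : ℕ → A, ∑ i ∈ Finset.range (n + 1), f (b i) * w ^ i = 0 →
      ∀ i < n + 1, b i = 0) : IsTrunc n (Fin.cons w (f ∘ v) : Fin (m + 1) → A') := by
  have hcw : ∀ a, f a * w = w * f a := fun a => by
    have := h.mem_subring ((Subring.centralizer {w}).comap f)
      (fun j => Subring.mem_comap.2 (Subring.mem_centralizer_iff.2 (by simp [hc]))) a
    have := Subring.mem_centralizer_iff.1 (Subring.mem_comap.1 this) w rfl
    exact this.symm
  have hcw' : ∀ a (k : ℕ), Commute (f a) (w ^ k) := fun a k => Commute.pow_right (hcw a) k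
  have hmon : ∀ M, mon n (Fin.cons w (f ∘ v) : Fin (m + 1) → A') M =
      f (mon n v (fun j => M j.succ)) * w ^ (M 0 : ℕ) := fun M => by
    rw [mon_succ, (hcw' _ _).eq, map_mon]
    rfl
  have hfs : ∀ (c : ZMod 2) a, f (c • a) = c • f a :=
    fun c a => map_smul (f.toAddMonoidHom.toZModLinearMap 2) c a
  refine ⟨fun a b => ?_, fun j => ?_, ?_, ?_⟩
  · obtain ⟨a, rfl⟩ := hspan a
    obtain ⟨b, rfl⟩ := hspan b
    refine (Commute.sum_left _ _ _ fun i _ => Commute.sum_right _ _ _ fun j _ => ?_).eq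
    have h1 : Commute (f (a i)) (f (b j)) := by
      rw [Commute, SemiconjBy, ← map_mul, h.comm, map_mul]
    exact Commute.mul_left (h1.mul_right (hcw' _ _))
      ((hcw' _ _).symm.mul_right (Commute.pow_pow (Commute.refl w) _ _))
  · refine Fin.cases ?_ (fun j => ?_) j
    · exact hw
    · rw [Fin.cons_succ, Function.comp, ← map_pow, h.pow, map_zero]
  · rw [Fintype.linearIndependent_iff]
    intro g hg M
    have e : ∑ i ∈ Finset.range (n + 1), f (∑ M' : Fin m → Fin (n + 1),
        (if hi : i < n + 1 then g (Fin.cons ⟨i, hi⟩ M') else 0) • mon n v M') * w ^ i = 0 := by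
      rw [← hg, ← (Fin.consEquiv fun _ : Fin (m + 1) => Fin (n + 1)).sum_comp,
        Fintype.sum_prod_type, Finset.sum_range]
      refine Finset.sum_congr rfl fun i _ => ?_
      rw [map_sum, Finset.sum_mul]
      refine Finset.sum_congr rfl fun M' _ => ?_
      rw [dif_pos i.2, hmon, hfs, smul_mul_assoc]
      rfl
    have h2 := hind _ e (M 0) (M 0).2
    have h3 := Fintype.linearIndependent_iff.1 h.indep _ h2 fun j => M j.succ
    rw [dif_pos (M 0).2] at h3
    rw [← h3]
    congr 1
    exact (Fin.cons_self_tail M).symm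
  · rintro z -
    obtain ⟨b, rfl⟩ := hspan z
    refine Submodule.sum_mem _ fun i hi => ?_
    have hb := h.span (Submodule.mem_top (x := b i))
    generalize b i = x at hb ⊢
    induction hb using Submodule.span_induction with
    | mem x hx =>
      obtain ⟨M, rfl⟩ := hx
      refine Submodule.subset_span ⟨Fin.cons ⟨i, Finset.mem_range.1 hi⟩ M, ?_⟩
      rw [hmon]
      simp
    | zero => simp
    | add x y _ _ hx hy => rw [map_add, add_mul]; exact Submodule.add_mem _ hx hy
    | smul c x _ hx => rw [hfs, smul_mul_assoc]; exact Submodule.smul_mem _ _ hx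
end Trunc

end AlexSpan

end

section

open Topology

namespace AlexSpan

section Space
variable {X Y Z : Type} [TopologicalSpace X] [TopologicalSpace Y] [TopologicalSpace Z]

/-- The map induced on cohomology by a continuous map. -/
noncomputable def AS.Hmap (f : C(X, Y)) : H (AS Y) →+* H (AS X) := H.map (AS.map f) (AS.map_d f)

lemma AS.Hmap_comp (f : C(X, Y)) (g : C(Y, Z)) (x : H (AS Z)) :
    AS.Hmap (g.comp f) x = AS.Hmap f (AS.Hmap g x) := by
  obtain ⟨a, rfl⟩ := cl_surj x
  simp only [AS.Hmap, H.map_cl, AS.map_comp]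

lemma AS.Hmap_id (x : H (AS X)) : AS.Hmap (ContinuousMap.id X) x = x := by
  obtain ⟨a, rfl⟩ := cl_surj x
  simp only [AS.Hmap, H.map_cl, AS.map_id]

lemma AS.Hmap_homotopic [CompactSpace X] [Nonempty X] {f g : C(X, Y)} (h : f.Homotopic g)
    (x : H (AS Y)) : AS.Hmap f x = AS.Hmap g x := by
  obtain ⟨a, rfl⟩ := cl_surj x
  simp only [AS.Hmap, H.map_cl]
  exact cl_eq.2 (AS.map_homotopic h a.2)

lemma AS.isDeg_Hmap (f : C(X, Y)) {k : ℕ} {x : H (AS Y)} (hx : IsDeg k x) :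
    IsDeg k (AS.Hmap f x) := hx.map _ _ (AS.map_pr f)

lemma AS.Hmap_bijective [CompactSpace X] [CompactSpace Y] [Nonempty X] [Nonempty Y]
    (e : ContinuousMap.HomotopyEquiv X Y) : Function.Bijective (AS.Hmap e.toFun) := by
  refine ⟨Function.LeftInverse.injective (g := AS.Hmap e.invFun) fun y => ?_,
    Function.RightInverse.surjective (g := AS.Hmap e.invFun) fun x => ?_⟩
  · rw [← AS.Hmap_comp, AS.Hmap_homotopic e.right_inv, AS.Hmap_id]
  · rw [← AS.Hmap_comp, AS.Hmap_homotopic e.left_inv, AS.Hmap_id]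

lemma isTrunc_point [Subsingleton X] [Nonempty X] (n : ℕ) (v : Fin 0 → H (AS X)) : IsTrunc n v := by
  obtain ⟨u⟩ := ‹Nonempty X›
  have : Nonempty X := ⟨u⟩
  have key : ∀ x : H (AS X), ∃ c : ZMod 2, x = c • 1 := by
    intro x
    obtain ⟨a, rfl⟩ := cl_surj x
    obtain ⟨z, hz⟩ := AS.mk_surj a.1
    have hdz := a.2
    change Dga.d a.1 = 0 at hdz
    rw [← hz, AS.d_mk, AS.mk_eq_zero] at hdz
    obtain ⟨U, hU, hdz⟩ := hdz u trivial
    have hdz : ∀ l, cd z.1 l = 0 := fun l => hdz l fun y _ =>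
      ⟨by rw [Subsingleton.elim y u]; exact mem_of_mem_nhds hU, trivial⟩
    have hc : cl a = cl (if z.1 [u] = 0 then 0 else 1) := by
      rw [cl_eq]
      refine ⟨AS.mk ⟨fun l => if l = [] then 0 else z.1 (u :: l), by simp [cochains]⟩, ?_⟩
      have e : (if z.1 [u] = 0 then (0 : Cocycles (AS X)) else 1).1 =
          AS.mk ⟨AlexSpan.pt fun _ => z.1 [u], rfl⟩ := by
        split_ifs with h
        · rw [h]
          change (0 : AS X) = _
          rw [eq_comm, AS.mk_eq_zero]
          convert LZOn.zero
          funext l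
          match l with
          | [] => simp [AlexSpan.pt]
          | [x] => simp [AlexSpan.pt]
          | x :: y :: l => simp [AlexSpan.pt]
        · rw [(show ∀ c : ZMod 2, c ≠ 0 → c = 1 by decide) _ h]
          exact AS.pt_one.symm
      rw [e, ← hz, AS.d_mk, ← map_add, AS.mk_eq]
      convert LZOn.zero
      funext l
      simp only [coe_addc, coe_cdHom, Pi.add_apply, Pi.zero_apply]
      have h2 : (fun l => z.1 (u :: l)) = (fun l => if l = [] then 0 else z.1 (u :: l)) +
          fun l => if l = [] then z.1 [u] else 0 := by
        funext l
        by_cases h : l = [] <;> simp [h]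
      have h3 : cd (fun l : List X => if l = [] then z.1 [u] else 0) =
          AlexSpan.pt fun _ => z.1 [u] := by
        funext l
        cases l with
        | nil => simp [AlexSpan.pt]
        | cons x l =>
          rw [cd_cons, show (fun l => if x :: l = [] then z.1 [u] else 0) =
            (0 : List X → ZMod 2) by funext l; simp, cd_zero]
          cases l <;> simp [AlexSpan.pt]
      have h4 := hdz (u :: l)
      rw [cd_cons, h2, cd_add, h3, Pi.add_apply] at h4
      grind
    rw [hc]
    split_ifs
    · exact ⟨0, by simp⟩
    · exact ⟨1, by simp⟩
  have : Nontrivial (H (AS X)) := CharP.nontrivial_of_char_ne_one (v := 2) (by decide)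
  have hm : ∀ M, mon n v M = 1 := fun M => by simp [mon]
  refine ⟨fun a b => ?_, fun j => j.elim0, ?_, ?_⟩
  · obtain ⟨c, rfl⟩ := key a
    obtain ⟨c', rfl⟩ := key b
    simp [smul_comm c c']
  · rw [show mon n v = fun _ => 1 from funext hm]
    exact LinearIndependent.of_subsingleton (fun j => j.elim0) one_ne_zero
  · rintro x -
    obtain ⟨c, rfl⟩ := key x
    exact Submodule.smul_mem _ _ (Submodule.subset_span ⟨fun j => j.elim0, hm _⟩)

theorem kunneth (n m : ℕ) : ∃ v : Fin m → H (AS (Fin m → RP n)),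
    (∀ j, IsDeg 1 (v j)) ∧ IsTrunc n v := by
  induction m with
  | zero => exact ⟨fun j => j.elim0, fun j => j.elim0, isTrunc_point n _⟩
  | succ m ih =>
    obtain ⟨v, hv, ht⟩ := ih
    obtain ⟨w, hw, hw1, ⟨y, hy⟩, hspan, hind⟩ := lerayHirsch n (Fin m → RP n)
    let B := Fin m → RP n
    let β : H (AS B) →+* H (AS (RP n × B)) := AS.Hmap ContinuousMap.snd
    let x : H (AS (RP n × B)) := cl ⟨w, hw⟩
    have hx : IsDeg 1 x := isDeg_iff.2 ⟨_, hw1, rfl⟩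
    have hsum : ∀ b : ℕ → Cocycles (AS B), ∑ i ∈ Finset.range (n + 1), β (cl (b i)) * x ^ i =
        cl (∑ i ∈ Finset.range (n + 1), cocyclesMap (AS.map (ContinuousMap.snd : C(RP n × B, B)))
          (AS.map_d _) (b i) * (⟨w, hw⟩ : Cocycles (AS (RP n × B))) ^ i) := by
      intro b
      rw [map_sum]
      simp only [map_mul, map_pow]
      rfl
    have hsum' : ∀ b : ℕ → Cocycles (AS B),
        (∑ i ∈ Finset.range (n + 1), cocyclesMap (AS.map (ContinuousMap.snd : C(RP n × B, B)))
          (AS.map_d _) (b i) * (⟨w, hw⟩ : Cocycles (AS (RP n × B))) ^ i).1 =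
        ∑ i ∈ Finset.range (n + 1), AS.map ContinuousMap.snd (b i).1 * w ^ i := by
      intro b
      rw [AddSubmonoidClass.coe_finsetSum]
      rfl
    have h := ht.cons β x (by rw [← map_pow, cl_eq_zero]; exact ⟨y, hy⟩)
      (fun j => (AS.isDeg_Hmap _ (hv j)).commute hx) (fun z => by
        obtain ⟨z, rfl⟩ := cl_surj z
        obtain ⟨b, hb, y, e⟩ := hspan z.1 z.2
        refine ⟨fun i => cl ⟨b i, hb i⟩, ?_⟩
        rw [hsum, cl_eq, hsum', e]
        exact ⟨y, by rw [add_right_comm, add_self_two, zero_add]⟩) (fun b hb i hi => by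
        choose c hc using fun i => cl_surj (b i)
        obtain rfl : b = fun i => cl (c i) := funext fun i => (hc i).symm
        rw [hsum, cl_eq_zero, hsum'] at hb
        obtain ⟨e, he⟩ := hind (fun i => (c i).1) (fun i => (c i).2) hb i hi
        have h5 : cl (c i) = 0 := cl_eq_zero.2 ⟨e, he⟩
        exact h5)
    let f : C(Fin (m + 1) → RP n, RP n × B) := ⟨fun p => (p 0, fun j => p j.succ), by fun_prop⟩
    let g : C(RP n × B, Fin (m + 1) → RP n) :=
      ⟨fun p => Fin.cons p.1 p.2, by
        refine continuous_pi fun j => Fin.cases ?_ (fun j => ?_) j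
        · exact continuous_fst
        · exact (continuous_apply j).comp continuous_snd⟩
    have hfg : f.comp g = ContinuousMap.id _ := by ext1 p; rfl
    have hgf : g.comp f = ContinuousMap.id _ := by
      ext1 p
      exact Fin.cons_self_tail p
    refine ⟨AS.Hmap f ∘ Fin.cons x (β ∘ v), fun j => AS.isDeg_Hmap _ ?_, h.of_ringEquiv _ ?_⟩
    · refine Fin.cases ?_ (fun j => ?_) j
      · exact hx
      · exact AS.isDeg_Hmap _ (hv j)
    · refine ⟨Function.LeftInverse.injective (g := AS.Hmap g) fun y => ?_,
        Function.RightInverse.surjective (g := AS.Hmap g) fun y => ?_⟩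
      · rw [← AS.Hmap_comp, hfg, AS.Hmap_id]
      · rw [← AS.Hmap_comp, hgf, AS.Hmap_id]

theorem exists_isTrunc [CompactSpace X] [Nonempty X] {n m : ℕ}
    (e : ContinuousMap.HomotopyEquiv X (Fin m → RP n)) : ∃ v : Fin m → H (AS X),
    (∀ j, IsDeg 1 (v j)) ∧ IsTrunc n v := by
  obtain ⟨v, hv, ht⟩ := kunneth n m
  exact ⟨AS.Hmap e.toFun ∘ v, fun j => AS.isDeg_Hmap _ (hv j),
    ht.of_ringEquiv _ (AS.Hmap_bijective e)⟩

end Space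

end AlexSpan

end

section

open Topology

namespace AlexSpan

section CW
variable {n k : ℕ} {X : Type} [TopologicalSpace X] (f : Fin k → C(CellBoundary n, X))

/-- A point of the original space, in the space with cells attached. -/
def AttachCells.inl (x : X) : AttachCells n k X f := Quot.mk _ (Sum.inl x)

/-- A point of an attached cell. -/
def AttachCells.inr (i : Fin k) (c : Cell n) : AttachCells n k X f := Quot.mk _ (Sum.inr ⟨i, c⟩)

lemma AttachCells.exists_continuous (φ : C(X, ℝ)) (ψ : Fin k → C(Cell n, ℝ))
    (h : ∀ i (s : CellBoundary n), φ (f i s) = ψ i ⟨s.1, Metric.sphere_subset_closedBall s.2⟩) :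
    ∃ g : C(AttachCells n k X f, ℝ), (∀ x, g (AttachCells.inl f x) = φ x) ∧
      ∀ i c, g (AttachCells.inr f i c) = ψ i c := by
  let F : X ⊕ (Σ _ : Fin k, Cell n) → ℝ := Sum.elim φ fun p => ψ p.1 p.2
  have hF : Continuous F := φ.continuous.sumElim (continuous_sigma fun i => (ψ i).continuous)
  refine ⟨⟨Quot.lift F ?_, continuous_quot_lift _ hF⟩, fun x => rfl, fun i c => rfl⟩
  rintro a b ⟨i, s, rfl, rfl⟩
  exact h i s

lemma AttachCells.separate_cell (i : Fin k) (c : Cell n) (hc : ‖c.1‖ < 1)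
    (q : AttachCells n k X f) (hq : q ≠ AttachCells.inr f i c) :
    ∃ g : C(AttachCells n k X f, ℝ), g (AttachCells.inr f i c) ≠ g q := by
  classical
  have key : ∀ r : ℝ, r ≤ 1 - ‖c.1‖ → ∃ g : C(AttachCells n k X f, ℝ),
      (∀ x, g (AttachCells.inl f x) = 0) ∧
      ∀ j d, g (AttachCells.inr f j d) = if j = i then max 0 (r - dist d.1 c.1) else 0 := by
    intro r hr
    obtain ⟨g, h1, h2⟩ := AttachCells.exists_continuous f 0
      (fun j => if j = i then ⟨fun d => max 0 (r - dist d.1 c.1), by fun_prop⟩ else 0) (by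
        intro j s
        split_ifs
        · simp only [ContinuousMap.zero_apply, ContinuousMap.coe_mk]
          rw [eq_comm, max_eq_left]
          have h1 : ‖s.1‖ = 1 := by simp
          have := norm_sub_norm_le s.1 c.1
          rw [dist_eq_norm]
          linarith
        · rfl)
    refine ⟨g, h1, fun j d => ?_⟩
    rw [h2]
    split_ifs <;> rfl
  obtain ⟨a, rfl⟩ := Quot.exists_rep q
  match a with
  | Sum.inl x =>
    obtain ⟨g, h1, h2⟩ := key _ le_rfl
    refine ⟨g, ?_⟩
    change _ ≠ g (AttachCells.inl f x)
    rw [h1, h2]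
    simp only [if_true, dist_self, sub_zero]
    exact (lt_max_of_lt_right (by linarith)).ne'
  | Sum.inr ⟨j, d⟩ =>
    by_cases hj : j = i
    · subst hj
      have hd : 0 < dist d.1 c.1 := dist_pos.2 fun h => hq (by
        rw [Subtype.ext h]; rfl)
      obtain ⟨g, h1, h2⟩ := key (min (1 - ‖c.1‖) (dist d.1 c.1)) (min_le_left _ _)
      refine ⟨g, ?_⟩
      change _ ≠ g (AttachCells.inr f j d)
      rw [h2, h2]
      simp only [if_true, dist_self, sub_zero]
      rw [max_eq_left (sub_nonpos.2 (min_le_right _ _))]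
      exact (lt_max_of_lt_right (lt_min (by linarith) hd)).ne'
    · obtain ⟨g, h1, h2⟩ := key _ le_rfl
      refine ⟨g, ?_⟩
      change _ ≠ g (AttachCells.inr f j d)
      rw [h2, h2, if_neg hj]
      simp only [if_true, dist_self, sub_zero]
      exact (lt_max_of_lt_right (by linarith)).ne'

lemma AttachCells.eq_inl_or_inr (q : AttachCells n k X f) :
    (∃ x, q = AttachCells.inl f x) ∨ ∃ i c, ‖c.1‖ < 1 ∧ q = AttachCells.inr f i c := by
  obtain ⟨a, rfl⟩ := Quot.exists_rep q
  match a with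
  | Sum.inl x => exact Or.inl ⟨x, rfl⟩
  | Sum.inr ⟨i, c⟩ =>
    have h : ‖c.1‖ ≤ 1 := mem_closedBall_zero_iff.1 c.2
    rcases h.lt_or_eq with h | h
    · exact Or.inr ⟨i, c, h, rfl⟩
    · exact Or.inl ⟨f i ⟨c.1, by simpa using h⟩, (Quot.sound ⟨i, ⟨c.1, by simpa using h⟩, rfl, rfl⟩).symm⟩

lemma AttachCells.separate_inl [CompactSpace X] [T2Space X] (x y : X) (hxy : x ≠ y) :
    ∃ g : C(AttachCells n k X f, ℝ), g (AttachCells.inl f x) ≠ g (AttachCells.inl f y) := by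
  obtain ⟨φ, h1, h2, -⟩ := exists_continuous_zero_one_of_isClosed (isClosed_singleton (x := x))
    (isClosed_singleton (x := y)) (by simpa using hxy)
  let inc : CellBoundary n → Cell n := fun s => ⟨s.1, Metric.sphere_subset_closedBall s.2⟩
  have hinc : IsClosedEmbedding inc := by
    have : Continuous inc := by fun_prop
    exact this.isClosedEmbedding fun s t h => Subtype.ext (congrArg (fun c : Cell n => c.1) h)
  have hT : ∀ i, ∃ ψ : C(Cell n, ℝ), ∀ s, ψ (inc s) = φ (f i s) := by
    intro i
    obtain ⟨ψ, hψ⟩ := ContinuousMap.exists_extension hinc (φ.comp (f i))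
    exact ⟨ψ, fun s => congrArg (fun g => g s) hψ⟩
  choose ψ hψ using hT
  obtain ⟨g, hg, -⟩ := AttachCells.exists_continuous f φ ψ fun i s => (hψ i s).symm
  refine ⟨g, ?_⟩
  rw [hg, hg, h1 rfl, h2 rfl]
  simp

lemma AttachCells.t2 [CompactSpace X] [T2Space X] : T2Space (AttachCells n k X f) := by
  refine T2Space.of_injective_continuous (Y := C(AttachCells n k X f, ℝ) → ℝ)
    (f := fun q g => g q) (fun p q h => ?_) (continuous_pi fun g => g.continuous)
  by_contra hpq
  rcases AttachCells.eq_inl_or_inr f p with ⟨x, rfl⟩ | ⟨i, c, hc, rfl⟩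
  · rcases AttachCells.eq_inl_or_inr f q with ⟨y, rfl⟩ | ⟨i, c, hc, rfl⟩
    · obtain ⟨g, hg⟩ := AttachCells.separate_inl f x y fun h => hpq (by rw [h])
      exact hg (congrFun h g)
    · obtain ⟨g, hg⟩ := AttachCells.separate_cell f i c hc _ hpq
      exact hg (congrFun h g).symm
  · obtain ⟨g, hg⟩ := AttachCells.separate_cell f i c hc _ (Ne.symm hpq)
    exact hg (congrFun h g)

lemma IsFiniteCWAtMost.compact_t2 {n : ℕ} {X : Type} [TopologicalSpace X]
    (h : IsFiniteCWAtMost n X) : CompactSpace X ∧ T2Space X := by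
  induction h with
  | base k f =>
    exact ⟨Quot.compactSpace, AttachCells.t2 f⟩
  | up _ ih => exact ih
  | attach _ k f ih =>
    obtain ⟨h1, h2⟩ := ih
    exact ⟨Quot.compactSpace, AttachCells.t2 f⟩
  | homeo _ e ih =>
    obtain ⟨h1, h2⟩ := ih
    exact ⟨e.compactSpace, e.t2Space⟩
end CW

section Involution
variable {X : Type} [TopologicalSpace X]

lemma exists_odd_of_free (g : X → X) (hg : ∀ x, g (g x) = x) (hfree : ∀ x, g x ≠ x) :
    ∃ u : X → ZMod 2, ∀ x, u (g x) = u x + 1 := by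
  classical
  let s : Setoid X := ⟨fun x y => y = x ∨ y = g x, ⟨fun x => Or.inl rfl, by
    rintro x y (rfl | rfl)
    · exact Or.inl rfl
    · exact Or.inr (hg _).symm, by
    rintro x y z (rfl | rfl) (rfl | rfl)
    · exact Or.inl rfl
    · exact Or.inr rfl
    · exact Or.inr rfl
    · exact Or.inl (hg _)⟩⟩
  refine ⟨fun x => if x = (Quotient.mk s x).out then 1 else 0, fun x => ?_⟩
  have h1 : Quotient.mk s (g x) = Quotient.mk s x := Quotient.sound (Or.inr (hg x).symm)
  have h2 : (Quotient.mk s x).out = x ∨ (Quotient.mk s x).out = g x :=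
    Setoid.symm (Quotient.mk_out x)
  simp only [h1]
  rcases h2 with h2 | h2 <;> rw [h2]
  · simp only [hfree x, if_true, if_false]; grind
  · simp [(hfree x).symm]

theorem free_involution [CompactSpace X] [T2Space X] [Nonempty X] (g : C(X, X))
    (hg : ∀ x, g (g x) = x) (hfree : ∀ x, g x ≠ x) :
    ∃ u : X → ZMod 2, (∀ x, u (g x) = u x + 1) ∧
      ∃ N y, AS.map g y = y ∧ Dga.d (AS.pt u) ^ (N + 1) = Dga.d y := by
  classical
  obtain ⟨u, hu⟩ := exists_odd_of_free g hg hfree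
  have hU : ∀ x, ∃ U : Set X, IsOpen U ∧ x ∈ U ∧ ∀ y ∈ U, g y ∉ U := fun x => by
    obtain ⟨V, W, hV, hW, hxV, hxW, hd⟩ := t2_separation (hfree x).symm
    refine ⟨V ∩ g ⁻¹' W, hV.inter (hW.preimage g.continuous), ⟨hxV, hxW⟩, fun y hy hy' => ?_⟩
    exact Set.disjoint_left.1 hd hy'.1 hy.2
  choose U hUo hxU hUg using hU
  obtain ⟨t, ht⟩ := isCompact_univ.elim_finite_subcover U hUo fun x _ => Set.mem_iUnion.2 ⟨x, hxU x⟩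
  obtain ⟨x₀⟩ := ‹Nonempty X›
  have : Nonempty X := ⟨x₀⟩
  let t' : List X := x₀ :: t.toList
  let θ : Fin (t.toList.length + 1) → X → ZMod 2 := fun i x =>
    if x ∈ U (t'.get i) then 1 else if g x ∈ U (t'.get i) then 0 else u x
  have hθ : ∀ i x, θ i (g x) = θ i x + 1 := by
    intro i x
    simp only [θ, hg]
    by_cases h1 : x ∈ U (t'.get i)
    · rw [if_neg (hUg _ _ h1), if_pos h1, if_pos h1]; grind
    · by_cases h2 : g x ∈ U (t'.get i)
      · rw [if_pos h2, if_neg h1, if_pos h2, zero_add]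
      · rw [if_neg h2, if_neg h1, if_neg h1, if_neg h2, hu]
  have hloc : ∀ x, ∃ i, ∃ c, ∀ᶠ y in 𝓝 x, θ i y = c := by
    intro x
    obtain ⟨y, hy, hx⟩ : ∃ y ∈ t, x ∈ U y := by simpa using ht (Set.mem_univ x)
    obtain ⟨i, hi⟩ := List.get_of_mem (show y ∈ t' by simp [t', hy])
    refine ⟨i, 1, ?_⟩
    filter_upwards [(hUo y).mem_nhds hx] with w hw
    simp only [θ]
    rw [if_pos]
    rwa [hi]
  obtain ⟨y, hy, e⟩ := AS.d_sph_odd g hu _ θ hθ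
  rw [AS.d_sph_eq_zero _ θ hloc] at e
  exact ⟨u, hu, _, y, hy, eq_of_add_eq_zero_two e.symm⟩
end Involution

end AlexSpan

end

section

open Topology

namespace AlexSpan

section Involution
variable {C : Type} [GDga C]

/-- A ring endomorphism compatible with all the structure. -/
structure IsEndo (τ : C →+* C) : Prop where
  d : ∀ a, τ (Dga.d a) = Dga.d (τ a)
  pr : ∀ k a, τ (GDga.pr k a) = GDga.pr k (τ a)
  star : ∀ a b, τ (GDga.star a b) = GDga.star (τ a) (τ b)

/-- The algebraic counterpart of a free involution of a compact space. -/
structure IsFreeInv (τ : C →+* C) : Prop extends IsEndo τ where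
  inv : ∀ a, τ (τ a) = a
  free : ∃ (θ : C) (N : ℕ) (y : C), GDga.pr 0 θ = θ ∧ τ θ = θ + 1 ∧ τ y = y ∧
    Dga.d θ ^ (N + 1) = Dga.d y

/-- The only closed elements of degree zero are the constants. -/
def Conn (C : Type) [GDga C] : Prop := ∀ a : C, Dga.d a = 0 → GDga.pr 0 a = a → a = 0 ∨ a = 1

/-- Classes represented by invariant cocycles. -/
def lifts (τ : C →+* C) : Subring (H C) where
  carrier := {x | ∃ e : Cocycles C, τ e.1 = e.1 ∧ x = cl e}
  zero_mem' := ⟨0, map_zero _, (map_zero _).symm⟩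
  one_mem' := ⟨1, map_one _, (map_one _).symm⟩
  add_mem' := by
    rintro _ _ ⟨a, ha, rfl⟩ ⟨b, hb, rfl⟩
    exact ⟨a + b, by change τ (a.1 + b.1) = a.1 + b.1; rw [map_add, ha, hb], (map_add _ _ _).symm⟩
  neg_mem' := by
    rintro _ ⟨a, ha, rfl⟩
    exact ⟨-a, by change τ (-a.1) = -a.1; rw [map_neg, ha], (map_neg _ _).symm⟩
  mul_mem' := by
    rintro _ _ ⟨a, ha, rfl⟩ ⟨b, hb, rfl⟩
    exact ⟨a * b, by change τ (a.1 * b.1) = a.1 * b.1; rw [map_mul, ha, hb], (map_mul _ _ _).symm⟩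

lemma mem_lifts {τ : C →+* C} {x : H C} :
    x ∈ lifts τ ↔ ∃ e : Cocycles C, τ e.1 = e.1 ∧ x = cl e := Iff.rfl

variable [CharP C 2] {τ : C →+* C}

lemma one_not_exact (y : C) : (1 : C) ≠ Dga.d y := by
  intro h
  have h1 := congrArg (GDga.pr 0) h
  rw [GDga.pr_zero_d, GDga.pr_one] at h1
  have h2 : ((1 : ℕ) : C) = 0 := by simpa using h1
  have := (CharP.cast_eq_zero_iff C 2 1).1 h2
  omega

/-- Not every invariant class of a free involution comes from a trace and an invariant cocycle. -/
theorem IsFreeInv.exists_not_lift (h : IsFreeInv τ) (hC : Conn C) :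
    ∃ x : H C, H.map τ h.d x = x ∧ ∀ f, x + (f + H.map τ h.d f) ∉ lifts τ := by
  by_contra hcon
  push Not at hcon
  obtain ⟨θ, N, y, hθ0, hθ, hy, hw⟩ := h.free
  have hτw : τ (Dga.d θ) = Dga.d θ := by rw [h.d, hθ, map_add, d_one, add_zero]
  have key : ∀ N, ∀ y, τ y = y → Dga.d θ ^ (N + 1) = Dga.d y → False := by
    intro N
    induction N with
    | zero =>
      intro y hy hw
      rw [zero_add, pow_one] at hw
      have h1 : Dga.d (GDga.pr 0 (θ + y)) = 0 := by
        apply d_pr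
        rw [map_add, ← hw, add_self_two]
      have h2 : τ (GDga.pr 0 (θ + y)) = GDga.pr 0 (θ + y) + 1 := by
        rw [h.pr, map_add τ, hθ, hy, add_right_comm, map_add _ (θ + y), GDga.pr_one]
      rcases hC _ h1 (by simp [GDga.pr_pr]) with h3 | h3 <;> rw [h3] at h2
      · rw [map_zero, zero_add] at h2
        exact one_not_exact (0 : C) (by rw [map_zero]; exact h2.symm)
      · rw [map_one, add_self_two] at h2
        exact one_not_exact (0 : C) (by rw [map_zero]; exact h2)
    | succ N ih =>
      intro y hy hw
      set w := Dga.d θ with hwd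
      have hdw : Dga.d w = 0 := Dga.d_d _
      have ha : Dga.d (y + w ^ (N + 1) * θ) = 0 := by
        rw [map_add, ← hw, Dga.d_mul, d_cocycle_pow hdw, zero_mul, zero_add, ← hwd, ← pow_succ,
          add_self_two]
      have hτa : τ (y + w ^ (N + 1) * θ) = y + w ^ (N + 1) * θ + w ^ (N + 1) := by
        rw [map_add, hy, map_mul, map_pow, hτw, hθ, mul_add, mul_one, add_assoc]
      obtain ⟨f, hf⟩ := hcon (cl ⟨_, ha⟩) (by
        rw [H.map_cl, cl_eq]
        refine ⟨w ^ N * θ, ?_⟩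
        change τ (y + w ^ (N + 1) * θ) + (y + w ^ (N + 1) * θ) = _
        rw [hτa, add_right_comm, add_self_two, zero_add, Dga.d_mul, d_cocycle_pow hdw, zero_mul,
          zero_add, ← pow_succ])
      obtain ⟨f, rfl⟩ := cl_surj f
      obtain ⟨e, he, hfe⟩ := mem_lifts.1 hf
      rw [H.map_cl, ← map_add, ← map_add, cl_eq] at hfe
      obtain ⟨α, hα⟩ := hfe
      change y + w ^ (N + 1) * θ + (f.1 + τ f.1) + e.1 = Dga.d α at hα
      refine ih (α + τ α) (by rw [map_add, h.inv, add_comm]) ?_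
      have h3 := congrArg τ hα
      rw [map_add τ _ e.1, map_add τ _ (f.1 + τ f.1), map_add τ f.1, hτa, he, h.inv, h.d] at h3
      rw [map_add, ← h3, ← hα]
      generalize y + w ^ (N + 1) * θ = p
      generalize w ^ (N + 1) = q
      generalize τ f.1 = f'
      clear * -
      grind
  exact key N y hy hw

lemma IsFreeInv.norm_mem (h : IsFreeInv τ) {x : H C} (hx : IsDeg 1 x) :
    x * H.map τ h.d x ∈ lifts τ := by
  obtain ⟨θ, -, -, -, hθ, -, -⟩ := h.free
  obtain ⟨c, hc, rfl⟩ := isDeg_iff.1 hx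
  have hc' : GDga.pr 1 (τ c.1) = τ c.1 := by rw [← h.pr, hc]
  have hd : Dga.d c.1 = 0 := c.2
  have hd' : Dga.d (τ c.1) = 0 := by rw [← h.d, hd, map_zero]
  have hs := GDga.d_star _ _ hc hc' hd hd'
  set s := GDga.star c.1 (τ c.1)
  have hτs : τ s = s := by rw [h.star, h.inv, GDga.star_comm]
  refine mem_lifts.2 ⟨⟨c.1 * τ c.1 + Dga.d (θ * s), ?_⟩, ?_, ?_⟩
  · change Dga.d _ = 0
    rw [map_add, Dga.d_d, Dga.d_mul, hd, hd', mul_zero, zero_mul, add_zero, add_zero]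
  · change τ (c.1 * τ c.1 + Dga.d (θ * s)) = _
    rw [map_add, map_mul, h.inv, h.d, map_mul, hθ, hτs, add_mul, one_mul, map_add, hs]
    grind
  · rw [H.map_cl, ← map_mul, cl_eq]
    refine ⟨θ * s, ?_⟩
    change c.1 * τ c.1 + (c.1 * τ c.1 + Dga.d (θ * s)) = _
    grind

/-- The obstruction to lifting an invariant class of degree one takes the value `ε`. -/
def Obs (τ : C →+* C) (x : H C) (ε : ZMod 2) : Prop :=
  ∃ (c : Cocycles C) (u : C), GDga.pr 1 c.1 = c.1 ∧ x = cl c ∧ GDga.pr 0 u = u ∧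
    c.1 + τ c.1 = Dga.d u ∧ u + τ u = ZMod.castHom (dvd_refl 2) C ε

lemma IsFreeInv.mem_lifts_of_obs (h : IsFreeInv τ) {x : H C} (hx : Obs τ x 0) : x ∈ lifts τ := by
  obtain ⟨θ, -, -, -, hθ, -, -⟩ := h.free
  obtain ⟨c, u, -, rfl, -, hcu, hu⟩ := hx
  rw [map_zero] at hu
  have hu := eq_of_add_eq_zero_two hu
  refine mem_lifts.2 ⟨⟨c.1 + Dga.d (u * θ), ?_⟩, ?_, ?_⟩
  · change Dga.d _ = 0
    rw [map_add, Dga.d_d, show Dga.d c.1 = 0 from c.2, add_zero]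
  · change τ (c.1 + Dga.d (u * θ)) = _
    rw [map_add, h.d, map_mul, hθ, ← hu, mul_add, mul_one, map_add, ← hcu]
    grind
  · rw [cl_eq]
    refine ⟨u * θ, ?_⟩
    change c.1 + (c.1 + Dga.d (u * θ)) = _
    grind

lemma cast_zmod_inj {ε δ : ZMod 2}
    (h : ZMod.castHom (dvd_refl 2) C ε = ZMod.castHom (dvd_refl 2) C δ) : ε = δ :=
  ZMod.castHom_injective C h

lemma castHom_cases (ε : ZMod 2) : (ε = 0 ∧ ZMod.castHom (dvd_refl 2) C ε = 0) ∨
    (ε = 1 ∧ ZMod.castHom (dvd_refl 2) C ε = 1) := by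
  rcases (show ∀ c : ZMod 2, c = 0 ∨ c = 1 by decide) ε with rfl | rfl
  · exact Or.inl ⟨rfl, map_zero _⟩
  · exact Or.inr ⟨rfl, map_one _⟩

lemma Conn.exists_cast (hC : Conn C) {a : C} (ha : Dga.d a = 0) (h0 : GDga.pr 0 a = a) :
    ∃ ε, a = ZMod.castHom (dvd_refl 2) C ε := by
  rcases hC a ha h0 with rfl | rfl
  · exact ⟨0, (map_zero _).symm⟩
  · exact ⟨1, (map_one _).symm⟩

lemma map_cast (f : C →+* C) (ε : ZMod 2) :
    f (ZMod.castHom (dvd_refl 2) C ε) = ZMod.castHom (dvd_refl 2) C ε := by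
  rcases castHom_cases (C := C) ε with ⟨-, h⟩ | ⟨-, h⟩ <;> rw [h]
  · exact map_zero _
  · exact map_one _

lemma exists_primitive (hτ : IsEndo τ) {c : Cocycles C} (hc : GDga.pr 1 c.1 = c.1)
    (h : H.map τ hτ.d (cl c) = cl c) : ∃ u, GDga.pr 0 u = u ∧ c.1 + τ c.1 = Dga.d u := by
  rw [H.map_cl, cl_eq] at h
  obtain ⟨u, hu⟩ := h
  refine ⟨GDga.pr 0 u, by simp [GDga.pr_pr], ?_⟩
  rw [← GDga.pr_d, ← hu, map_add]
  change _ = GDga.pr 1 (τ c.1) + GDga.pr 1 c.1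
  rw [← hτ.pr, hc, add_comm]

lemma exists_obs (hC : Conn C) (hτ : IsEndo τ) (hinv : ∀ a, τ (τ a) = a) {x : H C}
    (hx : IsDeg 1 x) (h : H.map τ hτ.d x = x) : ∃ ε, Obs τ x ε := by
  obtain ⟨c, hc, rfl⟩ := isDeg_iff.1 hx
  obtain ⟨u, hu0, hu⟩ := exists_primitive hτ hc h
  obtain ⟨ε, hε⟩ := hC.exists_cast (a := u + τ u) (by
    rw [map_add, ← hτ.d, ← hu, map_add, hinv, add_comm (τ c.1), add_self_two])
    (by rw [map_add, ← hτ.pr, hu0])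
  exact ⟨ε, c, u, hc, rfl, hu0, hu, hε⟩

lemma Obs.unique (hC : Conn C) (hτ : IsEndo τ) (hinv : ∀ a, τ (τ a) = a) {x : H C} {ε δ : ZMod 2}
    (h : Obs τ x ε) (h' : Obs τ x δ) : ε = δ := by
  obtain ⟨c, u, hc, rfl, hu0, hu, hε⟩ := h
  obtain ⟨c', u', hc', e, hu0', hu', hδ⟩ := h'
  obtain ⟨y, hy⟩ := cl_eq.1 e
  have hy' : c.1 + c'.1 = Dga.d (GDga.pr 0 y) := by
    rw [← GDga.pr_d, ← hy, map_add]
    change _ = GDga.pr 1 c.1 + GDga.pr 1 c'.1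
    rw [hc, hc']
  have hτy : τ c.1 + τ c'.1 = Dga.d (τ (GDga.pr 0 y)) := by rw [← map_add, hy', hτ.d]
  obtain ⟨κ, hκ⟩ := hC.exists_cast (a := u + u' + (GDga.pr 0 y + τ (GDga.pr 0 y))) (by
    rw [map_add, map_add, map_add, ← hu, ← hu', ← hy', ← hτy]
    grind) (by rw [map_add, map_add, map_add, ← hτ.pr, hu0, hu0']; simp [GDga.pr_pr])
  apply cast_zmod_inj (C := C)
  have h3 := congrArg τ hκ
  rw [map_cast, map_add, map_add, map_add, hinv, ← hκ] at h3
  rw [← hε, ← hδ]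
  apply eq_of_add_eq_zero_two
  calc u + τ u + (u' + τ u') = (τ u + τ u' + (τ (GDga.pr 0 y) + GDga.pr 0 y)) +
      (u + u' + (GDga.pr 0 y + τ (GDga.pr 0 y))) := by grind
    _ = 0 := by rw [h3, add_self_two]

lemma Obs.add {x y : H C} {ε δ : ZMod 2} (h : Obs τ x ε) (h' : Obs τ y δ) :
    Obs τ (x + y) (ε + δ) := by
  obtain ⟨c, u, hc, rfl, hu0, hu, hε⟩ := h
  obtain ⟨c', u', hc', rfl, hu0', hu', hδ⟩ := h'
  refine ⟨c + c', u + u', ?_, (map_add _ _ _).symm, by rw [map_add, hu0, hu0'], ?_, ?_⟩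
  · change GDga.pr 1 (c.1 + c'.1) = c.1 + c'.1
    rw [map_add, hc, hc']
  · change c.1 + c'.1 + τ (c.1 + c'.1) = _
    rw [map_add, map_add, ← hu, ← hu']
    grind
  · rw [map_add, map_add, ← hε, ← hδ]
    grind
end Involution

end AlexSpan

end

namespace AlexSpan

section Count
variable {C : Type} [GDga C] [CharP C 2] {τ : C →+* C}

/-- The ring of invariants. -/
abbrev Inv (τ : C →+* C) : Subring C := τ.eqLocus (RingHom.id C)

/-- The invariants form a differential ring. -/
abbrev IsEndo.dgaInv (h : IsEndo τ) : Dga (Inv τ) where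
  d := AddMonoidHom.mk' (fun a => ⟨Dga.d a.1, by
    change τ (Dga.d a.1) = Dga.d a.1
    rw [h.d, show τ a.1 = a.1 from a.2]⟩) fun a b => Subtype.ext (map_add _ a.1 b.1)
  d_mul a b := Subtype.ext (Dga.d_mul a.1 b.1)
  d_d a := Subtype.ext (Dga.d_d a.1)

/-- If left multiplication by `w` has finite kernel and `w` is nilpotent then everything is
finite. -/
lemma finite_of_nilpotent {A : Type*} [Ring A] (w : A) (hf : {z : A | w * z = 0}.Finite) (N : ℕ)
    (hw : w ^ N = 0) : Finite A := by
  have key : ∀ k, {z : A | w ^ k * z = 0}.Finite := by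
    intro k
    induction k with
    | zero => simp
    | succ k ih =>
      refine Set.Finite.of_finite_fibers (fun z => w * z) (ih.subset ?_) fun a _ => ?_
      · rintro _ ⟨z, hz, rfl⟩
        change w ^ k * (w * z) = 0
        rw [← mul_assoc, ← pow_succ]
        exact hz
      · rcases Set.eq_empty_or_nonempty ({z : A | w ^ (k + 1) * z = 0} ∩ (fun z => w * z) ⁻¹' {a})
          with h | ⟨z₀, -, hz₀⟩
        · rw [h]; exact Set.finite_empty
        · refine (hf.image (fun z => z + z₀)).subset ?_
          rintro z ⟨-, hz⟩
          refine ⟨z - z₀, ?_, sub_add_cancel _ _⟩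
          change w * (z - z₀) = 0
          rw [mul_sub, show w * z = a from hz, show w * z₀ = a from hz₀, sub_self]
  have := key N
  rw [hw] at this
  simp only [zero_mul, Set.ofPred_true] at this
  exact Set.finite_univ_iff.1 this

/-- The exact couple of a double cover. -/
lemma card_eq_sq {A B : Type} [AddCommGroup A] [AddCommGroup B] [Finite A] [Finite B] (i : B →+ A)
    (p : A →+ B) (w : B →+ B) (h1 : i.ker = w.range) (h2 : p.ker = i.range) (h3 : w.ker = p.range) :
    Nat.card A = Nat.card w.ker ^ 2 := by
  have e1 := AddSubgroup.card_mul_index p.ker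
  rw [AddSubgroup.index_ker, h2, ← h3] at e1
  have e2 := AddSubgroup.card_mul_index i.ker
  rw [AddSubgroup.index_ker, h1] at e2
  have e3 := AddSubgroup.card_mul_index w.ker
  rw [AddSubgroup.index_ker] at e3
  have h0 : 0 < Nat.card w.range := Nat.card_pos
  have : Nat.card i.range = Nat.card w.ker := by
    apply Nat.eq_of_mul_eq_mul_left h0
    rw [e2, ← e3, mul_comm]
  rw [← e1, this, sq]

theorem IsFreeInv.card_eq_sq (h : IsFreeInv τ) [Finite (H C)] : ∃ k, Nat.card (H C) = k ^ 2 := by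
  let := h.dgaInv
  obtain ⟨θ, N, y, -, hθ, hy, hw⟩ := h.free
  have hτw : τ (Dga.d θ) = Dga.d θ := by rw [h.d, hθ, map_add, d_one, add_zero]
  let i : H (Inv τ) →+* H C := H.map (Inv τ).subtype fun _ => rfl
  let w : H (Inv τ) := cl ⟨⟨Dga.d θ, hτw⟩, Subtype.ext (Dga.d_d θ)⟩
  have hτtr : ∀ a : C, τ (a + τ a) = a + τ a := fun a => by rw [map_add, h.inv, add_comm]
  let pc : Cocycles C →+ Cocycles (Inv τ) := AddMonoidHom.mk' (fun a => ⟨⟨a.1 + τ a.1, hτtr a.1⟩,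
    Subtype.ext (by
      change Dga.d (a.1 + τ a.1) = 0
      rw [map_add, ← h.d, show Dga.d a.1 = 0 from a.2, map_zero, add_zero])⟩) fun a b =>
    Subtype.ext (Subtype.ext (by
      change a.1 + b.1 + τ (a.1 + b.1) = (a.1 + τ a.1) + (b.1 + τ b.1)
      rw [map_add]; abel))
  let p : H C →+ H (Inv τ) := QuotientAddGroup.map (Exacts C).toAddSubgroup
    (Exacts (Inv τ)).toAddSubgroup pc fun a ⟨y, hy⟩ => ⟨⟨y + τ y, hτtr y⟩, Subtype.ext (by
      change a.1 + τ a.1 = Dga.d (y + τ y)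
      rw [map_add, ← h.d, hy])⟩
  have hp : ∀ a, p (cl a) = cl (pc a) := fun a => rfl
  have eqI : ∀ a b : Cocycles (Inv τ), cl a = cl b ↔ ∃ e : C, τ e = e ∧ a.1.1 + b.1.1 = Dga.d e :=
    fun a b => cl_eq.trans ⟨fun ⟨e, he⟩ => ⟨e.1, e.2, congrArg Subtype.val he⟩,
      fun ⟨e, he, h'⟩ => ⟨⟨e, he⟩, Subtype.ext h'⟩⟩
  have zeroI : ∀ a : Cocycles (Inv τ), cl a = 0 ↔ ∃ e : C, τ e = e ∧ a.1.1 = Dga.d e :=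
    fun a => cl_eq_zero.trans ⟨fun ⟨e, he⟩ => ⟨e.1, e.2, congrArg Subtype.val he⟩,
      fun ⟨e, he, h'⟩ => ⟨⟨e, he⟩, Subtype.ext h'⟩⟩
  have ci : ∀ a : Cocycles (Inv τ), Dga.d a.1.1 = 0 := fun a => congrArg Subtype.val a.2
  have h1 : i.toAddMonoidHom.ker = (AddMonoidHom.mulLeft w).range := by
    ext x
    obtain ⟨a, rfl⟩ := cl_surj x
    have ha : τ a.1.1 = a.1.1 := a.1.2
    constructor
    · intro hx
      obtain ⟨y, hy⟩ := cl_eq_zero.1 (show cl ⟨a.1.1, _⟩ = 0 from hx)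
      change a.1.1 = Dga.d y at hy
      refine ⟨cl ⟨⟨y + τ y, hτtr y⟩, Subtype.ext ?_⟩, ?_⟩
      · change Dga.d (y + τ y) = 0
        rw [map_add, ← h.d, ← hy, ha, add_self_two]
      · change w * cl _ = _
        rw [← map_mul, eqI]
        refine ⟨y + θ * (y + τ y), ?_, ?_⟩
        · rw [map_add, map_mul, hτtr, hθ]; grind
        · change Dga.d θ * (y + τ y) + a.1.1 = _
          rw [map_add, Dga.d_mul, map_add Dga.d y (τ y), ← h.d, ← hy, ha, add_self_two, mul_zero,
            add_zero, add_comm]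
    · rintro ⟨z, hz⟩
      obtain ⟨z, rfl⟩ := cl_surj z
      change w * cl z = cl a at hz
      rw [← hz]
      change i (w * cl z) = 0
      rw [← map_mul]
      refine cl_eq_zero.2 ⟨θ * z.1.1, ?_⟩
      rw [Dga.d_mul, ci, mul_zero, add_zero]
      rfl
  have h2 : p.ker = i.toAddMonoidHom.range := by
    ext x
    obtain ⟨a, rfl⟩ := cl_surj x
    have ha : Dga.d a.1 = 0 := a.2
    constructor
    · intro hx
      rw [AddMonoidHom.mem_ker, hp, zeroI] at hx
      obtain ⟨e, he, hae⟩ := hx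
      change a.1 + τ a.1 = _ at hae
      refine ⟨cl ⟨⟨a.1 + Dga.d (e * θ), ?_⟩, Subtype.ext ?_⟩, ?_⟩
      · change τ (a.1 + Dga.d (e * θ)) = a.1 + Dga.d (e * θ)
        rw [map_add, h.d, map_mul, he, hθ, mul_add, mul_one, map_add, ← hae]
        grind
      · change Dga.d (a.1 + Dga.d (e * θ)) = 0
        rw [map_add, Dga.d_d, ha, add_zero]
      · refine cl_eq.2 ⟨e * θ, ?_⟩
        change a.1 + Dga.d (e * θ) + a.1 = _
        grind
    · rintro ⟨z, hz⟩
      obtain ⟨z, rfl⟩ := cl_surj z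
      rw [← hz, AddMonoidHom.mem_ker]
      change cl (pc ⟨z.1.1, _⟩) = 0
      rw [zeroI]
      refine ⟨0, map_zero _, ?_⟩
      change z.1.1 + τ z.1.1 = _
      rw [show τ z.1.1 = z.1.1 from z.1.2, add_self_two, map_zero]
  have h3 : (AddMonoidHom.mulLeft w).ker = p.range := by
    ext x
    obtain ⟨z, rfl⟩ := cl_surj x
    have hz : τ z.1.1 = z.1.1 := z.1.2
    constructor
    · intro hx
      rw [AddMonoidHom.mem_ker] at hx
      change w * cl z = 0 at hx
      rw [← map_mul, zeroI] at hx
      obtain ⟨e, he, hze⟩ := hx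
      change Dga.d θ * z.1.1 = _ at hze
      refine ⟨cl ⟨θ * z.1.1 + e, ?_⟩, ?_⟩
      · change Dga.d (θ * z.1.1 + e) = 0
        rw [map_add, Dga.d_mul, ci, ← hze, mul_zero, add_zero, add_self_two]
      · rw [hp]
        congr 1
        refine Subtype.ext (Subtype.ext ?_)
        change θ * z.1.1 + e + τ (θ * z.1.1 + e) = z.1.1
        rw [map_add, map_mul, hθ, he, hz]
        grind
    · rintro ⟨a, ha⟩
      obtain ⟨a, rfl⟩ := cl_surj a
      rw [← ha, hp, AddMonoidHom.mem_ker]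
      change w * _ = 0
      rw [← map_mul, zeroI]
      refine ⟨θ * (a.1 + τ a.1) + a.1, ?_, ?_⟩
      · rw [map_add, map_mul, hτtr, hθ]; grind
      · rw [map_add, Dga.d_mul, map_add Dga.d a.1, ← h.d, show Dga.d a.1 = 0 from a.2, map_zero,
          add_zero, add_zero, mul_zero, add_zero]
        rfl
  have hwN : w ^ (N + 1) = 0 := by
    change cl _ ^ (N + 1) = 0
    rw [← map_pow, zeroI]
    exact ⟨y, hy, hw⟩
  have hfin : {z : H (Inv τ) | w * z = 0}.Finite := by
    have : {z : H (Inv τ) | w * z = 0} = (p.range : Set (H (Inv τ))) := by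
      rw [← h3]; rfl
    rw [this]
    exact Set.finite_range p
  have := finite_of_nilpotent w hfin _ hwN
  exact ⟨_, AlexSpan.card_eq_sq _ _ _ h1 h2 h3⟩
end Count
end AlexSpan

namespace AlexSpan

section Combinatorics

@[to_additive]
lemma exists_prod_involution {ι M : Type*} [Fintype ι] [DecidableEq ι] [CommMonoid M] (s : ι → ι)
    (hs : ∀ i, s (s i) = i) (f : ι → M) :
    ∃ T : Finset ι, ∏ i, f i = (∏ i ∈ T, f i * f (s i)) * ∏ i with s i = i, f i := by
  let o := Fintype.equivFin ι
  refine ⟨Finset.univ.filter fun i => o i < o (s i), ?_⟩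
  rw [Finset.prod_mul_distrib]
  have h1 : ∏ i with o i < o (s i), f (s i) = ∏ i with o (s i) < o i, f i := by
    refine Finset.prod_nbij' s s ?_ ?_ ?_ ?_ ?_ <;> simp [hs]
  have h2 : (Finset.univ.filter fun i => s i = i) =
      Finset.univ.filter fun i => ¬ (o i < o (s i)) ∧ ¬ (o (s i) < o i) := by
    refine Finset.filter_congr fun i _ => ?_
    rw [← o.injective.eq_iff (a := s i)]
    omega
  have h3 : (Finset.univ.filter fun i => o (s i) < o i) =
      Finset.univ.filter fun i => ¬ (o i < o (s i)) ∧ o (s i) < o i := by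
    refine Finset.filter_congr fun i _ => ?_
    omega
  rw [h1, h2, h3, mul_assoc, ← Finset.filter_filter, ← Finset.filter_filter,
    Finset.prod_filter_mul_prod_filter_not, Finset.prod_filter_mul_prod_filter_not]
end Combinatorics

section CommAlg
variable {A : Type} {m n : ℕ}

lemma mon_eq_prod [CommRing A] (v : Fin m → A) (M : Fin m → Fin (n + 1)) :
    mon n v M = ∏ j, v j ^ (M j : ℕ) := List.prod_ofFn

lemma exists_sum_mon [Ring A] [Algebra (ZMod 2) A] {v : Fin m → A} (hv : IsTrunc n v) (x : A) :
    ∃ c : (Fin m → Fin (n + 1)) → ZMod 2, x = ∑ M, c M • mon n v M := by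
  obtain ⟨c, hc⟩ := (Submodule.mem_span_range_iff_exists_fun (ZMod 2)).1
    (hv.span (Submodule.mem_top (x := x)))
  exact ⟨c, hc.symm⟩

/-- An involution permuting the variables: every invariant element is the sum of a trace and an
element of any subring containing the norms and the fixed variables. -/
theorem exists_add_trace_mem [CommRing A] [Algebra (ZMod 2) A] {v : Fin m → A} (hv : IsTrunc n v)
    (σ : Fin m → Fin m) (hσ : ∀ j, σ (σ j) = j) (τ : A →+* A) (hτ : ∀ j, τ (v j) = v (σ j))
    (L : Subring A) (hL : ∀ j, v j * v (σ j) ∈ L) (hfix : ∀ j, σ j = j → v j ∈ L) {x : A}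
    (hx : τ x = x) : ∃ f, x + (f + τ f) ∈ L := by
  classical
  have hsmul : ∀ (c : ZMod 2) a, τ (c • a) = c • τ a :=
    fun c a => map_smul (τ.toAddMonoidHom.toZModLinearMap 2) c a
  have htwo : ∀ a : A, a + a = 0 := fun a => by
    rw [← two_smul (ZMod 2) a, show (2 : ZMod 2) = 0 from rfl, zero_smul]
  have hmon : ∀ M : Fin m → Fin (n + 1), τ (mon n v M) = mon n v (M ∘ σ) := fun M => by
    rw [map_mon, mon_eq_prod, mon_eq_prod, ← Equiv.prod_comp (Function.Involutive.toPerm σ hσ)]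
    refine Finset.prod_congr rfl fun j _ => ?_
    change τ (v (σ j)) ^ _ = _
    rw [hτ, hσ]
    rfl
  have hinv : ∀ M : Fin m → Fin (n + 1), (M ∘ σ) ∘ σ = M := fun M =>
    funext fun j => congrArg M (hσ j)
  have hmem : ∀ M : Fin m → Fin (n + 1), M ∘ σ = M → mon n v M ∈ L := fun M hM => by
    obtain ⟨T, hT⟩ := exists_prod_involution σ hσ fun j => v j ^ (M j : ℕ)
    rw [mon_eq_prod, hT]
    refine L.mul_mem (L.prod_mem fun j _ => ?_) (L.prod_mem fun j hj => ?_)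
    · rw [show M (σ j) = M j from congrFun hM j, ← mul_pow]
      exact L.pow_mem (hL j) _
    · exact L.pow_mem (hfix j (Finset.mem_filter.1 hj).2) _
  obtain ⟨c, hc⟩ := exists_sum_mon hv x
  have hcσ : ∀ M, c (M ∘ σ) = c M := by
    have h1 : ∑ M, (c (M ∘ σ) - c M) • mon n v M = 0 := by
      simp only [sub_smul]
      rw [Finset.sum_sub_distrib, ← hc, sub_eq_zero, ← hx, hc, map_sum,
        ← Equiv.sum_comp (Function.Involutive.toPerm (fun M : Fin m → Fin (n + 1) => M ∘ σ) hinv)]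
      refine Finset.sum_congr rfl fun M _ => ?_
      change c ((M ∘ σ) ∘ σ) • mon n v (M ∘ σ) = _
      rw [hinv, hsmul, hmon]
    exact fun M => sub_eq_zero.1 (Fintype.linearIndependent_iff.1 hv.indep _ h1 M)
  obtain ⟨T, hT⟩ := exists_sum_involution (fun M : Fin m → Fin (n + 1) => M ∘ σ) hinv
    fun M => c M • mon n v M
  refine ⟨∑ M ∈ T, c M • mon n v M, ?_⟩
  have h2 : x + (∑ M ∈ T, c M • mon n v M + τ (∑ M ∈ T, c M • mon n v M)) =
      ∑ M with M ∘ σ = M, c M • mon n v M := by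
    rw [map_sum, ← Finset.sum_add_distrib]
    have : ∀ M ∈ T, c M • mon n v M + τ (c M • mon n v M) =
        c M • mon n v M + c (M ∘ σ) • mon n v (M ∘ σ) := fun M _ => by
      rw [hsmul, hmon, hcσ]
    rw [Finset.sum_congr rfl this, hc, hT, add_right_comm, htwo, zero_add]
  rw [h2]
  refine L.sum_mem fun M hM => ?_
  rcases (show ∀ c : ZMod 2, c = 0 ∨ c = 1 by decide) (c M) with h | h <;> rw [h]
  · rw [zero_smul]; exact L.zero_mem
  · rw [one_smul]; exact hmem M (Finset.mem_filter.1 hM).2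

/-- The commutative ring structure. -/
abbrev IsTrunc.commRing [Ring A] [Algebra (ZMod 2) A] {v : Fin m → A} (hv : IsTrunc n v) :
    CommRing A := { (inferInstance : Ring A) with mul_comm := hv.comm }

lemma add_pow_mul_pow [CommRing A] (p q : A) (b : ℕ) (hp : p ^ (b + 2) = 0) (hq : q ^ (b + 2) = 0) :
    (p + q) ^ (b + 2) * q ^ b = (b + 2 : ℕ) * (p ^ (b + 1) * q ^ (b + 1)) := by
  rw [add_pow, Finset.sum_mul, Finset.sum_eq_single (b + 1)]
  · rw [show b + 2 = (b + 1) + 1 from rfl, Nat.choose_succ_self_right, Nat.add_sub_cancel_left]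
    ring
  · intro i hi hib
    rw [Finset.mem_range] at hi
    rcases Nat.lt_or_ge i (b + 1) with h | h
    · have : q ^ (b + 2 - i) * q ^ b = 0 := by
        rw [← pow_add, show b + 2 - i + b = (b + 2) + (b - i) by omega, pow_add, hq, zero_mul]
      rw [mul_right_comm, mul_assoc _ _ (q ^ b), this, mul_zero, zero_mul]
    · rw [show i = b + 2 by omega, hp]
      ring
  · intro h
    simp at h
lemma add_pow_mul_of_mul_eq_zero [CommRing A] (p e P : A) (h : e * P = 0) (b : ℕ) :
    (p + e) ^ b * P = p ^ b * P := by
  induction b with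
  | zero => simp
  | succ b ih =>
    rw [pow_succ', mul_assoc, ih, add_mul, mul_left_comm e, h, mul_zero, add_zero, ← mul_assoc,
      ← pow_succ']

/-- The elements of degree one whose `n + 1`-st power vanishes. -/
theorem IsTrunc.eq_of_pow_eq_zero [CommRing A] [Algebra (ZMod 2) A] [CharP A 2] {v : Fin m → A}
    (hv : IsTrunc n v) {a b : ℕ} (hn : n + 1 = 2 ^ a * (b + 2)) (hb : Odd (b + 2))
    (c : Fin m → ZMod 2) (hx : (∑ j, c j • v j) ^ (n + 1) = 0) :
    ∑ j, c j • v j = 0 ∨ ∃ j, ∑ j, c j • v j = v j := by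
  classical
  set S := Finset.univ.filter fun j => c j = 1
  have hS : ∑ j, c j • v j = ∑ j ∈ S, v j := by
    rw [Finset.sum_filter]
    refine Finset.sum_congr rfl fun j _ => ?_
    rcases (show ∀ c : ZMod 2, c = 0 ∨ c = 1 by decide) (c j) with h | h <;> simp [h]
  rw [hS] at hx ⊢
  rcases Nat.lt_or_ge 1 S.card with h | h
  · exfalso
    obtain ⟨j, hj, k, hk, hjk⟩ := Finset.one_lt_card.1 h
    set w : Fin m → A := fun j => v j ^ 2 ^ a
    have hw : ∀ j, w j ^ (b + 2) = 0 := fun j => by rw [← pow_mul, ← hn, hv.pow]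
    rw [hn, pow_mul, sum_pow_char_pow] at hx
    set R := (Finset.univ.erase j).erase k
    set P := ∏ l ∈ R, w l ^ (b + 1)
    set S' := (S.erase j).erase k
    have hkS : k ∈ S.erase j := Finset.mem_erase.2 ⟨hjk.symm, hk⟩
    have hsum : ∑ l ∈ S, w l = (w j + w k) + ∑ l ∈ S', w l := by
      rw [add_assoc, Finset.add_sum_erase _ w hkS, Finset.add_sum_erase _ w hj]
    have hprod : w j ^ (b + 1) * w k ^ (b + 1) * P = ∏ l, w l ^ (b + 1) := by
      rw [mul_assoc, Finset.mul_prod_erase _ (fun l => w l ^ (b + 1))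
        (Finset.mem_erase.2 ⟨hjk.symm, Finset.mem_univ k⟩),
        Finset.mul_prod_erase _ (fun l => w l ^ (b + 1)) (Finset.mem_univ j)]
    have he : (∑ l ∈ S', w l) * P = 0 := by
      rw [Finset.sum_mul]
      refine Finset.sum_eq_zero fun l hl => ?_
      have hlR : l ∈ R := by
        simp only [S', R, Finset.mem_erase, Finset.mem_univ, and_true] at hl ⊢
        exact ⟨hl.1, hl.2.1⟩
      rw [show P = _ from (Finset.mul_prod_erase R _ hlR).symm, ← mul_assoc, ← pow_succ', hw, zero_mul]
    have h1 : (∑ l ∈ S, w l) ^ (b + 2) * P * w k ^ b = 0 := by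
      rw [hx, zero_mul, zero_mul]
    rw [hsum, add_pow_mul_of_mul_eq_zero _ _ _ he, mul_right_comm,
      add_pow_mul_pow _ _ _ (hw j) (hw k), mul_assoc, hprod,
      natCast_eq_one_of_odd_of_two_eq_zero hb CharTwo.two_eq_zero, one_mul] at h1
    have hlt : 2 ^ a * (b + 1) < n + 1 := by
      rw [hn]
      exact Nat.mul_lt_mul_of_pos_left (by omega) (by positivity)
    refine hv.indep.ne_zero (fun _ => ⟨2 ^ a * (b + 1), hlt⟩) ?_
    rw [mon_eq_prod, ← h1]
    exact Finset.prod_congr rfl fun l _ => pow_mul _ _ _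
  · rcases Finset.eq_empty_or_nonempty S with hS | ⟨j, hj⟩
    · exact Or.inl (by rw [hS, Finset.sum_empty])
    · rw [ge_iff_le, Finset.card_le_one] at h
      rw [Finset.eq_singleton_iff_unique_mem.2 ⟨hj, fun k hk => h k hk j hj⟩]
      exact Or.inr ⟨j, Finset.sum_singleton _ _⟩

/-- A generating family of elements with vanishing powers is a truncated generating family. -/
lemma IsTrunc.of_adjoin [CommRing A] [Algebra (ZMod 2) A] {v : Fin m → A} (hv : IsTrunc n v)
    {u : Fin m → A} (hu : ∀ j, u j ^ (n + 1) = 0)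
    (hs : ∀ j, v j ∈ Submodule.span (ZMod 2) (Set.range u)) : IsTrunc n u := by
  have hspan : ⊤ ≤ Submodule.span (ZMod 2) (Set.range (mon n u)) := by
    have h1 : (⊤ : Submodule (ZMod 2) A) ≤ Subalgebra.toSubmodule
        (Algebra.adjoin (ZMod 2) (Set.range u)) := by
      refine hv.span.trans (Submodule.span_le.2 ?_)
      rintro _ ⟨M, rfl⟩
      rw [mon_eq_prod]
      refine Subalgebra.prod_mem _ fun j _ => Subalgebra.pow_mem _ ?_ _
      exact (Submodule.span_le.2 (Algebra.subset_adjoin (R := ZMod 2)) :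
        _ ≤ Subalgebra.toSubmodule (Algebra.adjoin (ZMod 2) (Set.range u))) (hs j)
    refine h1.trans ?_
    rw [Algebra.adjoin_eq_span, Submodule.span_le]
    intro z hz
    obtain ⟨k, rfl⟩ := (Submonoid.mem_closure_range_iff_of_fintype).1 hz
    by_cases hk : ∀ j, k j < n + 1
    · refine Submodule.subset_span ⟨fun j => ⟨k j, hk j⟩, ?_⟩
      rw [mon_eq_prod]
    · push Not at hk
      obtain ⟨j, hj⟩ := hk
      rw [Finset.prod_eq_zero (Finset.mem_univ j)]
      · exact Submodule.zero_mem _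
      · exact pow_eq_zero_of_le hj (hu j)
  refine ⟨hv.comm, hu, ?_, hspan⟩
  refine linearIndependent_of_top_le_span_of_card_eq_finrank hspan ?_
  exact (Module.finrank_eq_card_basis (Module.Basis.mk hv.indep hv.span)).symm
end CommAlg
end AlexSpan

namespace AlexSpan

/-- An involution of a vector space over the field with two elements permutes some basis. -/
theorem exists_permuted_basis {V : Type*} [AddCommGroup V] [Module (ZMod 2) V]
    [Module.Finite (ZMod 2) V] {m : ℕ} (hm : Module.finrank (ZMod 2) V = m)
    (g : V →ₗ[ZMod 2] V) (hg : ∀ x, g (g x) = x) :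
    ∃ (b : Fin m → V) (σ : Fin m → Fin m), ⊤ ≤ Submodule.span (ZMod 2) (Set.range b) ∧
      (∀ j, σ (σ j) = j) ∧ ∀ j, g (b j) = b (σ j) := by
  have htwo : ∀ a : V, a + a = 0 := fun a => by
    rw [← two_smul (ZMod 2) a, show (2 : ZMod 2) = 0 from rfl, zero_smul]
  set N : V →ₗ[ZMod 2] V := LinearMap.id + g
  have hN : ∀ x, N x = x + g x := fun x => rfl
  have hNg : ∀ x, N (g x) = N x := fun x => by rw [hN, hN, hg, add_comm]
  have hNN : ∀ x, N (N x) = 0 := fun x => by rw [hN x, map_add, hNg, htwo]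
  set I := LinearMap.range N
  set K := LinearMap.ker N
  have hIK : I ≤ K := by rintro _ ⟨x, rfl⟩; exact hNN x
  obtain ⟨T', hT'⟩ := Submodule.exists_isCompl (I.submoduleOf K)
  set T := T'.map K.subtype
  have hsup : K ≤ I ⊔ T := by
    intro x hx
    have : (⟨x, hx⟩ : K) ∈ I.submoduleOf K ⊔ T' := by rw [hT'.sup_eq_top]; trivial
    obtain ⟨y, hy, z, hz, hyz⟩ := Submodule.mem_sup.1 this
    exact Submodule.mem_sup.2 ⟨y, hy, z, ⟨z, hz, rfl⟩, congrArg Subtype.val hyz⟩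
  have hcard : Module.finrank (ZMod 2) I + Module.finrank (ZMod 2) T =
      Module.finrank (ZMod 2) K := by
    rw [← Submodule.finrank_add_eq_of_isCompl hT']
    congr 1
    · exact (Submodule.submoduleOfEquivOfLe hIK).finrank_eq.symm
    · exact (Submodule.equivMapOfInjective _ K.injective_subtype T').finrank_eq.symm
  set bI := Module.finBasis (ZMod 2) I
  set bT := Module.finBasis (ZMod 2) T
  have hf : ∀ i, ∃ f, N f = (bI i : V) := fun i => (bI i).2
  choose f hf using hf
  let b : (Fin (Module.finrank (ZMod 2) I) ⊕ Fin (Module.finrank (ZMod 2) I)) ⊕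
      Fin (Module.finrank (ZMod 2) T) → V :=
    Sum.elim (Sum.elim f fun i => g (f i)) fun k => bT k
  let s : (Fin (Module.finrank (ZMod 2) I) ⊕ Fin (Module.finrank (ZMod 2) I)) ⊕
      Fin (Module.finrank (ZMod 2) T) → _ := Sum.map Sum.swap id
  have hb : ⊤ ≤ Submodule.span (ZMod 2) (Set.range b) := by
    set S := Submodule.span (ZMod 2) (Set.range b)
    have hbS : ∀ i, b i ∈ S := fun i => Submodule.subset_span ⟨i, rfl⟩
    have hIS : I ≤ S := by
      have : I = Submodule.span (ZMod 2) (Set.range fun i => (bI i : V)) := by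
        rw [show (fun i => (bI i : V)) = I.subtype ∘ bI from rfl, Set.range_comp,
          Submodule.span_image, bI.span_eq, Submodule.map_top, Submodule.range_subtype]
      rw [this, Submodule.span_le]
      rintro _ ⟨i, rfl⟩
      change (bI i : V) ∈ S
      rw [← hf, hN]
      exact S.add_mem (hbS (Sum.inl (Sum.inl i))) (hbS (Sum.inl (Sum.inr i)))
    have hTS : T ≤ S := by
      have : T = Submodule.span (ZMod 2) (Set.range fun i => (bT i : V)) := by
        rw [show (fun i => (bT i : V)) = T.subtype ∘ bT from rfl, Set.range_comp,
          Submodule.span_image, bT.span_eq, Submodule.map_top, Submodule.range_subtype]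
      rw [this, Submodule.span_le]
      rintro _ ⟨i, rfl⟩
      exact hbS (Sum.inr i)
    have hKS : K ≤ S := hsup.trans (sup_le hIS hTS)
    intro x _
    obtain ⟨c, hc⟩ : ∃ c : Fin (Module.finrank (ZMod 2) I) → ZMod 2,
        N x = ∑ i, c i • (bI i : V) := ⟨fun i => bI.repr ⟨N x, x, rfl⟩ i,
      (congrArg I.subtype (bI.sum_repr ⟨N x, x, rfl⟩)).symm.trans (by rw [map_sum]; rfl)⟩
    have hx : N x = N (∑ i, c i • f i) := by
      rw [hc, map_sum]
      simp [hf]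
    rw [← sub_add_cancel x (∑ i, c i • f i)]
    refine S.add_mem (hKS ?_) (S.sum_mem fun i _ => S.smul_mem _ (hbS (Sum.inl (Sum.inl i))))
    rw [LinearMap.mem_ker, map_sub, ← hx, sub_self]
  have hgb : ∀ i, g (b i) = b (s i) := by
    rintro ((i | i) | k)
    · rfl
    · exact hg _
    · obtain ⟨t, -, ht⟩ := (bT k).2
      have h1 : N (bT k : V) = 0 := by rw [← ht]; exact t.2
      change g (bT k : V) = (bT k : V)
      rw [hN] at h1
      rw [← add_zero (g _), ← htwo (bT k : V), ← add_assoc, add_comm (g _), h1, zero_add]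
  have hcard2 : Fintype.card ((Fin (Module.finrank (ZMod 2) I) ⊕ Fin (Module.finrank (ZMod 2) I)) ⊕
      Fin (Module.finrank (ZMod 2) T)) = m := by
    simp only [Fintype.card_sum, Fintype.card_fin]
    have : Module.finrank (ZMod 2) I + Module.finrank (ZMod 2) K = Module.finrank (ZMod 2) V :=
      LinearMap.finrank_range_add_finrank_ker N
    omega
  let e := Fintype.equivFinOfCardEq hcard2
  have hss : ∀ i, s (s i) = i := by rintro ((i | i) | k) <;> rfl
  refine ⟨b ∘ e.symm, fun j => e (s (e.symm j)), ?_, fun j => by simp [hss], fun j => ?_⟩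
  · rwa [Set.range_comp, e.symm.range_eq_univ, Set.image_univ]
  · simp [hgb]

section Classes
variable {C : Type} [GDga C] [CharP C 2] {τ : C →+* C} {m n : ℕ} {v : Fin m → H C}

lemma isDeg_mon {m : ℕ} {v : Fin m → H C} (hd : ∀ j, IsDeg 1 (v j)) (M : Fin m → Fin (n + 1)) :
    IsDeg (∑ j, (M j : ℕ)) (mon n v M) := by
  induction m with
  | zero => simpa [mon] using isDeg_one
  | succ m ih =>
    rw [mon_succ, Fin.sum_univ_succ]
    have := (hd 0).pow (M 0)
    rw [mul_one] at this
    exact this.mul (ih (fun j => hd j.succ) fun j => M j.succ)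

lemma IsTrunc.mem_span_of_isDeg (hv : IsTrunc n v) (hd : ∀ j, IsDeg 1 (v j)) {k : ℕ} {x : H C}
    (hx : IsDeg k x) : x ∈ Submodule.span (ZMod 2) (mon n v '' {M | ∑ j, (M j : ℕ) = k}) := by
  obtain ⟨c, hc⟩ := exists_sum_mon hv x
  have hs : ∀ (c : ZMod 2) (a : H C), prH k (c • a) = c • prH k a :=
    fun c a => map_smul ((prH k).toZModLinearMap 2) c a
  rw [← show prH k x = x from hx, hc, map_sum]
  refine Submodule.sum_mem _ fun M _ => ?_
  rw [hs]
  refine Submodule.smul_mem _ _ ?_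
  by_cases h : k = ∑ j, (M j : ℕ)
  · rw [h, show prH _ (mon n v M) = _ from isDeg_mon hd M, ← h]
    exact Submodule.subset_span ⟨M, h.symm, rfl⟩
  · rw [(isDeg_mon hd M).prH_ne h]
    exact Submodule.zero_mem _

lemma IsTrunc.conn (hv : IsTrunc n v) (hd : ∀ j, IsDeg 1 (v j)) : Conn C := by
  intro a ha h0
  have h1 := hv.mem_span_of_isDeg hd (isDeg_iff.2 ⟨⟨a, ha⟩, h0, rfl⟩)
  have h2 : mon n v '' {M | ∑ j, (M j : ℕ) = 0} ⊆ {1} := by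
    rintro _ ⟨M, hM, rfl⟩
    have hM : ∀ j, (M j : ℕ) = 0 := by simpa using hM
    simp [mon, hM]
  obtain ⟨c, hc⟩ := Submodule.mem_span_singleton.1 (Submodule.span_mono h2 h1)
  rcases (show ∀ c : ZMod 2, c = 0 ∨ c = 1 by decide) c with rfl | rfl
  · rw [zero_smul] at hc
    obtain ⟨y, hy⟩ := cl_eq_zero.1 hc.symm
    left
    rw [← h0, show a = Dga.d y from hy, GDga.pr_zero_d]
  · rw [one_smul, ← map_one cl, cl_eq] at hc
    obtain ⟨y, hy⟩ := hc
    right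
    have := congrArg (GDga.pr 0) hy
    rw [GDga.pr_zero_d, show (1 : Cocycles C).1 + a = 1 + a from rfl, map_add, GDga.pr_one, h0]
      at this
    exact (eq_of_add_eq_zero_two this).symm

lemma IsTrunc.mem_span_one (hv : IsTrunc n v) (hd : ∀ j, IsDeg 1 (v j)) {x : H C}
    (hx : IsDeg 1 x) : x ∈ Submodule.span (ZMod 2) (Set.range v) := by
  let := hv.commRing
  refine Submodule.span_mono ?_ (hv.mem_span_of_isDeg hd hx)
  rintro _ ⟨M, hM, rfl⟩
  have hM : ∑ j, (M j : ℕ) = 1 := hM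
  have : ∃ j, (M j : ℕ) ≠ 0 := by
    by_contra h
    push Not at h
    simp [h] at hM
  obtain ⟨j, hj⟩ := this
  have h1 := Finset.add_sum_erase Finset.univ (fun j => (M j : ℕ)) (Finset.mem_univ j)
  have h2 : ∑ i ∈ Finset.univ.erase j, (M i : ℕ) = 0 := by omega
  have h3 : (M j : ℕ) = 1 := by omega
  refine ⟨j, ?_⟩
  rw [mon_eq_prod, Finset.prod_eq_single j, h3, pow_one]
  · intro i _ hi
    rw [Finset.sum_eq_zero_iff.1 h2 i (Finset.mem_erase.2 ⟨hi, Finset.mem_univ i⟩), pow_zero]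
  · simp

lemma isDeg_of_mem_span (hd : ∀ j, IsDeg 1 (v j)) {x : H C}
    (hx : x ∈ Submodule.span (ZMod 2) (Set.range v)) : IsDeg 1 x := by
  induction hx using Submodule.span_induction with
  | mem x hx => obtain ⟨j, rfl⟩ := hx; exact hd j
  | zero => exact isDeg_zero 1
  | add x y _ _ hx hy => exact hx.add hy
  | smul c x _ hx =>
    rcases (show ∀ c : ZMod 2, c = 0 ∨ c = 1 by decide) c with rfl | rfl
    · rw [zero_smul]; exact isDeg_zero 1
    · rwa [one_smul]

/-- The variables form a linearly independent family. -/
lemma IsTrunc.linearIndependent (hv : IsTrunc n v) (hn : 1 ≤ n) :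
    LinearIndependent (ZMod 2) v := by
  let := hv.commRing
  have h := hv.indep.comp (fun j k => if k = j then ⟨1, by omega⟩ else 0) fun i j hij => by
    by_contra hne
    have := congrFun hij i
    simp [hne, Fin.ext_iff] at this
  convert h using 1
  funext j
  rw [Function.comp, mon_eq_prod, Finset.prod_eq_single j]
  · simp
  · intro i _ hi
    simp [hi]
  · simp

lemma IsEndo.isDeg (h : IsEndo τ) {k : ℕ} {x : H C} (hx : IsDeg k x) :
    IsDeg k (H.map τ h.d x) := hx.map τ h.d h.pr

lemma IsFreeInv.map_map (h : IsFreeInv τ) (x : H C) : H.map τ h.d (H.map τ h.d x) = x := by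
  obtain ⟨a, rfl⟩ := cl_surj x
  rw [H.map_cl, H.map_cl]
  congr 1
  exact Subtype.ext (h.inv _)

/-- A free involution permuting the variables has a fixed variable which does not lift. -/
theorem IsFreeInv.exists_obs_one_of_perm (h : IsFreeInv τ) (hv : IsTrunc n v)
    (hd : ∀ j, IsDeg 1 (v j)) (hC : Conn C) (σ : Fin m → Fin m) (hσ : ∀ j, σ (σ j) = j)
    (hτ : ∀ j, H.map τ h.d (v j) = v (σ j)) : ∃ j, σ j = j ∧ Obs τ (v j) 1 := by
  by_contra hcon
  push Not at hcon
  let := hv.commRing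
  obtain ⟨x, hx, hxL⟩ := h.exists_not_lift hC
  obtain ⟨f, hf⟩ := exists_add_trace_mem hv σ hσ (H.map τ h.d) hτ (lifts τ)
    (fun j => by rw [← hτ]; exact h.norm_mem (hd j)) (fun j hj => by
      obtain ⟨ε, hε⟩ := exists_obs hC h.toIsEndo h.inv (hd j) (by rw [hτ, hj])
      rcases (show ∀ c : ZMod 2, c = 0 ∨ c = 1 by decide) ε with rfl | rfl
      · exact h.mem_lifts_of_obs hε
      · exact absurd hε (hcon j hj)) hx
  exact hxL f hf

/-- If `n + 1` is not a power of two, automorphisms permute the variables. -/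
lemma IsTrunc.exists_perm (hv : IsTrunc n v) (hd : ∀ j, IsDeg 1 (v j)) {a b : ℕ}
    (hn : n + 1 = 2 ^ a * (b + 2)) (hb : Odd (b + 2)) (h : IsEndo τ)
    (hinv : ∀ a, τ (τ a) = a) (j : Fin m) : ∃ k, H.map τ h.d (v j) = v k := by
  let := hv.commRing
  obtain ⟨c, hc⟩ := (Submodule.mem_span_range_iff_exists_fun (ZMod 2)).1
    (hv.mem_span_one hd (h.isDeg (hd j)))
  rw [← hc]
  rcases hv.eq_of_pow_eq_zero hn hb c (by rw [hc, ← map_pow, hv.pow, map_zero]) with h0 | h0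
  · exfalso
    have h1 : 1 ≤ n := by
      have : 1 ≤ 2 ^ a := Nat.one_le_two_pow
      nlinarith
    refine (hv.linearIndependent h1).ne_zero j ?_
    rw [hc] at h0
    have h2 : H.map τ h.d (H.map τ h.d (v j)) = v j := by
      obtain ⟨a, ha⟩ := cl_surj (v j)
      rw [← ha, H.map_cl, H.map_cl]
      congr 1
      exact Subtype.ext (hinv _)
    rw [← h2, h0, map_zero]
  · exact h0

lemma exists_two_pow_mul_odd (n : ℕ) : ∃ a b, n + 1 = 2 ^ a * (b + 1) ∧ Odd (b + 1) := by
  obtain ⟨a, b, hb, hab⟩ := Nat.exists_eq_two_pow_mul_odd (n := n + 1) (by omega)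
  obtain ⟨c, rfl⟩ : ∃ c, b = c + 1 := ⟨b - 1, by have := hb.pos; omega⟩
  exact ⟨a, c, hab, hb⟩

/-- A free involution acts such that some invariant class of degree one does not lift. -/
theorem IsFreeInv.exists_obs_one (h : IsFreeInv τ) (hv : IsTrunc n v)
    (hd : ∀ j, IsDeg 1 (v j)) (hn : 1 ≤ n) :
    ∃ x, IsDeg 1 x ∧ H.map τ h.d x = x ∧ Obs τ x 1 := by
  have hC := hv.conn hd
  obtain ⟨a, b, hab, hb⟩ := exists_two_pow_mul_odd n
  suffices ∃ (u : Fin m → H C) (σ : Fin m → Fin m), IsTrunc n u ∧ (∀ j, IsDeg 1 (u j)) ∧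
      (∀ j, σ (σ j) = j) ∧ ∀ j, H.map τ h.d (u j) = u (σ j) by
    obtain ⟨u, σ, hu, hud, hσ, huσ⟩ := this
    obtain ⟨j, hj, hob⟩ := h.exists_obs_one_of_perm hu hud hC σ hσ huσ
    exact ⟨u j, hud j, by rw [huσ, hj], hob⟩
  cases b with
  | succ b =>
    choose σ hσ using hv.exists_perm hd hab hb h.toIsEndo h.inv
    refine ⟨v, σ, hv, hd, fun j => ?_, hσ⟩
    apply (hv.linearIndependent hn).injective
    rw [← hσ, ← hσ]
    exact h.map_map _
  | zero =>
    let := hv.commRing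
    set V := Submodule.span (ZMod 2) (Set.range v)
    let g0 : H C →ₗ[ZMod 2] H C := (H.map τ h.d).toAddMonoidHom.toZModLinearMap 2
    let g : V →ₗ[ZMod 2] V := g0.restrict fun x hx =>
      hv.mem_span_one hd (h.isDeg (isDeg_of_mem_span hd hx))
    have : Module.Finite (ZMod 2) V := Module.Finite.span_of_finite _ (Set.finite_range v)
    have hm : Module.finrank (ZMod 2) V = m := by
      rw [finrank_span_eq_card (hv.linearIndependent hn), Fintype.card_fin]
    obtain ⟨u, σ, hu, hσ, huσ⟩ := exists_permuted_basis hm g fun x =>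
      Subtype.ext (h.map_map x.1)
    refine ⟨fun j => u j, σ, hv.of_adjoin (fun j => ?_) (fun j => ?_), fun j =>
      isDeg_of_mem_span hd (u j).2, hσ, fun j => congrArg Subtype.val (huσ j)⟩
    · obtain ⟨c, hc⟩ := (Submodule.mem_span_range_iff_exists_fun (ZMod 2)).1 (u j).2
      rw [← hc, hab, zero_add, mul_one, sum_pow_char_pow]
      refine Finset.sum_eq_zero fun k _ => ?_
      rw [smul_pow, ← mul_one (2 ^ a), ← zero_add 1, ← hab, hv.pow, smul_zero]
    · have h1 : (⟨v j, Submodule.subset_span ⟨j, rfl⟩⟩ : V) ∈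
          Submodule.span (ZMod 2) (Set.range u) := hu trivial
      have h2 := Submodule.mem_map_of_mem (f := V.subtype) h1
      rw [← Submodule.span_image, ← Set.range_comp] at h2
      exact h2

lemma IsTrunc.card (hv : IsTrunc n v) : Nat.card (H C) = 2 ^ (n + 1) ^ m := by
  have e := (Module.Basis.mk hv.indep hv.span).equivFun
  rw [Nat.card_congr e.toEquiv]
  simp

/-- There is no free involution if `n` is even. -/
theorem IsFreeInv.odd (h : IsFreeInv τ) (hv : IsTrunc n v) : Odd n := by
  by_contra hn
  rw [Nat.not_odd_iff_even] at hn
  have hc := hv.card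
  have : Finite (H C) := Nat.finite_of_card_ne_zero (by rw [hc]; positivity)
  obtain ⟨k, hk⟩ := h.card_eq_sq
  rw [hc] at hk
  obtain ⟨i, -, rfl⟩ := (Nat.dvd_prime_pow Nat.prime_two).1 (⟨k, by rw [hk, sq]⟩ :
    k ∣ 2 ^ (n + 1) ^ m)
  rw [← pow_mul] at hk
  have h1 := Nat.pow_right_injective le_rfl hk
  have h2 : Odd ((n + 1) ^ m) := hn.add_one.pow
  rw [h1, mul_comm] at h2
  exact (Nat.not_odd_iff_even.2 (even_two_mul i)) h2
end Classes
end AlexSpan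

namespace AlexSpan

section QuadraticSums

/-- The nontrivial character of the group with two elements. -/
def chi (a : ZMod 2) : ℤ := if a = 0 then 1 else -1

lemma chi_add (a b : ZMod 2) : chi (a + b) = chi a * chi b := by
  revert a b; decide

lemma sum_chi_eq_zero {ι : Type*} [Fintype ι] (f : ι → ZMod 2) (e : ι ≃ ι)
    (h : ∀ i, f (e i) = f i + 1) : ∑ i, chi (f i) = 0 := by
  have h1 : ∑ i, chi (f i) = ∑ i, -chi (f i) := by
    rw [← Equiv.sum_comp e]
    refine Finset.sum_congr rfl fun i _ => ?_
    rw [h, chi_add]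
    simp [chi]
  rw [Finset.sum_neg_distrib] at h1
  omega

/-- The Gauss sum of a quadratic form. -/
lemma card_dvd_sum_sq {K : Type*} [CommGroup K] [Fintype K] (q : K → ZMod 2)
    (b : K → K → ZMod 2) (hb : ∀ g g' h, b (g * g') h = b g h + b g' h)
    (hq : ∀ g h, q (g * h) = q g + q h + b g h) :
    (Fintype.card K : ℤ) ∣ (∑ g, chi (q g)) ^ 2 := by
  have h1 : (∑ g, chi (q g)) ^ 2 = ∑ k, chi (q k) * ∑ g, chi (b g k) := by
    rw [sq, Finset.sum_mul_sum]
    simp_rw [Finset.mul_sum]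
    rw [Finset.sum_comm (s := Finset.univ) (t := Finset.univ) (f := fun k g => chi (q k) * chi (b g k))]
    refine Finset.sum_congr rfl fun g _ => ?_
    rw [← Equiv.sum_comp (Equiv.mulLeft g)]
    refine Finset.sum_congr rfl fun k _ => ?_
    rw [Equiv.coe_mulLeft, hq, ← chi_add, ← chi_add]
    congr 1
    have : ∀ a : ZMod 2, a + a = 0 := by decide
    linear_combination this (q g)
  rw [h1]
  refine Finset.dvd_sum fun k _ => Dvd.dvd.mul_left ?_ _
  by_cases h : ∃ g₀, b g₀ k = 1
  · obtain ⟨g₀, hg₀⟩ := h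
    rw [sum_chi_eq_zero (fun g => b g k) (Equiv.mulRight g₀) fun g => by
      rw [Equiv.coe_mulRight, hb, hg₀]]
    exact dvd_zero _
  · push Not at h
    have h0 : ∀ g, b g k = 0 := fun g =>
      ((show ∀ c : ZMod 2, c = 0 ∨ c = 1 by decide) (b g k)).resolve_right (h g)
    simp [h0, chi]

lemma dvd_sum_of_orbits {G V : Type*} [Group G] [MulAction G V] [Fintype V] [DecidableEq V]
    (f : V → ℤ) (d : ℤ) (hf : ∀ (g : G) x, f (g • x) = f x)
    (hd : ∀ x, d ∣ Nat.card (MulAction.orbit G x) * f x) : d ∣ ∑ x, f x := by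
  classical
  rw [Finset.sum_partition (MulAction.orbitRel G V)]
  refine Finset.dvd_sum fun o _ => ?_
  refine Quotient.inductionOn o fun x => ?_
  have h1 : ∀ y ∈ Finset.univ.filter (fun y => (⟦y⟧ : Quotient (MulAction.orbitRel G V)) = ⟦x⟧),
      f y = f x := fun y hy => by
    obtain ⟨g, rfl⟩ : y ∈ MulAction.orbit G x :=
      (MulAction.orbitRel_apply).1 (Quotient.eq.1 (Finset.mem_filter.1 hy).2)
    exact hf g x
  rw [Finset.sum_congr rfl h1, Finset.sum_const, nsmul_eq_mul]
  have h2 : (Finset.univ.filter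
      (fun y => (⟦y⟧ : Quotient (MulAction.orbitRel G V)) = ⟦x⟧)).card =
      Nat.card (MulAction.orbit G x) := by
    rw [Nat.card_eq_card_toFinset (MulAction.orbit G x)]
    congr 1
    ext y
    simp only [Finset.mem_filter, Finset.mem_univ, true_and, Set.mem_toFinset]
    rw [Quotient.eq]
    exact MulAction.orbitRel_apply
  rw [h2]
  exact hd x

lemma two_pow_dvd_of_sq {r : ℕ} {t : ℤ} (h : (2 : ℤ) ^ r ∣ t ^ 2) : (2 : ℤ) ^ ((r + 1) / 2) ∣ t := by
  rcases Nat.even_or_odd' r with ⟨s, rfl | rfl⟩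
  · rw [show (2 * s + 1) / 2 = s by omega]
    rwa [mul_comm, pow_mul, Int.pow_dvd_pow_iff two_ne_zero] at h
  · rw [show (2 * s + 1 + 1) / 2 = s + 1 by omega]
    have h1 : (2 : ℤ) ^ s ∣ t := by
      rw [← Int.pow_dvd_pow_iff two_ne_zero, ← pow_mul, mul_comm]
      exact (pow_dvd_pow 2 (by omega)).trans h
    obtain ⟨u, rfl⟩ := h1
    rw [mul_pow, ← pow_mul, mul_comm s, pow_succ] at h
    have h2 := Int.dvd_of_mul_dvd_mul_left (by positivity) h
    rw [pow_succ]
    exact mul_dvd_mul_left _ (Int.prime_two.dvd_of_dvd_pow h2)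

/-- A family of quadratic forms on the stabilizers bounds the rank of an elementary abelian
2-group acting on a vector space. -/
theorem rank_le_two_mul {G V : Type*} [CommGroup G] [Finite G] [AddCommGroup V] [Finite V]
    [DistribMulAction G V] {r m : ℕ} (hG : Nat.card G = 2 ^ r) (hV : Nat.card V = 2 ^ m)
    (q : V → G → ZMod 2) (hadd : ∀ g x y, g • x = x → g • y = y → q (x + y) g = q x g + q y g)
    (hconj : ∀ (h g : G) x, g • x = x → q (h • x) g = q x g)
    (hb : ∀ x, ∃ b : G → G → ZMod 2,
      (∀ g g' h, g • x = x → g' • x = x → h • x = x → b (g * g') h = b g h + b g' h) ∧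
      ∀ g h, g • x = x → h • x = x → q x (g * h) = q x g + q x h + b g h)
    (hIL : ∀ g : G, g ≠ 1 → ∃ x : V, g • x = x ∧ q x g = 1) : r ≤ 2 * m := by
  classical
  have := Fintype.ofFinite G
  have := Fintype.ofFinite V
  set S : V → ℤ := fun x => ∑ g : MulAction.stabilizer G x, chi (q x g)
  have hS : ∀ x, S x = ∑ g with g • x = x, chi (q x g) := fun x =>
    (Finset.sum_subtype (p := (· ∈ MulAction.stabilizer G x)) _
      (fun g => by simp [MulAction.mem_stabilizer_iff]) fun g => chi (q x g)).symm
  have hq1 : ∀ x, q x 1 = 0 := fun x => by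
    obtain ⟨b, hb1, hb2⟩ := hb x
    have h1 := hb1 1 1 1 (one_smul _ _) (one_smul _ _) (one_smul _ _)
    have h2 := hb2 1 1 (one_smul _ _) (one_smul _ _)
    rw [mul_one] at h1 h2
    rw [left_eq_add] at h1
    rw [h1, add_zero, left_eq_add] at h2
    exact h2
  have hsum : ∑ x, S x = 2 ^ m := by
    simp_rw [hS, Finset.sum_filter]
    rw [Finset.sum_comm, Finset.sum_eq_single 1]
    · simp only [one_smul, if_true, hq1]
      simp [chi, ← Nat.card_eq_fintype_card, hV]
    · intro g _ hg
      obtain ⟨x, hx, hqx⟩ := hIL g hg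
      rw [← Finset.sum_filter, Finset.sum_subtype _ (p := fun y => g • y = y) (by simp)]
      let e : {y : V // g • y = y} ≃ {y : V // g • y = y} :=
        { toFun := fun y => ⟨y + x, by rw [smul_add, y.2, hx]⟩
          invFun := fun y => ⟨y - x, by rw [smul_sub, y.2, hx]⟩
          left_inv := fun y => Subtype.ext (add_sub_cancel_right _ _)
          right_inv := fun y => Subtype.ext (sub_add_cancel _ _) }
      refine sum_chi_eq_zero (fun y : {y : V // g • y = y} => q y g) e fun y => ?_
      change q (y + x) g = _
      rw [hadd _ _ _ y.2 hx, hqx]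
    · simp
  have hdiv : (2 : ℤ) ^ ((r + 1) / 2) ∣ ∑ x, S x := by
    refine dvd_sum_of_orbits (G := G) S _ (fun h x => ?_) fun x => ?_
    · rw [hS, hS]
      have hst : ∀ g : G, g • h • x = h • x ↔ g • x = x := fun g => by
        rw [smul_comm, smul_left_cancel_iff]
      simp only [hst]
      refine Finset.sum_congr rfl fun g hg => ?_
      rw [hconj _ _ _ (Finset.mem_filter.1 hg).2]
    · apply two_pow_dvd_of_sq
      obtain ⟨b, hb1, hb2⟩ := hb x
      obtain ⟨k, hk⟩ := card_dvd_sum_sq (K := MulAction.stabilizer G x) (fun g => q x g)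
        (fun g h => b g h) (fun g g' h => hb1 _ _ _ g.2 g'.2 h.2) fun g h => hb2 _ _ g.2 h.2
      have hc := MulAction.card_orbit_mul_card_stabilizer_eq_card_group G x
      refine ⟨Nat.card (MulAction.orbit G x) * k, ?_⟩
      rw [mul_pow, show S x ^ 2 = _ from hk, Nat.card_eq_fintype_card]
      have hc' : (2 : ℤ) ^ r = Fintype.card (MulAction.orbit G x) *
          Fintype.card (MulAction.stabilizer G x) := by
        rw [Nat.card_eq_fintype_card] at hG
        exact_mod_cast (hc.trans hG).symm
      rw [hc']
      ring
  rw [hsum] at hdiv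
  have h1 : 2 ^ ((r + 1) / 2) ∣ 2 ^ m := by exact_mod_cast hdiv
  have := (Nat.pow_dvd_pow_iff_le_right (by norm_num)).1 h1
  omega
end QuadraticSums
end AlexSpan

namespace AlexSpan

section Action
variable {C : Type} [GDga C] [CharP C 2] {G : Type} [CommGroup G]

/-- The algebraic counterpart of a free action of an elementary abelian 2-group. -/
structure IsFreeAct (ρ : G →* (C →+* C)) : Prop where
  sq : ∀ g : G, g * g = 1
  endo : ∀ g, IsEndo (ρ g)
  free : ∀ g, g ≠ 1 → IsFreeInv (ρ g)

variable {ρ : G →* (C →+* C)} (hρ : IsFreeAct ρ)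
include hρ

omit hρ in
lemma act_mul_apply (g h : G) (a : C) : ρ (g * h) a = ρ g (ρ h a) := by
  rw [map_mul]
  rfl

lemma IsFreeAct.inv (g : G) (a : C) : ρ g (ρ g a) = a := by
  rw [← act_mul_apply, hρ.sq, map_one]
  rfl

lemma IsFreeAct.comm (g h : G) (a : C) : ρ g (ρ h a) = ρ h (ρ g a) := by
  rw [← act_mul_apply, ← act_mul_apply, mul_comm]

/-- The action on cohomology. -/
abbrev IsFreeAct.act (g : G) : H C →+* H C := H.map (ρ g) (hρ.endo g).d

lemma IsFreeAct.act_mul (g h : G) (x : H C) : hρ.act (g * h) x = hρ.act g (hρ.act h x) := by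
  obtain ⟨a, rfl⟩ := cl_surj x
  simp only [IsFreeAct.act, H.map_cl, map_mul]
  rfl

lemma IsFreeAct.act_one (x : H C) : hρ.act 1 x = x := by
  obtain ⟨a, rfl⟩ := cl_surj x
  simp only [IsFreeAct.act, H.map_cl, map_one]
  rfl

lemma IsFreeAct.obs_act {x : H C} {g : G} {ε : ZMod 2} (h : G) (hx : Obs (ρ g) x ε) :
    Obs (ρ g) (hρ.act h x) ε := by
  obtain ⟨c, u, hc, rfl, hu, hcu, hε⟩ := hx
  refine ⟨_, ρ h u, ?_, H.map_cl _ _ _, by rw [← (hρ.endo h).pr, hu], ?_, ?_⟩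
  · change GDga.pr 1 (ρ h c.1) = ρ h c.1
    rw [← (hρ.endo h).pr, hc]
  · change ρ h c.1 + ρ g (ρ h c.1) = _
    rw [hρ.comm, ← map_add, hcu, (hρ.endo h).d]
  · rw [hρ.comm, ← map_add, hε, map_cast]

lemma IsFreeAct.obs_mul {c : Cocycles C} (hc : GDga.pr 1 c.1 = c.1) {g h : G} {u w : C}
    (hu0 : GDga.pr 0 u = u) (hw0 : GDga.pr 0 w = w) (hu : c.1 + ρ g c.1 = Dga.d u)
    (hw : c.1 + ρ h c.1 = Dga.d w) {ε δ β : ZMod 2}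
    (e1 : u + ρ g u = ZMod.castHom (dvd_refl 2) C ε)
    (e2 : w + ρ h w = ZMod.castHom (dvd_refl 2) C δ)
    (e3 : u + ρ h u + (w + ρ g w) = ZMod.castHom (dvd_refl 2) C β) :
    Obs (ρ (g * h)) (cl c) (ε + δ + β) := by
  refine ⟨c, u + ρ g w, hc, rfl, ?_, ?_, ?_⟩
  · rw [map_add, ← (hρ.endo g).pr, hu0, hw0]
  · rw [map_add, ← (hρ.endo g).d, ← hu, ← hw, map_add, act_mul_apply]
    grind
  · have e4 := congrArg (ρ h) e1
    rw [map_cast, ← e1, map_add, hρ.comm] at e4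
    rw [map_add, map_add, map_add, ← e3, ← e1, ← e2, act_mul_apply,
      act_mul_apply, hρ.comm h g w, hρ.inv g (ρ h w)]
    have e5 := eq_of_add_eq_zero_two (a := ρ g (ρ h u) + ρ h u) (b := u + ρ g u)
      (by rw [add_comm (ρ g _), e4, add_self_two])
    have e6 : ρ g (ρ h u) = ρ h u + (u + ρ g u) := by rw [← e5]; grind
    rw [e6]
    grind

/-- The obstructions form a quadratic form. -/
theorem IsFreeAct.exists_polar (hC : Conn C) {x : H C} (hx : IsDeg 1 x) :
    ∃ b : G → G → ZMod 2,
      (∀ g g' h, hρ.act g x = x → hρ.act g' x = x → hρ.act h x = x →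
        b (g * g') h = b g h + b g' h) ∧
      ∀ g h ε δ, Obs (ρ g) x ε → Obs (ρ h) x δ → hρ.act g x = x → hρ.act h x = x →
        Obs (ρ (g * h)) x (ε + δ + b g h) := by
  obtain ⟨c, hc, rfl⟩ := isDeg_iff.1 hx
  have h1 : ∀ g, ∃ u, hρ.act g (cl c) = cl c → GDga.pr 0 u = u ∧ c.1 + ρ g c.1 = Dga.d u := by
    intro g
    by_cases h : hρ.act g (cl c) = cl c
    · obtain ⟨u, hu⟩ := exists_primitive (hρ.endo g) hc h
      exact ⟨u, fun _ => hu⟩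
    · exact ⟨0, fun h' => absurd h' h⟩
  choose u hu using h1
  have h2 : ∀ g h, ∃ ε, hρ.act g (cl c) = cl c → hρ.act h (cl c) = cl c →
      u g + ρ h (u g) + (u h + ρ g (u h)) = ZMod.castHom (dvd_refl 2) C ε := by
    intro g h
    by_cases hg : hρ.act g (cl c) = cl c
    · by_cases hh : hρ.act h (cl c) = cl c
      · obtain ⟨ε, hε⟩ := hC.exists_cast (a := u g + ρ h (u g) + (u h + ρ g (u h))) (by
          rw [map_add, map_add, map_add, ← (hρ.endo h).d, ← (hρ.endo g).d, ← (hu g hg).2,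
            ← (hu h hh).2, map_add, map_add, hρ.comm h g]
          grind) (by
          rw [map_add, map_add, map_add, ← (hρ.endo h).pr, ← (hρ.endo g).pr, (hu g hg).1,
            (hu h hh).1])
        exact ⟨ε, fun _ _ => hε⟩
      · exact ⟨0, fun _ h' => absurd h' hh⟩
    · exact ⟨0, fun h' => absurd h' hg⟩
  choose b hb using h2
  have hmulfix : ∀ g h, hρ.act g (cl c) = cl c → hρ.act h (cl c) = cl c →
      hρ.act (g * h) (cl c) = cl c := fun g h hg hh => by rw [hρ.act_mul, hh, hg]
  have hprim : ∀ g h, hρ.act g (cl c) = cl c → hρ.act h (cl c) = cl c →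
      c.1 + ρ (g * h) c.1 = Dga.d (u g + ρ g (u h)) := fun g h hg hh => by
    rw [map_add, ← (hρ.endo g).d, ← (hu g hg).2, ← (hu h hh).2, map_add, act_mul_apply]
    grind
  have hprim0 : ∀ g h, hρ.act g (cl c) = cl c → hρ.act h (cl c) = cl c →
      GDga.pr 0 (u g + ρ g (u h)) = u g + ρ g (u h) := fun g h hg hh => by
    rw [map_add, ← (hρ.endo g).pr, (hu g hg).1, (hu h hh).1]
  refine ⟨b, fun g g' h hg hg' hh => ?_, fun g h ε δ hε hδ hg hh => ?_⟩
  · have hgg' := hmulfix g g' hg hg'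
    obtain ⟨κ, hκ⟩ := hC.exists_cast (a := u (g * g') + (u g + ρ g (u g'))) (by
      rw [map_add, ← hprim g g' hg hg', ← (hu _ hgg').2, add_self_two])
      (by rw [map_add, hprim0 g g' hg hg', (hu _ hgg').1])
    have hκ : u (g * g') = u g + ρ g (u g') + ZMod.castHom (dvd_refl 2) C κ := by
      rw [← hκ]; grind
    apply cast_zmod_inj (C := C)
    rw [map_add, ← hb _ _ hgg' hh, ← hb _ _ hg hh, ← map_cast (ρ g) (b g' h), ← hb _ _ hg' hh, hκ,
      map_add, map_add, map_cast, map_add, map_add, map_add, act_mul_apply,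
      hρ.comm h g]
    grind
  · have e1 : u g + ρ g (u g) = ZMod.castHom (dvd_refl 2) C ε := by
      obtain ⟨ε', hε'⟩ := hC.exists_cast (a := u g + ρ g (u g)) (by
        rw [map_add, ← (hρ.endo g).d, ← (hu g hg).2, map_add, hρ.inv]
        grind) (by rw [map_add, ← (hρ.endo g).pr, (hu g hg).1])
      rw [hε', Obs.unique hC (hρ.endo g) (hρ.inv g) hε
        ⟨c, u g, hc, rfl, (hu g hg).1, (hu g hg).2, hε'⟩]
    have e2 : u h + ρ h (u h) = ZMod.castHom (dvd_refl 2) C δ := by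
      obtain ⟨ε', hε'⟩ := hC.exists_cast (a := u h + ρ h (u h)) (by
        rw [map_add, ← (hρ.endo h).d, ← (hu h hh).2, map_add, hρ.inv]
        grind) (by rw [map_add, ← (hρ.endo h).pr, (hu h hh).1])
      rw [hε', Obs.unique hC (hρ.endo h) (hρ.inv h) hδ
        ⟨c, u h, hc, rfl, (hu h hh).1, (hu h hh).2, hε'⟩]
    exact hρ.obs_mul hc (hu g hg).1 (hu h hh).1 (hu g hg).2 (hu h hh).2 e1 e2 (hb g h hg hh)

/-- The bound for all odd `n`. -/
theorem IsFreeAct.rank_le_two_mul [Finite G] {m n r : ℕ} {v : Fin m → H C} (hv : IsTrunc n v)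
    (hd : ∀ j, IsDeg 1 (v j)) (hn : 1 ≤ n) (hG : Nat.card G = 2 ^ r) : r ≤ 2 * m := by
  classical
  have hC := hv.conn hd
  set V := Submodule.span (ZMod 2) (Set.range v)
  have hV : ∀ x : V, IsDeg 1 (x : H C) := fun x => isDeg_of_mem_span hd x.2
  let : DistribMulAction G V :=
    { smul := fun g x => ⟨hρ.act g x, hv.mem_span_one hd ((hρ.endo g).isDeg (hV x))⟩
      one_smul := fun x => Subtype.ext (hρ.act_one x)
      mul_smul := fun g h x => Subtype.ext (hρ.act_mul g h x)
      smul_zero := fun g => Subtype.ext (map_zero (hρ.act g))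
      smul_add := fun g x y => Subtype.ext (map_add (hρ.act g) x.1 y.1) }
  have hfix : ∀ (g : G) (x : V), g • x = x → hρ.act g x = x := fun g x h => congrArg Subtype.val h
  have : Module.Finite (ZMod 2) V := Module.Finite.span_of_finite _ (Set.finite_range v)
  have : Finite V := Module.finite_of_finite (ZMod 2)
  have hcard : Nat.card V = 2 ^ m := by
    rw [Module.natCard_eq_pow_finrank (K := ZMod 2),
      finrank_span_eq_card (hv.linearIndependent hn), Fintype.card_fin, Nat.card_zmod]
  let q : V → G → ZMod 2 := fun x g => if Obs (ρ g) x.1 1 then 1 else 0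
  have hq : ∀ (x : V) g ε, Obs (ρ g) x.1 ε → q x g = ε := by
    intro x g ε h
    rcases (show ∀ c : ZMod 2, c = 0 ∨ c = 1 by decide) ε with rfl | rfl
    · refine if_neg fun h' => ?_
      exact zero_ne_one (Obs.unique hC (hρ.endo g) (hρ.inv g) h h')
    · exact if_pos h
  have hob : ∀ (x : V) g, g • x = x → Obs (ρ g) x.1 (q x g) := fun x g h => by
    obtain ⟨ε, hε⟩ := exists_obs hC (hρ.endo g) (hρ.inv g) (hV x) (hfix g x h)
    rwa [hq x g ε hε]
  refine AlexSpan.rank_le_two_mul hG hcard q (fun g x y hx hy => ?_) (fun h g x hx => ?_)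
    (fun x => ?_) fun g hg => ?_
  · exact hq _ _ _ ((hob x g hx).add (hob y g hy))
  · exact hq _ _ _ (hρ.obs_act h (hob x g hx))
  · obtain ⟨b, hb1, hb2⟩ := hρ.exists_polar hC (hV x)
    exact ⟨b, fun g g' h hg hg' hh => hb1 g g' h (hfix _ _ hg) (hfix _ _ hg') (hfix _ _ hh),
      fun g h hg hh => hq _ _ _ (hb2 g h _ _ (hob x g hg) (hob x h hh) (hfix _ _ hg)
        (hfix _ _ hh))⟩
  · obtain ⟨x, hx, hgx, hobs⟩ := (hρ.free g hg).exists_obs_one hv hd hn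
    exact ⟨⟨x, hv.mem_span_one hd hx⟩, Subtype.ext hgx, hq _ _ _ hobs⟩
end Action
end AlexSpan

namespace AlexSpan

section Geometry
variable {X : Type} [TopologicalSpace X] {G : Type} [CommGroup G]

lemma AS.map_one_homeo (a : AS X) : AS.map ((1 : X ≃ₜ X) : C(X, X)) a = a := by
  have h : ((1 : X ≃ₜ X) : C(X, X)) = ContinuousMap.id X := rfl
  rw [h, AS.map_id]

lemma AS.map_mul_homeo (e f : X ≃ₜ X) (a : AS X) :
    AS.map ((e * f : X ≃ₜ X) : C(X, X)) a = AS.map (f : C(X, X)) (AS.map (e : C(X, X)) a) := by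
  have h : ((e * f : X ≃ₜ X) : C(X, X)) = (e : C(X, X)).comp (f : C(X, X)) := rfl
  rw [h, AS.map_comp]

/-- The action on cochains induced by an action on a space. -/
noncomputable def AS.action (φ : G →* (X ≃ₜ X)) : G →* (AS X →+* AS X) where
  toFun g := AS.map (φ g : C(X, X))
  map_one' := RingHom.ext fun a => by rw [map_one, AS.map_one_homeo]; rfl
  map_mul' g h := RingHom.ext fun a => by rw [mul_comm g h, map_mul, AS.map_mul_homeo]; rfl

lemma AS.action_apply (φ : G →* (X ≃ₜ X)) (g : G) : AS.action φ g = AS.map (φ g : C(X, X)) := rfl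

lemma AS.isEndo_map (f : C(X, X)) : IsEndo (AS.map f) :=
  ⟨AS.map_d f, AS.map_pr f, AS.map_star f⟩

theorem AS.isFreeAct_action [CompactSpace X] [T2Space X] [Nonempty X] (φ : G →* (X ≃ₜ X))
    (hsq : ∀ g : G, g * g = 1) (hfree : ∀ g x, φ g x = x → g = 1) :
    IsFreeAct (AS.action φ) where
  sq := hsq
  endo g := AS.isEndo_map _
  free g hg := by
    have hinv : ∀ x, φ g (φ g x) = x := fun x => by
      change (φ g * φ g) x = x
      rw [← map_mul, hsq, map_one]
      rfl
    obtain ⟨u, hu, N, y, hy, huy⟩ := free_involution (φ g : C(X, X)) hinv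
      fun x hx => hg (hfree g x hx)
    refine ⟨AS.isEndo_map _, fun a => ?_, AS.pt u, N, y, AS.pr_pt u, ?_, hy, huy⟩
    · rw [AS.action_apply, ← AS.map_mul_homeo, ← map_mul, hsq, map_one, AS.map_one_homeo]
    · have h1 : AS.pt (u ∘ (φ g : C(X, X))) = AS.pt (u + fun _ => 1) :=
        congrArg AS.pt (funext hu)
      rw [AS.action_apply, AS.map_pt, ← AS.pt_one, ← AS.pt_add, h1]

lemma zmod_two_sq (r : ℕ) (g : Fin r → Multiplicative (ZMod 2)) : g * g = 1 :=
  funext fun i => (show ∀ a : Multiplicative (ZMod 2), a * a = 1 by decide) (g i)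

lemma natCard_zmod_two (r : ℕ) : Nat.card (Fin r → Multiplicative (ZMod 2)) = 2 ^ r := by
  rw [Nat.card_eq_fintype_card, Fintype.card_pi]
  simp

lemma eq_zero_of_trivial {r : ℕ} (h : ∀ g : Fin r → Multiplicative (ZMod 2), g = 1) : r = 0 := by
  have : Subsingleton (Fin r → Multiplicative (ZMod 2)) := ⟨fun a b => by rw [h a, h b]⟩
  have h1 := natCard_zmod_two r
  rw [Nat.card_unique] at h1
  exact (Nat.pow_eq_one.1 h1.symm).resolve_left (by decide)

end Geometry
end AlexSpan

namespace AlexSpan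

section Twisted

lemma sum_sum_eq_zero {ι M : Type*} [Fintype ι] [AddCommMonoid M] (f : ι → ι → M)
    (h : ∀ i j, f i j + f j i = 0) (h0 : ∀ i, f i i = 0) : ∑ i, ∑ j, f i j = 0 := by
  classical
  rw [← Fintype.sum_prod_type']
  refine Finset.sum_involution (fun p _ => p.swap) (fun p _ => h p.1 p.2) (fun p _ hp he => ?_)
    (fun _ _ => Finset.mem_univ _) fun p _ => Prod.swap_swap p
  have : p.1 = p.2 := by simpa using congrArg Prod.snd he
  exact hp (by rw [this, h0])

/-- The data of a differential ring, commuting automorphisms and a ring containing both of them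
in which the automorphisms become inner up to the variables `t`. -/
structure Twisted {k A P ι : Type} [Field k] [Ring A] [Algebra k A] [Ring P] [Algebra k P]
    (d : A →ₗ[k] A) (g : ι → A →ₐ[k] A) (L : A →ₐ[k] P) (t : ι → P) (δ : P) : Prop where
  comm : ∀ i j, t i * t j = t j * t i
  skew : ∀ j a, t j * L a = L (g j a) * t j
  leib : ∀ a, δ * L a = L a * δ + L (d a)
  cen : ∀ j, δ * t j = t j * δ

/-- The commutator with `x`. -/
def ad {P : Type*} [Ring P] (x z : P) : P := x * z + z * x

section ad
variable {P : Type} [Ring P] [CharP P 2] (x : P)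

omit [CharP P 2] in
lemma ad_add (a b : P) : ad x (a + b) = ad x a + ad x b := by
  simp only [ad, mul_add, add_mul]; abel

omit [CharP P 2] in
lemma ad_sum {κ : Type*} (s : Finset κ) (f : κ → P) : ad x (∑ i ∈ s, f i) = ∑ i ∈ s, ad x (f i) := by
  simp only [ad, Finset.mul_sum, Finset.sum_mul, Finset.sum_add_distrib]

omit [CharP P 2] in
lemma ad_smul {k : Type*} [Field k] [Algebra k P] (r : k) (a : P) : ad x (r • a) = r • ad x a := by
  simp only [ad, mul_smul_comm, smul_mul_assoc, smul_add]

lemma ad_mul (a b : P) : ad x (a * b) = ad x a * b + a * ad x b := by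
  simp only [ad]; grind

lemma ad_one : ad x (1 : P) = 0 := by
  simp only [ad]; grind
end ad

namespace Twisted
variable {k A P ι : Type} [Field k] [Ring A] [Algebra k A] [Ring P] [Algebra k P] [CharP P 2]
  [CharP A 2] [Fintype ι] {d : A →ₗ[k] A} {g : ι → A →ₐ[k] A} {L : A →ₐ[k] P} {t : ι → P} {δ : P}
  (h : Twisted d g L t δ)
include h

omit [CharP A 2] in
lemma ad_L (a : A) : ad (δ + ∑ j, t j) (L a) = L (d a) + ∑ j, L (a + g j a) * t j := by
  simp only [ad, add_mul, mul_add, h.leib, Finset.sum_mul, Finset.mul_sum, h.skew, map_add,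
    Finset.sum_add_distrib]
  grind

omit [CharP A 2] in
lemma ad_t (j : ι) : ad (δ + ∑ j, t j) (t j) = 0 := by
  have h1 : (∑ i, t i) * t j = t j * ∑ i, t i := by
    rw [Finset.sum_mul, Finset.mul_sum]
    exact Finset.sum_congr rfl fun i _ => h.comm i j
  rw [ad, add_mul, mul_add, h.cen, h1, add_self_two]

variable {c : A} {u : ι → A} {Q : ι → ι → k} (hc : d c = 0) (hu : ∀ j, c + g j c = d (u j))
  (hQ : ∀ j, u j + g j (u j) = algebraMap k A (Q j j))
  (hB : ∀ i j, u i + g j (u i) + (u j + g i (u j)) = algebraMap k A (Q i j + Q j i))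

/-- The extension of a cocycle. -/
def ext (L : A →ₐ[k] P) (t : ι → P) (c : A) (u : ι → A) : P := L c + ∑ j, L (u j) * t j

include hc hu hQ hB in
lemma ad_ext : ad (δ + ∑ j, t j) (ext L t c u) = ∑ i, ∑ j, Q i j • (t i * t j) := by
  have h1 : ad (δ + ∑ j, t j) (ext L t c u) = ∑ i, ∑ j, L (u i + g j (u i)) * (t i * t j) := by
    rw [ext, ad_add, h.ad_L, hc, map_zero, zero_add, ad_sum]
    simp_rw [ad_mul, h.ad_t, mul_zero, add_zero, h.ad_L, hu, add_mul, Finset.sum_add_distrib]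
    rw [← add_assoc, add_self_two, zero_add]
    refine Finset.sum_congr rfl fun i _ => ?_
    rw [Finset.sum_mul]
    refine Finset.sum_congr rfl fun j _ => ?_
    rw [mul_assoc, h.comm]
  refine eq_of_add_eq_zero_two ?_
  rw [h1, ← Finset.sum_add_distrib]
  simp_rw [← Finset.sum_add_distrib]
  have h2 : ∀ i j, Q i j • (t i * t j) = L (algebraMap k A (Q i j)) * (t i * t j) := fun i j => by
    rw [AlgHom.commutes, ← Algebra.smul_def]
  simp_rw [h2, ← add_mul, ← map_add]
  refine sum_sum_eq_zero _ (fun i j => ?_) fun i => ?_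
  · rw [h.comm j i, ← add_mul, ← map_add]
    have h3 := hB i j
    rw [map_add] at h3
    have : u i + g j (u i) + algebraMap k A (Q i j) + (u j + g i (u j) + algebraMap k A (Q j i)) = 0 := by
      rw [show u i + g j (u i) + algebraMap k A (Q i j) + (u j + g i (u j) + algebraMap k A (Q j i))
        = u i + g j (u i) + (u j + g i (u j)) + (algebraMap k A (Q i j) + algebraMap k A (Q j i)) by abel,
        h3, add_self_two]
    rw [this, map_zero, zero_mul]
  · rw [hQ, add_self_two, map_zero, zero_mul]

omit [CharP A 2] in
include hu hB in
lemma ad_ext_t (j : ι) : t j * ext L t c u + ext L t c u * t j =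
    ad (δ + ∑ j, t j) (L (u j) * t j) + ∑ l, (Q l j + Q j l) • (t l * t j) := by
  rw [ad_mul, h.ad_t, mul_zero, add_zero, h.ad_L, ext, add_mul, Finset.sum_mul, add_mul, mul_add,
    h.skew, Finset.mul_sum, Finset.sum_mul]
  have h1 : L (d (u j)) * t j = L c * t j + L (g j c) * t j := by rw [← hu, map_add, add_mul]
  have h2 : ∑ l, (Q l j + Q j l) • (t l * t j) = ∑ l, (t j * (L (u l) * t l) + L (u l) * t l * t j
      + L (u j + g l (u j)) * t l * t j) := by
    refine Finset.sum_congr rfl fun l _ => ?_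
    rw [← mul_assoc, h.skew, mul_assoc, h.comm j l, Algebra.smul_def, ← AlgHom.commutes L,
      ← hB l j]
    simp only [map_add]
    grind
  rw [h2, h1]
  simp only [Finset.sum_add_distrib]
  grind

/-- The correction of the square of an extension. -/
def sqCorr (L : A →ₐ[k] P) (t : ι → P) (u : ι → A) (Q : ι → ι → k) : P :=
  ∑ i, ∑ j, Q i j • (t i * (L (u j) * t j) + L (u i) * t i * t j)

include hc hu hQ hB in
/-- The transgression of the square. -/
lemma ad_sq : ad (δ + ∑ j, t j) (ext L t c u * ext L t c u + sqCorr L t u Q) =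
    ∑ i, ∑ j, Q i j • (t i * (∑ l, (Q l j + Q j l) • (t l * t j)) +
      (∑ l, (Q l i + Q i l) • (t l * t i)) * t j) := by
  rw [ad_add, ad_mul, h.ad_ext hc hu hQ hB, sqCorr, Finset.sum_mul, Finset.mul_sum, ad_sum,
    ← Finset.sum_add_distrib, ← Finset.sum_add_distrib]
  refine Finset.sum_congr rfl fun i _ => ?_
  rw [Finset.sum_mul, Finset.mul_sum, ad_sum, ← Finset.sum_add_distrib, ← Finset.sum_add_distrib]
  refine Finset.sum_congr rfl fun j _ => ?_
  rw [ad_smul, smul_mul_assoc, mul_smul_comm, ← smul_add, ← smul_add]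
  congr 1
  have h1 : t i * t j * ext L t c u + ext L t c u * (t i * t j) =
      t i * (t j * ext L t c u + ext L t c u * t j) +
        (t i * ext L t c u + ext L t c u * t i) * t j := by grind
  rw [h1, h.ad_ext_t hu hB, h.ad_ext_t hu hB, ad_add, ad_mul _ (t i), h.ad_t i, zero_mul, zero_add,
    ad_mul _ (L (u i) * t i) (t j), h.ad_t j, mul_zero, add_zero]
  grind
end Twisted
end Twisted
end AlexSpan

section

open Polynomial

namespace AlexSpan

section Shifted
variable {k A ι : Type} [Field k] [Ring A] [Algebra k A] [Fintype ι]

/-- A differential algebra over a field with commuting involutive automorphisms. -/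
structure InvAlg (d : A →ₗ[k] A) (g : ι → A →ₐ[k] A) : Prop where
  d_mul : ∀ a b, d (a * b) = d a * b + a * d b
  d_d : ∀ a, d (d a) = 0
  g_d : ∀ j a, g j (d a) = d (g j a)
  comm : ∀ i j a, g i (g j a) = g j (g i a)
  inv : ∀ j a, g j (g j a) = a

/-- Left multiplications, as constant polynomials. -/
noncomputable def lmulC (k A : Type) [Field k] [Ring A] [Algebra k A] : A →ₐ[k] (Module.End k A)[X] :=
  CAlgHom.comp (Algebra.lmul k A)

/-- The scaled automorphisms. -/
noncomputable def sc (g : ι → A →ₐ[k] A) (v : ι → k) (j : ι) : Module.End k A := v j • (g j).toLinearMap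

/-- The norm operator attached to a vector. -/
def Delta (g : ι → A →ₐ[k] A) (v : ι → k) (a : A) : A := ∑ j, v j • (a + g j a)

variable {d : A →ₗ[k] A} {g : ι → A →ₐ[k] A} (h : InvAlg d g) (v : ι → k)

lemma Delta_add (a b : A) : Delta g v (a + b) = Delta g v a + Delta g v b := by
  simp only [Delta, ← Finset.sum_add_distrib, map_add, smul_add]
  exact Finset.sum_congr rfl fun j _ => by abel

lemma Delta_smul (r : k) (a : A) : Delta g v (r • a) = r • Delta g v a := by
  simp only [Delta, Finset.smul_sum, map_smul]
  exact Finset.sum_congr rfl fun j _ => by rw [← smul_add, smul_comm]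

include h

lemma InvAlg.d_Delta (a : A) : d (Delta g v a) = Delta g v (d a) := by
  simp only [Delta, map_sum, map_smul, map_add, h.g_d]

lemma InvAlg.Delta_Delta [CharP A 2] (a : A) : Delta g v (Delta g v a) = 0 := by
  have h1 : Delta g v (Delta g v a) =
      ∑ i, ∑ j, (v i * v j) • (a + g j a + (g i a + g i (g j a))) := by
    simp only [Delta, map_sum, map_smul, map_add]
    refine Finset.sum_congr rfl fun i _ => ?_
    rw [← Finset.sum_add_distrib, Finset.smul_sum]
    refine Finset.sum_congr rfl fun j _ => ?_
    rw [← smul_add, smul_smul]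
  rw [h1]
  refine sum_sum_eq_zero _ (fun i j => ?_) fun i => ?_
  · rw [mul_comm (v j), ← smul_add, h.comm j i,
      show a + g j a + (g i a + g i (g j a)) + (a + g i a + (g j a + g i (g j a))) = 0 by grind,
      smul_zero]
  · rw [h.inv, show a + g i a + (g i a + a) = 0 by grind, smul_zero]

lemma InvAlg.twisted [CharP A 2] : Twisted d g (lmulC k A) (fun j => X * C (sc g v j)) (C d) where
  comm i j := by
    have h1 : sc g v i * sc g v j = sc g v j * sc g v i := by
      refine LinearMap.ext fun a => ?_
      simp only [sc, Module.End.mul_apply, LinearMap.smul_apply, AlgHom.toLinearMap_apply, map_smul,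
        h.comm i j]
      rw [smul_comm]
    rw [mul_assoc, mul_assoc, ← mul_assoc (C _) X, ← X_mul_C, mul_assoc, ← C_mul, h1,
      ← mul_assoc (C _) X, ← X_mul_C, mul_assoc, ← C_mul]
  skew j a := by
    have h1 : sc g v j * Algebra.lmul k A a = Algebra.lmul k A (g j a) * sc g v j := by
      refine LinearMap.ext fun b => ?_
      simp [sc, Module.End.mul_apply]
    change X * C _ * C (Algebra.lmul k A a) = C (Algebra.lmul k A (g j a)) * (X * C _)
    rw [mul_assoc, ← C_mul, h1, C_mul, ← mul_assoc, X_mul_C, mul_assoc]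
  leib a := by
    have h1 : d * Algebra.lmul k A a = Algebra.lmul k A a * d + Algebra.lmul k A (d a) := by
      refine LinearMap.ext fun b => ?_
      change d (a * b) = a * d b + d a * b
      rw [h.d_mul, add_comm]
    change C _ * C (Algebra.lmul k A a) = C (Algebra.lmul k A a) * C _ + C (Algebra.lmul k A (d a))
    rw [← C_mul, h1, C_add, C_mul]
  cen j := by
    have h1 : d * sc g v j = sc g v j * d := by
      refine LinearMap.ext fun b => ?_
      simp [sc, Module.End.mul_apply, h.g_d]
    rw [← mul_assoc, ← X_mul_C, mul_assoc, ← C_mul, h1, C_mul, mul_assoc]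

omit h

/-- The components of the value at one. -/
noncomputable def ev (p : ℕ) (z : (Module.End k A)[X]) : A := z.coeff p 1

/-- The total differential. -/
noncomputable abbrev tot (d : A →ₗ[k] A) (g : ι → A →ₐ[k] A) (v : ι → k) : (Module.End k A)[X] :=
  C d + ∑ j, X * C (sc g v j)

lemma ev_add (p : ℕ) (z w : (Module.End k A)[X]) : ev p (z + w) = ev p z + ev p w := by
  simp [ev]

lemma ev_C_mul (p : ℕ) (e : Module.End k A) (z : (Module.End k A)[X]) :
    ev p (C e * z) = e (ev p z) := by simp [ev]

include h in
lemma InvAlg.d_one [CharP A 2] : d 1 = 0 := by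
  have h1 := h.d_mul 1 1
  rw [mul_one, one_mul, mul_one, add_self_two] at h1
  exact h1

lemma tot_eq : tot d g v = C d + X * C (∑ j, sc g v j) := by
  rw [map_sum, Finset.mul_sum]

include h in
lemma InvAlg.ev_ad_succ [CharP A 2] (p : ℕ) (z : (Module.End k A)[X]) :
    ev (p + 1) (ad (tot d g v) z) = d (ev (p + 1) z) + Delta g v (ev p z) := by
  rw [tot_eq, ad, add_mul, mul_add, mul_assoc, ← mul_assoc z X, ← X_mul, mul_assoc]
  have h1 : (∑ j, sc g v j) 1 = (∑ j, v j) • (1 : A) := by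
    simp [sc, LinearMap.sum_apply, Finset.sum_smul]
  simp only [ev, coeff_add, LinearMap.add_apply, coeff_C_mul, coeff_mul_C, Module.End.mul_apply,
    h.d_one, map_zero, coeff_X_mul, h1, map_smul, Delta, smul_add, Finset.sum_add_distrib]
  simp only [sc, LinearMap.sum_apply, LinearMap.smul_apply, AlgHom.toLinearMap_apply,
    Finset.sum_smul]
  abel

/-- Cocycles which survive to the third stage. -/
def Good (d : A →ₗ[k] A) (g : ι → A →ₐ[k] A) (v : ι → k) (a : A) : Prop :=
  ∃ a₁ a₂, d a₁ = Delta g v a ∧ d a₂ = Delta g v a₁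

lemma Good.add {a b : A} (ha : Good d g v a) (hb : Good d g v b) : Good d g v (a + b) := by
  obtain ⟨a₁, a₂, h1, h2⟩ := ha
  obtain ⟨b₁, b₂, h3, h4⟩ := hb
  exact ⟨a₁ + b₁, a₂ + b₂, by rw [map_add, h1, h3, Delta_add], by rw [map_add, h2, h4, Delta_add]⟩

lemma Good.smul {a : A} (r : k) (ha : Good d g v a) : Good d g v (r • a) := by
  obtain ⟨a₁, a₂, h1, h2⟩ := ha
  exact ⟨r • a₁, r • a₂, by rw [map_smul, h1, Delta_smul], by rw [map_smul, h2, Delta_smul]⟩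

include h in
lemma InvAlg.good_d [CharP A 2] (a : A) : Good d g v (d a) :=
  ⟨Delta g v a, 0, h.d_Delta v a, by rw [map_zero, h.Delta_Delta]⟩

/-- `a` is an eigenvector of `e` modulo exact elements. -/
def Eig (d : A →ₗ[k] A) (a : A) (e : Module.End k A) (r : k) : Prop :=
  (∀ x ∈ LinearMap.range d, e x ∈ LinearMap.range d) ∧ e a - r • a ∈ LinearMap.range d

lemma Eig.mul {a : A} {e f : Module.End k A} {r s : k} (he : Eig d a e r) (hf : Eig d a f s) :
    Eig d a (e * f) (r * s) := by
  refine ⟨fun x hx => he.1 _ (hf.1 x hx), ?_⟩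
  have h1 : (e * f) a - (r * s) • a = e (f a - s • a) + s • (e a - r • a) := by
    rw [map_sub, map_smul, smul_sub, smul_smul, mul_comm s r, Module.End.mul_apply]
    abel
  rw [h1]
  exact add_mem (he.1 _ hf.2) (Submodule.smul_mem _ _ he.2)

lemma Eig.add {a : A} {e f : Module.End k A} {r s : k} (he : Eig d a e r) (hf : Eig d a f s) :
    Eig d a (e + f) (r + s) := by
  refine ⟨fun x hx => add_mem (he.1 x hx) (hf.1 x hx), ?_⟩
  have h1 : (e + f) a - (r + s) • a = (e a - r • a) + (f a - s • a) := by
    rw [add_smul, LinearMap.add_apply]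
    abel
  rw [h1]
  exact add_mem he.2 hf.2

lemma Eig.smul {a : A} {e : Module.End k A} {r : k} (t : k) (he : Eig d a e r) :
    Eig d a (t • e) (t * r) := by
  refine ⟨fun x hx => Submodule.smul_mem _ t (he.1 x hx), ?_⟩
  have h1 : (t • e) a - (t * r) • a = t • (e a - r • a) := by
    rw [smul_sub, smul_smul, LinearMap.smul_apply]
  rw [h1]
  exact Submodule.smul_mem _ t he.2

lemma Eig.zero (a : A) : Eig d a 0 0 := ⟨fun x _ => by simp, by simp⟩

lemma Eig.sum {κ : Type*} (s : Finset κ) {a : A} {e : κ → Module.End k A} {r : κ → k}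
    (he : ∀ i, Eig d a (e i) (r i)) : Eig d a (∑ i ∈ s, e i) (∑ i ∈ s, r i) := by
  classical
  induction s using Finset.induction_on with
  | empty => simpa using Eig.zero a
  | insert i s hi ih => rw [Finset.sum_insert hi, Finset.sum_insert hi]; exact (he i).add ih

/-- Cocycles whose class is invariant. -/
def IsInv (d : A →ₗ[k] A) (g : ι → A →ₐ[k] A) (a : A) : Prop :=
  d a = 0 ∧ ∀ j, g j a - a ∈ LinearMap.range d

include h in
lemma InvAlg.eig {a : A} (ha : IsInv d g a) (j : ι) : Eig d a (sc g v j) (v j) := by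
  refine ⟨?_, ?_⟩
  · rintro _ ⟨y, rfl⟩
    exact ⟨v j • g j y, by simp [sc, h.g_d]⟩
  · change v j • g j a - _ ∈ _
    rw [← smul_sub]
    exact Submodule.smul_mem _ _ (ha.2 j)

include h in
lemma InvAlg.mul_range {a b : A} (ha : d a = 0) (hb : b ∈ LinearMap.range d) :
    a * b ∈ LinearMap.range d := by
  obtain ⟨y, rfl⟩ := hb
  exact ⟨a * y, by rw [h.d_mul, ha, zero_mul, zero_add]⟩

include h in
lemma InvAlg.range_mul {a b : A} (ha : d a = 0) (hb : b ∈ LinearMap.range d) :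
    b * a ∈ LinearMap.range d := by
  obtain ⟨y, rfl⟩ := hb
  exact ⟨y * a, by rw [h.d_mul, ha, mul_zero, add_zero]⟩

include h in
lemma InvAlg.isInv_mul {a b : A} (ha : IsInv d g a) (hb : IsInv d g b) : IsInv d g (a * b) := by
  refine ⟨by rw [h.d_mul, ha.1, hb.1, zero_mul, mul_zero, add_zero], fun j => ?_⟩
  have h1 : g j (a * b) - a * b = g j a * (g j b - b) + (g j a - a) * b := by
    rw [map_mul]; noncomm_ring
  rw [h1]
  refine add_mem (h.mul_range (by rw [← h.g_d, ha.1, map_zero]) (hb.2 j))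
    (h.range_mul hb.1 (ha.2 j))

include h in
lemma InvAlg.isInv_one [CharP A 2] : IsInv d g 1 := ⟨h.d_one, fun j => by simp⟩

lemma sum_X_sq (v : ι → k) (Q : ι → ι → k) :
    ∑ i, ∑ j, Q i j • ((X * C (sc g v i)) * (X * C (sc g v j))) =
      X ^ 2 * C (∑ i, ∑ j, Q i j • (sc g v i * sc g v j)) := by
  simp only [map_sum, Finset.mul_sum]
  refine Finset.sum_congr rfl fun i _ => Finset.sum_congr rfl fun j _ => ?_
  rw [← smul_C, mul_smul_comm]
  congr 1
  rw [mul_assoc, ← mul_assoc (C _) X, ← X_mul_C, C_mul, sq]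
  simp only [mul_assoc]

variable {c : A} {u : ι → A} {Q : ι → ι → k}

/-- Compatible data for an extension of `c` with quadratic form `Q`. -/
structure IsExt (d : A →ₗ[k] A) (g : ι → A →ₐ[k] A) (c : A) (u : ι → A) (Q : ι → ι → k) : Prop where
  closed : d c = 0
  diff : ∀ j, c + g j c = d (u j)
  diag : ∀ j, u j + g j (u j) = algebraMap k A (Q j j)
  polar : ∀ i j, u i + g j (u i) + (u j + g i (u j)) = algebraMap k A (Q i j + Q j i)

/-- Value of a quadratic form. -/
def qval (Q : ι → ι → k) (v : ι → k) : k := ∑ i, ∑ j, Q i j * (v i * v j)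

/-- Value of the transgression of the square. -/
def sval (Q : ι → ι → k) (v : ι → k) : k :=
  ∑ i, ∑ j, Q i j * (v i * (∑ l, (Q l j + Q j l) * (v l * v j)) +
      (∑ l, (Q l i + Q i l) * (v l * v i)) * v j)

variable [CharP A 2]

lemma IsExt.isInv (hx : IsExt d g c u Q) : IsInv d g c :=
  ⟨hx.closed, fun j => ⟨u j, by rw [← hx.diff]; grind⟩⟩

/-- Elements of the twisted ring whose value at one is a partial cocycle. -/
def Adm (d : A →ₗ[k] A) (g : ι → A →ₐ[k] A) (v : ι → k) (z : (Module.End k A)[X]) : Prop :=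
  IsInv d g (ev 0 z) ∧ ∃ y, ad (tot d g v) z = X ^ 2 * y ∧ ev 0 y ∈ LinearMap.range d

lemma ev_ext (g : ι → A →ₐ[k] A) (v : ι → k) (c : A) (u : ι → A) (z : (Module.End k A)[X]) :
    ev 0 (Twisted.ext (lmulC k A) (fun j => X * C (sc g v j)) c u * z) = c * ev 0 z := by
  have h1 : Twisted.ext (lmulC k A) (fun j => X * C (sc g v j)) c u = C (Algebra.lmul k A c) +
      X * ∑ j, C (Algebra.lmul k A (u j) * sc g v j) := by
    rw [Twisted.ext, Finset.mul_sum]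
    congr 1
    refine Finset.sum_congr rfl fun j _ => ?_
    change C _ * _ = _
    rw [← mul_assoc, ← X_mul_C, mul_assoc, ← C_mul]
    rfl
  rw [h1, add_mul, ev_add, ev_C_mul, mul_assoc]
  simp [ev]

include h in
lemma InvAlg.ad_ext_X [CharP (Module.End k A) 2] (hx : IsExt d g c u Q) :
    ad (tot d g v) (Twisted.ext (lmulC k A) (fun j => X * C (sc g v j)) c u) =
      X ^ 2 * C (∑ i, ∑ j, Q i j • (sc g v i * sc g v j)) := by
  rw [← sum_X_sq]
  exact (h.twisted v).ad_ext hx.closed hx.diff hx.diag hx.polar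

omit [CharP A 2] in
include h in
lemma InvAlg.eig_q {a : A} (ha : IsInv d g a) (Q : ι → ι → k) :
    Eig d a (∑ i, ∑ j, Q i j • (sc g v i * sc g v j)) (qval Q v) :=
  Eig.sum _ fun i => Eig.sum _ fun j => ((h.eig v ha i).mul (h.eig v ha j)).smul _

include h in
lemma InvAlg.adm_ext [CharP (Module.End k A) 2] (hx : IsExt d g c u Q) (hv : qval Q v = 0)
    {z : (Module.End k A)[X]} (hz : Adm d g v z) :
    Adm d g v (Twisted.ext (lmulC k A) (fun j => X * C (sc g v j)) c u * z) := by
  obtain ⟨h1, y, hy, hyr⟩ := hz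
  refine ⟨by rw [ev_ext]; exact h.isInv_mul hx.isInv h1,
    C (∑ i, ∑ j, Q i j • (sc g v i * sc g v j)) * z +
      Twisted.ext (lmulC k A) (fun j => X * C (sc g v j)) c u * y, ?_, ?_⟩
  · rw [ad_mul, hy, h.ad_ext_X v hx, mul_add, ← mul_assoc _ (X ^ 2), ← X_pow_mul]
    simp only [mul_assoc]
  · rw [ev_add, ev_ext, ev_C_mul]
    have h2 := (h.eig_q v h1 Q).2
    rw [hv, zero_smul, sub_zero] at h2
    exact add_mem h2 (h.mul_range hx.closed hyr)

include h in
lemma InvAlg.adm_one [CharP (Module.End k A) 2] : Adm d g v 1 :=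
  ⟨by simpa [ev] using h.isInv_one, 0, by rw [ad_one, mul_zero], by simp [ev]⟩

include h in
lemma InvAlg.good_of_adm {z : (Module.End k A)[X]} (hz : Adm d g v z) : Good d g v (ev 0 z) := by
  obtain ⟨h1, y, hy, w, hw⟩ := hz
  have h2 := h.ev_ad_succ v 0 z
  have h3 := h.ev_ad_succ v 1 z
  rw [hy, sq, mul_assoc, ev, coeff_X_mul] at h2 h3
  rw [coeff_X_mul] at h3
  rw [zero_add] at h2
  have h4 : (X * y).coeff 0 = 0 := by simp
  rw [h4] at h2
  refine ⟨ev 1 z, ev 2 z + w, eq_of_add_eq_zero_two h2.symm, ?_⟩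
  rw [map_add, hw]
  change ev 0 y = _ at h3
  rw [h3]
  grind

omit [CharP A 2] in
include h in
lemma InvAlg.eig_s {a : A} (ha : IsInv d g a) (Q : ι → ι → k) :
    Eig d a (∑ i, ∑ j, Q i j • (sc g v i * (∑ l, (Q l j + Q j l) • (sc g v l * sc g v j)) +
      (∑ l, (Q l i + Q i l) • (sc g v l * sc g v i)) * sc g v j)) (sval Q v) :=
  Eig.sum _ fun i => Eig.sum _ fun j => (((h.eig v ha i).mul
    (Eig.sum _ fun l => ((h.eig v ha l).mul (h.eig v ha j)).smul _)).add
    ((Eig.sum _ fun l => ((h.eig v ha l).mul (h.eig v ha i)).smul _).mul (h.eig v ha j))).smul _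

omit [Fintype ι] [CharP A 2] in
lemma X_mul_X_mul (e f : Module.End k A) : (X * C e) * (X * C f) = X ^ 2 * C (e * f) := by
  rw [mul_assoc, ← mul_assoc (C _) X, ← X_mul_C, C_mul, sq]
  simp only [mul_assoc]

omit [CharP A 2] in
lemma sum_X_mul_C (E : ι → Module.End k A) (Q : ι → ι → k) :
    ∑ i, ∑ j, Q i j • (X * C (sc g v i) * (X ^ 2 * C (E j)) +
      X ^ 2 * C (E i) * (X * C (sc g v j))) =
      X ^ 3 * C (∑ i, ∑ j, Q i j • (sc g v i * E j + E i * sc g v j)) := by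
  simp only [map_sum, Finset.mul_sum]
  refine Finset.sum_congr rfl fun i _ => Finset.sum_congr rfl fun j _ => ?_
  rw [← smul_C, mul_smul_comm]
  congr 1
  generalize E j = e
  generalize E i = f
  rw [C_add, C_mul, C_mul, mul_add, mul_assoc X, ← mul_assoc (C _) (X ^ 2), ← X_pow_mul,
    mul_assoc (X ^ 2), mul_assoc (X ^ 2), ← mul_assoc (C f) X, ← X_mul_C]
  congr 1
  · simp only [pow_succ, pow_zero, one_mul, mul_assoc]
  · simp only [pow_succ, pow_zero, one_mul, mul_assoc]

include h in
lemma InvAlg.ad_sq_X [CharP (Module.End k A) 2] (hx : IsExt d g c u Q) :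
    ad (tot d g v) (Twisted.ext (lmulC k A) (fun j => X * C (sc g v j)) c u *
      Twisted.ext (lmulC k A) (fun j => X * C (sc g v j)) c u +
      Twisted.sqCorr (lmulC k A) (fun j => X * C (sc g v j)) u Q) =
      X ^ 3 * C (∑ i, ∑ j, Q i j • (sc g v i * (∑ l, (Q l j + Q j l) • (sc g v l * sc g v j)) +
      (∑ l, (Q l i + Q i l) • (sc g v l * sc g v i)) * sc g v j)) := by
  have h1 := (h.twisted v).ad_sq hx.closed hx.diff hx.diag hx.polar
  rw [show tot d g v = C d + ∑ j, X * C (sc g v j) from rfl, h1]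
  have h2 : ∀ j, ∑ l, (Q l j + Q j l) • (X * C (sc g v l) * (X * C (sc g v j))) =
      X ^ 2 * C (∑ l, (Q l j + Q j l) • (sc g v l * sc g v j)) := fun j => by
    simp only [map_sum, Finset.mul_sum]
    refine Finset.sum_congr rfl fun l _ => ?_
    rw [X_mul_X_mul, ← smul_C, mul_smul_comm]
  simp only [h2]
  exact sum_X_mul_C v (fun j => ∑ l, (Q l j + Q j l) • (sc g v l * sc g v j)) Q

omit [CharP A 2] in
lemma ev_sqCorr_mul (z : (Module.End k A)[X]) :
    ev 0 (Twisted.sqCorr (lmulC k A) (fun j => X * C (sc g v j)) u Q * z) = 0 := by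
  have h1 : (Twisted.sqCorr (lmulC k A) (fun j => X * C (sc g v j)) u Q).coeff 0 = 0 := by
    simp [Twisted.sqCorr, mul_coeff_zero]
  rw [ev, mul_coeff_zero, h1, zero_mul]; rfl

include h in
/-- The transgression of the square vanishes at common zeros of the quadratic forms. -/
theorem InvAlg.sval_eq_zero [CharP k 2] {m : ℕ} {c : Fin m → A} {u : Fin m → ι → A}
    {Q : Fin m → ι → ι → k} (hx : ∀ i, IsExt d g (c i) (u i) (Q i))
    (hv : ∀ i, qval (Q i) v = 0)
    (hspan : ∀ a, d a = 0 →
      a ∈ Submodule.span k (Set.range fun l : List (Fin m) => (l.map c).prod) ⊔ LinearMap.range d)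
    (i : Fin m) (p : ℕ) (hp : Odd (p + 1)) (hc : c i ^ (2 * (p + 1)) ∈ LinearMap.range d)
    (hne : ∀ r : k, r • c i ^ (2 * p) ∈ LinearMap.range d → r = 0) : sval (Q i) v = 0 := by
  have : CharP (Module.End k A) 2 := by
    have : Nontrivial A := CharP.nontrivial_of_char_ne_one (R := A) (v := 2) (by decide)
    exact charP_of_injective_algebraMap (algebraMap k (Module.End k A)).injective 2
  have hgood : ∀ a, d a = 0 → Good d g v a := by
    have h1 : ∀ l : List (Fin m), ∃ z, Adm d g v z ∧ ev 0 z = (l.map c).prod := by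
      intro l
      induction l with
      | nil => exact ⟨1, h.adm_one v, by simp [ev]⟩
      | cons j l ih =>
        obtain ⟨z, hz, hz'⟩ := ih
        exact ⟨_, h.adm_ext v (hx j) (hv j) hz, by rw [ev_ext, hz', List.map_cons, List.prod_cons]⟩
    intro a ha
    obtain ⟨x, hx, _, ⟨y, rfl⟩, rfl⟩ := Submodule.mem_sup.1 (hspan a ha)
    clear ha
    refine Good.add v ?_ (h.good_d v y)
    induction hx using Submodule.span_induction with
    | mem x hx =>
      obtain ⟨l, rfl⟩ := hx
      obtain ⟨z, hz, hz'⟩ := h1 l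
      have := h.good_of_adm v hz
      rwa [hz'] at this
    | zero => exact ⟨0, 0, by simp [Delta], by simp [Delta]⟩
    | add x y _ _ hx hy => exact Good.add v hx hy
    | smul r x _ hx => exact Good.smul v r hx
  set η := Twisted.ext (lmulC k A) (fun j => X * C (sc g v j)) (c i) (u i) *
    Twisted.ext (lmulC k A) (fun j => X * C (sc g v j)) (c i) (u i) +
    Twisted.sqCorr (lmulC k A) (fun j => X * C (sc g v j)) (u i) (Q i) with hη
  have hadη := h.ad_sq_X v (hx i)
  rw [← hη] at hadη
  have hevη : ∀ z, ev 0 (η * z) = c i ^ 2 * ev 0 z := fun z => by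
    rw [hη, add_mul, ev_add, mul_assoc, ev_ext, ev_ext, ev_sqCorr_mul, add_zero, sq, mul_assoc]
  have hinv : ∀ q, IsInv d g (c i ^ q) := fun q => by
    induction q with
    | zero => simpa using h.isInv_one
    | succ q ih => rw [pow_succ]; exact h.isInv_mul ih (hx i).isInv
  have hevp : ∀ q, ev 0 (η ^ q) = c i ^ (2 * q) := fun q => by
    induction q with
    | zero => simp [ev]
    | succ q ih => rw [pow_succ', hevη, ih, ← pow_add]; congr 1; ring
  have hadp : ∀ q, ∃ y, ad (tot d g v) (η ^ (q + 1)) = X ^ 3 * y ∧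
      ev 0 y - (((q + 1 : ℕ) : k) * sval (Q i) v) • c i ^ (2 * q) ∈ LinearMap.range d := fun q => by
    induction q with
    | zero =>
      refine ⟨_, by rw [zero_add, pow_one, hadη], ?_⟩
      have h2 := (h.eig_s v (h.isInv_one) (Q i)).2
      simpa [ev] using h2
    | succ q ih =>
      obtain ⟨y, hy, hyr⟩ := ih
      refine ⟨_, by rw [pow_succ', ad_mul, hadη, hy, ← mul_assoc η, ← X_pow_mul, mul_assoc,
        mul_assoc (X ^ 3), ← mul_add], ?_⟩
      rw [ev_add, ev_C_mul, hevp, hevη]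
      have h2 := (h.eig_s v (hinv (2 * (q + 1))) (Q i)).2
      have h3 := h.mul_range (hinv 2).1 hyr
      rw [mul_sub, mul_smul_comm, ← pow_add, show 2 + 2 * q = 2 * (q + 1) by ring] at h3
      have h4 := add_mem h2 h3
      rw [Nat.cast_succ, add_mul, one_mul, add_smul]
      convert h4 using 1
      abel
  obtain ⟨y, hy, hyr⟩ := hadp p
  obtain ⟨w₀, hw₀⟩ := hc
  have e0 := h.ev_ad_succ v 0 (η ^ (p + 1))
  have e1 := h.ev_ad_succ v 1 (η ^ (p + 1))
  have e2 := h.ev_ad_succ v 2 (η ^ (p + 1))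
  have hp1 : ((p + 1 : ℕ) : k) = 1 := by
    obtain ⟨b, hb⟩ := hp
    rw [hb]
    have h2 : (2 : k) = 0 := by exact_mod_cast CharP.cast_eq_zero k 2
    push_cast
    rw [h2, zero_mul, zero_add]
  rw [hp1, one_mul] at hyr
  have f0 : ev 1 (X ^ 3 * y) = 0 := by simp [ev, coeff_X_pow_mul']
  have f1 : ev 2 (X ^ 3 * y) = 0 := by simp [ev, coeff_X_pow_mul']
  have f2 : ev 3 (X ^ 3 * y) = ev 0 y := by simp [ev, coeff_X_pow_mul']
  rw [hy] at e0 e1 e2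
  rw [f0, hevp, ← hw₀, zero_add] at e0
  rw [f1] at e1
  rw [f2] at e2
  have e0' := (eq_of_add_eq_zero_two e0.symm)
  have e1' := (eq_of_add_eq_zero_two e1.symm)
  obtain ⟨a₁, a₂, ha₁, ha₂⟩ := hgood (ev 1 (η ^ (p + 1)) + Delta g v w₀) (by
    rw [map_add, e0', h.d_Delta, add_self_two])
  rw [Delta_add, h.Delta_Delta, add_zero] at ha₁
  obtain ⟨b₁, b₂, hb₁, hb₂⟩ := hgood (ev 2 (η ^ (p + 1)) + a₁) (by
    rw [map_add, ha₁, e1', add_self_two])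
  rw [Delta_add, ← ha₂] at hb₁
  refine hne _ ?_
  have h5 : Delta g v (ev 2 (η ^ (p + 1))) = d (b₁ + a₂) := by
    rw [map_add, hb₁, add_assoc, add_self_two, add_zero]
  have h6 : ev 0 y ∈ LinearMap.range d := ⟨ev 3 (η ^ (p + 1)) + (b₁ + a₂), by
    rw [map_add, ← h5, e2]⟩
  have h7 := sub_mem h6 hyr
  rwa [sub_sub_cancel] at h7
end Shifted
end AlexSpan

end

section

open Polynomial

namespace AlexSpan

section Zeros
variable {k : Type} [Field k] {s : ℕ}

/-- The ideal generated by the first `i` variables. -/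
noncomputable def killFirst (k : Type) [Field k] (s i : ℕ) :
    MvPolynomial (Fin s) k →ₐ[k] MvPolynomial (Fin s) k :=
  MvPolynomial.aeval fun j => if j.1 < i then 0 else MvPolynomial.X j

lemma killFirst_lt (i : ℕ) (hi : i < s) :
    RingHom.ker (killFirst k s i) < RingHom.ker (killFirst k s (i + 1)) := by
  refine lt_of_le_of_ne (fun p hp => ?_) fun h => ?_
  · have h1 : killFirst k s (i + 1) = (killFirst k s (i + 1)).comp (killFirst k s i) := by
      refine MvPolynomial.algHom_ext fun j => ?_
      simp only [killFirst, AlgHom.comp_apply, MvPolynomial.aeval_X]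
      by_cases hj : j.1 < i
      · simp [hj, hj.trans (Nat.lt_succ_self i)]
      · simp [hj]
    rw [RingHom.mem_ker] at hp ⊢
    rw [h1, AlgHom.comp_apply, hp, map_zero]
  · have h1 : (MvPolynomial.X ⟨i, hi⟩ : MvPolynomial (Fin s) k) ∈
        RingHom.ker (killFirst k s (i + 1)) := by
      simp [RingHom.mem_ker, killFirst]
    rw [← h] at h1
    simp [RingHom.mem_ker, killFirst, MvPolynomial.X_ne_zero] at h1

/-- Homogeneous systems with fewer equations than unknowns have nontrivial solutions. -/
lemma exists_common_zero [IsAlgClosed k] {o : Type} [Fintype o] (q : o → MvPolynomial (Fin s) k)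
    (h0 : ∀ i, MvPolynomial.aeval (0 : Fin s → k) (q i) = 0) (ho : Fintype.card o < s) :
    ∃ v : Fin s → k, v ≠ 0 ∧ ∀ i, MvPolynomial.aeval v (q i) = 0 := by
  by_contra! hcon
  set I := Ideal.span (Set.range q)
  have hI : ∀ v : Fin s → k, (∀ i, MvPolynomial.aeval v (q i) = 0) → ∀ p ∈ I,
      MvPolynomial.aeval v p = 0 := by
    intro v hv p hp
    have : I ≤ RingHom.ker (MvPolynomial.aeval v : MvPolynomial (Fin s) k →ₐ[k] k) :=
      Ideal.span_le.2 (by rintro _ ⟨i, rfl⟩; exact hv i)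
    exact this hp
  have hz : MvPolynomial.zeroLocus k I ⊆ {0} := by
    intro v hv
    by_contra h
    obtain ⟨i, hi⟩ := hcon v h
    exact hi (hv _ (Ideal.subset_span ⟨i, rfl⟩))
  have hX : ∀ j, MvPolynomial.X j ∈ I.radical := by
    intro j
    rw [← MvPolynomial.vanishingIdeal_zeroLocus_eq_radical (K := k)]
    intro v hv
    rw [Set.mem_singleton_iff.1 (hz hv)]
    simp
  have htop : I ≠ ⊤ := fun h => by
    have := hI 0 h0 1 (h ▸ Submodule.mem_top)
    simp at this
  set P : ℕ → PrimeSpectrum (MvPolynomial (Fin s) k) :=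
    fun i => ⟨RingHom.ker (killFirst k s i), RingHom.ker_isPrime _⟩
  have hker : ∀ J : Ideal (MvPolynomial (Fin s) k), J.IsPrime → I ≤ J → (P s).asIdeal ≤ J := by
    intro J hJ hIJ p hp
    have h1 : ∀ j, MvPolynomial.X j ∈ J := fun j =>
      (hJ.radical_le_iff.2 hIJ) (hX j)
    have h2 : p - killFirst k s s p ∈ J := by
      rw [← Ideal.Quotient.eq, ← Ideal.Quotient.mkₐ_eq_mk k, ← AlgHom.comp_apply]
      refine DFunLike.congr_fun (MvPolynomial.algHom_ext fun j => ?_) p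
      simp only [killFirst, AlgHom.comp_apply, MvPolynomial.aeval_X, j.2, if_true, map_zero]
      exact Ideal.Quotient.eq_zero_iff_mem.2 (h1 j)
    have h3 : killFirst k s s p = 0 := hp
    rwa [h3, sub_zero] at h2
  have hheight : (s : ℕ∞) ≤ I.height := by
    rw [Ideal.height_eq_inf_minimalPrimes]
    refine le_iInf₂ fun J hJ => ?_
    have := hJ.1.1
    refine le_trans ?_ (Ideal.height_mono (hker J hJ.1.1 hJ.1.2))
    have := (P s).isPrime
    change (s : ℕ∞) ≤ (P s).asIdeal.height
    rw [PrimeSpectrum.height_eq_orderHeight]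
    refine Order.length_le_height (p := ⟨s, fun i => P i.1, fun i => ?_⟩) le_rfl
    exact killFirst_lt i.1 i.2
  have h2 := hheight.trans (Ideal.height_le_spanFinrank I htop)
  have h3 : I.spanFinrank ≤ Fintype.card o := by
    refine (Submodule.spanFinrank_span_le_ncard_of_finite (Set.finite_range q)).trans ?_
    rw [← Nat.card_coe_set_eq, ← Nat.card_eq_fintype_card]
    exact Finite.card_range_le q
  have h4 : s ≤ I.spanFinrank := by exact_mod_cast h2
  omega

end Zeros

section Frobenius
variable {k : Type} [Field k] [CharP k 2] {s : ℕ} (Q : Fin s → Fin s → ZMod 2)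

/-- The scalar extension of a matrix. -/
def ext2 (k : Type) [Field k] [CharP k 2] (Q : Fin s → Fin s → ZMod 2) (i j : Fin s) : k :=
  ZMod.castHom (dvd_refl 2) k (Q i j)

/-- The polar form. -/
def bil (v w : Fin s → k) : k := ∑ i, ∑ j, ext2 k (fun i j => Q i j + Q j i) i j * (v i * w j)

lemma ext2_sq (i j : Fin s) : ext2 k Q i j ^ 2 = ext2 k Q i j := by
  rw [ext2, ← map_pow]
  congr 1
  generalize Q i j = a
  revert a
  decide

lemma bil_add_left (v v' w : Fin s → k) : bil Q (v + v') w = bil Q v w + bil Q v' w := by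
  simp only [bil, ← Finset.sum_add_distrib, Pi.add_apply]
  exact Finset.sum_congr rfl fun i _ => Finset.sum_congr rfl fun j _ => by ring

lemma bil_smul_left (r : k) (v w : Fin s → k) : bil Q (r • v) w = r * bil Q v w := by
  simp only [bil, Finset.mul_sum, Pi.smul_apply, smul_eq_mul]
  exact Finset.sum_congr rfl fun i _ => Finset.sum_congr rfl fun j _ => by ring

lemma bil_comm (v w : Fin s → k) : bil Q v w = bil Q w v := by
  rw [bil, Finset.sum_comm]
  refine Finset.sum_congr rfl fun i _ => Finset.sum_congr rfl fun j _ => ?_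
  simp only [ext2]
  rw [add_comm (Q j i), mul_comm (v j)]

lemma bil_zero_left (w : Fin s → k) : bil Q 0 w = 0 := by simp [bil]

lemma bil_add_right (v w w' : Fin s → k) : bil Q v (w + w') = bil Q v w + bil Q v w' := by
  rw [bil_comm, bil_add_left, bil_comm _ w, bil_comm _ w']

lemma bil_self (v : Fin s → k) : bil Q v v = 0 := by
  refine sum_sum_eq_zero _ (fun i j => ?_) fun i => ?_
  · simp only [ext2]
    rw [add_comm (Q j i), mul_comm (v j), add_self_two]
  · simp only [ext2]
    rw [add_self_two, map_zero, zero_mul]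

lemma qval_add (v w : Fin s → k) :
    qval (ext2 k Q) (v + w) = qval (ext2 k Q) v + qval (ext2 k Q) w + bil Q v w := by
  have h : bil Q v w = ∑ i, ∑ j, ext2 k Q i j * (v i * w j + w i * v j) := by
    simp only [bil, ext2, map_add, add_mul, Finset.sum_add_distrib, mul_add]
    congr 1
    rw [Finset.sum_comm]
    exact Finset.sum_congr rfl fun i _ => Finset.sum_congr rfl fun j _ => by ring
  rw [h]
  simp only [qval, ← Finset.sum_add_distrib, Pi.add_apply]
  exact Finset.sum_congr rfl fun i _ => Finset.sum_congr rfl fun j _ => by ring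

lemma qval_smul (r : k) (v : Fin s → k) :
    qval (ext2 k Q) (r • v) = r ^ 2 * qval (ext2 k Q) v := by
  simp only [qval, Finset.mul_sum, Pi.smul_apply, smul_eq_mul]
  exact Finset.sum_congr rfl fun i _ => Finset.sum_congr rfl fun j _ => by ring

/-- The Frobenius map. -/
def frob (v : Fin s → k) : Fin s → k := fun j => v j ^ 2

lemma frob_add (v w : Fin s → k) : frob (v + w) = frob v + frob w :=
  funext fun j => CharTwo.add_sq (v j) (w j)

lemma frob_bil (v w : Fin s → k) : bil Q (frob v) (frob w) = bil Q v w ^ 2 := by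
  simp only [bil, CharTwo.sum_sq]
  refine Finset.sum_congr rfl fun i _ => Finset.sum_congr rfl fun j _ => ?_
  rw [mul_pow, ext2_sq, mul_pow]
  rfl

lemma frob_qval (v : Fin s → k) : qval (ext2 k Q) (frob v) = qval (ext2 k Q) v ^ 2 := by
  simp only [qval, CharTwo.sum_sq]
  refine Finset.sum_congr rfl fun i _ => Finset.sum_congr rfl fun j _ => ?_
  rw [mul_pow, ext2_sq, mul_pow]
  rfl

lemma sval_eq (v : Fin s → k) : sval (ext2 k Q) v = bil Q v (frob v) := by
  have h1 : ∀ j, (∑ l, ext2 k (fun i j => Q i j + Q j i) l j * v l) ^ 2 =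
      ∑ l, ext2 k (fun i j => Q i j + Q j i) l j * v l ^ 2 := fun j => by
    rw [CharTwo.sum_sq]
    exact Finset.sum_congr rfl fun l _ => by rw [mul_pow, ext2_sq]
  have h2 : bil Q v (frob v) =
      ∑ j, v j * (∑ l, ext2 k (fun i j => Q i j + Q j i) l j * v l) ^ 2 := by
    rw [bil_comm, bil, Finset.sum_comm]
    refine Finset.sum_congr rfl fun j _ => ?_
    rw [h1, Finset.mul_sum]
    refine Finset.sum_congr rfl fun l _ => ?_
    simp only [frob]
    ring
  have h3 : ∀ j, ∑ l, (ext2 k Q l j + ext2 k Q j l) * (v l * v j) =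
      v j * ∑ l, ext2 k (fun i j => Q i j + Q j i) l j * v l := fun j => by
    rw [Finset.mul_sum]
    refine Finset.sum_congr rfl fun l _ => ?_
    simp only [ext2, map_add]
    ring
  rw [h2, sval]
  simp only [h3]
  have h4 : ∀ j, (∑ l, ext2 k (fun i j => Q i j + Q j i) l j * v l) =
    (∑ l, ext2 k Q l j * v l) + ∑ l, ext2 k Q j l * v l := fun j => by
    rw [← Finset.sum_add_distrib]
    refine Finset.sum_congr rfl fun l _ => ?_
    simp only [ext2, map_add]
    ring
  generalize hL : (fun j => ∑ l, ext2 k (fun i j => Q i j + Q j i) l j * v l) = L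
  have hL' : ∀ j, ∑ l, ext2 k (fun i j => Q i j + Q j i) l j * v l = L j := fun j => by rw [← hL]
  simp only [hL'] at h4 ⊢
  have h5 : ∀ j, v j * L j ^ 2 = ∑ l, (ext2 k Q l j * (v l * (v j * L j)) +
      ext2 k Q j l * (v l * (v j * L j))) := fun j => by
    rw [Finset.sum_add_distrib]
    nth_rewrite 1 [sq]
    nth_rewrite 1 [h4 j]
    rw [add_mul, mul_add, Finset.sum_mul, Finset.sum_mul, Finset.mul_sum, Finset.mul_sum]
    congr 1 <;> exact Finset.sum_congr rfl fun l _ => by ring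
  simp only [h5, Finset.sum_add_distrib, mul_add]
  rw [Finset.sum_comm (f := fun x i => ext2 k Q i x * (v i * (v x * L x)))]
  congr 1
  exact Finset.sum_congr rfl fun i _ => Finset.sum_congr rfl fun j _ => by ring

/-- A Frobenius stable subspace contains a rational vector. -/
lemma exists_rational (U : Submodule k (Fin s → k)) (hU : ∀ u ∈ U, frob u ∈ U) (hne : U ≠ ⊥) :
    ∃ w : Fin s → ZMod 2, w ≠ 0 ∧ (fun j => ZMod.castHom (dvd_refl 2) k (w j)) ∈ U := by
  classical
  let supp : (Fin s → k) → Finset (Fin s) := fun u => Finset.univ.filter fun j => u j ≠ 0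
  obtain ⟨u₀, hu₀, hu₀'⟩ := (Submodule.ne_bot_iff U).1 hne
  have hex : ∃ N, ∃ u ∈ U, u ≠ 0 ∧ (supp u).card = N := ⟨_, u₀, hu₀, hu₀', rfl⟩
  obtain ⟨u, hu, hu0, hN⟩ := Nat.find_spec hex
  have hmin : ∀ w ∈ U, (supp w).card < (supp u).card → w = 0 := fun w hw hlt => by
    by_contra h
    exact Nat.find_min hex (hN ▸ hlt) ⟨w, hw, h, rfl⟩
  obtain ⟨j, hj⟩ := Function.ne_iff.1 hu0
  have hj : u j ≠ 0 := hj
  set w := (u j)⁻¹ • u with hw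
  have hwU : w ∈ U := U.smul_mem _ hu
  have hwj : w j = 1 := by simp [hw, hj]
  have h1 : frob w - w = 0 := by
    refine hmin _ (sub_mem (hU w hwU) hwU) (Finset.card_lt_card ?_)
    refine (Finset.ssubset_iff_of_subset fun l hl => ?_).2 ⟨j, ?_, ?_⟩
    · simp only [supp, Finset.mem_filter, Finset.mem_univ, true_and] at hl ⊢
      intro h
      apply hl
      simp [frob, hw, h]
    · simpa [supp] using hj
    · simp [supp, show frob w j = 1 by rw [frob, hwj, one_pow], hwj]
  have h2 : ∀ l, w l = 0 ∨ w l = 1 := fun l => by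
    have h3 : w l ^ 2 - w l = 0 := congrFun h1 l
    have h4 : w l * (w l - 1) = 0 := by rw [← h3]; ring
    rcases mul_eq_zero.1 h4 with h | h
    · exact Or.inl h
    · exact Or.inr (sub_eq_zero.1 h)
  refine ⟨fun l => if w l = 0 then 0 else 1, fun h => ?_, ?_⟩
  · have := congrFun h j
    simp [hwj] at this
  · convert hwU using 1
    funext l
    rcases h2 l with h | h <;> simp [h]

/-- A Serre type argument for producing rational zeros. -/
theorem exists_rational_zero [IsAlgClosed k] {o : Type} [Fintype o]
    (Q : o → Fin s → Fin s → ZMod 2) (ho : Fintype.card o < s)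
    (hs : ∀ v : Fin s → k, (∀ i, qval (ext2 k (Q i)) v = 0) → ∀ i, sval (ext2 k (Q i)) v = 0) :
    ∃ w : Fin s → ZMod 2, w ≠ 0 ∧ ∀ i, qval (Q i) w = 0 := by
  obtain ⟨v, hv0, hv⟩ := exists_common_zero (k := k)
    (fun i => ∑ a, ∑ b, MvPolynomial.C (ext2 k (Q i) a b) * (MvPolynomial.X a * MvPolynomial.X b))
    (fun i => by simp) ho
  have hv : ∀ i, qval (ext2 k (Q i)) v = 0 := fun i => by simpa [qval] using hv i
  have hq : ∀ a i, qval (ext2 k (Q i)) (frob^[a] v) = 0 := by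
    intro a
    induction a with
    | zero => exact hv
    | succ a ih =>
      intro i
      rw [Function.iterate_succ_apply', frob_qval, ih, sq, zero_mul]
  have hsh : ∀ t a b i, bil (Q i) (frob^[a] v) (frob^[b] v) = 0 →
      bil (Q i) (frob^[a + t] v) (frob^[b + t] v) = 0 := by
    intro t
    induction t with
    | zero => exact fun _ _ _ h => h
    | succ t ih =>
      intro a b i h
      rw [← add_assoc, ← add_assoc, Function.iterate_succ_apply', Function.iterate_succ_apply',
        frob_bil, ih a b i h, sq, zero_mul]
  have h1 : ∀ i, bil (Q i) v (frob v) = 0 := fun i => by rw [← sval_eq]; exact hs v hv i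
  have h2 : ∀ b i, bil (Q i) v (frob^[b] v) = 0 := by
    intro b
    induction b using Nat.strong_induction_on with
    | _ b ih =>
      rcases b with _ | _ | b
      · exact fun i => bil_self _ v
      · exact h1
      · intro i
        have h3 : ∀ i, qval (ext2 k (Q i)) (v + frob^[b + 1] v) = 0 := fun i => by
          rw [qval_add, hv, hq, ih (b + 1) (by omega), add_zero, add_zero]
        have h4 := hs _ h3 i
        rw [sval_eq, frob_add, bil_add_left, bil_add_right, bil_add_right, h1,
          ← Function.iterate_succ_apply' frob, bil_comm _ (frob^[b + 1] v) (frob v)] at h4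
        have h5 := hsh 1 0 b i (ih b (by omega) i)
        have h6 := hsh (b + 1) 0 1 i (h1 i)
        rw [add_comm 1, zero_add] at h6
        rw [h6, show bil (Q i) (frob v) (frob^[b + 1] v) = 0 from h5, zero_add, add_zero,
          add_zero] at h4
        exact h4
  have h3 : ∀ a b i, bil (Q i) (frob^[a] v) (frob^[b] v) = 0 := by
    intro a b i
    rcases le_total a b with h | h
    · have := hsh a 0 (b - a) i (h2 _ i)
      rwa [zero_add, Nat.sub_add_cancel h] at this
    · have := hsh b 0 (a - b) i (h2 _ i)
      rw [zero_add, Nat.sub_add_cancel h] at this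
      rwa [bil_comm]
  set U := Submodule.span k (Set.range fun a => frob^[a] v) with hU
  have hbil : ∀ i, ∀ x ∈ U, ∀ y ∈ U, bil (Q i) x y = 0 := by
    intro i x hx y hy
    induction hx using Submodule.span_induction with
    | mem x hx =>
      obtain ⟨a, rfl⟩ := hx
      rw [bil_comm]
      induction hy using Submodule.span_induction with
      | mem y hy =>
        obtain ⟨b, rfl⟩ := hy
        exact h3 _ _ _
      | zero => exact bil_zero_left _ _
      | add y z _ _ h h' => rw [bil_add_left, h, h', add_zero]
      | smul r y _ h => rw [bil_smul_left, h, mul_zero]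
    | zero => exact bil_zero_left _ _
    | add y z _ _ h h' => rw [bil_add_left, h, h', add_zero]
    | smul r y _ h => rw [bil_smul_left, h, mul_zero]
  have hqU : ∀ i, ∀ x ∈ U, qval (ext2 k (Q i)) x = 0 := by
    intro i x hx
    induction hx using Submodule.span_induction with
    | mem x hx =>
      obtain ⟨a, rfl⟩ := hx
      exact hq _ _
    | zero => simp [qval]
    | add y z hy hz h h' => rw [qval_add, h, h', hbil i y hy z hz, add_zero, add_zero]
    | smul r y _ h => rw [qval_smul, h, mul_zero]
  have hfU : ∀ x ∈ U, frob x ∈ U := by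
    intro x hx
    induction hx using Submodule.span_induction with
    | mem x hx =>
      obtain ⟨a, rfl⟩ := hx
      exact Submodule.subset_span ⟨a + 1, Function.iterate_succ_apply' _ _ _⟩
    | zero => convert U.zero_mem; funext j; simp [frob]
    | add y z _ _ h h' => rw [frob_add]; exact add_mem h h'
    | smul r y _ h =>
      convert U.smul_mem (r ^ 2) h using 1
      funext j
      simp [frob, mul_pow]
  obtain ⟨w, hw, hwU⟩ := exists_rational U hfU ((Submodule.ne_bot_iff U).2
    ⟨v, Submodule.subset_span ⟨0, rfl⟩, hv0⟩)
  refine ⟨w, hw, fun i => ?_⟩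
  have h4 := hqU i _ hwU
  refine (ZMod.castHom (dvd_refl 2) k).injective ?_
  rw [map_zero, ← h4]
  simp only [qval, map_sum, map_mul, ext2]

end Frobenius
end AlexSpan

end

section

open TensorProduct

namespace AlexSpan

section BaseChange
variable {C : Type} [Ring C] [Algebra (ZMod 2) C] [CharP C 2] {s : ℕ}
  {D : C →ₗ[ZMod 2] C} {g : Fin s → C →ₐ[ZMod 2] C}
  (k : Type) [Field k] [CharP k 2] [Algebra (ZMod 2) k]

/-- Scalar extension of an endomorphism. -/
noncomputable abbrev extEnd (f : C →ₐ[ZMod 2] C) : k ⊗[ZMod 2] C →ₐ[k] k ⊗[ZMod 2] C :=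
  Algebra.TensorProduct.map (AlgHom.id k k) f

lemma InvAlg.baseChange (h : InvAlg D g) :
    InvAlg (D.baseChange k) fun j => extEnd k (g j) where
  d_mul a b := by
    induction a using TensorProduct.induction_on with
    | zero => simp
    | add x y hx hy => rw [add_mul, map_add, hx, hy, map_add]; noncomm_ring
    | tmul r x =>
      induction b using TensorProduct.induction_on with
      | zero => simp
      | add x y hx hy => rw [mul_add, map_add, hx, hy, map_add]; noncomm_ring
      | tmul t y =>
        simp only [Algebra.TensorProduct.tmul_mul_tmul, LinearMap.baseChange_tmul, h.d_mul,
          TensorProduct.tmul_add]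
  d_d a := by
    induction a using TensorProduct.induction_on with
    | zero => simp
    | add x y hx hy => rw [map_add, map_add, hx, hy, add_zero]
    | tmul r x => simp [h.d_d]
  g_d j a := by
    induction a using TensorProduct.induction_on with
    | zero => simp
    | add x y hx hy => simp only [map_add, hx, hy]
    | tmul r x => simp [h.g_d]
  comm i j a := by
    induction a using TensorProduct.induction_on with
    | zero => simp
    | add x y hx hy => simp only [map_add, hx, hy]
    | tmul r x => simp [h.comm i j]
  inv j a := by
    induction a using TensorProduct.induction_on with
    | zero => simp
    | add x y hx hy => simp only [map_add, hx, hy]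
    | tmul r x => simp [h.inv]

lemma one_tmul_algebraMap (a : ZMod 2) :
    (1 : k) ⊗ₜ[ZMod 2] (algebraMap (ZMod 2) C a) =
      algebraMap k (k ⊗[ZMod 2] C) (ZMod.castHom (dvd_refl 2) k a) := by
  rw [show ZMod.castHom (dvd_refl 2) k = algebraMap (ZMod 2) k from Subsingleton.elim _ _,
    Algebra.TensorProduct.algebraMap_apply, Algebra.algebraMap_self, RingHom.id_apply,
    Algebra.algebraMap_eq_smul_one, Algebra.algebraMap_eq_smul_one, TensorProduct.smul_tmul]

lemma IsExt.baseChange {c : C} {u : Fin s → C} {Q : Fin s → Fin s → ZMod 2}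
    (hx : IsExt D g c u Q) : IsExt (D.baseChange k) (fun j => extEnd k (g j)) (1 ⊗ₜ c)
      (fun j => 1 ⊗ₜ u j) (ext2 k Q) where
  closed := by simp [hx.closed]
  diff j := by simp [← TensorProduct.tmul_add, hx.diff]
  diag j := by
    rw [ext2, ← one_tmul_algebraMap, ← hx.diag, TensorProduct.tmul_add]
    simp
  polar i j := by
    rw [ext2, ext2, ← map_add, ← one_tmul_algebraMap, ← hx.polar]
    simp [TensorProduct.tmul_add]

/-- The transgression of the square over extension fields. -/
theorem sval_ext_eq_zero (h : InvAlg D g) {m : ℕ} {c : Fin m → C} {u : Fin m → Fin s → C}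
    {Q : Fin m → Fin s → Fin s → ZMod 2} (hx : ∀ i, IsExt D g (c i) (u i) (Q i))
    (hspan : ∀ a, D a = 0 → a ∈ Submodule.span (ZMod 2)
      (Set.range fun l : List (Fin m) => (l.map c).prod) ⊔ LinearMap.range D)
    (i : Fin m) (p : ℕ) (hp : Odd (p + 1)) (hc : c i ^ (2 * (p + 1)) ∈ LinearMap.range D)
    (hne : c i ^ (2 * p) ∉ LinearMap.range D) (v : Fin s → k)
    (hv : ∀ i, qval (ext2 k (Q i)) v = 0) : sval (ext2 k (Q i)) v = 0 := by
  have : CharP (k ⊗[ZMod 2] C) 2 := by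
    have hinj : Function.Injective
        (Algebra.TensorProduct.includeRight : C →ₐ[ZMod 2] k ⊗[ZMod 2] C) :=
      Algebra.TensorProduct.includeRight_injective (algebraMap (ZMod 2) k).injective
    exact charP_of_injective_ringHom (f := Algebra.TensorProduct.includeRight.toRingHom) hinj 2
  have hpow : ∀ q, ((1 : k) ⊗ₜ[ZMod 2] c i) ^ q = 1 ⊗ₜ (c i ^ q) := fun q => by
    rw [Algebra.TensorProduct.tmul_pow, one_pow]
  refine (h.baseChange k).sval_eq_zero v (fun i => (hx i).baseChange k) hv ?_ i p hp ?_ ?_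
  · intro a ha
    have hex : Function.Exact (LinearMap.ker D).subtype D := LinearMap.exact_subtype_ker_map D
    obtain ⟨b, rfl⟩ := (Module.Flat.lTensor_exact k hex a).1 ha
    clear ha
    induction b using TensorProduct.induction_on with
    | zero => rw [map_zero]; exact zero_mem _
    | add x y hx hy => rw [map_add]; exact add_mem hx hy
    | tmul r z =>
      rw [LinearMap.lTensor_tmul, Submodule.subtype_apply]
      obtain ⟨x, hx, _, ⟨y, rfl⟩, hz⟩ := Submodule.mem_sup.1 (hspan z.1 z.2)
      rw [← hz, TensorProduct.tmul_add]
      refine add_mem (Submodule.mem_sup_left ?_) (Submodule.mem_sup_right ⟨r ⊗ₜ y, by simp⟩)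
      clear hz
      induction hx using Submodule.span_induction with
      | mem x hx =>
        obtain ⟨l, rfl⟩ := hx
        rw [show r ⊗ₜ[ZMod 2] (l.map c).prod = r • ((1 : k) ⊗ₜ[ZMod 2] (l.map c).prod) by
          rw [TensorProduct.smul_tmul', smul_eq_mul, mul_one]]
        refine Submodule.smul_mem _ _ (Submodule.subset_span ⟨l, ?_⟩)
        have := map_list_prod
          (Algebra.TensorProduct.includeRight : C →ₐ[ZMod 2] k ⊗[ZMod 2] C) (l.map c)
        rw [List.map_map] at this
        exact this.symm
      | zero => rw [TensorProduct.tmul_zero]; exact zero_mem _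
      | add x y _ _ hx hy => rw [TensorProduct.tmul_add]; exact add_mem hx hy
      | smul t x _ hx =>
        rw [TensorProduct.tmul_smul, ← algebraMap_smul k t]
        exact Submodule.smul_mem _ _ hx
  · obtain ⟨y, hy⟩ := hc
    exact ⟨1 ⊗ₜ y, by rw [hpow, LinearMap.baseChange_tmul, hy]⟩
  · rintro r ⟨y, hy⟩
    obtain ⟨f, hf, hf'⟩ := Submodule.exists_le_ker_of_notMem hne
    have h1 : ∀ y, LinearMap.lTensor k f (D.baseChange k y) = 0 := fun y => by
      induction y using TensorProduct.induction_on with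
      | zero => simp
      | add x y hx hy => rw [map_add, map_add, hx, hy, add_zero]
      | tmul t x =>
        rw [LinearMap.baseChange_tmul, LinearMap.lTensor_tmul, show f (D x) = 0 from hf' ⟨x, rfl⟩,
          TensorProduct.tmul_zero]
    have h2 := h1 y
    have hf1 : f (c i ^ (2 * p)) = 1 := by
      generalize f (c i ^ (2 * p)) = a at hf
      revert a
      decide
    rw [hy, hpow, TensorProduct.smul_tmul', smul_eq_mul, mul_one, LinearMap.lTensor_tmul, hf1] at h2
    have h3 := congrArg (TensorProduct.rid (ZMod 2) k) h2
    rwa [TensorProduct.rid_tmul, one_smul, map_zero] at h3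

end BaseChange
end AlexSpan

end

namespace AlexSpan

section Count
variable {G : Type} [CommGroup G] [Finite G] {m : ℕ} [MulAction G (Fin m)]

/-- The order of a commutative permutation group. -/
lemma card_le_of_mulAction (K : Subgroup G) (hK : ∀ g : G, (∀ j : Fin m, g • j = j) → g ∈ K)
    (hcard : Nat.card K ≤ 2 ^ Nat.card (MulAction.orbitRel.Quotient G (Fin m))) :
    Nat.card G ≤ 2 ^ m := by
  classical
  have := Fintype.ofFinite (MulAction.orbitRel.Quotient G (Fin m))
  have h1 : Nat.card (G ⧸ K) ≤
      ∏ t : MulAction.orbitRel.Quotient G (Fin m), Nat.card t.orbit := by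
    rw [← Nat.card_pi]
    have hs : Function.Surjective (QuotientGroup.mk : G → G ⧸ K) := QuotientGroup.mk_surjective
    refine Nat.card_le_card_of_injective (fun x t => ⟨Function.surjInv hs x • t.out, ?_⟩) ?_
    · rw [MulAction.orbitRel.Quotient.mem_orbit]
      rw [← Quotient.out_eq t, Quotient.out_eq t]
      conv_rhs => rw [← Quotient.out_eq t]
      exact Quotient.sound (MulAction.mem_orbit _ _)
    · intro x y hxy
      rw [← Function.surjInv_eq hs x, ← Function.surjInv_eq hs y]
      refine QuotientGroup.eq.2 (hK _ fun j => ?_)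
      have h2 := congrArg Subtype.val (congrFun hxy (Quotient.mk'' j))
      obtain ⟨h, hh⟩ : ∃ h : G, h • j =
          (Quotient.mk'' j : MulAction.orbitRel.Quotient G (Fin m)).out :=
        MulAction.orbitRel_apply.1 (Quotient.mk_out j)
      simp only [← hh] at h2
      rw [mul_smul, inv_smul_eq_iff]
      refine (smul_left_cancel h ?_).symm
      rw [smul_smul, smul_smul, mul_comm h, mul_comm h, ← smul_smul, ← smul_smul, h2]
  have h3 : ∑ t : MulAction.orbitRel.Quotient G (Fin m), Nat.card t.orbit = m := by
    rw [← Nat.card_sigma, ← Nat.card_congr (MulAction.selfEquivSigmaOrbits' G (Fin m)),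
      Nat.card_fin]
  rw [Subgroup.card_eq_card_quotient_mul_card_subgroup K]
  refine (Nat.mul_le_mul h1 hcard).trans ?_
  rw [Nat.card_eq_fintype_card, ← Finset.card_univ, ← Finset.prod_const, ← Finset.prod_mul_distrib]
  conv_rhs => rw [← h3, ← Finset.prod_pow_eq_pow_sum]
  refine Finset.prod_le_prod' fun t _ => ?_
  have h4 : ∀ N : ℕ, 1 ≤ N → N * 2 ≤ 2 ^ N := fun N hN => by
    obtain ⟨M, rfl⟩ := Nat.exists_eq_add_of_le' hN
    rw [pow_succ]
    exact Nat.mul_le_mul_right 2 M.lt_two_pow_self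
  refine h4 _ ?_
  have : Nonempty t.orbit := (MulAction.orbitRel.Quotient.nonempty_orbit t).to_subtype
  exact Nat.card_pos
end Count

section Closed
variable {C : Type} [GDga C] [CharP C 2] [Algebra (ZMod 2) C] {m n : ℕ}

/-- The differential as a linear map. -/
def dLin (C : Type) [GDga C] [Algebra (ZMod 2) C] : C →ₗ[ZMod 2] C := Dga.d.toZModLinearMap 2

lemma mem_span_of_closed {c : Fin m → Cocycles C} (hv : IsTrunc n fun i => cl (c i)) (a : C)
    (ha : dLin C a = 0) : a ∈ Submodule.span (ZMod 2)
      (Set.range fun l : List (Fin m) => (l.map fun i => (c i).1).prod) ⊔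
        LinearMap.range (dLin C) := by
  set S := Submodule.span (ZMod 2)
      (Set.range fun l : List (Fin m) => (l.map fun i => (c i).1).prod)
  have h1 : ∀ x : H C, ∃ b : Cocycles C, cl b = x ∧ b.1 ∈ S := by
    intro x
    have hx := hv.span (Submodule.mem_top (x := x))
    induction hx using Submodule.span_induction with
    | mem x hx =>
      obtain ⟨M, rfl⟩ := hx
      refine ⟨mon n c M, map_mon cl n c M, Submodule.subset_span ?_⟩
      have h2 : (mon n c M).1 ∈ MonoidHom.mrange (FreeMonoid.lift fun i => (c i).1) := by
        rw [show (mon n c M).1 = mon n (fun i => (c i).1) M from map_mon (Cocycles C).subtype n c M]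
        refine Submonoid.list_prod_mem _ fun x hx => ?_
        obtain ⟨j, rfl⟩ := List.mem_ofFn.1 hx
        have hj : (c j).1 ∈ MonoidHom.mrange (FreeMonoid.lift fun i => (c i).1) :=
          ⟨FreeMonoid.of j, FreeMonoid.lift_eval_of _ _⟩
        exact pow_mem hj _
      obtain ⟨l, hl⟩ := h2
      exact ⟨l.toList, by rw [← hl, FreeMonoid.lift_apply]⟩
    | zero => exact ⟨0, map_zero _, zero_mem _⟩
    | add x y _ _ hx hy =>
      obtain ⟨b, rfl, hb⟩ := hx
      obtain ⟨b', rfl, hb'⟩ := hy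
      exact ⟨b + b', map_add _ _ _, add_mem hb hb'⟩
    | smul r x _ hx =>
      obtain ⟨b, rfl, hb⟩ := hx
      rcases (show ∀ c : ZMod 2, c = 0 ∨ c = 1 by decide) r with rfl | rfl
      · exact ⟨0, by rw [zero_smul, map_zero], zero_mem _⟩
      · exact ⟨b, by rw [one_smul], hb⟩
  obtain ⟨b, hb, hbS⟩ := h1 (cl ⟨a, ha⟩)
  obtain ⟨y, hy⟩ := cl_eq.1 hb
  rw [show a = b.1 + Dga.d y by rw [← hy]; grind]
  exact add_mem (Submodule.mem_sup_left hbS) (Submodule.mem_sup_right ⟨y, rfl⟩)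

end Closed

section Fixed
variable {C : Type} [GDga C] [CharP C 2] {G : Type} [CommGroup G]
variable {ρ : G →* (C →+* C)} (hρ : IsFreeAct ρ) {m n : ℕ} {v : Fin m → H C}
include hρ

/-- The order of the subgroup acting trivially on cohomology. -/
theorem IsFreeAct.card_le_of_fixed [Finite G] (hv : IsTrunc n v) (hd : ∀ j, IsDeg 1 (v j)) {p : ℕ}
    (hn : n + 1 = 2 * (p + 1)) (hp : Odd (p + 1)) (K : Subgroup G)
    (hK : ∀ g ∈ K, ∀ j, hρ.act g (v j) = v j) {o : Type} [Finite o] (f : Fin m → o)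
    (hf : Function.Surjective f)
    (hfK : ∀ i j, f i = f j → ∀ g ∈ K, ∀ ε, Obs (ρ g) (v i) ε → Obs (ρ g) (v j) ε) :
    Nat.card K ≤ 2 ^ Nat.card o := by
  classical
  have := Fintype.ofFinite o
  let _ : Algebra (ZMod 2) C := ZMod.algebra C 2
  have hC := hv.conn hd
  have h2 : ∀ x : Additive K, 2 • x = 0 := fun x => by
    rw [two_nsmul]
    exact Subtype.ext (hρ.sq _)
  let _ : Module (ZMod 2) (Additive K) := AddCommGroup.zmodModule h2
  have hcast : ∀ a, algebraMap (ZMod 2) C a = ZMod.castHom (dvd_refl 2) C a := fun a =>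
    congrArg (fun f : ZMod 2 →+* C => f a) (Subsingleton.elim _ _)
  let q : Fin m → Additive K → ZMod 2 := fun i x => if Obs (ρ x.toMul.1) (v i) 1 then 1 else 0
  have hq : ∀ i (x : Additive K) ε, Obs (ρ x.toMul.1) (v i) ε → q i x = ε := by
    intro i x ε h
    rcases (show ∀ c : ZMod 2, c = 0 ∨ c = 1 by decide) ε with rfl | rfl
    · refine if_neg fun h' => ?_
      exact zero_ne_one (Obs.unique hC (hρ.endo _) (hρ.inv _) h h')
    · exact if_pos h
  have hob : ∀ i (x : Additive K), Obs (ρ x.toMul.1) (v i) (q i x) := fun i x => by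
    obtain ⟨ε, hε⟩ := exists_obs hC (hρ.endo x.toMul.1) (hρ.inv _) (hd i) (hK _ x.toMul.2 i)
    rwa [hq i x ε hε]
  clear_value q
  have hpol : ∀ i, ∃ b : Additive K → Additive K → ZMod 2, (∀ x x' y, b (x + x') y = b x y + b x' y) ∧
      ∀ x y, QuadraticMap.polar (q i) x y = b x y := fun i => by
    obtain ⟨b, hb1, hb2⟩ := hρ.exists_polar hC (hd i)
    refine ⟨fun x y => b x.toMul.1 y.toMul.1, fun x x' y => hb1 _ _ _ (hK _ x.toMul.2 i)
      (hK _ x'.toMul.2 i) (hK _ y.toMul.2 i), fun x y => ?_⟩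
    rw [QuadraticMap.polar, hq i (x + y) _ (hb2 _ _ _ _ (hob i x) (hob i y) (hK _ x.toMul.2 i)
      (hK _ y.toMul.2 i))]
    ring
  have hq0 : ∀ i, q i 0 = 0 := fun i => by
    obtain ⟨b, hb1, hb2⟩ := hpol i
    have h3 := hb1 0 0 0
    have h4 := hb2 0 0
    rw [add_zero, left_eq_add] at h3
    rwa [QuadraticMap.polar, add_zero, h3, sub_self, zero_sub, neg_eq_zero] at h4
  let Qf : Fin m → QuadraticForm (ZMod 2) (Additive K) := fun i => QuadraticMap.ofPolar (q i)
    (fun a x => by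
      rcases (show ∀ c : ZMod 2, c = 0 ∨ c = 1 by decide) a with rfl | rfl
      · rw [zero_smul, hq0, zero_mul, zero_smul]
      · rw [one_smul, one_mul, one_smul])
    (fun x x' y => by
      obtain ⟨b, hb1, hb2⟩ := hpol i
      rw [hb2, hb2, hb2, hb1])
    (fun a x y => by
      obtain ⟨b, hb1, hb2⟩ := hpol i
      rcases (show ∀ c : ZMod 2, c = 0 ∨ c = 1 by decide) a with rfl | rfl
      · rw [zero_smul, zero_smul, QuadraticMap.polar, zero_add, hq0]
        ring
      · rw [one_smul, one_smul])
  let bm := Module.finBasis (ZMod 2) (Additive K)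
  set s := Module.finrank (ZMod 2) (Additive K)
  have hcardK : Nat.card K = 2 ^ s := by
    refine (Nat.card_congr (Additive.ofMul (α := K))).trans ?_
    rw [Module.natCard_eq_pow_finrank (K := ZMod 2), Nat.card_zmod]
  rw [hcardK]
  refine Nat.pow_le_pow_right (by norm_num) ?_
  by_contra hlt
  push Not at hlt
  let e : Fin s → G := fun a => (bm a).toMul.1
  have heK : ∀ a, e a ∈ K := fun a => (bm a).toMul.2
  let Q : Fin m → Fin s → Fin s → ZMod 2 := fun i a b => (Qf i).toBilin bm (bm a) (bm b)
  have hQq : ∀ i (w : Fin s → ZMod 2), q i (∑ a, w a • bm a) = qval (Q i) w := fun i w => by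
    change Qf i _ = _
    rw [← (Qf i).toQuadraticMap_toBilin bm, LinearMap.BilinMap.toQuadraticMap_apply]
    simp only [map_sum, map_smul, qval, Q, smul_eq_mul]
    simp only [LinearMap.sum_apply, LinearMap.smul_apply, smul_eq_mul, Finset.mul_sum]
    rw [Finset.sum_comm]
    exact Finset.sum_congr rfl fun a _ => Finset.sum_congr rfl fun b _ => by ring
  have hQf : ∀ i j, f i = f j → Q i = Q j := by
    intro i j hij
    have h3 : q i = q j := funext fun x => (hq j x _ (hfK i j hij _ x.toMul.2 _ (hob i x))).symm
    have h4 : Qf i = Qf j := QuadraticMap.ext fun x => congrFun h3 x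
    simp only [Q, h4]
  have hQ1 : ∀ i a, Q i a a = q i (bm a) := fun i a => by
    simp only [Q, QuadraticMap.toBilin_apply, if_true]
    rfl
  have hQ2 : ∀ i a b, a ≠ b → Q i a b + Q i b a = QuadraticMap.polar (q i) (bm a) (bm b) := by
    intro i a b hab
    simp only [Q, QuadraticMap.toBilin_apply, if_neg hab, if_neg hab.symm]
    rcases lt_or_gt_of_ne hab with h | h
    · rw [if_pos h, if_neg h.not_gt, add_zero]
      rfl
    · rw [if_pos h, if_neg h.not_gt, zero_add, QuadraticMap.polar_comm]
      rfl
  have hrep : ∀ i, ∃ c : Cocycles C, GDga.pr 1 c.1 = c.1 ∧ v i = cl c := fun i => isDeg_iff.1 (hd i)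
  choose c hc hvc using hrep
  have hprim : ∀ i a, ∃ u, GDga.pr 0 u = u ∧ (c i).1 + ρ (e a) (c i).1 = Dga.d u := fun i a =>
    exists_primitive (hρ.endo (e a)) (hc i) (by rw [← hvc]; exact hK _ (heK a) i)
  choose u hu0 hu using hprim
  let gg : Fin s → C →ₐ[ZMod 2] C := fun a =>
    AlgHom.mk (ρ (e a)) fun r => (congrArg (ρ (e a)) (hcast r)).trans
      ((map_cast (ρ (e a)) r).trans (hcast r).symm)
  have hgg : ∀ a x, gg a x = ρ (e a) x := fun _ _ => rfl
  have hinv : InvAlg (dLin C) gg :=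
    { d_mul := Dga.d_mul
      d_d := Dga.d_d
      g_d := fun a x => (hρ.endo (e a)).d x
      comm := fun a b x => hρ.comm (e a) (e b) x
      inv := fun a x => hρ.inv (e a) x }
  have hdiag : ∀ i a, u i a + ρ (e a) (u i a) = ZMod.castHom (dvd_refl 2) C (q i (bm a)) := by
    intro i a
    obtain ⟨ε, hε⟩ := hC.exists_cast (a := u i a + ρ (e a) (u i a)) (by
      rw [map_add, ← (hρ.endo _).d, ← hu, map_add, hρ.inv]
      grind) (by rw [map_add, ← (hρ.endo _).pr, hu0])
    rw [hε, hq i (bm a) ε ⟨c i, u i a, hc i, hvc i, hu0 i a, hu i a, hε⟩]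
  have hext : ∀ i, IsExt (dLin C) gg (c i).1 (u i) (Q i) := fun i =>
    { closed := (c i).2
      diff := fun a => hu i a
      diag := fun a => by rw [hcast, hQ1, hgg, hdiag]
      polar := fun a b => by
        rw [hcast, hgg, hgg]
        by_cases hab : a = b
        · subst hab
          rw [add_self_two, add_self_two, map_zero]
        obtain ⟨β, hβ⟩ := hC.exists_cast
          (a := u i a + ρ (e b) (u i a) + (u i b + ρ (e a) (u i b))) (by
            rw [map_add, map_add, map_add, ← (hρ.endo _).d, ← (hρ.endo _).d, ← hu, ← hu, map_add,
              map_add, hρ.comm (e b)]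
            grind) (by
            rw [map_add, map_add, map_add, ← (hρ.endo _).pr, ← (hρ.endo _).pr, hu0, hu0])
        have h3 := hρ.obs_mul (hc i) (hu0 i a) (hu0 i b) (hu i a) (hu i b) (hdiag i a) (hdiag i b) hβ
        rw [← hvc] at h3
        rw [hβ, hQ2 i a b hab, QuadraticMap.polar, hq i (bm a + bm b) _ h3]
        congr 1
        ring }
  have hv' : IsTrunc n fun i => cl (c i) := by
    rwa [show (fun i => cl (c i)) = v from (funext hvc).symm]
  have hexact : ∀ i t, v i ^ t = 0 ↔ (c i).1 ^ t ∈ LinearMap.range (dLin C) := fun i t => by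
    rw [hvc, ← map_pow, cl_eq_zero]
    exact ⟨fun ⟨y, hy⟩ => ⟨y, hy.symm⟩, fun ⟨y, hy⟩ => ⟨y, hy.symm⟩⟩
  have hpow : ∀ i, v i ^ (2 * p) ≠ 0 := fun i h => by
    have h3 := hv.indep.ne_zero (Function.update (fun _ => (0 : Fin (n + 1))) i ⟨2 * p, by omega⟩)
    apply h3
    let _ := hv.commRing
    rw [mon_eq_prod]
    exact Finset.prod_eq_zero (Finset.mem_univ i) (by simpa using h)
  let g := Function.surjInv hf
  have hfg : ∀ t, f (g t) = t := Function.surjInv_eq hf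
  obtain ⟨w, hw0, hw⟩ := exists_rational_zero (k := AlgebraicClosure (ZMod 2))
    (fun t : o => Q (g t)) (by rwa [← Nat.card_eq_fintype_card]) fun x hx t =>
      sval_ext_eq_zero _ hinv hext (mem_span_of_closed hv') (g t) p hp
        ((hexact _ _).1 (by rw [← hn]; exact hv.pow _)) (fun h => hpow _ ((hexact _ _).2 h)) x
        fun i => by rw [hQf i (g (f i)) (hfg (f i)).symm]; exact hx (f i)
  have hne : (∑ a, w a • bm a) ≠ 0 := fun h => hw0 (funext fun a =>
    Fintype.linearIndependent_iff.1 bm.linearIndependent w h a)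
  set x := ∑ a, w a • bm a with hx
  have hx1 : x.toMul.1 ≠ 1 := fun h => hne (Subtype.ext h)
  obtain ⟨j, -, hj⟩ := (hρ.free _ hx1).exists_obs_one_of_perm hv hd hC id (fun _ => rfl)
    (fun j => hK _ x.toMul.2 j)
  have h3 := hq j x 1 hj
  rw [hQq, hQf j (g (f j)) (hfg (f j)).symm, hw] at h3
  exact zero_ne_one h3

/-- The bound for `n` congruent to one modulo four, above one. -/
theorem IsFreeAct.rank_le [Finite G] (hv : IsTrunc n v) (hd : ∀ j, IsDeg 1 (v j)) {p r : ℕ}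
    (hn : n + 1 = 2 * (p + 1)) (hp : Odd (p + 1)) (hp1 : 1 ≤ p) (hG : Nat.card G = 2 ^ r) :
    r ≤ m := by
  classical
  have hinj : Function.Injective v := (hv.linearIndependent (by omega)).injective
  obtain ⟨b, rfl⟩ := Nat.exists_eq_add_of_le' hp1
  have hperm : ∀ (g : G) j, ∃ k, hρ.act g (v j) = v k := fun g j =>
    hv.exists_perm hd (a := 1) (b := b) (by rw [hn, pow_one]) hp (hρ.endo g) (hρ.inv g) j
  choose σ hσ using hperm
  let _ : MulAction G (Fin m) :=
    { smul := σ
      one_smul := fun j => hinj (by change v (σ 1 j) = _; rw [← hσ, hρ.act_one])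
      mul_smul := fun g h j => hinj (by
        change v (σ (g * h) j) = v (σ g (σ h j)); rw [← hσ, ← hσ, ← hσ, hρ.act_mul]) }
  have hsm : ∀ (g : G) (j : Fin m), hρ.act g (v j) = v (g • j) := hσ
  let K : Subgroup G := (MulAction.toPermHom G (Fin m)).ker
  have hK : ∀ g : G, g ∈ K ↔ ∀ j : Fin m, g • j = j := fun g => by
    rw [MonoidHom.mem_ker, Equiv.ext_iff]
    rfl
  have h1 := hρ.card_le_of_fixed hv hd hn hp K (fun g hg j => by rw [hsm, (hK g).1 hg])
    (fun j => (Quotient.mk'' j : MulAction.orbitRel.Quotient G (Fin m))) Quotient.mk''_surjective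
    fun i j hij g _ ε h => by
      obtain ⟨h', hh⟩ : ∃ h' : G, h' • i = j := MulAction.orbitRel_apply.1 (Quotient.exact hij.symm)
      have := hρ.obs_act h' h
      rwa [hsm, hh] at this
  have h2 := card_le_of_mulAction K (fun g => (hK g).2) h1
  rw [hG] at h2
  exact (Nat.pow_le_pow_iff_right (by norm_num)).1 h2
end Fixed
end AlexSpan

namespace AlexSpan

section Lattice
variable {M : Type} [AddCommGroup M]

/-- Quotients by such subgroups are torsion-free. -/
def Saturated (N : Submodule ℤ M) : Prop := ∀ (k : ℤ) (x : M), k ≠ 0 → k • x ∈ N → x ∈ N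

lemma Saturated.isTorsionFree {N : Submodule ℤ M} (h : Saturated N) :
    Module.IsTorsionFree ℤ (M ⧸ N) := by
  refine Module.isTorsionFree_iff_smul_eq_zero.2 fun k y hk => ?_
  obtain ⟨x, rfl⟩ := N.mkQ_surjective y
  rw [← map_smul, Submodule.mkQ_apply, Submodule.Quotient.mk_eq_zero] at hk
  rw [or_iff_not_imp_left, Submodule.mkQ_apply, Submodule.Quotient.mk_eq_zero]
  exact fun h0 => h k x h0 hk

/-- An element outside a saturated subgroup is a multiple of a primitive one. -/
lemma Saturated.exists_primitive {N : Submodule ℤ M} (h : Saturated N) [Module.Finite ℤ (M ⧸ N)]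
    {x : M} (hx : x ∉ N) : ∃ y, ∃ k : ℤ, k ≠ 0 ∧ y ∉ N ∧ x - k • y ∈ N ∧
      Saturated (N ⊔ Submodule.span ℤ {y}) := by
  have := h.isTorsionFree
  have := Module.free_of_finite_type_torsion_free' (R := ℤ) (M := M ⧸ N)
  let b := Module.Free.chooseBasis ℤ (M ⧸ N)
  have hne : (Finset.univ : Finset (Module.Free.ChooseBasisIndex ℤ (M ⧸ N))).Nonempty := by
    rw [Finset.univ_nonempty_iff]
    by_contra hcon
    rw [not_nonempty_iff] at hcon
    apply hx
    rw [← Submodule.Quotient.mk_eq_zero]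
    exact b.ext_elem fun i => hcon.elim i
  obtain ⟨c, hc, hc1⟩ := Finset.extract_gcd (fun i => b.repr (N.mkQ x) i) hne
  set k := Finset.univ.gcd fun i => b.repr (N.mkQ x) i
  obtain ⟨y, hy⟩ := N.mkQ_surjective (b.equivFun.symm c)
  have hyc : ∀ i, b.repr (N.mkQ y) i = c i := fun i => by
    rw [hy, ← b.equivFun_apply, LinearEquiv.apply_symm_apply]
  have hxy : N.mkQ x = k • N.mkQ y := b.ext_elem fun i => by
    rw [map_smul, Finsupp.smul_apply, hyc, smul_eq_mul]
    exact hc i (Finset.mem_univ i)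
  have hx0 : N.mkQ x ≠ 0 := fun h0 => hx ((Submodule.Quotient.mk_eq_zero N).1 h0)
  refine ⟨y, k, fun hk => hx0 (by rw [hxy, hk, zero_smul]), fun hyN => hx0 (by
    rw [hxy, Submodule.mkQ_apply, (Submodule.Quotient.mk_eq_zero N).2 hyN, smul_zero]),
    (Submodule.Quotient.mk_eq_zero N).1 (by
      rw [← Submodule.mkQ_apply, map_sub, map_smul, hxy, sub_self]), ?_⟩
  intro l z hl hz
  obtain ⟨a, ha, w, hw, haw⟩ := Submodule.mem_sup.1 hz
  obtain ⟨j, rfl⟩ := Submodule.mem_span_singleton.1 hw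
  have h1 : l • N.mkQ z = j • N.mkQ y := by
    rw [← map_smul, ← haw, map_add, map_smul, Submodule.mkQ_apply,
      (Submodule.Quotient.mk_eq_zero N).2 ha, zero_add]
  have h2 : l ∣ j := by
    have h3 : l ∣ Finset.univ.gcd fun i => j * c i := Finset.dvd_gcd fun i _ =>
      ⟨b.repr (N.mkQ z) i, by
        have := congrArg (fun q => b.repr q i) h1
        simp only [map_smul, Finsupp.smul_apply, smul_eq_mul, hyc] at this
        exact this.symm⟩
    rw [Finset.gcd_mul_left, hc1, mul_one] at h3
    exact (dvd_normalize_iff).1 h3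
  obtain ⟨t, rfl⟩ := h2
  rw [show z = (z - t • y) + t • y by abel]
  refine add_mem (Submodule.mem_sup_left (h l _ hl ?_))
    (Submodule.mem_sup_right (Submodule.smul_mem _ _ (Submodule.mem_span_singleton_self y)))
  rw [smul_sub, smul_smul]
  rw [← haw, add_sub_cancel_right]
  exact ha

lemma Saturated.finrank_lt {N : Submodule ℤ M} (h : Saturated N) [Module.Finite ℤ (M ⧸ N)]
    {y : M} (hy : y ∉ N) :
    Module.Finite ℤ (M ⧸ (N ⊔ Submodule.span ℤ {y})) ∧
      Module.finrank ℤ (M ⧸ (N ⊔ Submodule.span ℤ {y})) < Module.finrank ℤ (M ⧸ N) := by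
  have := h.isTorsionFree
  have := Module.free_of_finite_type_torsion_free' (R := ℤ) (M := M ⧸ N)
  let f : (M ⧸ N) →ₗ[ℤ] M ⧸ (N ⊔ Submodule.span ℤ {y}) := Submodule.factor le_sup_left
  have hf : Function.Surjective f := Submodule.factor_surjective _
  refine ⟨Module.Finite.of_surjective f hf, ?_⟩
  have h1 := (LinearMap.ker f).finrank_quotient_add_finrank
  rw [(f.quotKerEquivOfSurjective hf).finrank_eq] at h1
  have h2 : 0 < Module.finrank ℤ (LinearMap.ker f) := by
    rw [Module.finrank_pos_iff]
    refine ⟨⟨⟨N.mkQ y, ?_⟩, 0, fun h0 => hy ?_⟩⟩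
    · rw [LinearMap.mem_ker]
      exact (Submodule.Quotient.mk_eq_zero _).2
        (Submodule.mem_sup_right (Submodule.mem_span_singleton_self y))
    · exact (Submodule.Quotient.mk_eq_zero N).1 (congrArg Subtype.val h0)
  omega
end Lattice

section Eigen
variable {M : Type} [AddCommGroup M] {G : Type} [CommGroup G] [Finite G] (σ : G → M →ₗ[ℤ] M)

lemma exists_eigen (hsq : ∀ g x, σ g (σ g x) = x) (hmul : ∀ g h x, σ (g * h) x = σ g (σ h x))
    {N : Submodule ℤ M} (hN : N ≠ ⊤) (A : Subgroup G)
    (hst : ∀ g ∈ A, ∀ x ∈ N, σ g x ∈ N) :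
    ∃ x, x ∉ N ∧ ∀ g ∈ A, σ g x - x ∈ N ∨ σ g x + x ∈ N := by
  classical
  have := Fintype.ofFinite G
  have hcomm : ∀ g h x, σ g (σ h x) = σ h (σ g x) := fun g h x => by
    rw [← hmul, mul_comm, hmul]
  obtain ⟨x₀, hx₀⟩ : ∃ x, x ∉ N := by
    by_contra hcon
    push Not at hcon
    exact hN (Submodule.eq_top_iff'.2 hcon)
  let S : M → Finset G := fun x =>
    Finset.univ.filter fun g => g ∈ A ∧ (σ g x - x ∈ N ∨ σ g x + x ∈ N)
  obtain ⟨x, hx, hmin⟩ := (measure fun x => Fintype.card G - (S x).card).wf.has_min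
    {x | x ∉ N} ⟨x₀, hx₀⟩
  refine ⟨x, hx, fun g hg => ?_⟩
  by_contra hcon
  push Not at hcon
  refine hmin (x + σ g x) (fun h => hcon.2 (by rwa [add_comm])) ?_
  have h1 : (S x).card < (S (x + σ g x)).card := by
    refine Finset.card_lt_card ((Finset.ssubset_iff_of_subset fun h hh => ?_).2 ⟨g, ?_, ?_⟩)
    · obtain ⟨-, hA, h1⟩ := Finset.mem_filter.1 hh
      refine Finset.mem_filter.2 ⟨Finset.mem_univ _, hA, h1.imp (fun h1 => ?_) fun h1 => ?_⟩
      · rw [map_add, hcomm h g, show σ h x + σ g (σ h x) - (x + σ g x) =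
          (σ h x - x) + σ g (σ h x - x) by rw [map_sub]; abel]
        exact add_mem h1 (hst g hg _ h1)
      · rw [map_add, hcomm h g, show σ h x + σ g (σ h x) + (x + σ g x) =
          (σ h x + x) + σ g (σ h x + x) by rw [map_add]; abel]
        exact add_mem h1 (hst g hg _ h1)
    · refine Finset.mem_filter.2 ⟨Finset.mem_univ _, hg, Or.inl ?_⟩
      rw [map_add, hsq, add_comm, sub_self]
      exact zero_mem _
    · intro h
      exact (Finset.mem_filter.1 h).2.2.elim hcon.1 hcon.2
  have h2 : (S (x + σ g x)).card ≤ Fintype.card G := Finset.card_le_univ _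
  change Fintype.card G - _ < Fintype.card G - _
  omega

/-- Stable complements of a subgroup all of whose crossed homomorphisms split on subgroups of
index two. -/
theorem exists_stable_complement (hsq : ∀ g x, σ g (σ g x) = x)
    (hmul : ∀ g h x, σ (g * h) x = σ g (σ h x)) {E : Submodule ℤ M}
    (hE : ∀ g, ∀ x ∈ E, σ g x ∈ E)
    (hP : ∀ (A : Subgroup G) (χ : G → ℤ) (c : G → M), (∀ g ∈ A, χ g = 1 ∨ χ g = -1) →
      (∀ g ∈ A, ∀ h ∈ A, χ (g * h) = χ g * χ h) → (∀ g ∈ A, c g ∈ E) →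
      (∀ g ∈ A, ∀ h ∈ A, c (g * h) = χ h • c g + σ g (c h)) →
      ∃ w ∈ E, ∃ A' ≤ A, Nat.card A ≤ 2 * Nat.card A' ∧ ∀ g ∈ A', c g + σ g w = χ g • w)
    (d : ℕ) : ∀ (A : Subgroup G) (S : Submodule ℤ M), (∀ g ∈ A, ∀ x ∈ S, σ g x ∈ S) →
      S ⊓ E = ⊥ → Saturated (S ⊔ E) → Module.Finite ℤ (M ⧸ (S ⊔ E)) →
      Module.finrank ℤ (M ⧸ (S ⊔ E)) ≤ d →
      ∃ (A' : Subgroup G) (S' : Submodule ℤ M), Nat.card A ≤ 2 ^ d * Nat.card A' ∧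
        (∀ g ∈ A', ∀ x ∈ S', σ g x ∈ S') ∧ S' ⊓ E = ⊥ ∧ S' ⊔ E = ⊤ := by
  induction d with
  | zero =>
    intro A S hS hSE hsat hfin hrank
    have := hsat.isTorsionFree
    have h1 : Subsingleton (M ⧸ (S ⊔ E)) := (Module.finrank_zero_iff (R := ℤ)).1 (by omega)
    exact ⟨A, S, by rw [pow_zero, one_mul], hS, hSE, Submodule.Quotient.subsingleton_iff.1 h1⟩
  | succ d ih =>
    intro A S hS hSE hsat hfin hrank
    by_cases htop : S ⊔ E = ⊤
    · exact ⟨A, S, Nat.le_mul_of_pos_left _ (by positivity), hS, hSE, htop⟩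
    have hst : ∀ g ∈ A, ∀ x ∈ S ⊔ E, σ g x ∈ S ⊔ E := fun g hg x hx => by
      obtain ⟨s, hs, e, he, rfl⟩ := Submodule.mem_sup.1 hx
      rw [map_add]
      exact Submodule.add_mem_sup (hS g hg s hs) (hE g e he)
    obtain ⟨x, hx, hxe⟩ := exists_eigen σ hsq hmul htop A hst
    obtain ⟨y, k, hk, hy, hxy, hysat⟩ := hsat.exists_primitive hx
    have hye : ∀ g, ∃ χ : ℤ, g ∈ A → (χ = 1 ∨ χ = -1) ∧ σ g y - χ • y ∈ S ⊔ E := fun g => by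
      by_cases hg : g ∈ A
      · have h1 : ∀ χ : ℤ, σ g x - χ • x ∈ S ⊔ E → σ g y - χ • y ∈ S ⊔ E := fun χ h => by
          refine hsat k _ hk ?_
          rw [show k • (σ g y - χ • y) = (σ g x - χ • x) - σ g (x - k • y) + χ • (x - k • y) by
            rw [map_sub, map_smul]; module]
          exact add_mem (sub_mem h (hst g hg _ hxy)) (Submodule.smul_mem _ _ hxy)
        rcases hxe g hg with h | h
        · exact ⟨1, fun _ => ⟨Or.inl rfl, h1 1 (by rwa [one_smul])⟩⟩
        · exact ⟨-1, fun _ => ⟨Or.inr rfl, h1 (-1) (by rwa [neg_smul, one_smul, sub_neg_eq_add])⟩⟩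
      · exact ⟨0, fun h => (hg h).elim⟩
    choose χ hχ using hye
    have hdec : ∀ g, ∃ c s, g ∈ A → c ∈ E ∧ s ∈ S ∧ σ g y = χ g • y + s + c := fun g => by
      by_cases hg : g ∈ A
      · obtain ⟨s, hs, c, hc, h⟩ := Submodule.mem_sup.1 (hχ g hg).2
        exact ⟨c, s, fun _ => ⟨hc, hs, by rw [add_assoc, h]; abel⟩⟩
      · exact ⟨0, 0, fun h => (hg h).elim⟩
    choose c s hcs using hdec
    have hχm : ∀ g ∈ A, ∀ h ∈ A, χ (g * h) = χ g * χ h := fun g hg h hh => by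
      by_contra hcon
      refine hy (hsat _ _ (sub_ne_zero.2 hcon) ?_)
      rw [show (χ (g * h) - χ g * χ h) • y = (σ g (σ h y - χ h • y) + χ h • (σ g y - χ g • y)) -
        (σ (g * h) y - χ (g * h) • y) by rw [map_sub, map_smul, hmul]; module]
      exact sub_mem (add_mem (hst g hg _ (hχ h hh).2) (Submodule.smul_mem _ _ (hχ g hg).2))
        (hχ _ (mul_mem hg hh)).2
    have huniq : ∀ s c : M, s ∈ S → c ∈ E → s + c = 0 → c = 0 := fun s c hs hc h => by
      have : c ∈ S ⊓ E := ⟨by rw [← neg_eq_of_add_eq_zero_right h]; exact neg_mem hs, hc⟩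
      rwa [hSE, Submodule.mem_bot] at this
    obtain ⟨w, hwE, A', hA', hcard, hw⟩ := hP A χ c (fun g hg => (hχ g hg).1) hχm
      (fun g hg => (hcs g hg).1) fun g hg h hh => by
        have h1 := (hcs _ (mul_mem hg hh)).2.2
        rw [hmul, (hcs h hh).2.2, map_add, map_add, map_smul, (hcs g hg).2.2, hχm g hg h hh] at h1
        refine sub_eq_zero.1 (huniq (s (g * h) - χ h • s g - σ g (s h)) _
          (sub_mem (sub_mem (hcs _ (mul_mem hg hh)).2.1 (Submodule.smul_mem _ _ (hcs g hg).2.1))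
            (hS g hg _ (hcs h hh).2.1))
          (sub_mem (hcs _ (mul_mem hg hh)).1 (add_mem (Submodule.smul_mem _ _ (hcs g hg).1)
            (hE g _ (hcs h hh).1))) ?_)
        rw [← sub_eq_zero] at h1
        rw [← neg_eq_zero, ← h1]
        module
    have hN : S ⊔ Submodule.span ℤ {y + w} ⊔ E = S ⊔ E ⊔ Submodule.span ℤ {y} := by
      apply le_antisymm
      · refine sup_le (sup_le (le_sup_left.trans le_sup_left) ?_) (le_sup_right.trans le_sup_left)
        rw [Submodule.span_singleton_le_iff_mem, add_comm]
        exact Submodule.add_mem_sup (Submodule.mem_sup_right hwE) (Submodule.mem_span_singleton_self y)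
      · refine sup_le (sup_le (le_sup_left.trans le_sup_left) le_sup_right) ?_
        rw [Submodule.span_singleton_le_iff_mem, ← add_sub_cancel_right y w, sub_eq_add_neg]
        exact Submodule.add_mem_sup (Submodule.mem_sup_right (by
          rw [add_neg_cancel_right]
          exact Submodule.mem_span_singleton_self _))
          (neg_mem hwE)
    obtain ⟨hfin', hlt⟩ := hsat.finrank_lt hy
    obtain ⟨A'', S', h1, h2, h3, h4⟩ := ih A' (S ⊔ Submodule.span ℤ {y + w}) (fun g hg x hx => by
      obtain ⟨a, ha, b, hb, rfl⟩ := Submodule.mem_sup.1 hx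
      obtain ⟨j, rfl⟩ := Submodule.mem_span_singleton.1 hb
      rw [map_add, map_smul, map_add, (hcs g (hA' hg)).2.2,
        show σ g a + j • (χ g • y + s g + c g + σ g w) =
          (σ g a + j • s g) + j • (χ g • y + (c g + σ g w)) by module, hw g hg, ← smul_add]
      exact Submodule.add_mem_sup
        (add_mem (hS g (hA' hg) a ha) (Submodule.smul_mem _ _ (hcs g (hA' hg)).2.1))
        (Submodule.smul_mem _ _ (Submodule.smul_mem _ _ (Submodule.mem_span_singleton_self _)))) (by
      rw [eq_bot_iff]
      rintro x ⟨hx, hxE⟩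
      obtain ⟨a, ha, b, hb, rfl⟩ := Submodule.mem_sup.1 hx
      obtain ⟨j, rfl⟩ := Submodule.mem_span_singleton.1 hb
      by_cases hj : j = 0
      · rw [hj, zero_smul, add_zero] at hxE ⊢
        rw [← hSE]
        exact ⟨ha, hxE⟩
      · refine (hy (hsat j y hj ?_)).elim
        rw [show j • y = -a + ((a + j • (y + w)) - j • w) by module]
        exact Submodule.add_mem_sup (neg_mem ha) (sub_mem hxE (Submodule.smul_mem _ _ hwE)))
      (by rwa [hN]) (by rwa [hN]) (by rw [hN]; omega)
    refine ⟨A'', S', hcard.trans ?_, h2, h3, h4⟩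
    calc 2 * Nat.card A' ≤ 2 * (2 ^ d * Nat.card A'') := Nat.mul_le_mul_left 2 h1
      _ = 2 ^ (d + 1) * Nat.card A'' := by ring
end Eigen
end AlexSpan

namespace AlexSpan

section CircleMaps
variable {X Y : Type} [TopologicalSpace X] [TopologicalSpace Y]

/-- Reduction of real functions modulo one. -/
def modOne (X : Type) [TopologicalSpace X] : C(X, ℝ) →ₗ[ℤ] C(X, UnitAddCircle) :=
  (AddMonoidHom.compLeftContinuous X (QuotientAddGroup.mk' (AddSubgroup.zmultiples (1 : ℝ)))
    (AddCircle.continuous_mk' 1)).toIntLinearMap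

lemma modOne_apply (u : C(X, ℝ)) (x : X) : modOne X u x = ((u x : ℝ) : UnitAddCircle) := rfl

/-- The circle-valued functions with a real logarithm. -/
def logs (X : Type) [TopologicalSpace X] : Submodule ℤ C(X, UnitAddCircle) :=
  LinearMap.range (modOne X)

lemma const_mem_logs (c : UnitAddCircle) : ContinuousMap.const X c ∈ logs X := by
  obtain ⟨t, rfl⟩ := QuotientAddGroup.mk_surjective c
  exact ⟨ContinuousMap.const X t, rfl⟩

lemma comp_mem_logs (g : C(X, Y)) {f : C(Y, UnitAddCircle)} (hf : f ∈ logs Y) :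
    f.comp g ∈ logs X := by
  obtain ⟨u, rfl⟩ := hf
  exact ⟨u.comp g, rfl⟩

lemma logs_two_divisible {f : C(X, UnitAddCircle)} (hf : f ∈ logs X) :
    ∃ t ∈ logs X, f = (2 : ℤ) • t := by
  obtain ⟨u, rfl⟩ := hf
  refine ⟨_, ⟨(2⁻¹ : ℝ) • u, rfl⟩, ?_⟩
  rw [← map_smul]
  congr 1
  ext x
  change u x = (2 : ℤ) • ((2 : ℝ)⁻¹ * u x)
  rw [zsmul_eq_mul]
  push_cast
  ring

lemma sub_mem_logs_of_homotopic {f g : C(X, UnitAddCircle)} (h : f.Homotopic g) :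
    g - f ∈ logs X := by
  obtain ⟨H⟩ := h
  let H' : C(unitInterval × X, UnitAddCircle) := H.toContinuousMap - f.comp ContinuousMap.snd
  have cov : IsCoveringMap ((↑) : ℝ → UnitAddCircle) := AddCircle.isCoveringMap_coe (1 : ℝ)
  have h0 : ∀ a, H' (0, a) = (((0 : C(X, ℝ)) a : ℝ) : UnitAddCircle) := fun a => by
    change H (0, a) - f a = _
    rw [H.apply_zero, sub_self]
    rfl
  refine ⟨(cov.liftHomotopy H' 0 h0).comp ((ContinuousMap.const X 1).prodMk (.id X)), ?_⟩
  ext x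
  refine (congrFun (cov.liftHomotopy_lifts H' 0 h0) (1, x)).trans ?_
  change H (1, x) - f x = _
  rw [H.apply_one]
  rfl

lemma eq_intCast_of_modOne [PreconnectedSpace X] [Nonempty X] {u : C(X, ℝ)}
    (hu : modOne X u = 0) : ∃ n : ℤ, ∀ x, u x = n := by
  have h1 : ∀ x, u x ∈ Set.range ((↑) : ℤ → ℝ) := fun x => by
    obtain ⟨n, hn⟩ := (AddCircle.coe_eq_zero_iff (1 : ℝ)).1
      ((modOne_apply u x).symm.trans (congrArg (fun f => f x) hu))
    exact ⟨n, by rw [← hn, zsmul_one]⟩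
  obtain ⟨x₀⟩ := ‹Nonempty X›
  obtain ⟨n, hn⟩ := h1 x₀
  refine ⟨n, fun x => ?_⟩
  rw [hn]
  exact isPreconnected_univ.constant_of_mapsTo
    (Int.isClosedEmbedding_coe_real.isEmbedding.isDiscrete_range) u.continuous.continuousOn
    (fun x _ => h1 x) (Set.mem_univ _) (Set.mem_univ _)

lemma eq_const_of_zsmul [PreconnectedSpace X] {k : ℤ} (hk : k ≠ 0) {f : C(X, UnitAddCircle)}
    (hf : k • f = 0) (x y : X) : f x = f y := by
  have hfin : {u : UnitAddCircle | k.natAbs • u = 0}.Finite :=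
    AddCircle.finite_torsion (1 : ℝ) (Int.natAbs_pos.2 hk)
  refine isPreconnected_univ.constant_of_mapsTo hfin.isDiscrete f.continuous.continuousOn
    (fun x _ => ?_) (Set.mem_univ _) (Set.mem_univ _)
  have h1 : k • f x = 0 := congrArg (fun f => f x) hf
  rcases Int.natAbs_eq k with h | h
  · rw [h, natCast_zsmul] at h1
    exact h1
  · rw [h, neg_smul, neg_eq_zero, natCast_zsmul] at h1
    exact h1

lemma saturated_logs [PreconnectedSpace X] [Nonempty X] : Saturated (logs X) := by
  rintro k f hk ⟨u, hu⟩
  have h1 : k • (f - modOne X ((k : ℝ)⁻¹ • u)) = 0 := by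
    rw [smul_sub, ← hu, ← map_smul, ← map_sub]
    convert map_zero (modOne X)
    ext x
    have : (k : ℝ) ≠ 0 := Int.cast_ne_zero.2 hk
    simp [this]
  obtain ⟨x₀⟩ := ‹Nonempty X›
  rw [show f = (f - modOne X ((k : ℝ)⁻¹ • u)) + modOne X ((k : ℝ)⁻¹ • u) by abel]
  refine add_mem ?_ ⟨_, rfl⟩
  rw [show f - modOne X ((k : ℝ)⁻¹ • u) = ContinuousMap.const X
    ((f - modOne X ((k : ℝ)⁻¹ • u)) x₀) from ContinuousMap.ext fun x => eq_const_of_zsmul hk h1 x x₀]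
  exact const_mem_logs _

/-- The coordinates of the torus. -/
def coord {m : ℕ} (j : Fin m) : C(Fin m → UnitAddCircle, UnitAddCircle) := ⟨fun z => z j, by fun_prop⟩

lemma torus_mod_logs {m : ℕ} (f : C(Fin m → UnitAddCircle, UnitAddCircle)) :
    ∃ a : Fin m → ℤ, f - ∑ j, a j • coord j ∈ logs _ := by
  have hq : IsOpenQuotientMap (Pi.map fun _ : Fin m => ((↑) : ℝ → UnitAddCircle)) :=
    IsOpenQuotientMap.piMap fun _ => QuotientAddGroup.isOpenQuotientMap_mk
  let q : C(Fin m → ℝ, Fin m → UnitAddCircle) := ⟨_, hq.continuous⟩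
  have hqa : ∀ x j, q x j = ((x j : ℝ) : UnitAddCircle) := fun _ _ => rfl
  have hF : f.comp q ∈ logs (Fin m → ℝ) := by
    have h1 : (ContinuousMap.const _ (f (q 0))).Homotopic (f.comp q) :=
      ⟨{ toFun := fun p => f (q ((p.1 : ℝ) • p.2))
         continuous_toFun := by fun_prop
         map_zero_left := fun x => by simp
         map_one_left := fun x => by simp }⟩
    rw [← sub_add_cancel (f.comp q) (ContinuousMap.const _ (f (q 0)))]
    exact add_mem (sub_mem_logs_of_homotopic h1) (const_mem_logs _)
  obtain ⟨l, hl⟩ := hF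
  have hl' : ∀ x, ((l x : ℝ) : UnitAddCircle) = f (q x) := fun x =>
    congrArg (fun f => f x) hl
  have hshift : ∀ j, ∃ n : ℤ, ∀ x, l (x + Pi.single j 1) - l x = n := fun j => by
    refine eq_intCast_of_modOne (u := ⟨fun x => l (x + Pi.single j 1) - l x, by fun_prop⟩) ?_
    ext x
    rw [modOne_apply, ContinuousMap.coe_mk, AddCircle.coe_sub, hl', hl', ContinuousMap.zero_apply,
      sub_eq_zero]
    congr 1
    funext i
    rw [hqa, hqa, Pi.add_apply, AddCircle.coe_add]
    by_cases hij : i = j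
    · subst hij
      rw [Pi.single_eq_same, AddCircle.coe_period, add_zero]
    · rw [Pi.single_eq_of_ne hij, AddCircle.coe_zero, add_zero]
  choose a ha using hshift
  let l' : C(Fin m → ℝ, ℝ) := ⟨fun x => l x - ∑ j, a j * x j, by fun_prop⟩
  let P : AddSubgroup (Fin m → ℝ) :=
    { carrier := {p | ∀ x, l' (x + p) = l' x}
      zero_mem' := fun x => by rw [add_zero]
      add_mem' := fun {p p'} hp hp' x => by rw [← add_assoc, hp', hp]
      neg_mem' := fun {p} hp x => by rw [← hp, neg_add_cancel_right] }
  have hP : ∀ j, (Pi.single j 1 : Fin m → ℝ) ∈ P := fun j x => by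
    change l _ - ∑ i, a i * (x i + (Pi.single j 1 : Fin m → ℝ) i) = l x - ∑ i, a i * x i
    simp only [mul_add, Finset.sum_add_distrib, Pi.single_apply, mul_ite, mul_one, mul_zero,
      Finset.sum_ite_eq', Finset.mem_univ, if_true]
    linarith [ha j x]
  have hfac : Function.FactorsThrough l' q := fun x y hxy => by
    have h1 : ∀ j, ∃ k : ℤ, k • (1 : ℝ) = y j - x j := fun j =>
      (AddCircle.coe_eq_zero_iff (1 : ℝ)).1 (by
        rw [AddCircle.coe_sub, ← hqa, ← hqa, hxy, sub_self])
    choose k hk using h1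
    have h2 : y - x ∈ P := by
      rw [show y - x = ∑ j, k j • (Pi.single j 1 : Fin m → ℝ) by
        funext i
        rw [Pi.sub_apply, ← hk, Finset.sum_apply]
        simp [Pi.single_apply]]
      exact sum_mem fun j _ => zsmul_mem (hP j) _
    rw [← h2 x, add_sub_cancel]
  refine ⟨a, hq.isQuotientMap.lift (f := q) l' hfac, ?_⟩
  ext z
  obtain ⟨x, rfl⟩ := hq.surjective z
  have h3 : hq.isQuotientMap.lift (f := q) l' hfac (q x) = l' x :=
    congrArg (fun f => f x) (hq.isQuotientMap.lift_comp (f := q) l' hfac)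
  change ((hq.isQuotientMap.lift (f := q) l' hfac (q x) : ℝ) : UnitAddCircle) = _
  rw [h3]
  change ((l x - ∑ j, a j * x j : ℝ) : UnitAddCircle) = (f - ∑ j, a j • coord j) (q x)
  rw [AddCircle.coe_sub, hl', ContinuousMap.sub_apply, ContinuousMap.sum_apply]
  congr 1
  refine (map_sum (QuotientAddGroup.mk' (AddSubgroup.zmultiples (1 : ℝ))) _ _).trans ?_
  refine Finset.sum_congr rfl fun j _ => ?_
  rw [← zsmul_eq_mul, map_zsmul]
  rfl

section Equivalence
variable {m : ℕ} (e : ContinuousMap.HomotopyEquiv X (Fin m → UnitAddCircle))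

lemma comp_inv_sub_mem_logs (e : ContinuousMap.HomotopyEquiv X Y) (f : C(X, UnitAddCircle)) :
    f - (f.comp e.invFun).comp e.toFun ∈ logs X :=
  sub_mem_logs_of_homotopic ((ContinuousMap.Homotopic.refl f).comp e.left_inv)

lemma preconnectedSpace_of_homotopyEquiv [PreconnectedSpace Y]
    (e : ContinuousMap.HomotopyEquiv X Y) : PreconnectedSpace X := by
  refine preconnectedSpace_of_forall_constant fun f hf x y => ?_
  obtain ⟨H⟩ := e.left_inv
  have h1 : ∀ x, f (e.invFun (e.toFun x)) = f x := fun x => by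
    have h2 : ∀ t, f (H (t, x)) = f (H (0, x)) := fun t =>
      PreconnectedSpace.constant inferInstance (f := fun t => f (H (t, x))) (by fun_prop)
    have h3 := h2 1
    rw [H.apply_one, H.apply_zero] at h3
    exact h3.symm
  rw [← h1 x, ← h1 y]
  exact PreconnectedSpace.constant inferInstance (f := fun y => f (e.invFun y)) (by fun_prop)

/-- Generators of the circle-valued functions on a space equivalent to a torus. -/
def gen (j : Fin m) : C(X, UnitAddCircle) := (coord j).comp e.toFun

lemma exists_gen_sum (f : C(X, UnitAddCircle)) :
    ∃ a : Fin m → ℤ, f - ∑ j, a j • gen e j ∈ logs X := by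
  obtain ⟨a, ha⟩ := torus_mod_logs (f.comp e.invFun)
  refine ⟨a, ?_⟩
  have h1 := add_mem (comp_inv_sub_mem_logs e f) (comp_mem_logs e.toFun ha)
  convert h1 using 1
  ext x
  simp [gen]

include e in
lemma finite_mod_logs : Module.Finite ℤ (C(X, UnitAddCircle) ⧸ logs X) ∧
    Module.finrank ℤ (C(X, UnitAddCircle) ⧸ logs X) ≤ m := by
  have h1 : Submodule.span ℤ (Set.range fun j => (logs X).mkQ (gen e j)) = ⊤ := by
    rw [Submodule.eq_top_iff']
    intro y
    obtain ⟨f, rfl⟩ := (logs X).mkQ_surjective y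
    obtain ⟨a, ha⟩ := exists_gen_sum e f
    rw [← Submodule.Quotient.mk_eq_zero, ← Submodule.mkQ_apply, map_sub, sub_eq_zero, map_sum] at ha
    rw [ha]
    refine sum_mem fun j _ => ?_
    rw [map_smul]
    exact Submodule.smul_mem _ _ (Submodule.subset_span ⟨j, rfl⟩)
  refine ⟨⟨by rw [← h1]; exact Submodule.fg_span (Set.finite_range _)⟩, ?_⟩
  have h2 := finrank_range_le_card (R := ℤ) fun j => (logs X).mkQ (gen e j)
  rwa [Set.finrank, h1, finrank_top, Fintype.card_fin] at h2

/-- Subset sums of the generators are not divisible by two. -/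
lemma eq_zero_of_gen_two_divisible {ε : Fin m → ZMod 2} {t : C(X, UnitAddCircle)}
    (h : ∑ j, (ε j).val • gen e j = (2 : ℤ) • t) : ε = 0 := by
  classical
  funext i
  by_contra hi
  have hone : (ε i).val = 1 := by
    have : ∀ c : ZMod 2, c ≠ 0 → c.val = 1 := by decide
    exact this _ hi
  have h1 : (∑ j, (ε j).val • coord j : C(Fin m → UnitAddCircle, UnitAddCircle)) -
      (∑ j, (ε j).val • gen e j : C(X, UnitAddCircle)).comp e.invFun ∈ logs _ := by
    have := comp_inv_sub_mem_logs e.symm (∑ j, (ε j).val • coord j)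
    convert this using 2
    ext x
    simp [gen]
    rfl
  obtain ⟨s, -, hs⟩ := logs_two_divisible h1
  let ι : C(ℝ, Fin m → UnitAddCircle) :=
    ⟨fun x => Pi.single i (x : UnitAddCircle),
      (continuous_single i).comp (AddCircle.continuous_mk' 1)⟩
  let T : C(ℝ, UnitAddCircle) := (s + t.comp e.invFun).comp ι
  have hT : ∀ x, (2 : ℤ) • T x = (x : UnitAddCircle) := fun x => by
    have h2 := congrArg (fun f => f (ι x)) hs
    rw [h] at h2
    have h3 : (∑ j, (ε j).val • coord j : C(Fin m → UnitAddCircle, UnitAddCircle)) (ι x) = x := by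
      rw [ContinuousMap.sum_apply, Finset.sum_eq_single i]
      · rw [hone, one_smul]
        exact Pi.single_eq_same _ _
      · intro j _ hj
        change (ε j).val • (Pi.single i (x : UnitAddCircle) : Fin m → UnitAddCircle) j = 0
        rw [Pi.single_eq_of_ne hj, smul_zero]
      · exact fun h => (h (Finset.mem_univ _)).elim
    change (∑ j, (ε j).val • coord j : C(Fin m → UnitAddCircle, UnitAddCircle)) (ι x) -
      (2 : ℤ) • t (e.invFun (ι x)) = (2 : ℤ) • s (ι x) at h2
    rw [h3] at h2
    change (2 : ℤ) • (s (ι x) + t (e.invFun (ι x))) = _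
    rw [smul_add, ← h2, sub_add_cancel]
  let D : C(ℝ, UnitAddCircle) := T - modOne ℝ ((2⁻¹ : ℝ) • .id ℝ)
  have hD : (2 : ℤ) • D = 0 := by
    ext x
    change (2 : ℤ) • (T x - ((2⁻¹ * x : ℝ) : UnitAddCircle)) = 0
    rw [smul_sub, hT, ← AddCircle.coe_zsmul, zsmul_eq_mul]
    push_cast
    rw [mul_inv_cancel_left₀ (by norm_num), sub_self]
  have h4 := eq_const_of_zsmul (by norm_num) hD 1 0
  change T 1 - ((2⁻¹ * 1 : ℝ) : UnitAddCircle) = T 0 - ((2⁻¹ * 0 : ℝ) : UnitAddCircle) at h4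
  have h5 : ι 1 = ι 0 := by
    change (Pi.single i ((1 : ℝ) : UnitAddCircle) : Fin m → UnitAddCircle) =
      Pi.single i ((0 : ℝ) : UnitAddCircle)
    rw [AddCircle.coe_period, AddCircle.coe_zero]
  rw [show T 1 = T 0 from congrArg (s + t.comp e.invFun) h5, sub_right_inj, AddCircle.coe_eq_coe_iff_of_mem_Ico
    (a := 0) (by norm_num) (by norm_num)] at h4
  norm_num at h4
end Equivalence
end CircleMaps
end AlexSpan

namespace AlexSpan

lemma circle_two_torsion {t : UnitAddCircle} (h : (2 : ℤ) • t = 0) :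
    t = 0 ∨ t = ((1 / 2 : ℝ) : UnitAddCircle) := by
  obtain ⟨x, rfl⟩ := QuotientAddGroup.mk_surjective t
  change (2 : ℤ) • ((x : ℝ) : UnitAddCircle) = 0 at h
  rw [← AddCircle.coe_zsmul, AddCircle.coe_eq_zero_iff] at h
  obtain ⟨n, hn⟩ := h
  have hx : x = n / 2 := by
    simp only [zsmul_eq_mul, mul_one] at hn
    push_cast at hn
    linarith
  rcases Int.even_or_odd' n with ⟨k, hk | hk⟩
  · refine Or.inl ((AddCircle.coe_eq_zero_iff (1 : ℝ)).2 ⟨k, ?_⟩)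
    rw [hx, hk, zsmul_one]
    push_cast
    ring
  · refine Or.inr ?_
    rw [← sub_eq_zero]
    refine (AddCircle.coe_eq_zero_iff (1 : ℝ) (x := x - 1 / 2)).2 ⟨k, ?_⟩
    rw [hx, hk, zsmul_one]
    push_cast
    ring

lemma circle_halve (t : UnitAddCircle) : ∃ s, (2 : ℤ) • s = t := by
  obtain ⟨x, rfl⟩ := QuotientAddGroup.mk_surjective t
  refine ⟨((x / 2 : ℝ) : UnitAddCircle), ?_⟩
  rw [← AddCircle.coe_zsmul, zsmul_eq_mul]
  push_cast
  rw [mul_div_cancel₀ _ (by norm_num)]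

section Pull
variable {X : Type} [TopologicalSpace X] {G : Type} [CommGroup G] (φ : G →* (X ≃ₜ X))

/-- The action on circle-valued functions. -/
def circlePull (g : G) : C(X, UnitAddCircle) →ₗ[ℤ] C(X, UnitAddCircle) :=
  AddMonoidHom.toIntLinearMap
    { toFun := fun f => f.comp (φ g : C(X, X))
      map_zero' := rfl
      map_add' := fun _ _ => rfl }

lemma circlePull_apply (g : G) (f : C(X, UnitAddCircle)) (x : X) : circlePull φ g f x = f (φ g x) := rfl

lemma circlePull_mul (g h : G) (f : C(X, UnitAddCircle)) :
    circlePull φ (g * h) f = circlePull φ g (circlePull φ h f) := by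
  ext x
  rw [mul_comm, circlePull_apply, circlePull_apply, circlePull_apply, map_mul]
  rfl

lemma circlePull_const (g : G) (c : UnitAddCircle) :
    circlePull φ g (ContinuousMap.const X c) = ContinuousMap.const X c := rfl

/-- A crossed homomorphism to the circle splits on a subgroup of index two. -/
lemma exists_split_circle [Finite G] (A : Subgroup G) (χ : G → ℤ) (κ : G → UnitAddCircle)
    (hχ : ∀ g ∈ A, χ g = 1 ∨ χ g = -1) (hχm : ∀ g ∈ A, ∀ h ∈ A, χ (g * h) = χ g * χ h)
    (hsq : ∀ g : G, g * g = 1) (hκ : ∀ g ∈ A, ∀ h ∈ A, κ (g * h) = χ h • κ g + κ h) :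
    ∃ l : UnitAddCircle, ∃ A' ≤ A, Nat.card A ≤ 2 * Nat.card A' ∧
      ∀ g ∈ A', κ g + l - χ g • l = 0 := by
  have hl : ∃ l : UnitAddCircle, ∀ g ∈ A, (2 : ℤ) • (κ g + l - χ g • l) = 0 := by
    by_cases h : ∃ g ∈ A, χ g = -1
    · obtain ⟨g₀, hg₀, h₀⟩ := h
      obtain ⟨l, hl⟩ := circle_halve (-κ g₀)
      refine ⟨l, fun g hg => ?_⟩
      have h1 := hκ g₀ hg₀ g hg
      rw [mul_comm, hκ g hg g₀ hg₀, h₀, ← sub_eq_zero] at h1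
      rw [show (2 : ℤ) • (κ g + l - χ g • l) = (2 : ℤ) • κ g + (1 - χ g) • (2 : ℤ) • l by module, hl,
        ← neg_eq_zero, ← h1]
      module
    · push Not at h
      have h1 : ∀ g ∈ A, χ g = 1 := fun g hg => (hχ g hg).resolve_right (h g hg)
      refine ⟨0, fun g hg => ?_⟩
      have h2 := hκ g hg g hg
      have h3 := hκ 1 (one_mem A) 1 (one_mem A)
      rw [mul_one, h1 1 (one_mem A), one_smul, left_eq_add] at h3
      rw [hsq, h1 g hg, h3, one_smul] at h2
      rw [smul_zero, sub_zero, add_zero, two_smul, ← h2]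
  obtain ⟨l, hl⟩ := hl
  have hneg : ∀ t : UnitAddCircle, (2 : ℤ) • t = 0 → ∀ z : ℤ, z = 1 ∨ z = -1 → z • t = t := by
    rintro t ht z (rfl | rfl)
    · rw [one_smul]
    · rw [neg_smul, one_smul, neg_eq_iff_add_eq_zero, ← two_smul ℤ, ht]
  let ψ : A →* Multiplicative UnitAddCircle := MonoidHom.mk'
    (fun g => Multiplicative.ofAdd (κ g + l - χ g • l)) fun g h => by
      rw [← ofAdd_add]
      congr 1
      rw [Subgroup.coe_mul, hκ _ g.2 _ h.2, hχm _ g.2 _ h.2,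
        ← hneg _ (hl g g.2) _ (hχ h h.2)]
      module
  have hran : (ψ.range : Set (Multiplicative UnitAddCircle)) ⊆
      {1, Multiplicative.ofAdd ((1 / 2 : ℝ) : UnitAddCircle)} := by
    rintro _ ⟨g, rfl⟩
    exact (circle_two_torsion (hl g g.2)).imp (congrArg Multiplicative.ofAdd)
      (congrArg Multiplicative.ofAdd)
  refine ⟨l, ψ.ker.map A.subtype, Subgroup.map_subtype_le _, ?_, ?_⟩
  · rw [Subgroup.card_map_of_injective A.subtype_injective,
      Subgroup.card_eq_card_quotient_mul_card_subgroup ψ.ker,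
      Nat.card_congr (QuotientGroup.quotientKerEquivRange ψ).toEquiv]
    refine Nat.mul_le_mul_right _ ?_
    refine (Set.ncard_le_ncard hran (Set.toFinite _)).trans ((Set.ncard_insert_le _ _).trans ?_)
    rw [Set.ncard_singleton]
  · rintro _ ⟨g, hg, rfl⟩
    exact hg

/-- Crossed homomorphisms to the functions with a logarithm split on a subgroup of index two. -/
theorem exists_split_logs [Finite G] [PreconnectedSpace X] [Nonempty X] (hsq : ∀ g : G, g * g = 1)
    (A : Subgroup G) (χ : G → ℤ) (c : G → C(X, UnitAddCircle))
    (hχ : ∀ g ∈ A, χ g = 1 ∨ χ g = -1) (hχm : ∀ g ∈ A, ∀ h ∈ A, χ (g * h) = χ g * χ h)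
    (hcE : ∀ g ∈ A, c g ∈ logs X)
    (hc : ∀ g ∈ A, ∀ h ∈ A, c (g * h) = χ h • c g + circlePull φ g (c h)) :
    ∃ w ∈ logs X, ∃ A' ≤ A, Nat.card A ≤ 2 * Nat.card A' ∧
      ∀ g ∈ A', c g + circlePull φ g w = χ g • w := by
  have := Fintype.ofFinite A
  obtain ⟨x₀⟩ := id ‹Nonempty X›
  have hu : ∀ g, ∃ u : C(X, ℝ), g ∈ A → modOne X u = c g := fun g => by
    by_cases hg : g ∈ A
    · obtain ⟨u, hu⟩ := hcE g hg
      exact ⟨u, fun _ => hu⟩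
    · exact ⟨0, fun h => (hg h).elim⟩
  choose u hu using hu
  have hk : ∀ g h, ∃ n : ℤ, g ∈ A → h ∈ A →
      ∀ x, u (g * h) x = χ h * u g x + u h (φ g x) + n := fun g h => by
    by_cases hg : g ∈ A ∧ h ∈ A
    · obtain ⟨n, hn⟩ := eq_intCast_of_modOne
        (u := u (g * h) - (χ h • u g + (u h).comp (φ g : C(X, X)))) (by
          rw [map_sub, map_add, map_smul, hu _ (mul_mem hg.1 hg.2), hu _ hg.1,
            hc g hg.1 h hg.2, ← hu h hg.2]
          exact sub_self _)
      refine ⟨n, fun _ _ x => ?_⟩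
      rw [← hn x]
      change _ = _ + (u (g * h) x - (χ h • u g x + u h (φ g x)))
      rw [zsmul_eq_mul]
      ring
    · exact ⟨0, fun h1 h2 => (hg ⟨h1, h2⟩).elim⟩
  choose k hk using hk
  let W : C(X, ℝ) := (Fintype.card A : ℝ)⁻¹ • ∑ g : A, χ g • u g
  have hn0 : (Fintype.card A : ℝ) ≠ 0 := Nat.cast_ne_zero.2 Fintype.card_ne_zero
  have hW : ∀ x, Fintype.card A * W x = ∑ g : A, χ g * u g x := fun x => by
    simp [W]
  clear_value W
  have hχ2 : ∀ g ∈ A, (χ g : ℝ) * χ g = 1 := fun g hg => by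
    rcases hχ g hg with h | h <;> rw [h] <;> norm_num
  have hWh : ∀ h ∈ A, ∃ K : ℝ, ∀ x, u h x + W (φ h x) - χ h * W x = K := fun h hh => by
    refine ⟨-((Fintype.card A : ℝ)⁻¹ * ∑ g : A, (χ g : ℝ) * k h g), fun x => ?_⟩
    have h1 : ∑ g : A, (χ g : ℝ) * u (h * g) x =
        Fintype.card A * u h x + ∑ g : A, χ g * u g (φ h x) + ∑ g : A, (χ g : ℝ) * k h g := by
      rw [← Finset.card_univ, ← nsmul_eq_mul, ← Finset.sum_const, ← Finset.sum_add_distrib,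
        ← Finset.sum_add_distrib]
      refine Finset.sum_congr rfl fun g _ => ?_
      rw [hk h g hh g.2 x]
      linear_combination (u h x) * hχ2 g g.2
    have h2 : ∑ g : A, (χ g : ℝ) * u (h * g) x = χ h * ∑ g : A, χ g * u g x := by
      rw [← Equiv.sum_comp (Equiv.mulLeft (⟨h, hh⟩ : A)) fun g : A => (χ g : ℝ) * u g x,
        Finset.mul_sum]
      refine Finset.sum_congr rfl fun g _ => ?_
      change _ = (χ h : ℝ) * (χ (h * g) * u (h * g) x)
      rw [hχm h hh g g.2]
      push_cast
      linear_combination -((χ g : ℝ) * u (h * g) x) * hχ2 h hh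
    rw [h2, ← hW, ← hW] at h1
    apply mul_left_cancel₀ hn0
    rw [mul_neg, mul_inv_cancel_left₀ hn0]
    linear_combination -h1
  let κ : G → UnitAddCircle := fun g => (c g + circlePull φ g (modOne X W) - χ g • modOne X W) x₀
  have hκ : ∀ g ∈ A, c g + circlePull φ g (modOne X W) - χ g • modOne X W = ContinuousMap.const X (κ g) := by
    intro g hg
    obtain ⟨K, hK⟩ := hWh g hg
    have h1 : ∀ x, (c g + circlePull φ g (modOne X W) - χ g • modOne X W) x = ((K : ℝ) : UnitAddCircle) := by
      intro x
      rw [← hK x, ← hu g hg, ← zsmul_eq_mul]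
      rfl
    ext x
    rw [h1, ContinuousMap.const_apply]
    exact (h1 x₀).symm
  have hκm : ∀ g ∈ A, ∀ h ∈ A, κ (g * h) = χ h • κ g + κ h := fun g hg h hh => by
    have h1 : ContinuousMap.const X (κ (g * h)) = χ h • ContinuousMap.const X (κ g) +
        circlePull φ g (ContinuousMap.const X (κ h)) := by
      rw [← hκ _ (mul_mem hg hh), ← hκ g hg, ← hκ h hh, hc g hg h hh, hχm g hg h hh, circlePull_mul,
        map_sub, map_add, LinearMap.map_smul]
      module
    exact congrArg (fun f => f x₀) h1
  obtain ⟨l, A', hA', hcard, hl⟩ := exists_split_circle A χ κ hχ hχm hsq hκm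
  refine ⟨modOne X W + ContinuousMap.const X l, add_mem ⟨W, rfl⟩ (const_mem_logs l), A', hA', hcard,
    fun g hg => ?_⟩
  have h1 := hκ g (hA' hg)
  rw [map_add, circlePull_const, ← sub_eq_zero, show c g + (circlePull φ g (modOne X W) + ContinuousMap.const X l) -
    χ g • (modOne X W + ContinuousMap.const X l) = (c g + circlePull φ g (modOne X W) - χ g • modOne X W) +
      ContinuousMap.const X l - χ g • ContinuousMap.const X l by module, h1]
  exact ContinuousMap.ext fun x => hl g hg
end Pull
end AlexSpan

namespace AlexSpan

/-- The inclusion of the elements of order two in the circle. -/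
noncomputable def half (η : ZMod 2) : UnitAddCircle := if η = 0 then 0 else ((1 / 2 : ℝ) : UnitAddCircle)

lemma two_half_one : ((1 / 2 : ℝ) : UnitAddCircle) + ((1 / 2 : ℝ) : UnitAddCircle) = 0 := by
  rw [← AddCircle.coe_add, AddCircle.coe_eq_zero_iff]
  exact ⟨1, by norm_num⟩

lemma half_zero : half 0 = 0 := if_pos rfl
lemma half_one : half 1 = ((1 / 2 : ℝ) : UnitAddCircle) := if_neg (by decide)

lemma half_add (a b : ZMod 2) : half (a + b) = half a + half b := by
  rcases (show ∀ a : ZMod 2, a = 0 ∨ a = 1 by decide) a with rfl | rfl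
  · rw [zero_add, half_zero, zero_add]
  · rcases (show ∀ a : ZMod 2, a = 0 ∨ a = 1 by decide) b with rfl | rfl
    · rw [add_zero, half_zero, add_zero]
    · rw [show (1 : ZMod 2) + 1 = 0 from rfl, half_one, half_zero, two_half_one]

lemma two_smul_half (a : ZMod 2) : (2 : ℤ) • half a = 0 := by
  rw [two_smul, ← half_add, add_self_two, half_zero]

lemma norm_half_one : ‖half 1‖ = 1 / 2 := by
  rw [half_one, UnitAddCircle.norm_eq]
  norm_num [round_eq]

lemma exists_half {t : UnitAddCircle} (h : (2 : ℤ) • t = 0) : ∃ η, t = half η := by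
  rcases circle_two_torsion h with rfl | rfl
  · exact ⟨0, half_zero.symm⟩
  · exact ⟨1, half_one.symm⟩

lemma half_injective : Function.Injective half := by
  have h : ∀ a, half a = 0 → a = 0 := fun a ha => by
    by_contra h
    rw [(show ∀ a : ZMod 2, a ≠ 0 → a = 1 by decide) a h] at ha
    have := norm_half_one
    rw [ha, norm_zero] at this
    norm_num at this
  intro a b hab
  refine eq_of_add_eq_zero_two (h _ ?_)
  rw [half_add, hab, ← half_add, add_self_two, half_zero]

lemma exists_norm_sub_half_le (t : UnitAddCircle) : ∃ η, ‖t - half η‖ ≤ ‖(2 : ℤ) • t‖ / 2 := by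
  obtain ⟨x, rfl⟩ := QuotientAddGroup.mk_surjective t
  change ∃ η, ‖((x : ℝ) : UnitAddCircle) - half η‖ ≤ ‖(2 : ℤ) • ((x : ℝ) : UnitAddCircle)‖ / 2
  obtain ⟨η, h1⟩ : ∃ η, half η = ((((round (2 * x) : ℤ) : ℝ) / 2 : ℝ) : UnitAddCircle) := by
    refine (exists_half ?_).imp fun _ => Eq.symm
    rw [← AddCircle.coe_zsmul, AddCircle.coe_eq_zero_iff]
    refine ⟨round (2 * x), ?_⟩
    simp only [zsmul_eq_mul]
    push_cast
    ring
  refine ⟨η, ?_⟩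
  rw [h1]
  rw [← AddCircle.coe_zsmul, ← AddCircle.coe_sub, UnitAddCircle.norm_eq (x := (2 : ℤ) • x)]
  refine (QuotientAddGroup.norm_mk_le_norm).trans ?_
  rw [Real.norm_eq_abs, zsmul_eq_mul, Int.cast_ofNat, le_div_iff₀ two_pos, ← abs_two,
    ← abs_mul, abs_two]
  refine (congrArg _ ?_).le
  ring

/-- The distance indicator. -/
noncomputable def far (t : UnitAddCircle) : ZMod 2 := if ‖t‖ < 1 / 4 then 0 else 1

lemma far_eq {t : UnitAddCircle} {η : ZMod 2} (h : ‖t - half η‖ < 1 / 4) : far t = η := by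
  rcases (show ∀ a : ZMod 2, a = 0 ∨ a = 1 by decide) η with rfl | rfl
  · rw [half_zero, sub_zero] at h
    exact if_pos h
  · refine if_neg fun h1 => ?_
    have := norm_sub_le t (t - half 1)
    rw [sub_sub_cancel, norm_half_one] at this
    linarith

section Halves
variable {X : Type} [TopologicalSpace X]

/-- The functions to the circle whose double is continuous. -/
def halves (X : Type) [TopologicalSpace X] : AddSubgroup (X → UnitAddCircle) where
  carrier := {s | Continuous fun x => (2 : ℤ) • s x}
  zero_mem' := by
    change Continuous fun _ : X => (2 : ℤ) • (0 : UnitAddCircle)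
    exact continuous_const
  add_mem' := fun {a b} ha hb => by
    change Continuous fun x => (2 : ℤ) • (a x + b x)
    simp only [smul_add]
    exact ha.add hb
  neg_mem' := fun {a} ha => by
    change Continuous fun x => (2 : ℤ) • -a x
    simp only [smul_neg]
    exact ha.neg

lemma mem_halves {s : X → UnitAddCircle} : s ∈ halves X ↔ Continuous fun x => (2 : ℤ) • s x := Iff.rfl

lemma half_mem_halves (u : X → ZMod 2) : (fun x => half (u x)) ∈ halves X := by
  simp only [mem_halves, two_smul_half]
  exact continuous_const

lemma continuous_mem_halves (f : C(X, UnitAddCircle)) : (f : X → UnitAddCircle) ∈ halves X :=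
  (map_continuous f).zsmul 2

/-- The cochain comparing two values of a function to the circle. -/
noncomputable def jump (s : X → UnitAddCircle) : List X → ZMod 2
  | [x, y] => far (s x - s y)
  | _ => 0

omit [TopologicalSpace X] in
lemma cd_eq_zero_of_length {k : ℕ} {w : List X → ZMod 2} (hw : ∀ l, k ≤ l.length → w l = 0)
    {l : List X} (hl : k + 1 ≤ l.length) : cd w l = 0 := by
  induction l generalizing k w with
  | nil => exact cd_nil w
  | cons x l ih =>
    rw [List.length_cons] at hl
    rw [cd_cons, hw l (by omega), zero_add]
    cases k with
    | zero =>
      rw [show (fun l' => w (x :: l')) = 0 from funext fun _ => hw _ (Nat.zero_le _), cd_zero]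
      rfl
    | succ k => exact ih (k := k) (fun l' hl' => hw _ (by simpa using hl')) (by omega)

omit [TopologicalSpace X] in
lemma vanOn_jump {s : X → UnitAddCircle} {U : Set X} {p : UnitAddCircle} {u : X → ZMod 2}
    (h : ∀ y ∈ U, ‖s y - p - half (u y)‖ < 1 / 8) : VanOn U (jump s + cd (pt u)) := by
  intro l hl
  match l with
  | [] => simp [jump]
  | [x] => simp [jump, cd_cons, pt]
  | [x, y] =>
    have h1 : far (s x - s y) = u x + u y := far_eq <| by
      rw [half_add, show s x - s y - (half (u x) + half (u y)) =
        (s x - p - half (u x)) - (s y - p - half (u y)) - (2 : ℤ) • half (u y) by module,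
        two_smul_half, sub_zero]
      refine (norm_sub_le _ _).trans_lt ?_
      linarith [h x (hl x (by simp)), h y (hl y (by simp))]
    simp only [Pi.add_apply, jump, h1, cd_cons, pt, cd_nil]
    grind
  | x :: y :: z :: l => 
    rw [Pi.add_apply, cd_eq_zero_of_length (k := 2) (fun l hl => ?_) (by simp)]
    · simp [jump]
    · match l with
      | [] => simp at hl
      | [x] => simp at hl
      | x :: y :: l => rfl

lemma exists_near {s : X → UnitAddCircle} (hs : s ∈ halves X) (x₀ : X) {ε : ℝ} (hε : 0 < ε) :
    ∃ U ∈ nhds x₀, ∃ u : X → ZMod 2, ∀ y ∈ U, ‖s y - s x₀ - half (u y)‖ < ε := by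
  choose u hu using fun y => exists_norm_sub_half_le (s y - s x₀)
  refine ⟨_, (Metric.continuous_iff'.1 hs x₀ ε hε), u, fun y hy => (hu y).trans_lt ?_⟩
  have h1 : dist ((2 : ℤ) • s y) ((2 : ℤ) • s x₀) < ε := hy
  rw [dist_eq_norm, ← smul_sub] at h1
  linarith

/-- The cochain class comparing values of a function whose double is continuous. -/
noncomputable def jumpHom (X : Type) [TopologicalSpace X] : halves X →+ AS X :=
  AddMonoidHom.mk' (fun s => AS.mk ⟨jump s.1, rfl⟩) fun s t => by
    rw [← map_add, AS.mk_eq]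
    intro x₀ _
    obtain ⟨U, hU, u, hu⟩ := exists_near s.2 x₀ (show (0 : ℝ) < 1 / 16 by norm_num)
    obtain ⟨V, hV, w, hw⟩ := exists_near t.2 x₀ (show (0 : ℝ) < 1 / 16 by norm_num)
    refine ⟨U ∩ V, Filter.inter_mem hU hV, ?_⟩
    rw [Set.inter_univ]
    have h1 := vanOn_jump (U := U ∩ V) (s := s.1) fun y hy => (hu y hy.1).trans (by norm_num)
    have h2 := vanOn_jump (U := U ∩ V) (s := t.1) fun y hy => (hw y hy.2).trans (by norm_num)
    have h3 := vanOn_jump (U := U ∩ V) (s := s.1 + t.1) (p := s.1 x₀ + t.1 x₀) (u := u + w)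
      fun y hy => by
        rw [Pi.add_apply, Pi.add_apply, half_add, show s.1 y + t.1 y - (s.1 x₀ + t.1 x₀) -
          (half (u y) + half (w y)) = (s.1 y - s.1 x₀ - half (u y)) + (t.1 y - t.1 x₀ - half (w y)) by
          abel]
        refine (norm_add_le _ _).trans_lt ?_
        linarith [hu y hy.1, hw y hy.2]
    have h4 : cd (pt (u + w)) = cd (pt u) + cd (pt w) := by
      rw [← cd_add]
      congr 1
      funext l
      match l with
      | [] => rfl
      | [x] => rfl
      | x :: y :: l => rfl
    intro l hl
    have e := h3.add (h1.add h2) l hl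
    rw [h4] at e
    simp only [Pi.add_apply] at e
    change jump (s.1 + t.1) l + (jump s.1 l + jump t.1 l) = 0
    grind

lemma jumpHom_apply (s : halves X) : jumpHom X s = AS.mk ⟨jump s.1, rfl⟩ := rfl

lemma d_jumpHom (s : halves X) : Dga.d (jumpHom X s) = 0 := by
  rw [jumpHom_apply, AS.d_mk, AS.mk_eq_zero]
  intro x₀ _
  obtain ⟨U, hU, u, hu⟩ := exists_near s.2 x₀ (show (0 : ℝ) < 1 / 8 by norm_num)
  refine ⟨U, hU, ?_⟩
  have h := (vanOn_jump hu).cd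
  rw [cd_add, cd_cd, add_zero] at h
  rw [Set.inter_univ]
  exact h

lemma pr_jumpHom (s : halves X) : GDga.pr 1 (jumpHom X s) = jumpHom X s := by
  rw [jumpHom_apply, AS.pr_mk]
  congr 1
  refine Subtype.ext (funext fun l => ?_)
  rw [coe_degHom]
  match l with
  | [] => rfl
  | [x] => rfl
  | [x, y] => rfl
  | x :: y :: z :: l => exact if_neg (by simp)

lemma jumpHom_half (u : X → ZMod 2) :
    jumpHom X ⟨fun x => half (u x), half_mem_halves u⟩ = Dga.d (AS.pt u) := by
  rw [jumpHom_apply, AS.pt, AS.d_mk, AS.mk_eq]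
  refine fun x₀ _ => ⟨Set.univ, Filter.univ_mem, ?_⟩
  rw [Set.inter_univ]
  exact vanOn_jump (p := 0) fun y _ => by simp

lemma continuous_of_jumpHom {s : halves X} (h : jumpHom X s = 0) : Continuous s.1 := by
  rw [jumpHom_apply, AS.mk_eq_zero] at h
  rw [Metric.continuous_iff']
  intro x₀ ε hε
  obtain ⟨U, hU, h⟩ := h x₀ trivial
  obtain ⟨V, hV, u, hu⟩ := exists_near s.2 x₀ (lt_min hε (show (0 : ℝ) < 1 / 4 by norm_num))
  filter_upwards [hU, hV] with y hyU hyV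
  have h1 : far (s.1 y - s.1 x₀) = 0 := h [y, x₀] (by
    simp only [List.mem_cons, List.not_mem_nil, or_false, Set.inter_univ]
    rintro z (rfl | rfl)
    · exact hyU
    · exact mem_of_mem_nhds hU)
  have h2 := hu y hyV
  rw [← far_eq (h2.trans_le (min_le_right _ _)), h1, half_zero, sub_zero, ← dist_eq_norm] at h2
  exact h2.trans_le (min_le_left _ _)

lemma jumpHom_continuous (f : C(X, UnitAddCircle)) : jumpHom X ⟨f, continuous_mem_halves f⟩ = 0 := by
  rw [jumpHom_apply, AS.mk_eq_zero]
  intro x₀ _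
  refine ⟨_, Metric.continuous_iff'.1 (map_continuous f) x₀ (1 / 8) (by norm_num), ?_⟩
  rw [Set.inter_univ]
  have h := vanOn_jump (s := f) (p := f x₀) (u := 0)
    (U := {y | dist (f y) (f x₀) < 1 / 8}) fun y hy => by
      rw [Pi.zero_apply, half_zero, sub_zero, ← dist_eq_norm]
      exact hy
  have e : pt (0 : X → ZMod 2) = 0 := by
    funext l
    match l with
    | [] => rfl
    | [x] => rfl
    | x :: y :: l => rfl
  rw [e, cd_zero, add_zero] at h
  exact h

lemma map_jumpHom (g : C(X, X)) (s : halves X) :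
    AS.map g (jumpHom X s) = jumpHom X ⟨s.1 ∘ g, (mem_halves.1 s.2).comp g.continuous⟩ := by
  rw [jumpHom_apply, jumpHom_apply, AS.map_mk]
  congr 1
  refine Subtype.ext (funext fun l => ?_)
  rw [coe_pullHom]
  match l with
  | [] => rfl
  | [x] => rfl
  | [x, y] => rfl
  | x :: y :: z :: l => rfl

lemma AS.exists_pt {a : AS X} (h : GDga.pr 0 a = a) : ∃ u, a = AS.pt u := by
  obtain ⟨z, rfl⟩ := AS.mk_surj a
  refine ⟨fun x => z.1 [x], ?_⟩
  rw [← h, AS.pr_mk, AS.pt]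
  congr 1
  refine Subtype.ext (funext fun l => ?_)
  rw [coe_degHom]
  match l with
  | [] => rfl
  | [x] => rfl
  | x :: y :: l => exact if_neg (by simp)

/-- A function whose comparison cochain bounds is continuous up to elements of order two. -/
lemma exists_continuous_of_jumpHom [Nonempty X] {s : halves X} {y : AS X} (h : jumpHom X s = Dga.d y) :
    ∃ (u : X → ZMod 2) (f : C(X, UnitAddCircle)), (∀ x, s.1 x = f x + half (u x)) ∧
      jumpHom X s = Dga.d (AS.pt u) := by
  obtain ⟨u, hu⟩ := AS.exists_pt (a := GDga.pr 0 y) (by rw [GDga.pr_pr, if_pos rfl])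
  have h1 : jumpHom X s = Dga.d (AS.pt u) := by
    rw [← hu, ← GDga.pr_d, ← h, pr_jumpHom]
  have h2 : jumpHom X (s + ⟨fun x => half (u x), half_mem_halves u⟩) = 0 := by
    rw [map_add, jumpHom_half, h1]
    grind
  refine ⟨u, ⟨_, continuous_of_jumpHom h2⟩, fun x => ?_, h1⟩
  change s.1 x = s.1 x + half (u x) + half (u x)
  rw [add_assoc, ← half_add, add_self_two, half_zero, add_zero]
end Halves
end AlexSpan

namespace AlexSpan

section Torus
variable {X : Type} [TopologicalSpace X]

/-- The class comparing values of a function whose double is continuous. -/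
noncomputable def jumpCl (X : Type) [TopologicalSpace X] : halves X →+ H (AS X) :=
  AddMonoidHom.mk' (fun s => cl ⟨jumpHom X s, d_jumpHom s⟩) fun s t => by
    rw [← map_add]
    congr 1
    exact Subtype.ext (map_add _ s t)

lemma jumpCl_apply (s : halves X) : jumpCl X s = cl ⟨jumpHom X s, d_jumpHom s⟩ := rfl

lemma exists_of_jumpCl_eq_zero [Nonempty X] {s : halves X} (h : jumpCl X s = 0) :
    ∃ (u : X → ZMod 2) (f : C(X, UnitAddCircle)), ∀ x, s.1 x = f x + half (u x) := by
  obtain ⟨y, hy⟩ := cl_eq_zero.1 h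
  obtain ⟨u, f, h, -⟩ := exists_continuous_of_jumpHom hy
  exact ⟨u, f, h⟩

lemma jumpCl_comp (g : C(X, X)) (s : halves X) :
    AS.Hmap g (jumpCl X s) = jumpCl X ⟨s.1 ∘ g, (mem_halves.1 s.2).comp g.continuous⟩ := by
  rw [jumpCl_apply, jumpCl_apply, AS.Hmap, H.map_cl]
  congr 1
  exact Subtype.ext (map_jumpHom g s)

lemma jumpCl_continuous (f : C(X, UnitAddCircle)) : jumpCl X ⟨f, continuous_mem_halves f⟩ = 0 := by
  rw [jumpCl_apply, ← map_zero cl]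
  congr 1
  exact Subtype.ext (jumpHom_continuous f)

/-- Every class of degree one on a space equivalent to a torus compares values of a function whose
double is continuous. -/
lemma exists_jumpCl [Nonempty X] {m n : ℕ} (e : ContinuousMap.HomotopyEquiv X (Fin m → UnitAddCircle))
    {v : Fin m → H (AS X)} (hd : ∀ j, IsDeg 1 (v j)) (hv : IsTrunc n v) {x : H (AS X)}
    (hx : IsDeg 1 x) : ∃ s, x = jumpCl X s := by
  choose h hh using circle_halve
  have hs : ∀ j, (fun x => h (gen e j x)) ∈ halves X := fun j => by
    simp only [mem_halves, hh]
    exact map_continuous _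
  let s : Fin m → halves X := fun j => ⟨_, hs j⟩
  let L := Fintype.linearCombination (ZMod 2) fun j => jumpCl X (s j)
  have hL : ∀ ε, L ε = jumpCl X (∑ j, (ε j).val • s j) := fun ε => by
    rw [map_sum, Fintype.linearCombination_apply]
    refine Finset.sum_congr rfl fun j _ => ?_
    rw [map_nsmul, ← Nat.cast_smul_eq_nsmul (ZMod 2), ZMod.natCast_zmod_val]
  have hinj : Function.Injective L := by
    refine (injective_iff_map_eq_zero L).2 fun ε hε => ?_
    rw [hL] at hε
    obtain ⟨u, f, hf⟩ := exists_of_jumpCl_eq_zero hε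
    refine eq_zero_of_gen_two_divisible (e := e) (t := f) (ContinuousMap.ext fun x => ?_)
    have h1 := congrArg (fun z => (2 : ℤ) • z) (hf x)
    simp only [smul_add, two_smul_half, add_zero] at h1
    rw [ContinuousMap.smul_apply, ← h1]
    rw [AddSubgroup.val_finsetSum, Finset.sum_apply, Finset.smul_sum, ContinuousMap.sum_apply]
    refine Finset.sum_congr rfl fun j _ => ?_
    rw [ContinuousMap.smul_apply, ← hh (gen e j x), smul_comm]
    rfl
  have hle : LinearMap.range L ≤ Submodule.span (ZMod 2) (Set.range v) := by
    rintro _ ⟨ε, rfl⟩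
    rw [hL, jumpCl_apply]
    exact hv.mem_span_one hd (isDeg_iff.2 ⟨_, pr_jumpHom _, rfl⟩)
  have : Module.Finite (ZMod 2) (Submodule.span (ZMod 2) (Set.range v)) :=
    Module.Finite.span_of_finite _ (Set.finite_range _)
  have heq := Submodule.eq_of_le_of_finrank_le hle (by
    rw [LinearMap.finrank_range_of_inj hinj, Module.finrank_fintype_fun_eq_card]
    exact finrank_range_le_card v)
  have hmem : x ∈ LinearMap.range L := heq ▸ hv.mem_span_one hd hx
  obtain ⟨ε, rfl⟩ := hmem
  exact ⟨_, hL ε⟩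

variable {G : Type} [CommGroup G] (φ : G →* (X ≃ₜ X))

/-- A free involution of a space equivalent to a torus preserves no complement of the functions
with a logarithm. -/
theorem false_of_stable_complement [Nonempty X] {m n : ℕ}
    (e : ContinuousMap.HomotopyEquiv X (Fin m → UnitAddCircle))
    {v : Fin m → H (AS X)} (hd : ∀ j, IsDeg 1 (v j)) (hv : IsTrunc n v) (hn : 1 ≤ n) {g : G}
    (hg : IsFreeInv (AS.map (φ g : C(X, X)))) (hinv : ∀ x, φ g (φ g x) = x)
    {S : Submodule ℤ C(X, UnitAddCircle)} (hS : ∀ f ∈ S, circlePull φ g f ∈ S)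
    (hbot : S ⊓ logs X = ⊥) (htop : S ⊔ logs X = ⊤) : False := by
  have hconn : PreconnectedSpace X := preconnectedSpace_of_homotopyEquiv e
  have hdec : ∀ f, ∃ k ∈ S, ∃ l ∈ logs X, k + l = f := fun f =>
    Submodule.mem_sup.1 (htop ▸ Submodule.mem_top)
  have hzero : ∀ f ∈ S, f ∈ logs X → f = 0 := fun f h1 h2 =>
    (Submodule.mem_bot ℤ).1 (hbot ▸ ⟨h1, h2⟩)
  obtain ⟨x, hx, hgx, hob⟩ := hg.exists_obs_one hv hd hn
  obtain ⟨s, F, hFS, hsF, rfl⟩ : ∃ (s : halves X), ∃ F ∈ S, (∀ y, (2 : ℤ) • s.1 y = F y) ∧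
      x = jumpCl X s := by
    obtain ⟨s, rfl⟩ := exists_jumpCl e hd hv hx
    obtain ⟨F, hF, l, hl, hFl⟩ := hdec ⟨_, mem_halves.1 s.2⟩
    obtain ⟨t, -, rfl⟩ := logs_two_divisible hl
    refine ⟨s - ⟨t, continuous_mem_halves t⟩, F, hF, fun y => ?_, ?_⟩
    · have h1 : F y + (2 : ℤ) • t y = (2 : ℤ) • s.1 y := congrArg (fun f => f y) hFl
      change (2 : ℤ) • (s.1 y - t y) = _
      rw [smul_sub, ← h1, add_sub_cancel_right]
    · rw [map_sub, jumpCl_continuous, sub_zero]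
  set sg : halves X := ⟨s.1 ∘ φ g, (mem_halves.1 s.2).comp (φ g).continuous⟩ with hsg
  have hgs : jumpCl X sg = jumpCl X s := (jumpCl_comp (φ g : C(X, X)) s).symm.trans hgx
  obtain ⟨u₀, f₀, hf₀⟩ := exists_of_jumpCl_eq_zero (s := sg - s) (by rw [map_sub, hgs, sub_self])
  obtain ⟨k, hk, l, hl, rfl⟩ := hdec f₀
  have hdiff : ∀ y, s.1 (φ g y) - s.1 y = k y + l y + half (u₀ y) := hf₀
  have h2 : ∀ y, F (φ g y) - F y = (2 : ℤ) • k y + (2 : ℤ) • l y := fun y => by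
    rw [← hsF, ← hsF, ← smul_sub, hdiff, smul_add, smul_add, two_smul_half, add_zero]
  have hl0 : (2 : ℤ) • l = 0 := by
    refine hzero _ ?_ ((logs X).smul_mem 2 hl)
    have h3 : (2 : ℤ) • l = circlePull φ g F - F - (2 : ℤ) • k := ContinuousMap.ext fun y => by
      change (2 : ℤ) • l y = F (φ g y) - F y - (2 : ℤ) • k y
      rw [h2, add_sub_cancel_left]
    rw [h3]
    exact sub_mem (sub_mem (hS F hFS) hFS) (S.smul_mem 2 hk)
  have hu : ∀ y, ∃ η, l y + half (u₀ y) = half η := fun y => exists_half (by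
    rw [smul_add, two_smul_half, add_zero]
    exact congrArg (fun f => f y) hl0)
  choose u hu using hu
  have hdiff : ∀ y, s.1 (φ g y) - s.1 y = k y + half (u y) := fun y => by
    rw [hdiff, add_assoc, hu]
  have hsum : ∀ y, k y + k (φ g y) + (half (u y) + half (u (φ g y))) = 0 := fun y => by
    have h4 := hdiff (φ g y)
    rw [hinv] at h4
    rw [add_add_add_comm, ← hdiff, ← h4]
    abel
  have hk0 : k + circlePull φ g k = 0 := by
    have h5 : (2 : ℤ) • (k + circlePull φ g k) = 0 := ContinuousMap.ext fun y => by
      have h6 := congrArg (fun z => (2 : ℤ) • z) (hsum y)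
      simp only [smul_add, two_smul_half, add_zero, smul_zero] at h6
      rw [← smul_add] at h6
      exact h6
    refine hzero _ (add_mem hk (hS k hk)) (saturated_logs 2 _ two_ne_zero ?_)
    rw [h5]
    exact zero_mem _
  have huu : ∀ y, u y + u (φ g y) = 0 := fun y => half_injective (by
    have h7 : k y + k (φ g y) = 0 := congrArg (fun f => f y) hk0
    rw [half_add, half_zero, ← hsum y, h7, zero_add])
  have hjump : jumpHom X s + AS.map (φ g : C(X, X)) (jumpHom X s) = Dga.d (AS.pt u) := by
    have h8 : sg - s = ⟨k, continuous_mem_halves k⟩ + ⟨fun y => half (u y), half_mem_halves u⟩ :=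
      Subtype.ext (funext hdiff)
    have h9 := congrArg (jumpHom X) h8
    rw [map_add, jumpHom_continuous, zero_add, jumpHom_half, map_sub] at h9
    rw [map_jumpHom, ← h9]
    change jumpHom X s + jumpHom X sg = _
    grind
  have hob0 : Obs (AS.map (φ g : C(X, X))) (jumpCl X s) 0 := by
    refine ⟨⟨jumpHom X s, d_jumpHom s⟩, AS.pt u, pr_jumpHom s, rfl, AS.pr_pt u, hjump, ?_⟩
    rw [map_zero, AS.map_pt, ← AS.pt_add, show u + u ∘ (φ g : C(X, X)) = 0 from funext huu]
    have h9 := AS.pt_add (0 : X → ZMod 2) 0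
    rwa [add_zero, left_eq_add] at h9
  exact one_ne_zero (Obs.unique (hv.conn hd) hg.toIsEndo hg.inv hob hob0)

/-- The bound for spaces equivalent to a torus. -/
theorem card_le_of_torus [Finite G] [CompactSpace X] [T2Space X] [Nonempty X] {m n : ℕ}
    (e : ContinuousMap.HomotopyEquiv X (Fin m → UnitAddCircle))
    {v : Fin m → H (AS X)} (hd : ∀ j, IsDeg 1 (v j)) (hv : IsTrunc n v) (hn : 1 ≤ n)
    (hsq : ∀ g : G, g * g = 1) (hfree : ∀ g x, φ g x = x → g = 1) : Nat.card G ≤ 2 ^ m := by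
  have hconn : PreconnectedSpace X := preconnectedSpace_of_homotopyEquiv e
  have hinv : ∀ g x, φ g (φ g x) = x := fun g x => by
    change (φ g * φ g) x = x
    rw [← map_mul, hsq, map_one]
    rfl
  obtain ⟨hfin, hrank⟩ := finite_mod_logs e
  obtain ⟨A, S, hcard, hS, hbot, htop⟩ := exists_stable_complement (σ := circlePull φ) (E := logs X)
    (fun g f => ContinuousMap.ext fun x => by
      rw [circlePull_apply, circlePull_apply, hinv])
    (fun g h f => circlePull_mul φ g h f) (fun g f hf => comp_mem_logs _ hf)
    (fun A χ c hχ hχm hcE hc => exists_split_logs φ hsq A χ c hχ hχm hcE hc) m ⊤ ⊥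
    (fun g _ f hf => by
      rw [Submodule.mem_bot] at hf ⊢
      rw [hf, map_zero])
    (bot_inf_eq _) (by rw [bot_sup_eq]; exact saturated_logs) (by rwa [bot_sup_eq])
    (by rwa [bot_sup_eq])
  have hA : A = ⊥ := by
    rw [Subgroup.eq_bot_iff_forall]
    intro g hg
    by_contra h1
    exact false_of_stable_complement φ e hd hv hn ((AS.isFreeAct_action φ hsq hfree).free g h1)
      (hinv g) (hS g hg) hbot htop
  rw [hA, Subgroup.card_bot, mul_one, Subgroup.card_top] at hcard
  exact hcard
end Torus
end AlexSpan

namespace AlexSpan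

section ProjectiveLine

/-- The complex number with given coordinates. -/
def toComplex (v : EuclideanSpace ℝ (Fin 2)) : ℂ := ⟨v 0, v 1⟩

lemma continuous_toComplex : Continuous toComplex := by
  have h : toComplex = fun v => (v 0 : ℂ) + v 1 * Complex.I :=
    funext fun v => Complex.ext (by simp [toComplex]) (by simp [toComplex])
  rw [h]
  fun_prop

lemma toComplex_ne {v : EuclideanSpace ℝ (Fin 2)} (h : v ≠ 0) : toComplex v ≠ 0 := fun h0 => h <| by
  ext i
  fin_cases i
  · exact congrArg Complex.re h0
  · exact congrArg Complex.im h0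

lemma toComplex_smul (a : ℝ) (v : EuclideanSpace ℝ (Fin 2)) :
    toComplex (a • v) = a * toComplex v :=
  Complex.ext (by simp [toComplex]) (by simp [toComplex])

lemma coe_ofConjDivSelf (z : ℂ) (hz : z ≠ 0) :
    (Circle.ofConjDivSelf z hz : ℂ) = (starRingEnd ℂ) z / z := rfl

/-- The angle of a real line in the plane. -/
noncomputable def lineAngle : RP 1 → Circle :=
  Projectivization.lift (fun v => Circle.ofConjDivSelf (toComplex v.1) (toComplex_ne v.2)) <| by
    rintro ⟨v, hv⟩ ⟨w, hw⟩ a rfl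
    have ha : (a : ℂ) ≠ 0 := by
      rintro h
      rw [Complex.ofReal_eq_zero] at h
      exact hv (by simp [h])
    ext
    rw [coe_ofConjDivSelf, coe_ofConjDivSelf]
    change (starRingEnd ℂ) (toComplex (a • w)) / toComplex (a • w) = _
    rw [toComplex_smul, map_mul, Complex.conj_ofReal, mul_div_mul_left _ _ ha]

lemma lineAngle_mk (v : EuclideanSpace ℝ (Fin 2)) (hv : v ≠ 0) :
    lineAngle (Projectivization.mk ℝ v hv) = Circle.ofConjDivSelf (toComplex v) (toComplex_ne hv) := rfl

lemma continuous_lineAngle : Continuous lineAngle := by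
  refine Continuous.quotient_lift (s := projectivizationSetoid ℝ (EuclideanSpace ℝ (Fin 2))) ?_ _
  refine Continuous.subtype_mk ?_ _
  have h := continuous_toComplex.comp (continuous_subtype_val (p := fun v => v ≠ 0))
  exact (Complex.continuous_conj.comp h).div h fun v => toComplex_ne v.2

lemma lineAngle_injective : Function.Injective lineAngle := by
  intro p q hpq
  induction p using Projectivization.ind with | h v hv =>
  induction q using Projectivization.ind with | h w hw =>
  rw [lineAngle_mk, lineAngle_mk] at hpq
  have h1 := congrArg (fun z : Circle => (z : ℂ)) hpq
  simp only [coe_ofConjDivSelf] at h1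
  have hv' := toComplex_ne hv
  have hw' := toComplex_ne hw
  rw [div_eq_div_iff hv' hw'] at h1
  obtain ⟨r, hr⟩ := Complex.conj_eq_iff_real.1
    (show (starRingEnd ℂ) ((starRingEnd ℂ) (toComplex w) * toComplex v) =
      (starRingEnd ℂ) (toComplex w) * toComplex v by
      rw [map_mul, Complex.conj_conj, mul_comm, h1])
  rw [Projectivization.mk_eq_mk_iff']
  refine ⟨r / Complex.normSq (toComplex w), ?_⟩
  have hn : (Complex.normSq (toComplex w) : ℂ) ≠ 0 :=
    Complex.ofReal_ne_zero.2 (Complex.normSq_pos.2 hw').ne'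
  have h2 : toComplex ((r / Complex.normSq (toComplex w)) • w) = toComplex v := by
    rw [toComplex_smul, Complex.ofReal_div, ← hr, div_mul_eq_mul_div, div_eq_iff hn,
      ← Complex.mul_conj]
    ring
  ext i
  fin_cases i
  · exact congrArg Complex.re h2
  · exact congrArg Complex.im h2

lemma lineAngle_surjective : Function.Surjective lineAngle := by
  intro c
  obtain ⟨θ, rfl⟩ := Circle.exp_surjective c
  have h0 : (WithLp.toLp 2 ![Real.cos (θ / 2), -Real.sin (θ / 2)] : EuclideanSpace ℝ (Fin 2)) ≠ 0 := by
    intro h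
    have h1 : Real.cos (θ / 2) = 0 := congrArg (fun v : EuclideanSpace ℝ (Fin 2) => v 0) h
    have h2 : -Real.sin (θ / 2) = 0 := congrArg (fun v : EuclideanSpace ℝ (Fin 2) => v 1) h
    nlinarith [Real.sin_sq_add_cos_sq (θ / 2)]
  refine ⟨Projectivization.mk ℝ _ h0, ?_⟩
  have h1 : toComplex (WithLp.toLp 2 ![Real.cos (θ / 2), -Real.sin (θ / 2)]) =
      Complex.exp ((-(θ / 2) : ℝ) * Complex.I) := by
    refine Complex.ext ?_ ?_
    · rw [Complex.exp_ofReal_mul_I_re, Real.cos_neg]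
      rfl
    · rw [Complex.exp_ofReal_mul_I_im, Real.sin_neg]
      rfl
  ext
  rw [lineAngle_mk, coe_ofConjDivSelf, h1, ← Complex.exp_conj, ← Complex.exp_sub, Circle.coe_exp]
  rw [map_mul, Complex.conj_ofReal, Complex.conj_I]
  congr 1
  push_cast
  ring

/-- The projective line is a circle. -/
noncomputable def projectiveLineHomeo : RP 1 ≃ₜ UnitAddCircle :=
  (Continuous.homeoOfEquivCompactToT2
    (f := Equiv.ofBijective lineAngle ⟨lineAngle_injective, lineAngle_surjective⟩)
    continuous_lineAngle).trans (AddCircle.homeomorphCircle one_ne_zero).symm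

end ProjectiveLine

/-- A space with a product of nonempty spaces as its homotopy type is nonempty. -/
lemma nonempty_of_homotopyEquiv {X Y : Type} [TopologicalSpace X] [TopologicalSpace Y] [Nonempty Y]
    (e : ContinuousMap.HomotopyEquiv X Y) : Nonempty X := ‹Nonempty Y›.map e.invFun

end AlexSpan

/-- **Adem–Yalcin theorem.** Suppose `(ℤ/2)^r` acts freely and continuously on a finite CW
complex `X` homotopy equivalent to `(ℝP^n)^m`. Then: if `n ≡ 0, 2 (mod 4)` we must have
`r = 0`; if `n ≡ 1 (mod 4)` then `r ≤ m`; and if `n ≡ 3 (mod 4)` then `r ≤ 2m`. -/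
theorem adem_yalcin_rank_bound_free_action_on_product_of_projective_spaces
    (r m n : ℕ)
    (X : Type) [TopologicalSpace X] (hX : IsFiniteCW X)
    (e : Nonempty (ContinuousMap.HomotopyEquiv X (Fin m → RP n)))
    (φ : (Fin r → Multiplicative (ZMod 2)) →* (X ≃ₜ X))
    (hfree : ∀ (g : Fin r → Multiplicative (ZMod 2)) (x : X), φ g x = x → g = 1) :
    (n % 4 = 0 ∨ n % 4 = 2 → r = 0) ∧
      (n % 4 = 1 → r ≤ m) ∧
      (n % 4 = 3 → r ≤ 2 * m) := by
  obtain ⟨N, hN⟩ := hX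
  obtain ⟨hc, ht⟩ := AlexSpan.IsFiniteCWAtMost.compact_t2 hN
  obtain ⟨e⟩ := e
  have hne : Nonempty X := AlexSpan.nonempty_of_homotopyEquiv e
  obtain ⟨v, hd, hv⟩ := AlexSpan.exists_isTrunc e
  have hsq := AlexSpan.zmod_two_sq r
  have hact := AlexSpan.AS.isFreeAct_action φ hsq hfree
  have hcard := AlexSpan.natCard_zmod_two r
  refine ⟨fun hn => ?_, fun hn => ?_, fun hn => ?_⟩
  · refine AlexSpan.eq_zero_of_trivial fun g => ?_
    by_contra hg
    obtain ⟨k, hk⟩ := (hact.free g hg).odd hv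
    omega
  · obtain rfl | h5 : n = 1 ∨ 5 ≤ n := by omega
    · have h := AlexSpan.card_le_of_torus φ
        (e.trans (ContinuousMap.HomotopyEquiv.piCongrRight fun _ =>
          AlexSpan.projectiveLineHomeo.toHomotopyEquiv)) hd hv le_rfl hsq hfree
      rw [hcard] at h
      exact (Nat.pow_le_pow_iff_right (by norm_num)).1 h
    · exact hact.rank_le hv hd (p := (n - 1) / 2) (by omega) ⟨n / 4, by omega⟩ (by omega) hcard
  · exact hact.rank_le_two_mul hv hd (by omega) hcard
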